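/- Every surface of degree 6 in ℙ³(ℂ) whose only singularities are ν ordinary triple points satisfies ν ≤ 10, and there exists a sextic surface in ℙ³(ℂ) whose only singularities are exactly 10 ordinary triple points. Hence μ₃(6) = 10. -/

import Mathlib

open MvPolynomial

noncomputable section

/-- Iterated partial derivative of `f` along a list of variable indices. -/
def pderivList {n : ℕ} (l : List (Fin n)) (f : MvPolynomial (Fin n) ℂ) :
    MvPolynomial (Fin n) ℂ :=
  l.foldl (fun g i => MvPolynomial.pderiv i g) f

/-- All partial derivatives of `f` of order `< m` vanish at `p`
(`P` has multiplicity `≥ m` on `{f = 0}`). -/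
def MultAtLeast {n : ℕ} (f : MvPolynomial (Fin n) ℂ) (p : Fin n → ℂ) (m : ℕ) : Prop :=
  ∀ l : List (Fin n), l.length < m → MvPolynomial.eval p (pderivList l f) = 0

/-- `p` is (a representative of) a singular point of `{f = 0}`. -/
def SingularAt (f : MvPolynomial (Fin 4) ℂ) (p : Fin 4 → ℂ) : Prop :=
  MultAtLeast f p 2

/-- The partial derivatives of `c` have no common zero in `ℂⁿ ∖ {0}`. -/
def NowhereSingular {n : ℕ} (c : MvPolynomial (Fin n) ℂ) : Prop :=
  ∀ p : Fin n → ℂ, p ≠ 0 → ∃ i, MvPolynomial.eval p (MvPolynomial.pderiv i c) ≠ 0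

/-- Linear change of coordinates: `substMatrix B f` is the polynomial `x ↦ f (B.mulVec x)`. -/
def substMatrix {n : ℕ} (B : Matrix (Fin n) (Fin n) ℂ) (f : MvPolynomial (Fin n) ℂ) :
    MvPolynomial (Fin n) ℂ :=
  MvPolynomial.aeval (fun i => ∑ j, MvPolynomial.C (B i j) * MvPolynomial.X j) f

/-- `p` is (a representative of) an ordinary triple point of the degree-`d` surface `{f = 0}`:
all partials of order `≤ 2` vanish at `p`, some third-order partial does not, and after a
linear change of coordinates taking `(0,0,0,1)` to `p`, writing `f` as
`∑ⱼ x₃^(d-j) fⱼ(x₀,x₁,x₂)` with `fⱼ` homogeneous of degree `j`, the cubic `f₃` is nonsingular. -/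
def OrdinaryTriplePointAt (d : ℕ) (f : MvPolynomial (Fin 4) ℂ) (p : Fin 4 → ℂ) : Prop :=
  MultAtLeast f p 3 ∧
  (∃ l : List (Fin 4), l.length = 3 ∧ MvPolynomial.eval p (pderivList l f) ≠ 0) ∧
  ∃ B : Matrix (Fin 4) (Fin 4) ℂ, IsUnit B.det ∧ B.mulVec ![0, 0, 0, 1] = p ∧
    ∃ g : ℕ → MvPolynomial (Fin 3) ℂ,
      (∀ j, (g j).IsHomogeneous j) ∧
      substMatrix B f =
        ∑ j ∈ Finset.range (d + 1),
          (MvPolynomial.X 3) ^ (d - j) * MvPolynomial.rename Fin.castSucc (g j) ∧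
      NowhereSingular (g 3)

/-- The set of singular points of `{f = 0}` in `ℙ³(ℂ)`. -/
def SingSet (f : MvPolynomial (Fin 4) ℂ) : Set (Projectivization ℂ (Fin 4 → ℂ)) :=
  {P | SingularAt f P.rep}

/-- `{f = 0}` has `ν` ordinary triple points as its only singularities. -/
def OnlyTriplePoints (d ν : ℕ) (f : MvPolynomial (Fin 4) ℂ) : Prop :=
  (SingSet f).Finite ∧ (SingSet f).ncard = ν ∧
  ∀ P ∈ SingSet f, OrdinaryTriplePointAt d f P.rep

/-- The derivative of a polynomial in the direction of a constant vector field. -/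
def dirDeriv {σ : Type*} (u : σ → ℂ) :
    Derivation ℂ (MvPolynomial σ ℂ) (MvPolynomial σ ℂ) :=
  mkDerivation ℂ fun i => C (u i)

section DirDeriv

variable {σ : Type*} 

@[simp] lemma dirDeriv_X (u : σ → ℂ) (i : σ) : dirDeriv u (X i) = C (u i) :=
  mkDerivation_X _ _ _

@[simp] lemma dirDeriv_C (u : σ → ℂ) (a : ℂ) : dirDeriv u (C a) = 0 :=
  derivation_C _ _

lemma dirDeriv_mul (u : σ → ℂ) (f g : MvPolynomial σ ℂ) :
    dirDeriv u (f * g) = f * dirDeriv u g + g * dirDeriv u f := by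
  rw [Derivation.leibniz, smul_eq_mul, smul_eq_mul]

lemma dirDeriv_single [DecidableEq σ] (i : σ) : dirDeriv (Pi.single i 1) = pderiv i := by
  apply derivation_ext
  intro j
  rw [dirDeriv_X, pderiv_X]
  by_cases h : i = j
  · subst h; simp
  · simp [Ne.symm h]

lemma dirDeriv_add (u v : σ → ℂ) (f : MvPolynomial σ ℂ) :
    dirDeriv (u + v) f = dirDeriv u f + dirDeriv v f := by
  have : dirDeriv (u + v) = dirDeriv u + dirDeriv v := by
    apply derivation_ext
    intro j; simp
  rw [this]; rfl

lemma dirDeriv_smul (a : ℂ) (u : σ → ℂ) (f : MvPolynomial σ ℂ) :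
    dirDeriv (a • u) f = a • dirDeriv u f := by
  have : dirDeriv (a • u) = a • dirDeriv u := by
    apply derivation_ext
    intro j; simp [MvPolynomial.smul_eq_C_mul]
  rw [this]; rfl

/-- The directional derivative depends linearly on the direction. -/
def dirDerivₗ (f : MvPolynomial σ ℂ) : (σ → ℂ) →ₗ[ℂ] MvPolynomial σ ℂ where
  toFun u := dirDeriv u f
  map_add' u v := dirDeriv_add u v f
  map_smul' a u := dirDeriv_smul a u f

@[simp] lemma dirDeriv_zero_left (f : MvPolynomial σ ℂ) : dirDeriv 0 f = 0 :=
  (dirDerivₗ f).map_zero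

lemma dirDeriv_sub (u v : σ → ℂ) (f : MvPolynomial σ ℂ) :
    dirDeriv (u - v) f = dirDeriv u f - dirDeriv v f :=
  (dirDerivₗ f).map_sub u v

lemma dirDeriv_sum {ι : Type*} (s : Finset ι) (u : ι → σ → ℂ) (f : MvPolynomial σ ℂ) :
    dirDeriv (∑ i ∈ s, u i) f = ∑ i ∈ s, dirDeriv (u i) f :=
  map_sum (dirDerivₗ f) u s

lemma dirDeriv_comm (u v : σ → ℂ) (f : MvPolynomial σ ℂ) :
    dirDeriv u (dirDeriv v f) = dirDeriv v (dirDeriv u f) := by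
  have h : ⁅dirDeriv u, dirDeriv v⁆ = 0 := by
    apply derivation_ext
    intro j
    rw [Derivation.commutator_apply]; simp
  have := congrArg (fun D : Derivation ℂ (MvPolynomial σ ℂ) (MvPolynomial σ ℂ) => D f) h
  rw [Derivation.commutator_apply] at this
  exact sub_eq_zero.mp this

lemma dirDeriv_eq_sum [Fintype σ] (u : σ → ℂ) (f : MvPolynomial σ ℂ) :
    dirDeriv u f = ∑ i, u i • pderiv i f := by
  classical
  conv_lhs => rw [pi_eq_sum_univ' u]
  rw [dirDeriv_sum]
  refine Finset.sum_congr rfl fun i _ => ?_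
  rw [dirDeriv_smul, ← dirDeriv_single]

lemma MvPolynomial.IsHomogeneous.dirDeriv [Finite σ] {f : MvPolynomial σ ℂ} {n : ℕ}
    (hf : f.IsHomogeneous n)
    (u : σ → ℂ) : (dirDeriv u f).IsHomogeneous (n - 1) := by
  have := Fintype.ofFinite σ
  rw [dirDeriv_eq_sum]
  refine IsHomogeneous.sum _ _ _ fun i _ => ?_
  rw [MvPolynomial.smul_eq_C_mul]
  simpa using (isHomogeneous_C σ (u i)).mul (hf.pderiv (i := i))

/-- Euler's identity at a point. -/
lemma MvPolynomial.IsHomogeneous.eval_dirDeriv_self [Fintype σ] {f : MvPolynomial σ ℂ} {n : ℕ}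
    (hf : f.IsHomogeneous n) (x : σ → ℂ) : eval x (_root_.dirDeriv x f) = n * eval x f := by
  have := congrArg (eval x) hf.sum_X_mul_pderiv
  rw [dirDeriv_eq_sum]
  simpa [nsmul_eq_mul] using this

end DirDeriv

section Substitution

variable {n : ℕ}

lemma eval_substMatrix (B : Matrix (Fin n) (Fin n) ℂ) (f : MvPolynomial (Fin n) ℂ)
    (x : Fin n → ℂ) : eval x (substMatrix B f) = eval (B.mulVec x) f := by
  induction f using MvPolynomial.induction_on with
  | C a => simp [substMatrix]
  | add p q hp hq => simp only [substMatrix, map_add] at *; rw [hp, hq]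
  | mul_X p i hp =>
    simp only [substMatrix, map_mul] at *
    rw [hp]
    simp [Matrix.mulVec, dotProduct]

lemma dirDeriv_substMatrix (B : Matrix (Fin n) (Fin n) ℂ) (f : MvPolynomial (Fin n) ℂ)
    (u : Fin n → ℂ) :
    dirDeriv u (substMatrix B f) = substMatrix B (dirDeriv (B.mulVec u) f) := by
  induction f using MvPolynomial.induction_on with
  | C a => simp [substMatrix]
  | add p q hp hq => simp only [substMatrix, map_add] at *; rw [hp, hq]
  | mul_X p i hp =>
    simp only [substMatrix] at *
    rw [map_mul, dirDeriv_mul, dirDeriv_mul, hp]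
    simp [Matrix.mulVec, dotProduct]

lemma substMatrix_isHomogeneous (B : Matrix (Fin n) (Fin n) ℂ) {f : MvPolynomial (Fin n) ℂ}
    {d : ℕ} (hf : f.IsHomogeneous d) : (substMatrix B f).IsHomogeneous d := by
  have := hf.aeval (fun i => ∑ j, C (B i j) * X j) (n := 1) (fun i =>
    IsHomogeneous.sum _ _ _ fun j _ => by
      simpa using (isHomogeneous_C _ (B i j)).mul (isHomogeneous_X ℂ j))
  simpa [substMatrix] using this

end Substitution

lemma dirDeriv_eq_zero_of_isHomogeneous_zero {σ : Type*} {g : MvPolynomial σ ℂ}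
    (hg : g.IsHomogeneous 0) (u : σ → ℂ) : dirDeriv u g = 0 := by
  rw [← totalDegree_zero_iff_isHomogeneous, totalDegree_eq_zero_iff_eq_C] at hg
  rw [hg, dirDeriv_C]

lemma eval_zero_of_isHomogeneous {σ : Type*} {g : MvPolynomial σ ℂ} {d : ℕ}
    (hg : g.IsHomogeneous d) (hd : d ≠ 0) : eval 0 g = 0 := by
  rw [eval_zero, constantCoeff_eq]
  exact hg.coeff_eq_zero (by simpa using hd.symm)

lemma eval_eq_of_isHomogeneous_zero {σ : Type*} {g : MvPolynomial σ ℂ}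
    (hg : g.IsHomogeneous 0) (x y : σ → ℂ) : eval x g = eval y g := by
  rw [← totalDegree_zero_iff_isHomogeneous, totalDegree_eq_zero_iff_eq_C] at hg
  rw [hg]; simp

lemma eval_smul_of_isHomogeneous {σ : Type*} {g : MvPolynomial σ ℂ} {d : ℕ}
    (hg : g.IsHomogeneous d) (a : ℂ) (x : σ → ℂ) : eval (a • x) g = a ^ d * eval x g := by
  rw [eval_eq, eval_eq, Finset.mul_sum]
  refine Finset.sum_congr rfl fun s hs => ?_
  have := hg (mem_support_iff.mp hs)
  rw [show Finsupp.weight (1 : σ → ℕ) s = s.degree by rw [Finsupp.degree_eq_weight_one]; rfl,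
    Finsupp.degree_apply] at this
  simp only [Pi.smul_apply, smul_eq_mul, mul_pow, Finset.prod_mul_distrib,
    Finset.prod_pow_eq_pow_sum]
  rw [this]; ring

/-- `p` represents an ordinary triple point, in polarised form: the second derivatives vanish and
the tangent cone, as a cubic form on `ℂ⁴ / ℂ p`, is nonsingular. -/
structure TriplePt (f : MvPolynomial (Fin 4) ℂ) (p : Fin 4 → ℂ) : Prop where
  ne_zero : p ≠ 0
  second : ∀ u v, eval p (dirDeriv u (dirDeriv v f)) = 0
  nondeg : ∀ w, (∀ u, eval p (dirDeriv w (dirDeriv w (dirDeriv u f))) = 0) → ∃ c : ℂ, w = c • p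

namespace TriplePt

variable {f : MvPolynomial (Fin 4) ℂ} {p : Fin 4 → ℂ}

lemma first (hf : f.IsHomogeneous 6) (hp : TriplePt f p) (u : Fin 4 → ℂ) :
    eval p (dirDeriv u f) = 0 := by
  have := (hf.dirDeriv u).eval_dirDeriv_self p
  rw [hp.second] at this
  simpa using this.symm

lemma third_self (hf : f.IsHomogeneous 6) (hp : TriplePt f p) (u v : Fin 4 → ℂ) :
    eval p (dirDeriv p (dirDeriv u (dirDeriv v f))) = 0 := by
  rw [((hf.dirDeriv v).dirDeriv u).eval_dirDeriv_self p, hp.second, mul_zero]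

lemma third_self' (hf : f.IsHomogeneous 6) (hp : TriplePt f p) (u v : Fin 4 → ℂ) :
    eval p (dirDeriv u (dirDeriv v (dirDeriv p f))) = 0 := by
  rw [dirDeriv_comm v, dirDeriv_comm u, hp.third_self hf]

end TriplePt

lemma multAtLeast_three_iff {f : MvPolynomial (Fin 4) ℂ} {p : Fin 4 → ℂ}
    (hf : f.IsHomogeneous 6) :
    MultAtLeast f p 3 ↔ ∀ u v, eval p (dirDeriv u (dirDeriv v f)) = 0 := by
  constructor
  · intro h u v
    simp only [dirDeriv_eq_sum, map_sum, Derivation.map_smul, smul_eval]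
    refine Finset.sum_eq_zero fun i _ => ?_
    rw [Finset.sum_eq_zero, mul_zero]
    intro j _
    have := h [i, j] (by simp)
    simp only [pderivList, List.foldl] at this
    rw [this, mul_zero]
  · intro h l hl
    have h1 (u) : eval p (dirDeriv u f) = 0 := by
      have := (hf.dirDeriv u).eval_dirDeriv_self p
      rw [h] at this
      simpa using this.symm
    have h0 : eval p f = 0 := by
      have := hf.eval_dirDeriv_self p
      rw [h1] at this
      simpa using this.symm
    match l with
    | [] => simpa [pderivList]
    | [i] => simpa [pderivList, dirDeriv_single] using h1 (Pi.single i 1)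
    | [i, j] => simpa [pderivList, dirDeriv_single] using h (Pi.single j 1) (Pi.single i 1)
    | _ :: _ :: _ :: _ => simp at hl; omega

lemma singularAt_iff {f : MvPolynomial (Fin 4) ℂ} {p : Fin 4 → ℂ} (hf : f.IsHomogeneous 6) :
    SingularAt f p ↔ ∀ u, eval p (dirDeriv u f) = 0 := by
  constructor
  · intro h u
    simp only [dirDeriv_eq_sum, map_sum, smul_eval]
    refine Finset.sum_eq_zero fun i _ => ?_
    have := h [i] (by simp)
    simp only [pderivList, List.foldl] at this
    rw [this, mul_zero]
  · intro h l hl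
    match l with
    | [] =>
      have := hf.eval_dirDeriv_self p
      rw [h] at this
      simpa [pderivList] using this.symm
    | [i] => simpa [pderivList, dirDeriv_single] using h (Pi.single i 1)
    | _ :: _ :: _ => simp at hl

section TangentCone

/-- Extension of a vector of `ℂ³` by a zero last coordinate. -/
def extendZero (a : Fin 3 → ℂ) : Fin 4 → ℂ := Fin.snoc (α := fun _ => ℂ) a 0

lemma extendZero_castSucc (a : Fin 3 → ℂ) (i : Fin 3) : extendZero a i.castSucc = a i :=
  Fin.snoc_castSucc (α := fun _ => ℂ) _ _ _

lemma extendZero_last (a : Fin 3 → ℂ) : extendZero a 3 = 0 :=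
  Fin.snoc_last (α := fun _ => ℂ) 0 a

lemma dirDeriv_rename_castSucc (a : Fin 3 → ℂ) (g : MvPolynomial (Fin 3) ℂ) :
    dirDeriv (extendZero a) (rename Fin.castSucc g) = rename Fin.castSucc (dirDeriv a g) := by
  induction g using MvPolynomial.induction_on with
  | C a => simp
  | add p q hp hq => simp only [map_add, hp, hq]
  | mul_X p i hp => simp [hp, extendZero_castSucc]

lemma dirDeriv_X_pow_mul_rename (a : Fin 3 → ℂ) (k : ℕ) (g : MvPolynomial (Fin 3) ℂ) :
    dirDeriv (extendZero a) (X 3 ^ k * rename Fin.castSucc g) =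
      X 3 ^ k * rename Fin.castSucc (dirDeriv a g) := by
  rw [dirDeriv_mul, dirDeriv_rename_castSucc, Derivation.leibniz_pow, dirDeriv_X, extendZero_last]
  simp

lemma eval_third_expansion (g : ℕ → MvPolynomial (Fin 3) ℂ) (hg : ∀ j, (g j).IsHomogeneous j)
    (a b c : Fin 3 → ℂ) :
    eval ![0, 0, 0, 1] (dirDeriv (extendZero a) (dirDeriv (extendZero b) (dirDeriv (extendZero c)
      (∑ j ∈ Finset.range (6 + 1), (X 3) ^ (6 - j) * rename Fin.castSucc (g j))))) =
    eval 0 (dirDeriv a (dirDeriv b (dirDeriv c (g 3)))) := by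
  simp only [map_sum, dirDeriv_X_pow_mul_rename]
  rw [Finset.sum_eq_single 3]
  · simp only [map_mul, map_pow, eval_X, eval_rename]
    have : (![0, 0, 0, 1] : Fin 4 → ℂ) ∘ Fin.castSucc = 0 := by
      ext i; fin_cases i <;> rfl
    rw [this]; simp
  · intro j _ hj
    have h3 := (((hg j).dirDeriv c).dirDeriv b).dirDeriv a
    have : eval ((![0, 0, 0, 1] : Fin 4 → ℂ) ∘ Fin.castSucc)
        (dirDeriv a (dirDeriv b (dirDeriv c (g j)))) = 0 := by
      have h0 : (![0, 0, 0, 1] : Fin 4 → ℂ) ∘ Fin.castSucc = 0 := by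
        ext i; fin_cases i <;> rfl
      rw [h0]
      rcases lt_or_gt_of_ne hj with hj | hj
      · have : dirDeriv a (dirDeriv b (dirDeriv c (g j))) = 0 := by
          apply dirDeriv_eq_zero_of_isHomogeneous_zero
          have := ((hg j).dirDeriv c).dirDeriv b
          rwa [show j - 1 - 1 = 0 by omega] at this
        rw [this, map_zero]
      · exact eval_zero_of_isHomogeneous h3 (by omega)
    simp only [map_mul, eval_rename, this, mul_zero]
  · simp

end TangentCone

lemma exists_castSucc_expansion {d : ℕ} {f : MvPolynomial (Fin 4) ℂ} (hf : f.IsHomogeneous d) :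
    ∃ g : ℕ → MvPolynomial (Fin 3) ℂ, (∀ j, (g j).IsHomogeneous j) ∧
      f = ∑ j ∈ Finset.range (d + 1), (X 3) ^ (d - j) * rename Fin.castSucc (g j) := by
  classical
  have key : ∀ s ∈ f.support, ∃ g : ℕ → MvPolynomial (Fin 3) ℂ, (∀ j, (g j).IsHomogeneous j) ∧
      monomial s (coeff s f) =
        ∑ j ∈ Finset.range (d + 1), (X 3) ^ (d - j) * rename Fin.castSucc (g j) := by
    intro s hs
    have hd := hf (mem_support_iff.mp hs)
    rw [show Finsupp.weight (1 : Fin 4 → ℕ) s = s.degree by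
      rw [Finsupp.degree_eq_weight_one]; rfl, Finsupp.degree_eq_sum, Fin.sum_univ_four] at hd
    set m : MvPolynomial (Fin 3) ℂ := C (coeff s f) * (X 0 ^ s 0 * X 1 ^ s 1 * X 2 ^ s 2) with hm
    have hmh : m.IsHomogeneous (s 0 + s 1 + s 2) := by
      have := (isHomogeneous_C (Fin 3) (coeff s f)).mul ((((isHomogeneous_X_pow (R := ℂ)
        (0 : Fin 3) (s 0)).mul (isHomogeneous_X_pow 1 (s 1))).mul (isHomogeneous_X_pow 2 (s 2))))
      simpa using this
    refine ⟨fun j => if j = s 0 + s 1 + s 2 then m else 0, ?_, ?_⟩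
    · intro j
      by_cases h : j = s 0 + s 1 + s 2
      · simpa [h] using hmh
      · simpa [h] using isHomogeneous_zero _ _ _
    · rw [Finset.sum_eq_single (s 0 + s 1 + s 2)]
      · rw [monomial_eq, Finsupp.prod_fintype _ _ (by simp), Fin.prod_univ_four]
        beta_reduce
        rw [if_pos rfl, hm, show d - (s 0 + s 1 + s 2) = s 3 by omega]
        simp only [map_mul, map_pow, rename_C, rename_X]
        simp only [Fin.castSucc_zero, Fin.castSucc_one, show Fin.castSucc (2 : Fin 3) = 2 from rfl]
        ring
      · intro j _ h; simp [h]
      · intro h; exact absurd (Finset.mem_range.mpr (by omega)) h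
  choose! g hg1 hg2 using key
  refine ⟨fun j => ∑ s ∈ f.support, g s j, fun j => IsHomogeneous.sum _ _ _ fun s hs => hg1 s hs j,
    ?_⟩
  conv_lhs => rw [f.as_sum]
  rw [Finset.sum_congr rfl hg2, Finset.sum_comm]
  simp only [map_sum, Finset.mul_sum]

lemma mulVec_single_three (B : Matrix (Fin 4) (Fin 4) ℂ) (hB : IsUnit B.det) (v : Fin 4 → ℂ) :
    ∃ w, B.mulVec w = v := ⟨B⁻¹.mulVec v, by
  rw [Matrix.mulVec_mulVec, Matrix.mul_nonsing_inv _ hB, Matrix.one_mulVec]⟩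

lemma eq_extendZero_add (w : Fin 4 → ℂ) :
    w = extendZero (fun i => w i.castSucc) + w 3 • ![0, 0, 0, 1] := by
  ext i
  refine Fin.lastCases ?_ (fun i => ?_) i
  · have := extendZero_last (fun i => w i.castSucc)
    simp only [Pi.add_apply, show Fin.last 3 = 3 from rfl, this]; simp
  · simp only [Pi.add_apply, extendZero_castSucc]
    fin_cases i <;> simp

lemma triplePt_of_ordinary {f : MvPolynomial (Fin 4) ℂ} {p : Fin 4 → ℂ}
    (hf : f.IsHomogeneous 6) (h : OrdinaryTriplePointAt 6 f p) : TriplePt f p := by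
  obtain ⟨hm, -, B, hB, rfl, g, hg, hfg, hns⟩ := h
  have h2 := (multAtLeast_three_iff hf).mp hm
  refine ⟨?_, h2, ?_⟩
  · intro h0
    have := congrFun (Matrix.mulVec_injective_iff_isUnit.mpr
      ((Matrix.isUnit_iff_isUnit_det B).mpr hB)
      (h0.trans (Matrix.mulVec_zero B).symm)) 3
    simp at this
  · intro w hw
    obtain ⟨w, rfl⟩ := mulVec_single_three B hB w
    refine ⟨w 3, ?_⟩
    set a : Fin 3 → ℂ := fun i => w i.castSucc with ha
    have hwa := eq_extendZero_add w
    suffices a = 0 by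
      conv_lhs => rw [hwa, ← ha, this]
      rw [Matrix.mulVec_add, Matrix.mulVec_smul]
      have : extendZero 0 = 0 := by
        ext i; refine Fin.lastCases (extendZero_last 0) (fun i => extendZero_castSucc 0 i) i
      rw [this]; simp
    by_contra hne
    obtain ⟨i, hi⟩ := hns a hne
    apply hi
    have h0 := (hg 3).pderiv (i := i)
    have e1 := h0.eval_dirDeriv_self a
    have e2 := (h0.dirDeriv a).eval_dirDeriv_self a
    have e3 := eval_third_expansion g hg a a (Pi.single i 1)
    rw [← hfg] at e3
    have e4 := hw (B.mulVec (extendZero (Pi.single i 1)))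
    rw [← dirDeriv_single] at e1 e2 ⊢
    have hc := eval_eq_of_isHomogeneous_zero
      ((((hg 3).dirDeriv (Pi.single i 1)).dirDeriv a).dirDeriv a)
      0 a
    rw [hc, e2, e1] at e3
    have e5 : eval (B.mulVec ![0, 0, 0, 1]) (dirDeriv (B.mulVec (extendZero a))
        (dirDeriv (B.mulVec (extendZero a)) (dirDeriv (B.mulVec (extendZero (Pi.single i 1))) f))) =
          0 := by
      rw [hwa, ← ha] at e4
      simp only [Matrix.mulVec_add, Matrix.mulVec_smul, dirDeriv_add, dirDeriv_smul, map_add,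
        smul_eval, Derivation.map_smul] at e4
      have t (u v : Fin 4 → ℂ) : eval (B.mulVec ![0, 0, 0, 1])
          (dirDeriv (B.mulVec ![0, 0, 0, 1]) (dirDeriv u (dirDeriv v f))) = 0 := by
        rw [((hf.dirDeriv v).dirDeriv u).eval_dirDeriv_self, h2, mul_zero]
      rw [dirDeriv_comm (B.mulVec (extendZero a)) (B.mulVec ![0, 0, 0, 1]), t, t] at e4
      simpa using e4
    rw [dirDeriv_substMatrix, dirDeriv_substMatrix, dirDeriv_substMatrix, eval_substMatrix,
      e5] at e3
    simpa using e3.symm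

lemma exists_matrix_mulVec_eq {p : Fin 4 → ℂ} (hp : p ≠ 0) :
    ∃ B : Matrix (Fin 4) (Fin 4) ℂ, IsUnit B.det ∧ B.mulVec ![0, 0, 0, 1] = p := by
  have h3 : (![0, 0, 0, 1] : Fin 4 → ℂ) ≠ 0 := fun h => by simpa using congrFun h 3
  obtain ⟨A, hA⟩ := SeparatingDual.exists_continuousLinearEquiv_apply_eq (R := ℂ) h3 hp
  refine ⟨LinearMap.toMatrix' A.toLinearEquiv.toLinearMap, ?_, ?_⟩
  · rw [LinearMap.det_toMatrix']
    exact LinearEquiv.isUnit_det' A.toLinearEquiv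
  · rw [LinearMap.toMatrix'_mulVec]; exact hA

lemma ordinary_of_triplePt {f : MvPolynomial (Fin 4) ℂ} {p : Fin 4 → ℂ}
    (hf : f.IsHomogeneous 6) (hp : TriplePt f p) : OrdinaryTriplePointAt 6 f p := by
  refine ⟨(multAtLeast_three_iff hf).mpr hp.second, ?_, ?_⟩
  · by_contra hcon
    push Not at hcon
    have h3 (u v w : Fin 4 → ℂ) : eval p (dirDeriv u (dirDeriv v (dirDeriv w f))) = 0 := by
      simp only [dirDeriv_eq_sum, map_sum, Derivation.map_smul, smul_eval]
      refine Finset.sum_eq_zero fun i _ => ?_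
      rw [Finset.sum_eq_zero, mul_zero]
      intro j _
      rw [Finset.sum_eq_zero, mul_zero]
      intro k _
      have := hcon [i, j, k] (by simp)
      simp only [pderivList, List.foldl] at this
      rw [this, mul_zero]
    obtain ⟨c, hc⟩ := hp.nondeg (Pi.single 0 1) fun u => h3 _ _ _
    obtain ⟨d, hd⟩ := hp.nondeg (Pi.single 1 1) fun u => h3 _ _ _
    have c0 := congrFun hc 0
    have c1 := congrFun hc 1
    have d0 := congrFun hd 0
    have d1 := congrFun hd 1
    simp at c0 c1 d0 d1
    rcases c1 with h | h
    · simp [h] at c0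
    · simp [h] at d1
  · obtain ⟨B, hB, rfl⟩ := exists_matrix_mulVec_eq hp.ne_zero
    obtain ⟨g, hg, hfg⟩ := exists_castSucc_expansion (substMatrix_isHomogeneous B hf)
    refine ⟨B, hB, rfl, g, hg, hfg, ?_⟩
    intro a ha
    by_contra hcon
    push Not at hcon
    have key : ∀ b, eval (B.mulVec ![0, 0, 0, 1]) (dirDeriv (B.mulVec (extendZero a))
        (dirDeriv (B.mulVec (extendZero a)) (dirDeriv (B.mulVec (extendZero b)) f))) = 0 := by
      intro b
      have e3 := eval_third_expansion g hg a a b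
      rw [← hfg, dirDeriv_substMatrix, dirDeriv_substMatrix, dirDeriv_substMatrix,
        eval_substMatrix] at e3
      rw [e3, eval_eq_of_isHomogeneous_zero ((((hg 3).dirDeriv b).dirDeriv a).dirDeriv a)
        0 a, (((hg 3).dirDeriv b).dirDeriv a).eval_dirDeriv_self,
        ((hg 3).dirDeriv b).eval_dirDeriv_self, dirDeriv_eq_sum]
      simp [hcon]
    obtain ⟨c, hc⟩ := hp.nondeg (B.mulVec (extendZero a)) (by
      intro u
      obtain ⟨u, rfl⟩ := mulVec_single_three B hB u
      rw [eq_extendZero_add u, Matrix.mulVec_add, dirDeriv_add, map_add, map_add, map_add, key,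
        Matrix.mulVec_smul, dirDeriv_smul, Derivation.map_smul, Derivation.map_smul, smul_eval,
        hp.third_self' hf]
      simp)
    rw [← Matrix.mulVec_smul] at hc
    have := Matrix.mulVec_injective_iff_isUnit.mpr ((Matrix.isUnit_iff_isUnit_det B).mpr hB) hc
    apply ha
    ext i
    rw [← extendZero_castSucc a i, this]
    fin_cases i <;> simp

section Koszul

open Matrix

/-- Exactness of the Koszul complex of a triple of ring elements in its two middle spots. -/
structure KoszulExact {R : Type*} [CommRing R] (g : Fin 3 → R) : Prop where
  dot : ∀ v : Fin 3 → R, v ⬝ᵥ g = 0 → ∃ n : Fin 3 → R, v = n ⨯₃ g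
  cross : ∀ v : Fin 3 → R, v ⨯₃ g = 0 → ∃ w : R, v = w • g

variable {R : Type*} [CommRing R]

lemma cross_eq_zero_iff {v g : Fin 3 → R} : v ⨯₃ g = 0 ↔
    v 1 * g 2 = v 2 * g 1 ∧ v 2 * g 0 = v 0 * g 2 ∧ v 0 * g 1 = v 1 * g 0 := by
  rw [cross_apply, ← sub_eq_zero (a := v 1 * g 2), ← sub_eq_zero (a := v 2 * g 0),
    ← sub_eq_zero (a := v 0 * g 1)]
  constructor
  · intro h
    exact ⟨by simpa using congrFun h 0, by simpa using congrFun h 1, by simpa using congrFun h 2⟩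
  · rintro ⟨h0, h1, h2⟩
    simp [h0, h1, h2]

lemma exists_coeff_of_mem_span {g : Fin 3 → R} {a : R} (h : a ∈ Ideal.span (Set.range g)) :
    ∃ c : Fin 3 → R, c ⬝ᵥ g = a := by
  obtain ⟨c, hc⟩ := Ideal.mem_span_range_iff_exists_fun.mp h
  exact ⟨c, hc⟩

variable [IsDomain R]

lemma KoszulExact.of_regular {g : Fin 3 → R} (h0 : g 0 ≠ 0)
    (h1 : ∀ a, g 0 ∣ a * g 1 → g 0 ∣ a)
    (h2 : ∀ a, a * g 2 ∈ Ideal.span {g 0, g 1} → a ∈ Ideal.span {g 0, g 1}) :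
    KoszulExact g := by
  constructor
  · intro v hv
    have hv' : v 0 * g 0 + v 1 * g 1 + v 2 * g 2 = 0 := by
      simpa [dotProduct, Fin.sum_univ_three] using hv
    obtain ⟨a, b, hab⟩ := Ideal.mem_span_pair.mp (h2 (v 2) (Ideal.mem_span_pair.mpr
      ⟨-v 0, -v 1, by linear_combination -hv'⟩))
    obtain ⟨c, hc⟩ := h1 (v 1 + b * g 2) ⟨-(v 0 + a * g 2), by
      linear_combination hv' + g 2 * hab⟩
    refine ⟨![b, -a, c], ?_⟩
    have e0 : v 0 = -a * g 2 - c * g 1 := by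
      apply mul_right_cancel₀ h0
      linear_combination hv' - g 1 * hc + g 2 * hab
    rw [cross_apply]
    ext i; fin_cases i
    · simpa using e0
    · simp; linear_combination hc
    · simp; linear_combination -hab
  · intro v hv
    obtain ⟨e0, e1, e2⟩ := cross_eq_zero_iff.mp hv
    obtain ⟨w, hw⟩ := h1 (v 0) ⟨v 1, by rw [e2, mul_comm]⟩
    refine ⟨w, ?_⟩
    ext i; fin_cases i
    · simp [hw, mul_comm]
    · simp
      apply mul_right_cancel₀ h0
      rw [← e2, hw]; ring
    · simp
      apply mul_right_cancel₀ h0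
      rw [e1, hw]; ring

lemma KoszulExact.of_mem_span {α g : Fin 3 → R} (hα : KoszulExact α) (hα0 : ∀ i, α i ≠ 0)
    (h : ∀ i, α i ∈ Ideal.span (Set.range g)) : KoszulExact g := by
  choose c hc using fun i => exists_coeff_of_mem_span (h i)
  have hg : ∃ j, g j ≠ 0 := by
    by_contra hcon
    push Not at hcon
    apply hα0 0
    rw [← hc 0, dotProduct, Fin.sum_univ_three]; simp [hcon]
  have cross : ∀ v : Fin 3 → R, v ⨯₃ g = 0 → ∃ w : R, v = w • g := by
    intro v hv
    obtain ⟨e0, e1, e2⟩ := cross_eq_zero_iff.mp hv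
    have ev : ∀ i j, α i * v j = (c i ⬝ᵥ v) * g j := by
      intro i j
      rw [← hc i]
      simp only [dotProduct, Fin.sum_univ_three]
      fin_cases j
      · simp; linear_combination c i 1 * e2 - c i 2 * e1
      · simp; linear_combination c i 2 * e0 - c i 0 * e2
      · simp; linear_combination c i 0 * e1 - c i 1 * e0
    obtain ⟨j, hj⟩ := hg
    have hw : ∀ i k, α k * (c i ⬝ᵥ v) = α i * (c k ⬝ᵥ v) := by
      intro i k
      apply mul_right_cancel₀ hj
      linear_combination -α k * ev i j + α i * ev k j
    obtain ⟨w, hw⟩ := hα.cross (fun i => c i ⬝ᵥ v) (cross_eq_zero_iff.mpr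
      ⟨by linear_combination hw 1 2, by linear_combination hw 2 0, by linear_combination hw 0 1⟩)
    refine ⟨w, ?_⟩
    ext j
    have := congrFun hw 0
    simp only [Pi.smul_apply, smul_eq_mul] at this ⊢
    apply mul_left_cancel₀ (hα0 0)
    rw [ev, this]; ring
  refine ⟨fun v hv => ?_, cross⟩
  have hn : ∀ i, α i • v = (c i ⨯₃ v) ⨯₃ g := by
    intro i
    have hv' : v 0 * g 0 + v 1 * g 1 + v 2 * g 2 = 0 := by
      simpa [dotProduct, Fin.sum_univ_three] using hv
    rw [← hc i]
    simp only [dotProduct, Fin.sum_univ_three, cross_apply]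
    ext j; fin_cases j
    · simp; linear_combination c i 0 * hv'
    · simp; linear_combination c i 1 * hv'
    · simp; linear_combination c i 2 * hv'
  have hw : ∀ i k, ∃ w : R, α k • (c i ⨯₃ v) - α i • (c k ⨯₃ v) = w • g := by
    intro i k
    apply cross
    rw [map_sub, LinearMap.sub_apply, map_smul, map_smul, LinearMap.smul_apply,
      LinearMap.smul_apply, ← hn, ← hn, smul_smul, smul_smul, mul_comm, sub_self]
  obtain ⟨w0, hw0⟩ := hw 1 2
  obtain ⟨w1, hw1⟩ := hw 2 0
  obtain ⟨w2, hw2⟩ := hw 0 1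
  obtain ⟨j, hj⟩ := hg
  have hwα : ![w0, w1, w2] ⬝ᵥ α = 0 := by
    simp only [dotProduct, Fin.sum_univ_three]
    apply mul_right_cancel₀ hj
    have a0 := congrFun hw0 j
    have a1 := congrFun hw1 j
    have a2 := congrFun hw2 j
    simp only [Pi.sub_apply, Pi.smul_apply, smul_eq_mul] at a0 a1 a2
    simp only [Matrix.cons_val]
    linear_combination -α 0 * a0 - α 1 * a1 - α 2 * a2
  obtain ⟨r, hr⟩ := hα.dot _ hwα
  rw [cross_apply] at hr
  have r0 := congrFun hr 0
  have r1 := congrFun hr 1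
  have r2 := congrFun hr 2
  simp at r0 r1 r2
  have hu : ∀ j, ∃ u : R, (fun i => (c i ⨯₃ v) j - r i * g j) = u • α := by
    intro j
    apply hα.cross
    have a0 := congrFun hw0 j
    have a1 := congrFun hw1 j
    have a2 := congrFun hw2 j
    simp only [Pi.sub_apply, Pi.smul_apply, smul_eq_mul] at a0 a1 a2
    rw [cross_eq_zero_iff]
    rw [r0] at a0
    rw [r1] at a1
    rw [r2] at a2
    refine ⟨?_, ?_, ?_⟩
    · linear_combination a0
    · linear_combination a1
    · linear_combination a2
  choose u hu using hu
  refine ⟨u, ?_⟩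
  have e (j) : (c 0 ⨯₃ v) j = r 0 * g j + α 0 * u j := by
    have := congrFun (hu j) 0
    simp only [Pi.smul_apply, smul_eq_mul] at this
    linear_combination this
  ext j
  apply mul_left_cancel₀ (hα0 0)
  have := congrFun (hn 0) j
  simp only [Pi.smul_apply, smul_eq_mul] at this
  rw [this, cross_apply (c 0 ⨯₃ v), cross_apply u, e, e, e]
  fin_cases j
  · simp; ring
  · simp; ring
  · simp; ring

end Koszul

lemma koszulExact_X_pow (N : ℕ) :
    KoszulExact (fun i : Fin 3 => (X i : MvPolynomial (Fin 3) ℂ) ^ N) := by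
  apply KoszulExact.of_regular
  · exact pow_ne_zero _ (X_ne_zero 0)
  · intro a ha
    refine IsRelPrime.dvd_of_dvd_mul_right ?_ ha
    apply IsRelPrime.pow
    rw [(X_prime (R := ℂ) (i := (0 : Fin 3))).irreducible.isRelPrime_iff_not_dvd, X_dvd_X]
    simp
  · intro a ha
    have hs : ({(X 0 : MvPolynomial (Fin 3) ℂ) ^ N, X 1 ^ N} : Set _) =
      (fun s => monomial s (1 : ℂ)) '' {Finsupp.single 0 N, Finsupp.single 1 N} := by
      simp [Set.image_pair, X_pow_eq_monomial]
    change a * X 2 ^ N ∈ Ideal.span {X 0 ^ N, X 1 ^ N} at ha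
    change a ∈ Ideal.span {X 0 ^ N, X 1 ^ N}
    rw [hs, mem_ideal_span_monomial_image] at ha ⊢
    intro s hs
    have := ha (s + Finsupp.single 2 N) (by
      rw [X_pow_eq_monomial, mem_support_iff, coeff_mul_monomial]
      simpa using hs)
    simp only [Set.mem_insert_iff, Set.mem_singleton_iff, exists_eq_or_imp,
      exists_eq_left] at this ⊢
    simpa using this

lemma koszulExact_of_forall_zero {g : Fin 3 → MvPolynomial (Fin 3) ℂ}
    (hg : ∀ x, (∀ i, eval x (g i) = 0) → x = 0) : KoszulExact g := by
  have hrad : ∀ i, (X i : MvPolynomial (Fin 3) ℂ) ∈ (Ideal.span (Set.range g)).radical := by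
    intro i
    rw [← vanishingIdeal_zeroLocus_eq_radical (K := ℂ), mem_vanishingIdeal_iff]
    intro x hx
    have : x = 0 := hg x fun j => by
      have := hx (g j) (Ideal.subset_span ⟨j, rfl⟩)
      simpa using this
    simp [this]
  choose N hN using hrad
  have := koszulExact_X_pow (N 0 + N 1 + N 2)
  refine this.of_mem_span (fun i => pow_ne_zero _ (X_ne_zero i)) fun i => ?_
  refine Ideal.pow_mem_of_pow_mem _ (hN i) ?_
  fin_cases i <;> simp <;> omega

section Components

variable {σ : Type*}

lemma homogeneousComponent_mul_of_isHomogeneous {g : MvPolynomial σ ℂ} {e : ℕ}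
    (hg : g.IsHomogeneous e) (n : MvPolynomial σ ℂ) (k : ℕ) :
    homogeneousComponent k (n * g) = if e ≤ k then homogeneousComponent (k - e) n * g else 0 := by
  let : GradedAlgebra (homogeneousSubmodule σ ℂ) := gradedAlgebra
  have := DirectSum.coe_decompose_mul_of_right_mem (homogeneousSubmodule σ ℂ) (a := n) k
    ((mem_homogeneousSubmodule e g).mpr hg)
  have hd (p : MvPolynomial σ ℂ) (i : ℕ) :
      (DirectSum.decompose (homogeneousSubmodule σ ℂ) p i : MvPolynomial σ ℂ) =
        homogeneousComponent i p := decomposition.decompose'_apply p i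
  rwa [hd, hd] at this

lemma homogeneousComponent_mul_of_isHomogeneous_add {g : MvPolynomial σ ℂ} {e : ℕ}
    (hg : g.IsHomogeneous e) (n : MvPolynomial σ ℂ) (k : ℕ) :
    homogeneousComponent (k + e) (n * g) = homogeneousComponent k n * g := by
  rw [homogeneousComponent_mul_of_isHomogeneous hg, if_pos (by omega), Nat.add_sub_cancel]

/-- Polynomials all of whose monomials have degree less than `k`. -/
def degreeLT (σ : Type*) (k : ℕ) : Submodule ℂ (MvPolynomial σ ℂ) :=
  restrictSupport ℂ {s | s.degree < k}

lemma mem_degreeLT {k : ℕ} {p : MvPolynomial σ ℂ} :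
    p ∈ degreeLT σ k ↔ ∀ s, coeff s p ≠ 0 → s.degree < k := by
  rw [degreeLT, mem_restrictSupport_iff]
  constructor
  · intro h s hs
    exact h (by simpa using hs)
  · intro h s hs
    exact h s (by simpa using hs)

lemma degreeLT_mono {k l : ℕ} (h : k ≤ l) : degreeLT σ k ≤ degreeLT σ l := fun _ hp =>
  mem_degreeLT.mpr fun s hs => (mem_degreeLT.mp hp s hs).trans_le h

lemma eq_zero_of_mem_degreeLT_zero {p : MvPolynomial σ ℂ} (h : p ∈ degreeLT σ 0) : p = 0 := by
  ext s
  by_contra hs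
  exact absurd (mem_degreeLT.mp h s (by simpa using hs)) (by omega)

lemma exists_mem_degreeLT (p : MvPolynomial σ ℂ) : ∃ k, p ∈ degreeLT σ k :=
  ⟨p.totalDegree + 1, mem_degreeLT.mpr fun s hs => by
    have := le_totalDegree (mem_support_iff.mpr hs)
    rw [Finsupp.degree_apply]
    exact Nat.lt_succ_of_le this⟩

lemma isHomogeneous_iff_degree {p : MvPolynomial σ ℂ} {k : ℕ} :
    p.IsHomogeneous k ↔ ∀ s, coeff s p ≠ 0 → s.degree = k := by
  have : ∀ s : σ →₀ ℕ, Finsupp.weight (1 : σ → ℕ) s = s.degree := fun s => by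
    rw [Finsupp.degree_eq_weight_one]; rfl
  simp only [IsHomogeneous, IsWeightedHomogeneous, this]

lemma MvPolynomial.IsHomogeneous.mem_degreeLT {p : MvPolynomial σ ℂ} {k : ℕ}
    (h : p.IsHomogeneous k) : p ∈ degreeLT σ (k + 1) :=
  _root_.mem_degreeLT.mpr fun s hs => by rw [isHomogeneous_iff_degree.mp h s hs]; omega

lemma mul_mem_degreeLT {a b : ℕ} {p q : MvPolynomial σ ℂ} (hp : p ∈ degreeLT σ a)
    (hq : q ∈ degreeLT σ (b + 1)) : p * q ∈ degreeLT σ (a + b) := by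
  classical
  rw [mem_degreeLT] at *
  intro s hs
  have := support_mul p q (mem_support_iff.mpr hs)
  obtain ⟨u, hu, v, hv, rfl⟩ := Finset.mem_add.mp this
  have h1 := hp u (mem_support_iff.mp hu)
  have h2 := hq v (mem_support_iff.mp hv)
  rw [map_add]; omega

lemma homogeneousComponent_eq_zero_of_mem_degreeLT {p : MvPolynomial σ ℂ} {k j : ℕ}
    (h : p ∈ degreeLT σ k) (hj : k ≤ j) : homogeneousComponent j p = 0 := by
  ext s
  rw [coeff_homogeneousComponent, coeff_zero]
  split_ifs with hs
  · by_contra h0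
    have := mem_degreeLT.mp h s h0
    omega
  · rfl

lemma mem_degreeLT_of_homogeneousComponent_eq_zero {p : MvPolynomial σ ℂ} {k : ℕ}
    (h : p ∈ degreeLT σ (k + 1)) (h0 : homogeneousComponent k p = 0) : p ∈ degreeLT σ k := by
  rw [mem_degreeLT] at *
  intro s hs
  refine lt_of_le_of_ne (Nat.le_of_lt_succ (h s hs)) fun hk => hs ?_
  have := congrArg (coeff s) h0
  rwa [coeff_homogeneousComponent, if_pos hk, coeff_zero] at this

lemma sub_homogeneousComponent_mem {p : MvPolynomial σ ℂ} {k : ℕ}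
    (h : p ∈ degreeLT σ (k + 1)) : p - homogeneousComponent k p ∈ degreeLT σ k := by
  have hk := homogeneousComponent_isHomogeneous k p
  apply mem_degreeLT_of_homogeneousComponent_eq_zero
  · exact Submodule.sub_mem _ h hk.mem_degreeLT
  · rw [map_sub, homogeneousComponent_eq_self hk, sub_self]

lemma homogeneousComponent_mul_of_mem_degreeLT {p q : MvPolynomial σ ℂ} {a b : ℕ}
    (hp : p ∈ degreeLT σ (a + 1)) (hq : q ∈ degreeLT σ (b + 1)) :
    homogeneousComponent (a + b) (p * q) =
      homogeneousComponent a p * homogeneousComponent b q := by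
  have hqb := homogeneousComponent_isHomogeneous b q
  have h1 : p * (q - homogeneousComponent b q) ∈ degreeLT σ (a + b) := by
    rw [mul_comm, add_comm a b]
    exact mul_mem_degreeLT (sub_homogeneousComponent_mem hq) hp
  have := homogeneousComponent_eq_zero_of_mem_degreeLT h1 le_rfl
  rw [mul_sub, map_sub, sub_eq_zero] at this
  rw [this, homogeneousComponent_mul_of_isHomogeneous_add hqb]

lemma MvPolynomial.IsHomogeneous.degreeLT_of_lt {p : MvPolynomial σ ℂ} {k l : ℕ}
    (h : p.IsHomogeneous k) (hkl : k < l) : p ∈ degreeLT σ l :=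
  degreeLT_mono hkl h.mem_degreeLT

end Components

section Filtered

open Matrix

variable {e : ℕ} {g : Fin 3 → MvPolynomial (Fin 3) ℂ}

lemma KoszulExact.dot_homogeneous (hK : KoszulExact g) (hg : ∀ i, (g i).IsHomogeneous e) {k : ℕ}
    {v : Fin 3 → MvPolynomial (Fin 3) ℂ} (hv : ∀ i, (v i).IsHomogeneous k) (h : v ⬝ᵥ g = 0) :
    ∃ n : Fin 3 → MvPolynomial (Fin 3) ℂ, v = n ⨯₃ g ∧ (∀ i, (n i).IsHomogeneous (k - e)) ∧
      (k < e → n = 0) := by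
  obtain ⟨n, hn⟩ := hK.dot v h
  refine ⟨fun i => if e ≤ k then homogeneousComponent (k - e) (n i) else 0, ?_, ?_, ?_⟩
  · have h2 : ∀ i, v i = homogeneousComponent k ((n ⨯₃ g) i) := fun i => by
      rw [← hn, homogeneousComponent_eq_self (hv i)]
    ext1 i
    rw [h2]
    rw [cross_apply, cross_apply]
    fin_cases i <;> simp [homogeneousComponent_mul_of_isHomogeneous (hg _)]
  · intro i
    beta_reduce
    split_ifs
    · exact homogeneousComponent_isHomogeneous _ _
    · exact isHomogeneous_zero _ _ _
  · intro hk
    ext1 i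
    simp [not_le.mpr hk]

variable {F : Fin 3 → MvPolynomial (Fin 3) ℂ}

lemma cross_mem_degreeLT {k : ℕ} {n : Fin 3 → MvPolynomial (Fin 3) ℂ}
    (hF : ∀ i, F i ∈ degreeLT (Fin 3) (e + 1)) (hn : ∀ i, n i ∈ degreeLT (Fin 3) k) (i : Fin 3) :
    (n ⨯₃ F) i ∈ degreeLT (Fin 3) (k + e) := by
  have h := fun i j => mul_mem_degreeLT (hn i) (hF j)
  rw [cross_apply]
  fin_cases i
  · exact Submodule.sub_mem _ (h 1 2) (h 2 1)
  · exact Submodule.sub_mem _ (h 2 0) (h 0 2)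
  · exact Submodule.sub_mem _ (h 0 1) (h 1 0)

lemma homogeneousComponent_cross {k : ℕ} {n : Fin 3 → MvPolynomial (Fin 3) ℂ}
    (hF : ∀ i, F i ∈ degreeLT (Fin 3) (e + 1)) (hn : ∀ i, n i ∈ degreeLT (Fin 3) (k + 1))
    (i : Fin 3) : homogeneousComponent (k + e) ((n ⨯₃ F) i) =
      ((fun j => homogeneousComponent k (n j)) ⨯₃ (fun j => homogeneousComponent e (F j))) i := by
  have h := fun i j => homogeneousComponent_mul_of_mem_degreeLT (hn i) (hF j)
  rw [cross_apply, cross_apply]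
  fin_cases i <;> simp [h]

lemma homogeneousComponent_dot {k : ℕ} {n : Fin 3 → MvPolynomial (Fin 3) ℂ}
    (hF : ∀ i, F i ∈ degreeLT (Fin 3) (e + 1)) (hn : ∀ i, n i ∈ degreeLT (Fin 3) (k + 1)) :
    homogeneousComponent (k + e) (n ⬝ᵥ F) =
      (fun j => homogeneousComponent k (n j)) ⬝ᵥ (fun j => homogeneousComponent e (F j)) := by
  have h := fun i j => homogeneousComponent_mul_of_mem_degreeLT (hn i) (hF j)
  simp [dotProduct, Fin.sum_univ_three, h]

/-- One step of degree reduction along the Koszul complex. -/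
lemma exists_sub_cross_mem_degreeLT (hF : ∀ i, F i ∈ degreeLT (Fin 3) (e + 1))
    (hK : KoszulExact fun i => homogeneousComponent e (F i)) {k : ℕ}
    {v : Fin 3 → MvPolynomial (Fin 3) ℂ} (hv : ∀ i, v i ∈ degreeLT (Fin 3) (k + 1))
    (h : homogeneousComponent (k + e) (v ⬝ᵥ F) = 0) :
    ∃ n : Fin 3 → MvPolynomial (Fin 3) ℂ, (∀ i, n i ∈ degreeLT (Fin 3) (k + 1 - e)) ∧
      ∀ i, v i - (n ⨯₃ F) i ∈ degreeLT (Fin 3) k := by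
  rw [homogeneousComponent_dot hF hv] at h
  obtain ⟨n, hn, hnh, hn0⟩ := hK.dot_homogeneous
    (fun i => homogeneousComponent_isHomogeneous e (F i))
    (fun i => homogeneousComponent_isHomogeneous k (v i)) h
  rcases lt_or_ge k e with hke | hke
  · obtain rfl := hn0 hke
    refine ⟨0, fun i => Submodule.zero_mem _, fun i => ?_⟩
    have := congrFun hn i
    apply mem_degreeLT_of_homogeneousComponent_eq_zero
    · simpa using hv i
    · simpa using this
  · obtain ⟨l, rfl⟩ := Nat.exists_eq_add_of_le' hke
    rw [Nat.add_sub_cancel] at hnh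
    have hnd : ∀ i, n i ∈ degreeLT (Fin 3) (l + 1) := fun i => (hnh i).mem_degreeLT
    refine ⟨n, fun i => ?_, fun i => ?_⟩
    · rw [show l + e + 1 - e = l + 1 by omega]; exact hnd i
    · apply mem_degreeLT_of_homogeneousComponent_eq_zero
      · refine Submodule.sub_mem _ (hv i) ?_
        have := cross_mem_degreeLT hF hnd i
        rwa [show l + 1 + e = l + e + 1 by omega] at this
      · rw [map_sub, homogeneousComponent_cross hF hnd]
        have h3 : (fun j => homogeneousComponent l (n j)) = n :=
          funext fun j => homogeneousComponent_eq_self (hnh j)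
        rw [h3, ← hn, sub_self]

lemma exists_dot_eq_of_mem_degreeLT (hF : ∀ i, F i ∈ degreeLT (Fin 3) (e + 1))
    (hK : KoszulExact fun i => homogeneousComponent e (F i)) {k : ℕ}
    {b : Fin 3 → MvPolynomial (Fin 3) ℂ} (h : b ⬝ᵥ F ∈ degreeLT (Fin 3) k) :
    ∃ b' : Fin 3 → MvPolynomial (Fin 3) ℂ, (∀ i, b' i ∈ degreeLT (Fin 3) (k - e)) ∧
      b' ⬝ᵥ F = b ⬝ᵥ F := by
  have key : ∀ m, ∀ b : Fin 3 → MvPolynomial (Fin 3) ℂ, b ⬝ᵥ F ∈ degreeLT (Fin 3) k →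
      (∀ i, b i ∈ degreeLT (Fin 3) m) →
      ∃ b' : Fin 3 → MvPolynomial (Fin 3) ℂ, (∀ i, b' i ∈ degreeLT (Fin 3) (k - e)) ∧
      b' ⬝ᵥ F = b ⬝ᵥ F := by
    intro m
    induction m with
    | zero => exact fun b _ hb => ⟨b, fun i => degreeLT_mono (Nat.zero_le _) (hb i), rfl⟩
    | succ m ih =>
      intro b h hb
      rcases le_or_gt (m + 1) (k - e) with hm | hm
      · exact ⟨b, fun i => degreeLT_mono hm (hb i), rfl⟩
      · obtain ⟨n, -, hn⟩ := exists_sub_cross_mem_degreeLT hF hK hb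
          (homogeneousComponent_eq_zero_of_mem_degreeLT h (by omega))
        have e1 : (b - n ⨯₃ F) ⬝ᵥ F = b ⬝ᵥ F := by
          rw [sub_dotProduct, dotProduct_comm (n ⨯₃ F) F, dot_cross_self, sub_zero]
        obtain ⟨b', h1, h2⟩ := ih (b - n ⨯₃ F) (by rwa [e1]) hn
        exact ⟨b', h1, h2.trans e1⟩
  choose m hm using fun i => exists_mem_degreeLT (b i)
  exact key (m 0 + m 1 + m 2) b h fun i => degreeLT_mono (by fin_cases i <;> simp <;> omega) (hm i)

lemma exists_eq_cross_of_mem_degreeLT (hF : ∀ i, F i ∈ degreeLT (Fin 3) (e + 1))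
    (hK : KoszulExact fun i => homogeneousComponent e (F i)) {k : ℕ}
    {v : Fin 3 → MvPolynomial (Fin 3) ℂ} (hv : ∀ i, v i ∈ degreeLT (Fin 3) k) (h : v ⬝ᵥ F = 0) :
    ∃ n : Fin 3 → MvPolynomial (Fin 3) ℂ, (∀ i, n i ∈ degreeLT (Fin 3) (k - e)) ∧
      v = n ⨯₃ F := by
  induction k generalizing v with
  | zero =>
    refine ⟨0, fun i => Submodule.zero_mem _, ?_⟩
    ext1 i
    rw [eq_zero_of_mem_degreeLT_zero (hv i)]; simp
  | succ k ih =>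
    obtain ⟨n, hn1, hn2⟩ := exists_sub_cross_mem_degreeLT hF hK hv (by rw [h, map_zero])
    obtain ⟨n', h1, h2⟩ := ih (v := v - n ⨯₃ F) hn2 (by
      rw [sub_dotProduct, dotProduct_comm (n ⨯₃ F) F, dot_cross_self, sub_zero, h])
    refine ⟨n' + n, fun i => Submodule.add_mem _ (degreeLT_mono (by omega) (h1 i)) (hn1 i), ?_⟩
    rw [map_add, LinearMap.add_apply, ← h2, sub_add_cancel]

end Filtered

section Dehomogenization

open Matrix

/-- Dehomogenization with respect to the last variable. -/
def dehom : MvPolynomial (Fin 4) ℂ →ₐ[ℂ] MvPolynomial (Fin 3) ℂ :=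
  aeval (Fin.snoc (α := fun _ => MvPolynomial (Fin 3) ℂ) X 1)

lemma dehom_X_three : dehom (X 3) = 1 := by
  rw [dehom, aeval_X]; rfl

lemma dehom_X_castSucc (i : Fin 3) : dehom (X i.castSucc) = X i := by
  rw [dehom, aeval_X, Fin.snoc_castSucc]

lemma dehom_rename (g : MvPolynomial (Fin 3) ℂ) : dehom (rename Fin.castSucc g) = g := by
  induction g using MvPolynomial.induction_on with
  | C a => simp
  | add p q hp hq => simp [hp, hq]
  | mul_X p i hp => rw [map_mul, map_mul, hp, rename_X, dehom_X_castSucc]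

lemma dehom_expansion (d : ℕ) (g : ℕ → MvPolynomial (Fin 3) ℂ) :
    dehom (∑ j ∈ Finset.range (d + 1), (X 3) ^ (d - j) * rename Fin.castSucc (g j)) =
      ∑ j ∈ Finset.range (d + 1), g j := by
  simp [dehom_X_three, dehom_rename]

lemma homogeneousComponent_sum_range {σ : Type*} {d : ℕ} {g : ℕ → MvPolynomial σ ℂ}
    (hg : ∀ j, (g j).IsHomogeneous j) {k : ℕ} (hk : k ≤ d) :
    homogeneousComponent k (∑ j ∈ Finset.range (d + 1), g j) = g k := by
  rw [map_sum, Finset.sum_eq_single k]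
  · exact homogeneousComponent_eq_self (hg k)
  · intro j _ hj
    rw [homogeneousComponent_of_mem ((mem_homogeneousSubmodule _ _).mpr (hg j)), if_neg hj.symm]
  · intro h; exact absurd (Finset.mem_range.mpr (by omega)) h

lemma dehom_mem_degreeLT {P : MvPolynomial (Fin 4) ℂ} {d : ℕ} (hP : P.IsHomogeneous d) :
    dehom P ∈ degreeLT (Fin 3) (d + 1) := by
  obtain ⟨g, hg, rfl⟩ := exists_castSucc_expansion hP
  rw [dehom_expansion]
  refine Submodule.sum_mem _ fun j hj => (hg j).degreeLT_of_lt (by simpa using hj)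

lemma eq_zero_of_dehom_eq_zero {P : MvPolynomial (Fin 4) ℂ} {d : ℕ} (hP : P.IsHomogeneous d)
    (h : dehom P = 0) : P = 0 := by
  obtain ⟨g, hg, rfl⟩ := exists_castSucc_expansion hP
  rw [dehom_expansion] at h
  refine Finset.sum_eq_zero fun j hj => ?_
  rw [← homogeneousComponent_sum_range hg (k := j) (by simpa [Nat.lt_succ_iff] using hj), h]
  simp

lemma eq_of_dehom_eq {P Q : MvPolynomial (Fin 4) ℂ} {d : ℕ} (hP : P.IsHomogeneous d)
    (hQ : Q.IsHomogeneous d) (h : dehom P = dehom Q) : P = Q :=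
  sub_eq_zero.mp (eq_zero_of_dehom_eq_zero (hP.sub hQ) (by rw [map_sub, h, sub_self]))

lemma exists_dehom_eq {p : MvPolynomial (Fin 3) ℂ} {d : ℕ} (hp : p ∈ degreeLT (Fin 3) (d + 1)) :
    ∃ P : MvPolynomial (Fin 4) ℂ, P.IsHomogeneous d ∧ dehom P = p := by
  refine ⟨∑ j ∈ Finset.range (d + 1),
    (X 3) ^ (d - j) * rename Fin.castSucc (homogeneousComponent j p), ?_, ?_⟩
  · refine IsHomogeneous.sum _ _ _ fun j hj => ?_
    have := (isHomogeneous_X_pow (R := ℂ) (3 : Fin 4) (d - j)).mul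
      ((homogeneousComponent_isHomogeneous j p).rename_isHomogeneous (f := Fin.castSucc))
    rwa [Nat.sub_add_cancel (by simpa [Nat.lt_succ_iff] using hj)] at this
  · rw [dehom_expansion]
    have : p.totalDegree < d + 1 := by
      rw [totalDegree, Finset.sup_lt_iff (Nat.succ_pos d)]
      intro s hs
      have := mem_degreeLT.mp hp s (mem_support_iff.mp hs)
      rwa [Finsupp.degree_apply] at this
    rw [← Finset.sum_subset (Finset.range_mono (show p.totalDegree + 1 ≤ d + 1 by omega)),
      sum_homogeneousComponent]
    intro j _ hj
    exact homogeneousComponent_eq_zero _ _ (by simpa using hj)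

lemma eval_homogeneousComponent_dehom {P : MvPolynomial (Fin 4) ℂ} {d : ℕ}
    (hP : P.IsHomogeneous d) (a : Fin 3 → ℂ) :
    eval a (homogeneousComponent d (dehom P)) = eval (extendZero a) P := by
  obtain ⟨g, hg, rfl⟩ := exists_castSucc_expansion hP
  rw [dehom_expansion, homogeneousComponent_sum_range hg le_rfl, map_sum,
    Finset.sum_range_succ, Finset.sum_eq_zero]
  · have : extendZero a ∘ Fin.castSucc = a := funext fun i => extendZero_castSucc a i
    simp [eval_rename, this]
  · intro j hj
    have : d - j ≠ 0 := by have := Finset.mem_range.mp hj; omega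
    simp [extendZero_last, this]

/-- The dehomogenization of a polynomial is its value at `(y, 1)`. -/
lemma eval_dehom (P : MvPolynomial (Fin 4) ℂ) (y : Fin 3 → ℂ) :
    eval y (dehom P) = eval (Fin.snoc (α := fun _ => ℂ) y 1) P := by
  induction P using MvPolynomial.induction_on with
  | C a => simp
  | add p q hp hq => simp [hp, hq]
  | mul_X p i hp =>
    rw [map_mul, map_mul, hp, map_mul, eval_X]
    congr 1
    refine Fin.lastCases ?_ (fun i => ?_) i
    · rw [show Fin.last 3 = (3 : Fin 4) from rfl, dehom_X_three, map_one]; rfl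
    · rw [dehom_X_castSucc, eval_X, Fin.snoc_castSucc]

lemma koszulExact_dehom {e : ℕ} {g : Fin 3 → MvPolynomial (Fin 4) ℂ}
    (hg : ∀ i, (g i).IsHomogeneous e)
    (h0 : ∀ x : Fin 4 → ℂ, x 3 = 0 → (∀ i, eval x (g i) = 0) → x = 0) :
    KoszulExact fun i => homogeneousComponent e (dehom (g i)) := by
  refine koszulExact_of_forall_zero fun a ha => ?_
  have := h0 (extendZero a) (extendZero_last a) fun i => by
    rw [← eval_homogeneousComponent_dehom (hg i), ha i]
  ext i
  rw [← extendZero_castSucc a i, this]; rfl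

/-- Koszul exactness, with degrees, for three forms having no common zero on `x₃ = 0`. -/
lemma exists_homogeneous_cross {e : ℕ} {g : Fin 3 → MvPolynomial (Fin 4) ℂ}
    (hg : ∀ i, (g i).IsHomogeneous e)
    (h0 : ∀ x : Fin 4 → ℂ, x 3 = 0 → (∀ i, eval x (g i) = 0) → x = 0) {k : ℕ}
    {v : Fin 3 → MvPolynomial (Fin 4) ℂ} (hv : ∀ i, (v i).IsHomogeneous k) (h : v ⬝ᵥ g = 0) :
    ∃ n : Fin 3 → MvPolynomial (Fin 4) ℂ, v = n ⨯₃ g ∧ (∀ i, (n i).IsHomogeneous (k - e)) ∧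
      (k < e → n = 0) := by
  have hK := koszulExact_dehom hg h0
  obtain ⟨m, hm1, hm2⟩ := exists_eq_cross_of_mem_degreeLT (e := e) (k := k + 1)
    (F := fun i => dehom (g i)) (v := fun i => dehom (v i))
    (fun i => dehom_mem_degreeLT (hg i)) hK (fun i => dehom_mem_degreeLT (hv i)) (by
      have := congrArg dehom h
      simpa [dotProduct, Fin.sum_univ_three] using this)
  rcases lt_or_ge k e with hke | hke
  · have hm : m = 0 := funext fun i => eq_zero_of_mem_degreeLT_zero (by
      have := hm1 i; rwa [show k + 1 - e = 0 by omega] at this)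
    refine ⟨0, ?_, fun i => isHomogeneous_zero _ _ _, fun _ => rfl⟩
    ext1 i
    have := congrFun hm2 i
    rw [hm] at this
    rw [eq_zero_of_dehom_eq_zero (hv i) (by simpa using this)]; simp
  · choose n hn1 hn2 using fun i => exists_dehom_eq (d := k - e) (p := m i) (by
      have := hm1 i; rwa [show k + 1 - e = k - e + 1 by omega] at this)
    refine ⟨n, ?_, hn1, fun h => absurd h (by omega)⟩
    ext1 i
    have hc : ∀ i, ((n ⨯₃ g) i).IsHomogeneous k := by
      intro i
      have h := fun i j => (hn1 i).mul (hg j)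
      simp only [Nat.sub_add_cancel hke] at h
      rw [cross_apply]
      fin_cases i <;> exact (h _ _).sub (h _ _)
    refine eq_of_dehom_eq (hv i) (hc i) ?_
    have := congrFun hm2 i
    rw [this, cross_apply, cross_apply]
    fin_cases i <;> simp [hn2]

end Dehomogenization

section Dimensions

instance finiteDimensional_homogeneousSubmodule (n k : ℕ) :
    FiniteDimensional ℂ (homogeneousSubmodule (Fin n) ℂ k) :=
  Module.Finite.iff_fg.mpr (homogeneousSubmodule_fg _ _ k)

lemma finrank_homogeneousSubmodule (n k : ℕ) :
    Module.finrank ℂ (homogeneousSubmodule (Fin n) ℂ k) = n.multichoose k := by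
  have h : homogeneousSubmodule (Fin n) ℂ k =
      restrictSupport ℂ {s : Fin n →₀ ℕ | s.sum (fun _ ↦ id) = k} := by
    ext p
    rw [mem_homogeneousSubmodule, isHomogeneous_iff_degree, mem_restrictSupport_iff]
    constructor
    · intro h s hs
      exact h s (by simpa using hs)
    · intro h s hs
      exact h (by simpa using hs)
  rw [h, Module.finrank_eq_nat_card_basis (basisRestrictSupport ℂ _)]
  have := Nat.card_congr (Sym.equivNatSum (Fin n) k)
  rw [Nat.card_eq_fintype_card, Sym.card_sym_eq_multichoose, Fintype.card_fin] at this
  rw [this]; rfl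

/-- Dehomogenization identifies forms of degree `k` with polynomials of degree at most `k`. -/
def dehomEquiv (k : ℕ) : homogeneousSubmodule (Fin 4) ℂ k ≃ₗ[ℂ] degreeLT (Fin 3) (k + 1) :=
  LinearEquiv.ofBijective
    ((dehom.toLinearMap.domRestrict _).codRestrict _ fun P => dehom_mem_degreeLT P.2)
    ⟨fun P Q h => Subtype.ext (eq_of_dehom_eq P.2 Q.2 (congrArg Subtype.val h)), fun p => by
      obtain ⟨P, hP, hPp⟩ := exists_dehom_eq p.2
      exact ⟨⟨P, hP⟩, Subtype.ext hPp⟩⟩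

instance finiteDimensional_degreeLT (k : ℕ) : FiniteDimensional ℂ (degreeLT (Fin 3) (k + 1)) :=
  Module.Finite.equiv (dehomEquiv k)

lemma finrank_degreeLT (k : ℕ) :
    Module.finrank ℂ (degreeLT (Fin 3) (k + 1)) = Nat.multichoose 4 k := by
  rw [← (dehomEquiv k).finrank_eq, finrank_homogeneousSubmodule]

end Dimensions

section Socle

open Matrix

variable {g : Fin 3 → MvPolynomial (Fin 3) ℂ}

lemma koszulExact_X : KoszulExact (X : Fin 3 → MvPolynomial (Fin 3) ℂ) :=
  koszulExact_of_forall_zero fun x h => funext fun i => by simpa using h i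

lemma KoszulExact.ne_zero (hK : KoszulExact g) (hg : ∀ i, (g i).IsHomogeneous 5) (i : Fin 3) :
    g i ≠ 0 := by
  intro h
  obtain ⟨n, hn⟩ := hK.dot (Pi.single i 1) (by simp [h])
  have h1 := congrArg (eval 0) (congrFun hn i)
  have h2 : ∀ j, eval 0 (g j) = 0 := fun j => eval_zero_of_isHomogeneous (hg j) (by norm_num)
  rw [cross_apply] at h1
  have h3 : ∀ j, constantCoeff (g j) = 0 := fun j => by simpa using h2 j
  fin_cases i <;> simp [h3] at h1

lemma KoszulExact.exists_dot_of_mul {R : Type*} [CommRing R] {g x : Fin 3 → R}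
    (hx : KoszulExact x) {a : R} {u : Fin 3 → Fin 3 → R} (hu : ∀ i, u i ⬝ᵥ g = x i * a)
    {n : Fin 3 → Fin 3 → Fin 3 → R}
    (hn : ∀ i j, (fun l => x i * u j l - x j * u i l) = n i j ⨯₃ g)
    (h0 : ∀ l, x 0 * n 1 2 l + x 1 * n 2 0 l + x 2 * n 0 1 l = 0) :
    ∃ b : Fin 3 → R, x 0 * a = x 0 * (b ⬝ᵥ g) := by
  have hm : ∀ l : Fin 3, ∃ m : Fin 3 → R, ![n 1 2 l, n 2 0 l, n 0 1 l] = m ⨯₃ x := by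
    intro l
    apply hx.dot
    have := h0 l
    simp [dotProduct, Fin.sum_univ_three]
    linear_combination this
  choose m hm using hm
  set U : Fin 3 → Fin 3 → R := fun i => u i + (fun l => m l i) ⨯₃ g with hU
  have hUb : ∀ l : Fin 3, ∃ b : R, (fun i => U i l) = b • x := by
    intro l
    apply hx.cross
    have e1 := hn 1 2
    have e2 := hn 2 0
    have e3 := hn 0 1
    have m1 := fun l => congrFun (hm l) 0
    have m2 := fun l => congrFun (hm l) 1
    have m3 := fun l => congrFun (hm l) 2
    rw [cross_apply] at e1 e2 e3
    simp only [cross_apply] at m1 m2 m3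
    simp at m1 m2 m3
    rw [cross_eq_zero_iff]
    have e1 := congrFun e1 l
    have e2 := congrFun e2 l
    have e3 := congrFun e3 l
    simp only [m1, m2, m3] at e1 e2 e3
    simp only [hU, cross_apply]
    fin_cases l
    all_goals
      simp at e1 e2 e3 ⊢
      refine ⟨?_, ?_, ?_⟩
      · linear_combination -e1
      · linear_combination -e2
      · linear_combination -e3
  choose b hb using hUb
  refine ⟨b, ?_⟩
  rw [← hu 0]
  have h1 : U 0 ⬝ᵥ g = u 0 ⬝ᵥ g := by
    rw [hU]; simp only
    rw [add_dotProduct, dotProduct_comm (_ ⨯₃ g) g, dot_cross_self, add_zero]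
  rw [← h1]
  have h2 := fun l => congrFun (hb l) 0
  simp only [Pi.smul_apply, smul_eq_mul] at h2
  simp only [dotProduct, h2, Fin.sum_univ_three]
  ring

lemma sum_cross_eq_zero {R : Type*} [CommRing R] {g x : Fin 3 → R}
    {u : Fin 3 → Fin 3 → R} {n : Fin 3 → Fin 3 → Fin 3 → R}
    (hn : ∀ i j, (fun l => x i * u j l - x j * u i l) = n i j ⨯₃ g) :
    (fun l => x 0 * n 1 2 l + x 1 * n 2 0 l + x 2 * n 0 1 l) ⨯₃ g = 0 := by
  have e1 := hn 1 2
  have e2 := hn 2 0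
  have e3 := hn 0 1
  rw [cross_apply] at e1 e2 e3 ⊢
  ext1 l
  have e1 := congrFun e1 l
  have e2 := congrFun e2 l
  have e3 := congrFun e3 l
  fin_cases l
  all_goals
    simp at e1 e2 e3
    simp
    linear_combination - x 0 * e1 - x 1 * e2 - x 2 * e3

lemma mem_span_of_X_mul_mem (hK : KoszulExact g) (hg : ∀ i, (g i).IsHomogeneous 5)
    {a : MvPolynomial (Fin 3) ℂ} (ha : a ∈ degreeLT (Fin 3) 12)
    (h : ∀ i, X i * a ∈ Ideal.span (Set.range g)) : a ∈ Ideal.span (Set.range g) := by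
  have hF : ∀ i, g i ∈ degreeLT (Fin 3) (5 + 1) := fun i => (hg i).mem_degreeLT
  have hK' : KoszulExact fun i => homogeneousComponent 5 (g i) := by
    simpa only [homogeneousComponent_eq_self (hg _)] using hK
  have hX : ∀ (i : Fin 3) (k : ℕ) (p : MvPolynomial (Fin 3) ℂ), p ∈ degreeLT (Fin 3) k →
      X i * p ∈ degreeLT (Fin 3) (k + 1) := fun i k p hp => by
    rw [mul_comm]; exact mul_mem_degreeLT hp (isHomogeneous_X ℂ i).mem_degreeLT
  have hu : ∀ i : Fin 3, ∃ u : Fin 3 → MvPolynomial (Fin 3) ℂ,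
      (∀ j, u j ∈ degreeLT (Fin 3) 8) ∧ u ⬝ᵥ g = X i * a := by
    intro i
    obtain ⟨c, hc⟩ := exists_coeff_of_mem_span (h i)
    obtain ⟨b, hb, hb'⟩ := exists_dot_eq_of_mem_degreeLT (k := 13) hF hK' (b := c)
      (by rw [hc]; exact hX i 12 a ha)
    exact ⟨b, hb, hb'.trans hc⟩
  choose u hu1 hu2 using hu
  have hn : ∀ i j : Fin 3, ∃ n : Fin 3 → MvPolynomial (Fin 3) ℂ,
      (∀ l, n l ∈ degreeLT (Fin 3) 4) ∧ (fun l => X i * u j l - X j * u i l) = n ⨯₃ g := by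
    intro i j
    have h1 : ∀ l, X i * u j l - X j * u i l ∈ degreeLT (Fin 3) 9 := fun l =>
      Submodule.sub_mem _ (hX i 8 _ (hu1 j l)) (hX j 8 _ (hu1 i l))
    refine exists_eq_cross_of_mem_degreeLT (k := 9) hF hK' h1 ?_
    have h1 := hu2 i
    have h2 := hu2 j
    simp only [dotProduct, Fin.sum_univ_three] at h1 h2 ⊢
    linear_combination X i * h2 - X j * h1
  choose n hn1 hn2 using hn
  have hyd : ∀ l, X 0 * n 1 2 l + X 1 * n 2 0 l + X 2 * n 0 1 l ∈ degreeLT (Fin 3) 5 := fun l =>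
    Submodule.add_mem _ (Submodule.add_mem _ (hX 0 4 _ (hn1 1 2 l)) (hX 1 4 _ (hn1 2 0 l)))
      (hX 2 4 _ (hn1 0 1 l))
  obtain ⟨w, hw⟩ := hK.cross _ (sum_cross_eq_zero (x := X) hn2)
  have hw0 : w = 0 := by
    by_contra hw0
    have h1 := totalDegree_mul_of_isDomain hw0 (hK.ne_zero hg 0)
    have h2 := (hg 0).totalDegree (hK.ne_zero hg 0)
    have h3 : w * g 0 ∈ degreeLT (Fin 3) 5 := by
      have := congrFun hw 0
      rw [Pi.smul_apply, smul_eq_mul] at this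
      rw [← this]; exact hyd 0
    have h4 : (w * g 0).totalDegree < 5 := by
      rw [totalDegree, Finset.sup_lt_iff (by norm_num)]
      intro s hs
      have := mem_degreeLT.mp h3 s (mem_support_iff.mp hs)
      rwa [Finsupp.degree_apply] at this
    omega
  obtain ⟨b, hb⟩ := koszulExact_X.exists_dot_of_mul hu2 hn2 fun l => by
    rw [hw0, zero_smul] at hw
    exact congrFun hw l
  rw [mul_left_cancel₀ (X_ne_zero 0) hb]
  exact Submodule.sum_mem _ fun i _ => Ideal.mul_mem_left _ _ (Ideal.subset_span ⟨i, rfl⟩)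

end Socle

section SocleDimension

open Matrix

variable {g : Fin 3 → MvPolynomial (Fin 3) ℂ}

/-- The linear map `b ↦ b ⬝ᵥ g` on triples of forms of degree `k`. -/
def dotForms (g : Fin 3 → MvPolynomial (Fin 3) ℂ) (k : ℕ) :
    (Fin 3 → homogeneousSubmodule (Fin 3) ℂ k) →ₗ[ℂ] MvPolynomial (Fin 3) ℂ where
  toFun b := (fun i => (b i : MvPolynomial (Fin 3) ℂ)) ⬝ᵥ g
  map_add' b c := by simp [dotProduct, Fin.sum_univ_three]; ring
  map_smul' a b := by simp [dotProduct, Fin.sum_univ_three, smul_eq_C_mul]; ring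

/-- The linear map `n ↦ n ⨯₃ g` on triples of forms of degree `k`. -/
def crossForms (g : Fin 3 → MvPolynomial (Fin 3) ℂ) (k : ℕ) :
    (Fin 3 → homogeneousSubmodule (Fin 3) ℂ k) →ₗ[ℂ] (Fin 3 → MvPolynomial (Fin 3) ℂ) where
  toFun b := (fun i => (b i : MvPolynomial (Fin 3) ℂ)) ⨯₃ g
  map_add' b c := by
    ext1 i
    simp only [cross_apply]
    fin_cases i <;> simp <;> ring
  map_smul' a b := by
    ext1 i
    simp only [cross_apply]
    fin_cases i <;> simp [smul_eq_C_mul] <;> ring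

lemma le_finrank_range_dotForms (hK : KoszulExact g) (hg : ∀ i, (g i).IsHomogeneous 5) (k : ℕ) :
    3 * Nat.multichoose 3 k ≤ Module.finrank ℂ (LinearMap.range (dotForms g k)) +
      3 * Nat.multichoose 3 (k - 5) := by
  have h1 := LinearMap.finrank_range_add_finrank_ker (dotForms g k)
  rw [Module.finrank_pi_fintype] at h1
  simp only [finrank_homogeneousSubmodule, Finset.sum_const, Finset.card_univ, Fintype.card_fin,
    smul_eq_mul] at h1
  set ι : (Fin 3 → homogeneousSubmodule (Fin 3) ℂ k) →ₗ[ℂ] (Fin 3 → MvPolynomial (Fin 3) ℂ) :=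
    LinearMap.pi fun i => (Submodule.subtype _).comp (LinearMap.proj i) with hι
  have hinj : Function.Injective ι := fun a b h => funext fun i => Subtype.ext (congrFun h i)
  have h2 : (LinearMap.ker (dotForms g k)).map ι ≤ LinearMap.range (crossForms g (k - 5)) := by
    rintro _ ⟨v, hv, rfl⟩
    obtain ⟨n, hn, hnh, -⟩ := hK.dot_homogeneous hg (k := k) (v := ι v) (fun i => (v i).2) hv
    exact ⟨fun i => ⟨n i, hnh i⟩, hn.symm⟩
  have h3 := Submodule.finrank_mono h2
  rw [← (Submodule.equivMapOfInjective ι hinj _).finrank_eq] at h3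
  have h4 := LinearMap.finrank_range_le (crossForms g (k - 5))
  rw [Module.finrank_pi_fintype] at h4
  simp only [finrank_homogeneousSubmodule, Finset.sum_const, Finset.card_univ, Fintype.card_fin,
    smul_eq_mul] at h4
  omega

lemma range_dotForms_le (hg : ∀ i, (g i).IsHomogeneous 5) (k : ℕ) :
    LinearMap.range (dotForms g k) ≤ homogeneousSubmodule (Fin 3) ℂ (k + 5) := by
  rintro _ ⟨b, rfl⟩
  exact IsHomogeneous.sum _ _ _ fun i _ => (b i).2.mul (hg i)

lemma dotProduct_mem_span {R : Type*} [CommRing R] (b g : Fin 3 → R) :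
    b ⬝ᵥ g ∈ Ideal.span (Set.range g) :=
  Ideal.sum_mem _ fun i _ => Ideal.mul_mem_left _ _ (Ideal.subset_span ⟨i, rfl⟩)

lemma mem_span_of_mem_range_dotForms {k : ℕ} {p : MvPolynomial (Fin 3) ℂ}
    (hp : p ∈ LinearMap.range (dotForms g k)) : p ∈ Ideal.span (Set.range g) := by
  obtain ⟨b, rfl⟩ := hp
  exact dotProduct_mem_span (fun i => (b i : MvPolynomial (Fin 3) ℂ)) g

lemma mem_span_of_isHomogeneous (hK : KoszulExact g) (hg : ∀ i, (g i).IsHomogeneous 5) {k : ℕ}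
    (hk : 13 ≤ k) {p : MvPolynomial (Fin 3) ℂ} (hp : p.IsHomogeneous k) :
    p ∈ Ideal.span (Set.range g) := by
  have h13 : LinearMap.range (dotForms g 8) = homogeneousSubmodule (Fin 3) ℂ 13 := by
    refine Submodule.eq_of_le_of_finrank_le (range_dotForms_le hg 8) ?_
    have := le_finrank_range_dotForms hK hg 8
    rw [finrank_homogeneousSubmodule]
    norm_num [Nat.multichoose_eq, Nat.choose] at this ⊢
    omega
  have hmon : ∀ k, 13 ≤ k → ∀ s : Fin 3 →₀ ℕ, s.degree = k →
      monomial s (1 : ℂ) ∈ Ideal.span (Set.range g) := by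
    intro k hk
    induction k, hk using Nat.le_induction with
    | base =>
      intro s hs
      refine mem_span_of_mem_range_dotForms (k := 8) ?_
      rw [h13]
      exact isHomogeneous_monomial _ hs
    | succ k hk ih =>
      intro s hs
      obtain ⟨i, hi⟩ : ∃ i, s i ≠ 0 := by
        by_contra! h
        have : s = 0 := Finsupp.ext h
        simp [this] at hs
      have hs' : s = (s - Finsupp.single i 1) + Finsupp.single i 1 := by
        rw [tsub_add_cancel_of_le]
        simpa [Nat.one_le_iff_ne_zero] using hi
      have h := congrArg Finsupp.degree hs'
      rw [map_add, Finsupp.degree_single] at h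
      rw [hs', ← mul_one (1 : ℂ), ← monomial_mul]
      exact Ideal.mul_mem_right _ _ (ih _ (by omega))
  rw [p.as_sum]
  refine Submodule.sum_mem _ fun s hs => ?_
  rw [← mul_one (coeff s p), ← C_mul_monomial]
  exact Ideal.mul_mem_left _ _ (hmon k hk s (isHomogeneous_iff_degree.mp hp s
    (mem_support_iff.mp hs)))

lemma exists_sub_smul_mem_span (hK : KoszulExact g) (hg : ∀ i, (g i).IsHomogeneous 5)
    {a b : MvPolynomial (Fin 3) ℂ} (ha : a.IsHomogeneous 12) (hb : b.IsHomogeneous 12)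
    (hbI : b ∉ Ideal.span (Set.range g)) : ∃ c : ℂ, a - c • b ∈ Ideal.span (Set.range g) := by
  set W := LinearMap.range (dotForms g 7) with hW
  have hb' : b ∉ W := fun h => hbI (mem_span_of_mem_range_dotForms h)
  have hle : W ⊔ Submodule.span ℂ {b} ≤ homogeneousSubmodule (Fin 3) ℂ 12 :=
    sup_le (range_dotForms_le hg 7) ((Submodule.span_singleton_le_iff_mem _ _).mpr hb)
  have hlt : W < W ⊔ Submodule.span ℂ {b} := by
    refine lt_of_le_of_ne le_sup_left fun h => hb' ?_
    rw [h]; exact Submodule.mem_sup_right (Submodule.mem_span_singleton_self b)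
  have heq : W ⊔ Submodule.span ℂ {b} = homogeneousSubmodule (Fin 3) ℂ 12 := by
    have : FiniteDimensional ℂ ↥(W ⊔ Submodule.span ℂ {b}) :=
      Submodule.finiteDimensional_of_le hle
    refine Submodule.eq_of_le_of_finrank_le hle ?_
    have h1 := Submodule.finrank_lt_finrank_of_lt hlt
    have h2 := le_finrank_range_dotForms hK hg 7
    rw [finrank_homogeneousSubmodule]
    rw [← hW] at h2
    norm_num [Nat.multichoose_eq, Nat.choose] at h2 ⊢
    omega
  have ha' : a ∈ W ⊔ Submodule.span ℂ {b} := by rw [heq]; exact ha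
  obtain ⟨w, hw, z, hz, rfl⟩ := Submodule.mem_sup.mp ha'
  obtain ⟨c, rfl⟩ := Submodule.mem_span_singleton.mp hz
  exact ⟨c, by rw [add_sub_cancel_right]; exact mem_span_of_mem_range_dotForms hw⟩

lemma exists_mul_not_mem_span (hK : KoszulExact g) (hg : ∀ i, (g i).IsHomogeneous 5) {k l : ℕ}
    (hkl : k + l = 12) {a : MvPolynomial (Fin 3) ℂ} (ha : a.IsHomogeneous k)
    (haI : a ∉ Ideal.span (Set.range g)) :
    ∃ m : MvPolynomial (Fin 3) ℂ, m.IsHomogeneous l ∧ m * a ∉ Ideal.span (Set.range g) := by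
  induction l generalizing k a with
  | zero => exact ⟨1, isHomogeneous_one _ _, by rwa [one_mul]⟩
  | succ l ih =>
    obtain ⟨i, hi⟩ : ∃ i, X i * a ∉ Ideal.span (Set.range g) := by
      by_contra! h
      exact haI (mem_span_of_X_mul_mem hK hg (ha.degreeLT_of_lt (by omega)) h)
    obtain ⟨m, hm, hm'⟩ := ih (k := k + 1) (by omega)
      (by rw [mul_comm]; exact ha.mul (isHomogeneous_X ℂ i)) hi
    exact ⟨m * X i, hm.mul (isHomogeneous_X ℂ i), by rwa [mul_assoc]⟩

lemma one_not_mem_span (hg : ∀ i, (g i).IsHomogeneous 5) :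
    (1 : MvPolynomial (Fin 3) ℂ) ∉ Ideal.span (Set.range g) := by
  intro h
  obtain ⟨c, hc⟩ := exists_coeff_of_mem_span h
  have h2 : ∀ j, eval 0 (g j) = 0 := fun j => eval_zero_of_isHomogeneous (hg j) (by norm_num)
  have := congrArg (eval 0) hc
  rw [dotProduct, map_sum, map_one, Finset.sum_eq_zero] at this
  · exact zero_ne_one this
  · intro i _
    rw [map_mul, h2, mul_zero]

end SocleDimension

section Duality

open Matrix

variable {F : Fin 3 → MvPolynomial (Fin 3) ℂ}

lemma homogeneousComponent_mem_span (hF : ∀ i, F i ∈ degreeLT (Fin 3) (5 + 1))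
    (hK : KoszulExact fun i => homogeneousComponent 5 (F i)) {k : ℕ} {t : MvPolynomial (Fin 3) ℂ}
    (ht : t ∈ degreeLT (Fin 3) (k + 1)) (htF : t ∈ Ideal.span (Set.range F)) :
    homogeneousComponent k t ∈ Ideal.span (Set.range fun i => homogeneousComponent 5 (F i)) := by
  obtain ⟨c, rfl⟩ := exists_coeff_of_mem_span htF
  obtain ⟨b, hb, hbc⟩ := exists_dot_eq_of_mem_degreeLT hF hK ht
  rw [← hbc]
  rcases lt_or_ge k 5 with hk | hk
  · have : b = 0 := funext fun i => eq_zero_of_mem_degreeLT_zero (by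
      have := hb i; rwa [show k + 1 - 5 = 0 by omega] at this)
    simp [this]
  · obtain ⟨l, rfl⟩ := Nat.exists_eq_add_of_le' hk
    rw [homogeneousComponent_dot hF fun i => (by
      have := hb i; rwa [show l + 5 + 1 - 5 = l + 1 by omega] at this)]
    exact dotProduct_mem_span _ _

lemma exists_sub_mem_span (hF : ∀ i, F i ∈ degreeLT (Fin 3) (5 + 1)) {k : ℕ}
    {t : MvPolynomial (Fin 3) ℂ} (ht : t ∈ degreeLT (Fin 3) (k + 1))
    (htop : homogeneousComponent k t ∈
      Ideal.span (Set.range fun i => homogeneousComponent 5 (F i))) :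
    ∃ t' ∈ degreeLT (Fin 3) k, t - t' ∈ Ideal.span (Set.range F) := by
  have hg : ∀ i, (homogeneousComponent 5 (F i)).IsHomogeneous 5 :=
    fun i => homogeneousComponent_isHomogeneous 5 _
  obtain ⟨c, hc⟩ := exists_coeff_of_mem_span htop
  have hc2 := congrArg (homogeneousComponent k) hc
  rw [homogeneousComponent_eq_self (homogeneousComponent_isHomogeneous k t), dotProduct, map_sum]
    at hc2
  simp only [homogeneousComponent_mul_of_isHomogeneous (hg _)] at hc2
  rcases lt_or_ge k 5 with hk | hk
  · refine ⟨t, mem_degreeLT_of_homogeneousComponent_eq_zero ht ?_, by simp⟩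
    simpa [not_le.mpr hk] using hc2.symm
  · obtain ⟨l, rfl⟩ := Nat.exists_eq_add_of_le' hk
    simp only [hk, if_true, Nat.add_sub_cancel] at hc2
    have hn : ∀ i, homogeneousComponent l (c i) ∈ degreeLT (Fin 3) (l + 1) :=
      fun i => (homogeneousComponent_isHomogeneous l _).mem_degreeLT
    refine ⟨t - (fun i => homogeneousComponent l (c i)) ⬝ᵥ F, ?_, ?_⟩
    · apply mem_degreeLT_of_homogeneousComponent_eq_zero
      · refine Submodule.sub_mem _ ht (Submodule.sum_mem _ fun i _ => ?_)
        have := mul_mem_degreeLT (hn i) (hF i)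
        rwa [show l + 1 + 5 = l + 5 + 1 by omega] at this
      · rw [map_sub, homogeneousComponent_dot hF hn, ← hc2, sub_eq_zero]
        simp only [dotProduct,
          homogeneousComponent_eq_self (homogeneousComponent_isHomogeneous l _)]
    · rw [sub_sub_cancel]
      exact dotProduct_mem_span _ _

/-- Every residue class modulo `(F₀, F₁, F₂)` has a reduced representative of degree at most `12`.
-/
lemma mem_span_or_exists_reduced (hF : ∀ i, F i ∈ degreeLT (Fin 3) (5 + 1))
    (hK : KoszulExact fun i => homogeneousComponent 5 (F i)) (t : MvPolynomial (Fin 3) ℂ) :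
    t ∈ Ideal.span (Set.range F) ∨ ∃ k ≤ 12, ∃ t' ∈ degreeLT (Fin 3) (k + 1),
      t - t' ∈ Ideal.span (Set.range F) ∧ homogeneousComponent k t' ∉
        Ideal.span (Set.range fun i => homogeneousComponent 5 (F i)) := by
  obtain ⟨n, hn⟩ := exists_mem_degreeLT t
  induction n generalizing t with
  | zero => left; rw [eq_zero_of_mem_degreeLT_zero hn]; exact Ideal.zero_mem _
  | succ n ih =>
    by_cases htop : homogeneousComponent n t ∈
      Ideal.span (Set.range fun i => homogeneousComponent 5 (F i))
    · obtain ⟨t', ht', htt'⟩ := exists_sub_mem_span hF hn htop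
      rcases ih t' ht' with h | ⟨k, hk, t'', h1, h2, h3⟩
      · left
        simpa using Ideal.add_mem _ htt' h
      · right
        refine ⟨k, hk, t'', h1, ?_, h3⟩
        simpa using Ideal.add_mem _ htt' h2
    · right
      refine ⟨n, ?_, t, hn, by simp, htop⟩
      by_contra! hn12
      exact htop (mem_span_of_isHomogeneous hK (fun i => homogeneousComponent_isHomogeneous 5 _)
        hn12 (homogeneousComponent_isHomogeneous n t))

/-- A linear functional generating the dual of the complete intersection `(F₀, F₁, F₂)`. -/
lemma exists_socle_functional (hF : ∀ i, F i ∈ degreeLT (Fin 3) (5 + 1))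
    (hK : KoszulExact fun i => homogeneousComponent 5 (F i)) :
    ∃ φ : MvPolynomial (Fin 3) ℂ →ₗ[ℂ] ℂ, (∀ t ∈ Ideal.span (Set.range F), φ t = 0) ∧
      ∀ t ∈ degreeLT (Fin 3) 13, homogeneousComponent 12 t ∉
        Ideal.span (Set.range fun i => homogeneousComponent 5 (F i)) → φ t ≠ 0 := by
  have hg : ∀ i, (homogeneousComponent 5 (F i)).IsHomogeneous 5 :=
    fun i => homogeneousComponent_isHomogeneous 5 _
  set I := Ideal.span (Set.range fun i => homogeneousComponent 5 (F i)) with hI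
  obtain ⟨m, hm, hmI⟩ := exists_mul_not_mem_span hK hg (k := 0) (l := 12) rfl
    (isHomogeneous_one _ _) (one_not_mem_span hg)
  rw [mul_one] at hmI
  set N : Submodule ℂ (MvPolynomial (Fin 3) ℂ) :=
    (Ideal.span (Set.range F)).restrictScalars ℂ ⊔
      (degreeLT (Fin 3) 13 ⊓ (I.restrictScalars ℂ).comap (homogeneousComponent 12)) with hN
  have hmN : m ∉ N := by
    intro h
    obtain ⟨γ, hγ, t, ⟨ht1, ht2⟩, hmt⟩ := Submodule.mem_sup.mp h
    have h1 : γ ∈ degreeLT (Fin 3) 13 := by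
      rw [← add_sub_cancel_right γ t, hmt]
      exact Submodule.sub_mem _ hm.mem_degreeLT ht1
    have h2 := homogeneousComponent_mem_span hF hK h1 hγ
    apply hmI
    rw [← homogeneousComponent_eq_self hm, ← hmt, map_add]
    exact Ideal.add_mem _ h2 ht2
  obtain ⟨φ, hφm, hφN⟩ := Submodule.exists_le_ker_of_notMem hmN
  refine ⟨φ, fun t ht => hφN (Submodule.mem_sup_left ht), fun t ht htI h0 => hφm ?_⟩
  obtain ⟨c, hc⟩ := exists_sub_smul_mem_span hK hg hm
    (homogeneousComponent_isHomogeneous 12 t) htI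
  have h1 : m - c • t ∈ N := by
    refine Submodule.mem_sup_right ⟨Submodule.sub_mem _ hm.mem_degreeLT
      (Submodule.smul_mem _ _ ht), ?_⟩
    rw [SetLike.mem_coe, Submodule.mem_comap, map_sub, map_smul, homogeneousComponent_eq_self hm]
    exact hc
  have := hφN h1
  rw [LinearMap.mem_ker, map_sub, map_smul, h0, smul_zero, sub_zero] at this
  exact this

/-- Nondegeneracy of the pairing `(a, b) ↦ φ (a * b)`, with control of degrees. -/
lemma mem_span_or_exists_pairing_ne_zero
    (hK : KoszulExact fun i => homogeneousComponent 5 (F i))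
    (hF : ∀ i, F i ∈ degreeLT (Fin 3) (5 + 1)) {φ : MvPolynomial (Fin 3) ℂ →ₗ[ℂ] ℂ}
    (hφ0 : ∀ t ∈ Ideal.span (Set.range F), φ t = 0)
    (hφ : ∀ t ∈ degreeLT (Fin 3) 13, homogeneousComponent 12 t ∉
        Ideal.span (Set.range fun i => homogeneousComponent 5 (F i)) → φ t ≠ 0)
    (t : MvPolynomial (Fin 3) ℂ) :
    t ∈ Ideal.span (Set.range F) ∨ ∃ k ≤ 12, ∃ t' ∈ degreeLT (Fin 3) (k + 1),
      t - t' ∈ Ideal.span (Set.range F) ∧ ∃ m ∈ degreeLT (Fin 3) (13 - k), φ (t * m) ≠ 0 := by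
  rcases mem_span_or_exists_reduced hF hK t with h | ⟨k, hk, t', h1, h2, h3⟩
  · exact Or.inl h
  · right
    obtain ⟨m, hm, hmI⟩ := exists_mul_not_mem_span hK
      (fun i => homogeneousComponent_isHomogeneous 5 _) (k := k) (l := 12 - k) (by omega)
      (homogeneousComponent_isHomogeneous k t') h3
    have hmd : m ∈ degreeLT (Fin 3) (12 - k + 1) := hm.mem_degreeLT
    refine ⟨k, hk, t', h1, h2, m, by rwa [show 13 - k = 12 - k + 1 by omega], ?_⟩
    have e : φ (t * m) = φ (m * t') := by
      have := hφ0 _ (Ideal.mul_mem_right m _ h2)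
      rw [sub_mul, map_sub, sub_eq_zero] at this
      rw [this, mul_comm]
    rw [e]
    apply hφ
    · have := mul_mem_degreeLT hmd h1
      rwa [show 12 - k + 1 + k = 13 by omega] at this
    · have := homogeneousComponent_mul_of_mem_degreeLT hmd h1
      rw [show 12 - k + k = 12 by omega, homogeneousComponent_eq_self hm] at this
      rwa [this]

lemma exists_eq_functional_mul (hK : KoszulExact fun i => homogeneousComponent 5 (F i))
    (hF : ∀ i, F i ∈ degreeLT (Fin 3) (5 + 1)) {φ : MvPolynomial (Fin 3) ℂ →ₗ[ℂ] ℂ}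
    (hφ0 : ∀ t ∈ Ideal.span (Set.range F), φ t = 0)
    (hφ : ∀ t ∈ degreeLT (Fin 3) 13, homogeneousComponent 12 t ∉
        Ideal.span (Set.range fun i => homogeneousComponent 5 (F i)) → φ t ≠ 0)
    {Λ : MvPolynomial (Fin 3) ℂ →ₗ[ℂ] ℂ} (hΛ : ∀ t ∈ Ideal.span (Set.range F), Λ t = 0) :
    ∃ c, ∀ x, Λ x = φ (c * x) := by
  set G := (Ideal.span (Set.range F)).restrictScalars ℂ with hG
  set B : MvPolynomial (Fin 3) ℂ →ₗ[ℂ] Module.Dual ℂ (MvPolynomial (Fin 3) ℂ) :=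
    (LinearMap.mul ℂ _).compr₂ φ with hB
  have hBa : ∀ c x, B c x = φ (c * x) := fun c x => rfl
  have hker : LinearMap.ker B = G := by
    ext c
    rw [LinearMap.mem_ker]
    constructor
    · intro h
      rcases mem_span_or_exists_pairing_ne_zero hK hF hφ0 hφ c with hc | ⟨_, _, _, _, _, m, _, hm⟩
      · exact hc
      · exact absurd (LinearMap.congr_fun h m) hm
    · intro h
      refine LinearMap.ext fun x => ?_
      exact hφ0 _ (Ideal.mul_mem_right _ _ h)
  have hfin : FiniteDimensional ℂ (MvPolynomial (Fin 3) ℂ ⧸ G) := by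
    refine Module.Finite.of_surjective (G.mkQ.domRestrict (degreeLT (Fin 3) (12 + 1))) ?_
    intro q
    obtain ⟨t, rfl⟩ := G.mkQ_surjective q
    rcases mem_span_or_exists_reduced hF hK t with h | ⟨k, hk, t', h1, h2, -⟩
    · exact ⟨0, by rw [map_zero]; exact ((Submodule.Quotient.mk_eq_zero G).mpr h).symm⟩
    · exact ⟨⟨t', degreeLT_mono (by omega) h1⟩, ((Submodule.Quotient.eq G).mpr h2).symm⟩
  have hle : LinearMap.range B ≤ G.dualAnnihilator := by
    rintro _ ⟨c, rfl⟩
    rw [Submodule.mem_dualAnnihilator]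
    intro x hx
    exact hφ0 _ (Ideal.mul_mem_left _ _ hx)
  have h1 : Module.finrank ℂ (LinearMap.range B) =
      Module.finrank ℂ (MvPolynomial (Fin 3) ℂ ⧸ G) := by
    rw [← B.quotKerEquivRange.finrank_eq, hker]
  have h2 := G.dualQuotEquivDualAnnihilator.finrank_eq
  rw [Subspace.dual_finrank_eq] at h2
  have : FiniteDimensional ℂ G.dualAnnihilator :=
    Module.Finite.equiv G.dualQuotEquivDualAnnihilator
  have heq := Submodule.eq_of_le_of_finrank_le hle (by rw [h1, h2])
  have hΛ' : Λ ∈ LinearMap.range B := by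
    rw [heq, Submodule.mem_dualAnnihilator]; exact hΛ
  obtain ⟨c, rfl⟩ := hΛ'
  exact ⟨c, fun x => rfl⟩

/-- Functionals vanishing on the ideal `(F₀, F₁, F₂, h)` and in degrees at most `8` come from
residue classes `c` of degree at most `3` with `c * h ∈ (F₀, F₁, F₂)`. -/
lemma exists_low_degree_of_functional (hK : KoszulExact fun i => homogeneousComponent 5 (F i))
    (hF : ∀ i, F i ∈ degreeLT (Fin 3) (5 + 1)) {φ : MvPolynomial (Fin 3) ℂ →ₗ[ℂ] ℂ}
    (hφ0 : ∀ t ∈ Ideal.span (Set.range F), φ t = 0)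
    (hφ : ∀ t ∈ degreeLT (Fin 3) 13, homogeneousComponent 12 t ∉
        Ideal.span (Set.range fun i => homogeneousComponent 5 (F i)) → φ t ≠ 0)
    {Λ : MvPolynomial (Fin 3) ℂ →ₗ[ℂ] ℂ} (hΛ : ∀ t ∈ Ideal.span (Set.range F), Λ t = 0)
    (hΛ8 : ∀ t ∈ degreeLT (Fin 3) 9, Λ t = 0) {h : MvPolynomial (Fin 3) ℂ}
    (hΛh : ∀ x, Λ (h * x) = 0) :
    ∃ c ∈ degreeLT (Fin 3) 4, c * h ∈ Ideal.span (Set.range F) ∧ ∀ x, Λ x = φ (c * x) := by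
  obtain ⟨c, hc⟩ := exists_eq_functional_mul hK hF hφ0 hφ hΛ
  have key : ∃ c' ∈ degreeLT (Fin 3) 4, c - c' ∈ Ideal.span (Set.range F) := by
    rcases mem_span_or_exists_pairing_ne_zero hK hF hφ0 hφ c with
      hc' | ⟨k, hk, t', h1, h2, m, hm1, hm2⟩
    · exact ⟨0, Submodule.zero_mem _, by rwa [sub_zero]⟩
    · refine ⟨t', degreeLT_mono ?_ h1, h2⟩
      by_contra hk3
      rw [← hc] at hm2
      exact hm2 (hΛ8 m (degreeLT_mono (by omega) hm1))
  obtain ⟨c', hc'1, hc'2⟩ := key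
  have hc'3 : ∀ x, Λ x = φ (c' * x) := fun x => by
    have := hφ0 _ (Ideal.mul_mem_right x _ hc'2)
    rw [sub_mul, map_sub, sub_eq_zero] at this
    rw [hc, this]
  refine ⟨c', hc'1, ?_, hc'3⟩
  rcases mem_span_or_exists_pairing_ne_zero hK hF hφ0 hφ (c' * h) with h' | ⟨_, _, _, _, _, m, _,
    hm⟩
  · exact h'
  · rw [mul_assoc, ← hc'3, hΛh] at hm
    exact absurd rfl hm

end Duality

section Truncation

variable {σ : Type*}

/-- The part of a polynomial of degree less than `k`. -/
def lowPart (k : ℕ) : MvPolynomial σ ℂ →ₗ[ℂ] MvPolynomial σ ℂ :=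
  ∑ j ∈ Finset.range k, homogeneousComponent j

lemma coeff_lowPart (k : ℕ) (p : MvPolynomial σ ℂ) (m : σ →₀ ℕ) :
    coeff m (lowPart k p) = if m.degree < k then coeff m p else 0 := by
  simp only [lowPart, LinearMap.sum_apply, coeff_sum, coeff_homogeneousComponent]
  rw [Finset.sum_ite_eq]
  simp

lemma lowPart_mem_degreeLT (k : ℕ) (p : MvPolynomial σ ℂ) : lowPart k p ∈ degreeLT σ k := by
  rw [mem_degreeLT]
  intro s hs
  rw [coeff_lowPart] at hs
  by_contra h
  simp [h] at hs

lemma sub_lowPart_mem (k : ℕ) (p : MvPolynomial σ ℂ) : p - lowPart k p ∈ idealOfVars σ ℂ ^ k := by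
  rw [mem_pow_idealOfVars_iff']
  intro m hm
  rw [coeff_sub, coeff_lowPart, if_pos hm, sub_self]

lemma lowPart_eq_self {k : ℕ} {p : MvPolynomial σ ℂ} (hp : p ∈ degreeLT σ k) :
    lowPart k p = p := by
  ext m
  rw [coeff_lowPart]
  split_ifs with h
  · rfl
  · by_contra h0
    exact h (mem_degreeLT.mp hp m fun h' => h0 h'.symm)

lemma lowPart_eq_zero {k : ℕ} {p : MvPolynomial σ ℂ} (hp : p ∈ idealOfVars σ ℂ ^ k) :
    lowPart k p = 0 := by
  ext m
  rw [coeff_lowPart, coeff_zero]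
  split_ifs with h
  · exact (mem_pow_idealOfVars_iff' k p).mp hp m h
  · rfl

lemma mem_pow_succ_of_pderiv {k : ℕ} {p : MvPolynomial σ ℂ} (h0 : eval 0 p = 0)
    (h : ∀ i, pderiv i p ∈ idealOfVars σ ℂ ^ k) : p ∈ idealOfVars σ ℂ ^ (k + 1) := by
  classical
  rw [mem_pow_idealOfVars_iff']
  intro m hm
  by_cases hm0 : m = 0
  · rw [hm0, ← constantCoeff_eq, ← eval_zero, h0]
  · obtain ⟨i, hi⟩ := Finsupp.ne_iff.mp hm0
    have e : m = (m - Finsupp.single i 1) + Finsupp.single i 1 := by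
      ext j
      by_cases hj : i = j
      · subst hj; simp at hi ⊢; omega
      · simp [hj]
    have h1 := (mem_pow_idealOfVars_iff' k _).mp (h i) (m - Finsupp.single i 1) (by
      rw [e, map_add, Finsupp.degree_single] at hm; omega)
    rw [coeff_pderiv, ← e] at h1
    rcases mul_eq_zero.mp h1 with h1 | h1
    · exact h1
    · exact absurd h1 (Nat.cast_add_one_ne_zero _)

lemma pderiv_mem_pow {k : ℕ} {p : MvPolynomial σ ℂ} (h : p ∈ idealOfVars σ ℂ ^ (k + 1)) (i : σ) :
    pderiv i p ∈ idealOfVars σ ℂ ^ k := by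
  rw [mem_pow_idealOfVars_iff'] at *
  intro m hm
  rw [coeff_pderiv, h, zero_mul]
  rw [map_add, Finsupp.degree_single]; omega

lemma X_mem_idealOfVars (i : σ) : (X i : MvPolynomial σ ℂ) ∈ idealOfVars σ ℂ := by
  classical
  rw [← pow_one (idealOfVars σ ℂ), mem_pow_idealOfVars_iff']
  intro m hm
  rw [coeff_X, if_neg]
  rintro rfl
  simp at hm

lemma sum_X_mul_pderiv_sub_mem [Fintype σ] {k : ℕ} {p : MvPolynomial σ ℂ}
    (h : p ∈ idealOfVars σ ℂ ^ k) :
    ∑ i, X i * pderiv i p - k • p ∈ idealOfVars σ ℂ ^ (k + 1) := by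
  set q := homogeneousComponent k p with hq
  have hpq : p - q ∈ idealOfVars σ ℂ ^ (k + 1) := by
    rw [mem_pow_idealOfVars_iff'] at *
    intro m hm
    rw [coeff_sub, hq, coeff_homogeneousComponent]
    split_ifs with h'
    · exact sub_self _
    · rw [h m (by omega), sub_self]
  have e : ∑ i, X i * pderiv i p - k • p =
      ∑ i, X i * pderiv i (p - q) - k • (p - q) := by
    have := (homogeneousComponent_isHomogeneous k p).sum_X_mul_pderiv
    simp only [map_sub, mul_sub, Finset.sum_sub_distrib, smul_sub]
    rw [← hq] at this
    rw [this]; ring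
  rw [e]
  refine Ideal.sub_mem _ (Ideal.sum_mem _ fun i _ => ?_) ?_
  · rw [pow_succ']
    exact Ideal.mul_mem_mul (X_mem_idealOfVars i) (pderiv_mem_pow hpq i)
  · rw [nsmul_eq_mul]
    exact Ideal.mul_mem_left _ _ hpq

end Truncation

section LocalAlgebra

open Matrix

local notation "𝔪" => idealOfVars (Fin 3) ℂ

lemma exists_lowPart_eq {G : Fin 3 → MvPolynomial (Fin 3) ℂ} (hG : ∀ i, G i ∈ 𝔪 ^ 2)
    {t : MvPolynomial (Fin 3) ℂ} (ht : t ∈ 𝔪 ^ 4 ⊔ Ideal.span (Set.range G)) :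
    ∃ b : Fin 3 → degreeLT (Fin 3) 2,
      lowPart 4 t = lowPart 4 (∑ i, (b i : MvPolynomial (Fin 3) ℂ) * G i) := by
  obtain ⟨r, hr, s, hs, rfl⟩ := Submodule.mem_sup.mp ht
  obtain ⟨c, rfl⟩ := exists_coeff_of_mem_span hs
  refine ⟨fun i => ⟨lowPart 2 (c i), lowPart_mem_degreeLT 2 _⟩, ?_⟩
  rw [← sub_eq_zero, ← map_sub]
  apply lowPart_eq_zero
  rw [add_sub_assoc, dotProduct, ← Finset.sum_sub_distrib]
  refine Ideal.add_mem _ hr (Ideal.sum_mem _ fun i _ => ?_)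
  rw [← sub_mul, show 4 = 2 + 2 from rfl, pow_add]
  exact Ideal.mul_mem_mul (sub_lowPart_mem 2 _) (hG i)

lemma quotient_mk_surjective (J : Ideal (MvPolynomial (Fin 3) ℂ)) (hJ : 𝔪 ^ 4 ≤ J) :
    Function.Surjective ((Ideal.Quotient.mkₐ ℂ J).toLinearMap ∘ₗ
      (degreeLT (Fin 3) (3 + 1)).subtype) := by
  intro x
  obtain ⟨t, rfl⟩ := Ideal.Quotient.mk_surjective x
  refine ⟨⟨lowPart 4 t, lowPart_mem_degreeLT 4 t⟩, ?_⟩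
  simp only [LinearMap.coe_comp, Function.comp_apply, Submodule.subtype_apply,
    AlgHom.toLinearMap_apply, Ideal.Quotient.mkₐ_eq_mk]
  rw [eq_comm, Ideal.Quotient.eq]
  exact hJ (sub_lowPart_mem 4 t)

lemma finite_quotient_of_pow_le {J : Ideal (MvPolynomial (Fin 3) ℂ)} (hJ : 𝔪 ^ 4 ≤ J) :
    FiniteDimensional ℂ (MvPolynomial (Fin 3) ℂ ⧸ J) :=
  Module.Finite.of_surjective _ (quotient_mk_surjective J hJ)

lemma eight_le_finrank_quotient {G : Fin 3 → MvPolynomial (Fin 3) ℂ} (hG : ∀ i, G i ∈ 𝔪 ^ 2) :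
    8 ≤ Module.finrank ℂ (MvPolynomial (Fin 3) ℂ ⧸ (𝔪 ^ 4 ⊔ Ideal.span (Set.range G))) := by
  set J := 𝔪 ^ 4 ⊔ Ideal.span (Set.range G) with hJ
  set q := (Ideal.Quotient.mkₐ ℂ J).toLinearMap ∘ₗ (degreeLT (Fin 3) (3 + 1)).subtype with hq
  have hs : Function.Surjective q := quotient_mk_surjective J le_sup_left
  let B : (Fin 3 → degreeLT (Fin 3) (1 + 1)) →ₗ[ℂ] MvPolynomial (Fin 3) ℂ :=
    lowPart 4 ∘ₗ ∑ i, (LinearMap.mulRight ℂ (G i)) ∘ₗ (degreeLT (Fin 3) (1 + 1)).subtype ∘ₗ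
      LinearMap.proj i
  have hB : ∀ b, B b = lowPart 4 (∑ i, (b i : MvPolynomial (Fin 3) ℂ) * G i) := by
    intro b
    simp [B]
  have h1 : (LinearMap.ker q).map (degreeLT (Fin 3) (3 + 1)).subtype ≤ LinearMap.range B := by
    rintro _ ⟨t, ht, rfl⟩
    have ht' : (t : MvPolynomial (Fin 3) ℂ) ∈ J := Ideal.Quotient.eq_zero_iff_mem.mp ht
    obtain ⟨b, hb⟩ := exists_lowPart_eq hG ht'
    refine ⟨b, ?_⟩
    rw [hB, ← hb]
    exact lowPart_eq_self t.2
  have h2 := Submodule.finrank_mono h1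
  rw [Submodule.finrank_map_subtype_eq] at h2
  have h3 : Module.finrank ℂ (LinearMap.range B) ≤ 12 := by
    refine (LinearMap.finrank_range_le B).trans ?_
    rw [Module.finrank_pi_fintype]
    simp only [finrank_degreeLT]
    norm_num [Nat.multichoose_eq, Nat.choose]
  have h4 := LinearMap.finrank_range_add_finrank_ker q
  rw [LinearMap.range_eq_top.mpr hs, finrank_top, finrank_degreeLT,
    show Nat.multichoose 4 3 = 20 by norm_num [Nat.multichoose_eq, Nat.choose]] at h4
  omega

end LocalAlgebra

section LocalIdeal

open Matrix

local notation "𝔪" => idealOfVars (Fin 3) ℂ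

/-- Translation of the affine chart `x₃ = 1` moving the origin to `p`. -/
def shiftBy (p : Fin 4 → ℂ) : MvPolynomial (Fin 3) ℂ →ₐ[ℂ] MvPolynomial (Fin 3) ℂ :=
  aeval fun i => X i + C (p i.castSucc)

lemma shiftBy_X (p : Fin 4 → ℂ) (i : Fin 3) : shiftBy p (X i) = X i + C (p i.castSucc) :=
  aeval_X _ _

lemma shiftBy_surjective (p : Fin 4 → ℂ) : Function.Surjective (shiftBy p) := by
  intro t
  refine ⟨shiftBy (-p) t, ?_⟩
  have : (shiftBy p).comp (shiftBy (-p)) = AlgHom.id ℂ _ := by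
    ext1 i
    simp [shiftBy]
  exact DFunLike.congr_fun this t

lemma pderiv_shiftBy (p : Fin 4 → ℂ) (i : Fin 3) (t : MvPolynomial (Fin 3) ℂ) :
    pderiv i (shiftBy p t) = shiftBy p (pderiv i t) := by
  classical
  induction t using MvPolynomial.induction_on with
  | C a => simp [shiftBy]
  | add s t hs ht => simp only [map_add, hs, ht]
  | mul_X s j hs =>
    rw [map_mul, pderiv_mul, pderiv_mul, hs, shiftBy_X, map_add, pderiv_X, pderiv_C, add_zero,
      map_add, map_mul, map_mul, shiftBy_X]
    congr 2
    by_cases h : i = j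
    · subst h; simp
    · simp [h]

lemma eval_zero_shiftBy (p : Fin 4 → ℂ) (hp : p 3 = 1) (P : MvPolynomial (Fin 4) ℂ) :
    eval 0 (shiftBy p (dehom P)) = eval p P := by
  induction P using MvPolynomial.induction_on with
  | C a => simp [shiftBy]
  | add s t hs ht => simp only [map_add, hs, ht]
  | mul_X s j hs =>
    rw [map_mul, map_mul, map_mul, map_mul, hs, eval_X]
    refine Fin.lastCases ?_ (fun i => ?_) j
    · rw [show Fin.last 3 = 3 from rfl, dehom_X_three, hp]; simp
    · rw [dehom_X_castSucc, shiftBy_X]; simp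

lemma pderiv_dehom (i : Fin 3) (P : MvPolynomial (Fin 4) ℂ) :
    pderiv i (dehom P) = dehom (pderiv i.castSucc P) := by
  classical
  induction P using MvPolynomial.induction_on with
  | C a => simp
  | add s t hs ht => simp only [map_add, hs, ht]
  | mul_X s j hs =>
    rw [map_mul, pderiv_mul, pderiv_mul, hs, map_add, map_mul, map_mul]
    congr 2
    refine Fin.lastCases ?_ (fun k => ?_) j
    · rw [show Fin.last 3 = 3 from rfl, dehom_X_three, pderiv_X, Pi.single_eq_of_ne]
      · simp
      · exact (Fin.castSucc_lt_last i).ne'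
    · rw [dehom_X_castSucc, pderiv_X, pderiv_X]
      by_cases h : i = k
      · subst h; simp
      · simp [h]

/-- The ideal of the affine chart generated by the fourth power of the maximal ideal of `p` and
the partial derivatives of `f`. -/
def localIdeal (f : MvPolynomial (Fin 4) ℂ) (p : Fin 4 → ℂ) : Ideal (MvPolynomial (Fin 3) ℂ) :=
  Ideal.comap (shiftBy p) (𝔪 ^ 4 ⊔
    Ideal.span (Set.range fun i : Fin 3 => shiftBy p (dehom (pderiv i.castSucc f))))

variable {f : MvPolynomial (Fin 4) ℂ} {p : Fin 4 → ℂ}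

lemma pow_mem_localIdeal (i : Fin 3) : (X i - C (p i.castSucc)) ^ 4 ∈ localIdeal f p := by
  rw [localIdeal, Ideal.mem_comap, map_pow, map_sub, shiftBy_X]
  refine Ideal.mem_sup_left (Ideal.pow_mem_pow ?_ 4)
  simpa [shiftBy] using X_mem_idealOfVars i

lemma shiftBy_dehom_mem_pow_three (hp : p 3 = 1) (hf : f.IsHomogeneous 6)
    (h : ∀ u v, eval p (dirDeriv u (dirDeriv v f)) = 0) : shiftBy p (dehom f) ∈ 𝔪 ^ 3 := by
  have h1 : ∀ u, eval p (dirDeriv u f) = 0 := fun u => by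
    have := (hf.dirDeriv u).eval_dirDeriv_self p
    rw [h] at this
    simpa using this.symm
  have h0 : eval p f = 0 := by
    have := hf.eval_dirDeriv_self p
    rw [h1] at this
    simpa using this.symm
  refine mem_pow_succ_of_pderiv ?_ fun i => mem_pow_succ_of_pderiv ?_ fun j =>
    mem_pow_succ_of_pderiv ?_ fun k => ?_
  · rw [eval_zero_shiftBy p hp, h0]
  · rw [pderiv_shiftBy, pderiv_dehom, eval_zero_shiftBy p hp, ← dirDeriv_single, h1]
  · rw [pderiv_shiftBy, pderiv_shiftBy, pderiv_dehom, pderiv_dehom, eval_zero_shiftBy p hp,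
      ← dirDeriv_single, ← dirDeriv_single, h]
  · rw [pow_zero, Ideal.one_eq_top]; trivial

lemma dehom_pderiv_mem_localIdeal (hp : p 3 = 1) (hf : f.IsHomogeneous 6)
    (h : ∀ u v, eval p (dirDeriv u (dirDeriv v f)) = 0) (i : Fin 4) :
    dehom (pderiv i f) ∈ localIdeal f p := by
  rw [localIdeal, Ideal.mem_comap]
  have hlow : ∀ k : Fin 3, shiftBy p (dehom (pderiv k.castSucc f)) ∈
      𝔪 ^ 4 ⊔ Ideal.span (Set.range fun i : Fin 3 => shiftBy p (dehom (pderiv i.castSucc f))) :=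
    fun k => Ideal.mem_sup_right (Ideal.subset_span ⟨k, rfl⟩)
  refine Fin.lastCases ?_ (fun k => hlow k) i
  have h3 := shiftBy_dehom_mem_pow_three hp hf h
  have h4 := sum_X_mul_pderiv_sub_mem h3
  have hE := congrArg (fun P => shiftBy p (dehom P)) hf.sum_X_mul_pderiv
  simp only [map_sum, Fin.sum_univ_castSucc (n := 3), map_add, map_mul, dehom_X_castSucc,
    show Fin.last 3 = 3 from rfl, dehom_X_three, one_mul, shiftBy_X, nsmul_eq_mul,
    map_natCast] at hE
  simp only [pderiv_shiftBy, pderiv_dehom, nsmul_eq_mul] at h4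
  have e : shiftBy p (dehom (pderiv (Fin.last 3) f)) =
      (-2 : MvPolynomial (Fin 3) ℂ) *
        (∑ i, X i * shiftBy p (dehom (pderiv i.castSucc f)) - ((3 : ℕ) : MvPolynomial (Fin 3) ℂ) *
          shiftBy p (dehom f)) +
      ∑ i : Fin 3, (X i - C (p i.castSucc)) * shiftBy p (dehom (pderiv i.castSucc f)) := by
    rw [show Fin.last 3 = 3 from rfl, ← sub_eq_zero]
    rw [← sub_eq_zero] at hE
    rw [← hE]
    simp only [Fin.sum_univ_three]
    push_cast
    ring
  rw [e]
  exact Ideal.add_mem _ (Ideal.mem_sup_left (Ideal.mul_mem_left _ _ h4))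
    (Ideal.sum_mem _ fun k _ => Ideal.mul_mem_left _ _ (hlow k))

/-- The quotient by the local ideal, computed after translation to the origin. -/
def localQuotientEquiv (f : MvPolynomial (Fin 4) ℂ) (p : Fin 4 → ℂ) :
    (MvPolynomial (Fin 3) ℂ ⧸ localIdeal f p) ≃ₗ[ℂ] (MvPolynomial (Fin 3) ℂ ⧸ (𝔪 ^ 4 ⊔
      Ideal.span (Set.range fun i : Fin 3 => shiftBy p (dehom (pderiv i.castSucc f))))) :=
  LinearEquiv.ofBijective (Ideal.quotientMapₐ _ (shiftBy p) le_rfl).toLinearMap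
    ⟨Ideal.quotientMap_injective, Ideal.quotientMap_surjective (H := le_rfl) (shiftBy_surjective p)⟩

instance finiteDimensional_localQuotient :
    FiniteDimensional ℂ (MvPolynomial (Fin 3) ℂ ⧸ localIdeal f p) :=
  have := finite_quotient_of_pow_le (J := 𝔪 ^ 4 ⊔
      Ideal.span (Set.range fun i : Fin 3 => shiftBy p (dehom (pderiv i.castSucc f)))) le_sup_left
  (localQuotientEquiv f p).symm.finiteDimensional

lemma eight_le_finrank_localQuotient (hp : p 3 = 1) (hf : f.IsHomogeneous 6)
    (h : ∀ u v, eval p (dirDeriv u (dirDeriv v f)) = 0) :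
    8 ≤ Module.finrank ℂ (MvPolynomial (Fin 3) ℂ ⧸ localIdeal f p) := by
  rw [(localQuotientEquiv f p).finrank_eq]
  refine eight_le_finrank_quotient fun i => ?_
  rw [← pderiv_dehom, ← pderiv_shiftBy]
  exact pderiv_mem_pow (shiftBy_dehom_mem_pow_three hp hf h) i

lemma isCoprime_localIdeal {q : Fin 4 → ℂ} (hp : p 3 = 1) (hq : q 3 = 1) (hpq : p ≠ q) :
    IsCoprime (localIdeal f p) (localIdeal f q) := by
  obtain ⟨i, hi⟩ : ∃ i : Fin 3, p i.castSucc ≠ q i.castSucc := by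
    by_contra! hcon
    refine hpq (funext fun j => ?_)
    refine Fin.lastCases ?_ (fun i => hcon i) j
    exact hp.trans hq.symm
  rw [Ideal.isCoprime_iff_exists]
  have hc : IsCoprime ((X i - C (p i.castSucc) : MvPolynomial (Fin 3) ℂ) ^ 4)
      ((X i - C (q i.castSucc)) ^ 4) := by
    apply IsCoprime.pow
    refine ⟨C (q i.castSucc - p i.castSucc)⁻¹, -C (q i.castSucc - p i.castSucc)⁻¹, ?_⟩
    rw [neg_mul, ← sub_eq_add_neg, ← mul_sub, sub_sub_sub_cancel_left, ← C_sub, ← C_mul,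
      inv_mul_cancel₀ (sub_ne_zero.mpr hi.symm), C_1]
  obtain ⟨a, b, hab⟩ := hc
  exact ⟨_, Ideal.mul_mem_left _ a (pow_mem_localIdeal i), _,
    Ideal.mul_mem_left _ b (pow_mem_localIdeal i), hab⟩

end LocalIdeal

section Syzygies

open Matrix

/-- The map `(θᵢ) ↦ ∑ θᵢ Fᵢ` on quadruples of polynomials of degree at most `3`. -/
def cubicCombination (F : Fin 4 → MvPolynomial (Fin 3) ℂ) :
    (Fin 4 → degreeLT (Fin 3) (3 + 1)) →ₗ[ℂ] MvPolynomial (Fin 3) ℂ :=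
  ∑ i, (LinearMap.mulRight ℂ (F i)) ∘ₗ (degreeLT (Fin 3) (3 + 1)).subtype ∘ₗ LinearMap.proj i

lemma cubicCombination_apply (F : Fin 4 → MvPolynomial (Fin 3) ℂ)
    (θ : Fin 4 → degreeLT (Fin 3) (3 + 1)) :
    cubicCombination F θ = ∑ i, (θ i : MvPolynomial (Fin 3) ℂ) * F i := by
  simp [cubicCombination]

lemma exists_syzygy_of_mul_mem_span {F : Fin 4 → MvPolynomial (Fin 3) ℂ}
    (hF : ∀ i, F i ∈ degreeLT (Fin 3) (5 + 1))
    (hK : KoszulExact fun i : Fin 3 => homogeneousComponent 5 (F i.castSucc))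
    {c : MvPolynomial (Fin 3) ℂ} (hc : c ∈ degreeLT (Fin 3) 4)
    (hcF : c * F 3 ∈ Ideal.span (Set.range fun i : Fin 3 => F i.castSucc)) :
    ∃ θ ∈ LinearMap.ker (cubicCombination F), (θ 3 : MvPolynomial (Fin 3) ℂ) = c := by
  obtain ⟨b, hb⟩ := exists_coeff_of_mem_span hcF
  have hd : b ⬝ᵥ (fun i : Fin 3 => F i.castSucc) ∈ degreeLT (Fin 3) 9 := by
    rw [hb]; exact mul_mem_degreeLT hc (hF 3)
  obtain ⟨b', hb', hbb⟩ := exists_dot_eq_of_mem_degreeLT (fun i : Fin 3 => hF i.castSucc) hK hd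
  refine ⟨Fin.snoc (α := fun _ => degreeLT (Fin 3) (3 + 1)) (fun i => ⟨-b' i,
    Submodule.neg_mem _ (hb' i)⟩) ⟨c, hc⟩, ?_, ?_⟩
  · rw [LinearMap.mem_ker, cubicCombination_apply, Fin.sum_univ_castSucc]
    simp only [Fin.snoc_castSucc, Fin.snoc_last, neg_mul, Finset.sum_neg_distrib]
    rw [show Fin.last 3 = 3 from rfl, ← hb, ← hbb, dotProduct, neg_add_cancel]
  · exact congrArg Subtype.val
      (Fin.snoc_last (α := fun _ => degreeLT (Fin 3) (3 + 1)) _ _)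

variable {f : MvPolynomial (Fin 4) ℂ}

/-- The evaluation of the chart coordinate ring in all local quotients. -/
def localEval (f : MvPolynomial (Fin 4) ℂ) {ι : Type*} (p : ι → Fin 4 → ℂ) :
    MvPolynomial (Fin 3) ℂ →ₗ[ℂ] ∀ j, MvPolynomial (Fin 3) ℂ ⧸ localIdeal f (p j) :=
  LinearMap.pi fun j => (Ideal.Quotient.mkₐ ℂ (localIdeal f (p j))).toLinearMap

lemma localEval_surjective {ι : Type*} [Finite ι] {p : ι → Fin 4 → ℂ}
    (hp : Function.Injective p) (h1 : ∀ j, p j 3 = 1) :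
    Function.Surjective (localEval f p) := by
  intro x
  obtain ⟨r, hr⟩ := Ideal.pi_quotient_surjective (I := fun j => localIdeal f (p j))
    (fun j k hjk => isCoprime_localIdeal (h1 j) (h1 k) (hp.ne hjk)) x
  exact ⟨r, funext hr⟩

lemma localEval_eq_zero {ι : Type*} {p : ι → Fin 4 → ℂ} {t : MvPolynomial (Fin 3) ℂ}
    (ht : ∀ j, t ∈ localIdeal f (p j)) : localEval f p t = 0 :=
  funext fun j => Ideal.Quotient.eq_zero_iff_mem.mpr (ht j)

lemma mul_card_le_finrank {ι : Type*} [Fintype ι] (hf : f.IsHomogeneous 6) {p : ι → Fin 4 → ℂ}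
    (h1 : ∀ j, p j 3 = 1) (h2 : ∀ j u v, eval (p j) (dirDeriv u (dirDeriv v f)) = 0) :
    8 * Fintype.card ι ≤
      Module.finrank ℂ (∀ j, MvPolynomial (Fin 3) ℂ ⧸ localIdeal f (p j)) := by
  rw [Module.finrank_pi_fintype, mul_comm, ← smul_eq_mul, ← Finset.card_univ]
  exact Finset.card_nsmul_le_sum _ _ _ fun j _ =>
    eight_le_finrank_localQuotient (h1 j) hf (h2 j)

/-- Eleven triple points force at least two independent cubic syzygies. -/
lemma two_le_finrank_ker_cubicCombination (hf : f.IsHomogeneous 6)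
    (hH : ∀ x : Fin 4 → ℂ, x 3 = 0 → (∀ i : Fin 3, eval x (pderiv i.castSucc f) = 0) → x = 0)
    {p : Fin 11 → Fin 4 → ℂ} (hp : Function.Injective p) (h1 : ∀ j, p j 3 = 1)
    (h2 : ∀ j u v, eval (p j) (dirDeriv u (dirDeriv v f)) = 0) :
    2 ≤ Module.finrank ℂ (LinearMap.ker (cubicCombination fun i => dehom (pderiv i f))) := by
  set F : Fin 4 → MvPolynomial (Fin 3) ℂ := fun i => dehom (pderiv i f) with hFdef
  have hF : ∀ i, F i ∈ degreeLT (Fin 3) (5 + 1) := fun i => dehom_mem_degreeLT hf.pderiv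
  have hK : KoszulExact fun i : Fin 3 => homogeneousComponent 5 (F i.castSucc) :=
    koszulExact_dehom (g := fun i : Fin 3 => pderiv i.castSucc f) (fun i => hf.pderiv) hH
  obtain ⟨φ, hφ0, hφ⟩ := exists_socle_functional (fun i : Fin 3 => hF i.castSucc) hK
  set V := LinearMap.ker (cubicCombination F) with hV
  set Ψ := localEval f p with hΨ
  have hΨs : Function.Surjective Ψ := localEval_surjective hp h1
  have hΨF : ∀ i t, Ψ (t * F i) = 0 := fun i t => localEval_eq_zero fun j =>
    Ideal.mul_mem_left _ _ (dehom_pderiv_mem_localIdeal (h1 j) hf (h2 j) i)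
  -- the image of the polynomials of degree at most eight
  set A := Ψ ∘ₗ (degreeLT (Fin 3) (8 + 1)).subtype with hA
  have hrank : Module.finrank ℂ (LinearMap.range A) ≤ 85 + Module.finrank ℂ V := by
    have e1 := LinearMap.finrank_range_add_finrank_ker A
    have e2 := LinearMap.finrank_range_add_finrank_ker (cubicCombination F)
    have e3 : LinearMap.range (cubicCombination F) ≤
        (LinearMap.ker A).map (degreeLT (Fin 3) (8 + 1)).subtype := by
      rintro _ ⟨θ, rfl⟩
      rw [cubicCombination_apply]
      refine ⟨⟨∑ i, (θ i : MvPolynomial (Fin 3) ℂ) * F i,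
        Submodule.sum_mem _ fun i _ => (by
          have := mul_mem_degreeLT (θ i).2 (hF i); exact this)⟩, ?_, rfl⟩
      rw [SetLike.mem_coe, LinearMap.mem_ker, hA, LinearMap.comp_apply, Submodule.subtype_apply,
        map_sum]
      exact Finset.sum_eq_zero fun i _ => hΨF i _
    have e4 := Submodule.finrank_mono e3
    rw [Submodule.finrank_map_subtype_eq] at e4
    rw [finrank_degreeLT] at e1
    rw [Module.finrank_pi_fintype] at e2
    simp only [finrank_degreeLT] at e2
    norm_num [Nat.multichoose_eq, Nat.choose] at e1 e2
    rw [← hV] at e2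
    omega
  have hW := mul_card_le_finrank hf h1 h2
  rw [Fintype.card_fin] at hW
  -- functionals killing that image
  set D := (LinearMap.range A).dualAnnihilator with hD
  have hDdim := Subspace.finrank_add_finrank_dualAnnihilator_eq (LinearMap.range A)
  set M : Submodule ℂ (MvPolynomial (Fin 3) ℂ) := V.map
    ((degreeLT (Fin 3) (3 + 1)).subtype ∘ₗ LinearMap.proj 3) with hM
  have hMV : Module.finrank ℂ M ≤ Module.finrank ℂ V := Submodule.finrank_map_le _ _
  set g : MvPolynomial (Fin 3) ℂ →ₗ[ℂ] Module.Dual ℂ (MvPolynomial (Fin 3) ℂ) :=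
    (LinearMap.mul ℂ (MvPolynomial (Fin 3) ℂ)).compr₂ φ with hg
  have hDM : D.map Ψ.dualMap ≤ M.map g := by
    rintro _ ⟨Λ, hΛ, rfl⟩
    have hΛ' : ∀ t ∈ degreeLT (Fin 3) 9, Λ (Ψ t) = 0 := fun t ht =>
      (Submodule.mem_dualAnnihilator _).mp hΛ _ ⟨⟨t, ht⟩, rfl⟩
    obtain ⟨c, hc, hcF, hc2⟩ := exists_low_degree_of_functional hK (fun i => hF i.castSucc)
      hφ0 hφ (Λ := Λ ∘ₗ Ψ) (by
        intro t ht
        obtain ⟨b, rfl⟩ := exists_coeff_of_mem_span ht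
        rw [LinearMap.comp_apply, dotProduct, map_sum, map_sum]
        exact Finset.sum_eq_zero fun i _ => by rw [hΨF, map_zero])
      hΛ' (h := F 3) (fun x => by rw [LinearMap.comp_apply, mul_comm, hΨF, map_zero])
    obtain ⟨θ, hθ, rfl⟩ := exists_syzygy_of_mul_mem_span hF hK hc hcF
    refine ⟨_, ⟨θ, hθ, rfl⟩, ?_⟩
    refine LinearMap.ext fun x => ?_
    exact (hc2 x).symm
  have hDM2 := Submodule.finrank_mono hDM
  rw [← (Submodule.equivMapOfInjective _ (LinearMap.dualMap_injective_of_surjective hΨs)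
    D).finrank_eq] at hDM2
  have := Submodule.finrank_map_le g M
  rw [← hD] at hDdim
  omega

lemma exists_pair_of_two_le_finrank {E : Type*} [AddCommGroup E] [Module ℂ E]
    [FiniteDimensional ℂ E] {V : Submodule ℂ E} (h : 2 ≤ Module.finrank ℂ V) :
    ∃ x ∈ V, ∃ y ∈ V, ∀ a b : ℂ, a • x + b • y = 0 → a = 0 ∧ b = 0 := by
  have h0 : 0 < Module.finrank ℂ V := by omega
  obtain ⟨x, hx⟩ := Module.finrank_pos_iff_exists_ne_zero.mp h0
  obtain ⟨y, hxy⟩ := exists_linearIndependent_pair_of_one_lt_finrank (R := ℂ) (by omega) hx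
  exact ⟨x, x.2, y, y.2, fun a b hab => LinearIndependent.pair_iff.mp hxy a b (Subtype.ext hab)⟩

lemma exists_homogeneous_syzygy (hf : f.IsHomogeneous 6) {x : Fin 4 → degreeLT (Fin 3) (3 + 1)}
    (hx : cubicCombination (fun i => dehom (pderiv i f)) x = 0) :
    ∃ θ : Fin 4 → MvPolynomial (Fin 4) ℂ, (∀ i, (θ i).IsHomogeneous 3) ∧
      ∑ i, θ i * pderiv i f = 0 ∧ ∀ i, dehom (θ i) = x i := by
  choose θ hθ hθx using fun i => exists_dehom_eq (x i).2
  refine ⟨θ, hθ, ?_, hθx⟩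
  have h8 : (∑ i, θ i * pderiv i f).IsHomogeneous 8 :=
    IsHomogeneous.sum _ _ _ fun i _ => (hθ i).mul (hf.pderiv (i := i))
  apply eq_zero_of_dehom_eq_zero h8
  rw [cubicCombination_apply] at hx
  rw [map_sum, ← hx]
  exact Finset.sum_congr rfl fun i _ => by rw [map_mul, hθx]

/-- Two linearly independent homogeneous cubic syzygies between the partial derivatives. -/
lemma exists_cubic_syzygies (hf : f.IsHomogeneous 6)
    (h : 2 ≤ Module.finrank ℂ (LinearMap.ker (cubicCombination fun i => dehom (pderiv i f)))) :
    ∃ θ η : Fin 4 → MvPolynomial (Fin 4) ℂ,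
      (∀ i, (θ i).IsHomogeneous 3) ∧ (∀ i, (η i).IsHomogeneous 3) ∧
      ∑ i, θ i * pderiv i f = 0 ∧ ∑ i, η i * pderiv i f = 0 ∧
      ∀ a b : ℂ, a • θ + b • η = 0 → a = 0 ∧ b = 0 := by
  obtain ⟨x, hx, y, hy, hxy⟩ := exists_pair_of_two_le_finrank h
  obtain ⟨θ, hθ, hθ0, hθx⟩ := exists_homogeneous_syzygy hf (LinearMap.mem_ker.mp hx)
  obtain ⟨η, hη, hη0, hηy⟩ := exists_homogeneous_syzygy hf (LinearMap.mem_ker.mp hy)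
  refine ⟨θ, η, hθ, hη, hθ0, hη0, fun a b hab => hxy a b ?_⟩
  refine funext fun i => Subtype.ext ?_
  have h1 := congrArg dehom (congrFun hab i)
  rw [Pi.add_apply, Pi.smul_apply, Pi.smul_apply, map_add, map_smul, map_smul, hθx, hηy] at h1
  exact h1.trans (map_zero _)

end Syzygies

section GeneralHyperplane

open Matrix

variable {f : MvPolynomial (Fin 4) ℂ}

lemma multichoose_four (k : ℕ) : Nat.multichoose 4 k = (k + 3).choose 3 := by
  rw [Nat.multichoose_eq, show 4 + k - 1 = k + 3 by omega, Nat.choose_symm_add]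

lemma eval_aeval_eq {σ τ : Type*} (x : τ → ℂ) (g : σ → MvPolynomial τ ℂ) (G : MvPolynomial σ ℂ) :
    eval x (aeval g G) = eval (fun i => eval x (g i)) G := by
  induction G using MvPolynomial.induction_on with
  | C a => simp
  | add p q hp hq => simp only [map_add, hp, hq]
  | mul_X p i hp => simp only [map_mul, hp, aeval_X, eval_X]

/-- Some nonzero form vanishes at the gradients of `f` at all points of `{f = 0}`. -/
lemma exists_form_gradient (hf : f.IsHomogeneous 6) (hf0 : f ≠ 0) :
    ∃ (m : ℕ) (G h : MvPolynomial (Fin 4) ℂ), G.IsHomogeneous m ∧ G ≠ 0 ∧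
      aeval (fun i => pderiv i f) G = f * h := by
  have hhom : ∀ G : homogeneousSubmodule (Fin 4) ℂ 500,
      aeval (fun i => pderiv i f) (G : MvPolynomial (Fin 4) ℂ) ∈
        homogeneousSubmodule (Fin 4) ℂ 2500 := fun G =>
    IsHomogeneous.aeval G.2 (fun i => pderiv i f) (n := 5) fun i => hf.pderiv
  have hmul : ∀ h : homogeneousSubmodule (Fin 4) ℂ 2494,
      f * (h : MvPolynomial (Fin 4) ℂ) ∈ homogeneousSubmodule (Fin 4) ℂ 2500 := fun h => hf.mul h.2
  let L : (homogeneousSubmodule (Fin 4) ℂ 500 × homogeneousSubmodule (Fin 4) ℂ 2494) →ₗ[ℂ]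
      homogeneousSubmodule (Fin 4) ℂ 2500 :=
    LinearMap.coprod
      (LinearMap.codRestrict _ ((aeval fun i => pderiv i f).toLinearMap ∘ₗ
        (homogeneousSubmodule (Fin 4) ℂ 500).subtype) hhom)
      (LinearMap.codRestrict _ (LinearMap.mulLeft ℂ (-f) ∘ₗ
        (homogeneousSubmodule (Fin 4) ℂ 2494).subtype) fun h => by
          simpa using Submodule.neg_mem _ (hmul h))
  have hL : ∀ x, (L x : MvPolynomial (Fin 4) ℂ) =
      aeval (fun i => pderiv i f) (x.1 : MvPolynomial (Fin 4) ℂ) +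
        -f * (x.2 : MvPolynomial (Fin 4) ℂ) := fun x => rfl
  have hdim : Module.finrank ℂ (homogeneousSubmodule (Fin 4) ℂ 2500) < Module.finrank ℂ
      (homogeneousSubmodule (Fin 4) ℂ 500 × homogeneousSubmodule (Fin 4) ℂ 2494) := by
    rw [Module.finrank_prod]
    simp only [finrank_homogeneousSubmodule, multichoose_four]
    norm_num [Nat.choose_eq_descFactorial_div_factorial, Nat.descFactorial, Nat.factorial]
  obtain ⟨⟨G, h⟩, hx, hx0⟩ := (Submodule.ne_bot_iff _).mp
    (LinearMap.ker_ne_bot_of_finrank_lt (f := L) hdim)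
  have e := hL (G, h)
  rw [LinearMap.mem_ker.mp hx] at e
  refine ⟨500, G, h, G.2, ?_, ?_⟩
  · intro hG
    rw [hG, map_zero, zero_add] at e
    have : (h : MvPolynomial (Fin 4) ℂ) = 0 := by
      rcases mul_eq_zero.mp e.symm with h1 | h1
      · exact absurd (neg_eq_zero.mp h1) hf0
      · exact h1
    exact hx0 (Prod.ext (Subtype.ext hG) (Subtype.ext this))
  · rw [← sub_eq_zero, sub_eq_add_neg, ← neg_mul]
    exact e.symm

/-- A linear form not tangent to `{f = 0}` anywhere, and not vanishing at given points. -/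
lemma exists_transversal_form (hf : f.IsHomogeneous 6) (hf0 : f ≠ 0) {ι : Type*} [Finite ι]
    {P : ι → Fin 4 → ℂ} (hP0 : ∀ j, P j ≠ 0)
    (hsing : ∀ x ≠ 0, (∀ i, eval x (pderiv i f) = 0) → ∃ (j : ι) (c : ℂ), x = c • P j) :
    ∃ v : Fin 4 → ℂ, v ≠ 0 ∧ (∀ j, v ⬝ᵥ P j ≠ 0) ∧ ∀ (x : Fin 4 → ℂ) (l : ℂ), v ⬝ᵥ x = 0 →
      (∀ i, eval x (pderiv i f) = l * v i) → x = 0 := by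
  have := Fintype.ofFinite ι
  obtain ⟨m, G, h, hG, hG0, hGf⟩ := exists_form_gradient hf hf0
  have hne : G * (X 0 * ∏ j, ∑ i, C (P j i) * X i) * 1 ≠ 0 := by
    rw [mul_one]
    refine mul_ne_zero hG0 (mul_ne_zero (X_ne_zero 0) (Finset.prod_ne_zero_iff.mpr fun j _ h0 =>
      ?_))
    refine hP0 j (funext fun i => ?_)
    have := congrArg (eval (Pi.single i 1)) h0
    simpa [Pi.single_apply] using this
  obtain ⟨v, hv⟩ : ∃ v, eval v (G * (X 0 * ∏ j, ∑ i, C (P j i) * X i) * 1) ≠ 0 := by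
    by_contra! hcon
    exact hne (MvPolynomial.funext fun x => by rw [hcon, map_zero])
  rw [mul_one, map_mul, map_mul, eval_X, map_prod] at hv
  have hvG := left_ne_zero_of_mul hv
  have hv0 := left_ne_zero_of_mul (right_ne_zero_of_mul hv)
  have hvP := Finset.prod_ne_zero_iff.mp (right_ne_zero_of_mul (right_ne_zero_of_mul hv))
  have hvP' : ∀ j, v ⬝ᵥ P j ≠ 0 := fun j => by
    have := hvP j (Finset.mem_univ j)
    simpa [dotProduct, mul_comm] using this
  refine ⟨v, fun h => hv0 (congrFun h 0), hvP', fun x l hvx hx => ?_⟩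
  by_contra hx0
  have hfx : eval x f = 0 := by
    have := congrArg (eval x) hf.sum_X_mul_pderiv
    rw [map_sum] at this
    simp only [map_mul, eval_X, hx] at this
    have e : ∑ i, x i * (l * v i) = l * (v ⬝ᵥ x) := by
      rw [dotProduct, Finset.mul_sum]; exact Finset.sum_congr rfl fun i _ => by ring
    rw [e, hvx, mul_zero, map_nsmul] at this
    simpa using this.symm
  have hl : l = 0 := by
    have h1 := congrArg (eval x) hGf
    rw [map_mul, hfx, zero_mul, eval_aeval_eq] at h1
    have : (fun i => eval x (pderiv i f)) = l • v := funext hx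
    rw [this, eval_smul_of_isHomogeneous hG] at h1
    exact eq_zero_of_pow_eq_zero ((mul_eq_zero.mp h1).resolve_right hvG)
  obtain ⟨j, c, rfl⟩ := hsing x hx0 fun i => by rw [hx, hl, zero_mul]
  rw [dotProduct_smul, smul_eq_mul] at hvx
  rcases mul_eq_zero.mp hvx with h1 | h1
  · exact hx0 (by rw [h1, zero_smul])
  · exact hvP' j h1

/-- Linear coordinates in which the linear form `v` becomes the last coordinate. -/
lemma exists_matrix_dotProduct_eq {v : Fin 4 → ℂ} (hv : v ≠ 0) :
    ∃ B : Matrix (Fin 4) (Fin 4) ℂ, IsUnit B.det ∧ ∀ y, v ⬝ᵥ (B *ᵥ y) = y 3 := by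
  obtain ⟨A, hA, hAv⟩ := exists_matrix_mulVec_eq hv
  refine ⟨A⁻¹ᵀ, ?_, fun y => ?_⟩
  · rw [det_transpose]; exact isUnit_nonsing_inv_det A hA
  · rw [dotProduct_mulVec, vecMul_transpose, ← hAv, mulVec_mulVec, nonsing_inv_mul _ hA, one_mulVec]
    simp [dotProduct, Fin.sum_univ_four]

lemma TriplePt.substMatrix {B : Matrix (Fin 4) (Fin 4) ℂ} (hB : IsUnit B.det) {y : Fin 4 → ℂ}
    (h : TriplePt f (B *ᵥ y)) : TriplePt (substMatrix B f) y := by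
  refine ⟨?_, fun u v => ?_, fun w hw => ?_⟩
  · rintro rfl
    exact h.ne_zero (mulVec_zero B)
  · rw [dirDeriv_substMatrix, dirDeriv_substMatrix, eval_substMatrix, h.second]
  · obtain ⟨c, hc⟩ := h.nondeg (B *ᵥ w) fun u => by
      obtain ⟨u', rfl⟩ := mulVec_single_three B hB u
      have := hw u'
      rwa [dirDeriv_substMatrix, dirDeriv_substMatrix, dirDeriv_substMatrix, eval_substMatrix]
        at this
    refine ⟨c, ?_⟩
    rw [← mulVec_smul] at hc
    exact mulVec_injective_of_isUnit ((isUnit_iff_isUnit_det B).mpr hB) hc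

lemma TriplePt.smul {p : Fin 4 → ℂ} (hf : f.IsHomogeneous 6) (h : TriplePt f p) {c : ℂ}
    (hc : c ≠ 0) : TriplePt f (c • p) := by
  refine ⟨smul_ne_zero hc h.ne_zero, fun u v => ?_, fun w hw => ?_⟩
  · rw [eval_smul_of_isHomogeneous ((hf.dirDeriv v).dirDeriv u), h.second, mul_zero]
  · obtain ⟨a, ha⟩ := h.nondeg w fun u => by
      have := hw u
      rw [eval_smul_of_isHomogeneous (((hf.dirDeriv u).dirDeriv w).dirDeriv w)] at this
      exact (mul_eq_zero.mp this).resolve_left (pow_ne_zero _ hc)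
    exact ⟨a * c⁻¹, by rw [ha, smul_smul, mul_assoc, inv_mul_cancel₀ hc, mul_one]⟩

/-- Coordinates in which the plane at infinity `x₃ = 0` is transversal to the surface. -/
lemma exists_coordinates (hf : f.IsHomogeneous 6) (hf0 : f ≠ 0) {ι : Type*} [Finite ι]
    {P : ι → Fin 4 → ℂ} (hP0 : ∀ j, P j ≠ 0)
    (hsing : ∀ x ≠ 0, (∀ i, eval x (pderiv i f) = 0) → ∃ (j : ι) (c : ℂ), x = c • P j) :
    ∃ B : Matrix (Fin 4) (Fin 4) ℂ, IsUnit B.det ∧ (∀ x : Fin 4 → ℂ, x 3 = 0 →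
      (∀ i : Fin 3, eval x (pderiv i.castSucc (substMatrix B f)) = 0) → x = 0) ∧
      ∀ j, ∃ y : Fin 4 → ℂ, y 3 = 1 ∧ ∃ c : ℂ, c ≠ 0 ∧ B *ᵥ y = c • P j := by
  obtain ⟨v, hv0, hvP, hv⟩ := exists_transversal_form hf hf0 hP0 hsing
  obtain ⟨B, hB, hBv⟩ := exists_matrix_dotProduct_eq hv0
  refine ⟨B, hB, fun x hx3 hx => ?_, fun j => ?_⟩
  · have key : B *ᵥ x = 0 := by
      refine hv _ (eval x (dirDeriv (Pi.single 3 1) (substMatrix B f))) (by rw [hBv, hx3]) fun i =>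
        ?_
      obtain ⟨w, hw⟩ := mulVec_single_three B hB (Pi.single i 1)
      have h1 : v i = w 3 := by rw [← hBv w, hw]; simp
      rw [← dirDeriv_single, ← hw, ← eval_substMatrix, ← dirDeriv_substMatrix, h1,
        dirDeriv_eq_sum, Fin.sum_univ_castSucc, map_add, map_sum]
      simp only [smul_eval, hx, mul_zero, Finset.sum_const_zero, zero_add, dirDeriv_single]
      rw [mul_comm]; rfl
    exact mulVec_injective_of_isUnit ((isUnit_iff_isUnit_det B).mpr hB)
      (key.trans (mulVec_zero B).symm)
  · obtain ⟨w, hw⟩ := mulVec_single_three B hB (P j)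
    have h3 : w 3 = v ⬝ᵥ P j := by rw [← hBv w, hw]
    refine ⟨(w 3)⁻¹ • w, ?_, (w 3)⁻¹, ?_, ?_⟩
    · rw [Pi.smul_apply, smul_eq_mul, inv_mul_cancel₀]
      rw [h3]; exact hvP j
    · rw [h3]; exact inv_ne_zero (hvP j)
    · rw [mulVec_smul, hw]

end GeneralHyperplane

section QuadraticPolynomial

/-- The quadratic form of a bilinear form, as a polynomial. -/
def quadPoly (b : (Fin 3 → ℂ) →ₗ[ℂ] (Fin 3 → ℂ) →ₗ[ℂ] ℂ) : MvPolynomial (Fin 3) ℂ :=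
  ∑ j, ∑ k, C (b (Pi.single j 1) (Pi.single k 1)) * (X j * X k)

lemma linearMap_eq_sum_single {M : Type*} [AddCommGroup M] [Module ℂ M]
    (L : (Fin 3 → ℂ) →ₗ[ℂ] M) (x : Fin 3 → ℂ) : L x = ∑ j, x j • L (Pi.single j 1) := by
  conv_lhs => rw [pi_eq_sum_univ' x, map_sum]
  refine Finset.sum_congr rfl fun j _ => ?_
  rw [map_smul]

lemma eval_quadPoly (b : (Fin 3 → ℂ) →ₗ[ℂ] (Fin 3 → ℂ) →ₗ[ℂ] ℂ) (x : Fin 3 → ℂ) :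
    eval x (quadPoly b) = b x x := by
  rw [linearMap_eq_sum_single b x, quadPoly, map_sum, LinearMap.sum_apply]
  refine Finset.sum_congr rfl fun j _ => ?_
  rw [LinearMap.smul_apply, linearMap_eq_sum_single _ x, map_sum, Finset.smul_sum]
  refine Finset.sum_congr rfl fun k _ => ?_
  simp only [map_mul, eval_C, eval_X, smul_eq_mul]
  ring

lemma quadPoly_isHomogeneous (b : (Fin 3 → ℂ) →ₗ[ℂ] (Fin 3 → ℂ) →ₗ[ℂ] ℂ) :
    (quadPoly b).IsHomogeneous 2 :=
  IsHomogeneous.sum _ _ _ fun j _ => IsHomogeneous.sum _ _ _ fun k _ =>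
    ((isHomogeneous_X ℂ j).mul (isHomogeneous_X ℂ k)).C_mul _

end QuadraticPolynomial

section CubicForm

open Matrix

/-- A symmetric trilinear form on `ℂ³` whose associated plane cubic is nonsingular. -/
structure NonsingularCubic (T : (Fin 3 → ℂ) →ₗ[ℂ] (Fin 3 → ℂ) →ₗ[ℂ] (Fin 3 → ℂ) →ₗ[ℂ] ℂ) :
    Prop where
  comm : ∀ x y z, T x y z = T y x z
  comm' : ∀ x y z, T x y z = T x z y
  nondeg : ∀ x, (∀ u, T x x u = 0) → x = 0

variable {T : (Fin 3 → ℂ) →ₗ[ℂ] (Fin 3 → ℂ) →ₗ[ℂ] (Fin 3 → ℂ) →ₗ[ℂ] ℂ}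

/-- The gradient of the cubic form `T x x x`, up to a factor. -/
def cubicGrad (T : (Fin 3 → ℂ) →ₗ[ℂ] (Fin 3 → ℂ) →ₗ[ℂ] (Fin 3 → ℂ) →ₗ[ℂ] ℂ) (x : Fin 3 → ℂ) :
    Fin 3 → ℂ := fun i => T x x (Pi.single i 1)

lemma dotProduct_cubicGrad (x u : Fin 3 → ℂ) : u ⬝ᵥ cubicGrad T x = T x x u := by
  rw [linearMap_eq_sum_single (T x x) u]; rfl

/-- The gradient of the cubic form as a triple of polynomials. -/
def gradPoly (T : (Fin 3 → ℂ) →ₗ[ℂ] (Fin 3 → ℂ) →ₗ[ℂ] (Fin 3 → ℂ) →ₗ[ℂ] ℂ) (i : Fin 3) :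
    MvPolynomial (Fin 3) ℂ :=
  quadPoly (T.compr₂ (LinearMap.applyₗ (Pi.single i 1)))

lemma eval_gradPoly (x : Fin 3 → ℂ) (i : Fin 3) : eval x (gradPoly T i) = cubicGrad T x i := by
  rw [gradPoly, eval_quadPoly]; rfl

lemma NonsingularCubic.eq_zero_of_cubicGrad (hT : NonsingularCubic T) {x : Fin 3 → ℂ}
    (h : cubicGrad T x = 0) : x = 0 :=
  hT.nondeg x fun u => by rw [← dotProduct_cubicGrad, h, dotProduct_zero]

lemma NonsingularCubic.koszulExact (hT : NonsingularCubic T) : KoszulExact (gradPoly T) :=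
  koszulExact_of_forall_zero fun x hx => hT.eq_zero_of_cubicGrad <| funext fun i => by
    rw [← eval_gradPoly, hx]; rfl

lemma NonsingularCubic.linear_eq_zero (hT : NonsingularCubic T) (L : (Fin 3 → ℂ) →ₗ[ℂ] Fin 3 → ℂ)
    (h : ∀ x, T x x (L x) = 0) : L = 0 := by
  let v : Fin 3 → MvPolynomial (Fin 3) ℂ := fun i => ∑ j, C (L (Pi.single j 1) i) * X j
  have hv : ∀ x i, eval x (v i) = L x i := fun x i => by
    rw [linearMap_eq_sum_single L x]
    simp [v, mul_comm]
  obtain ⟨n, hn, -, hn0⟩ := hT.koszulExact.dot_homogeneous (k := 1) (v := v)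
    (fun i => quadPoly_isHomogeneous _)
    (fun i => IsHomogeneous.sum _ _ _ fun j _ => (isHomogeneous_X ℂ j).C_mul _)
    (MvPolynomial.funext fun x => by
      rw [map_zero, ← h x, ← dotProduct_cubicGrad, dotProduct, map_sum]
      exact Finset.sum_congr rfl fun i _ => by rw [map_mul, hv, eval_gradPoly])
  rw [hn0 (by norm_num)] at hn
  refine LinearMap.ext fun x => funext fun i => ?_
  rw [← hv, hn]
  simp

lemma NonsingularCubic.quadratic_eq_cross (hT : NonsingularCubic T)
    (b : (Fin 3 → ℂ) →ₗ[ℂ] (Fin 3 → ℂ) →ₗ[ℂ] Fin 3 → ℂ) (h : ∀ x, T x x (b x x) = 0) :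
    ∃ n : Fin 3 → ℂ, ∀ x, b x x = n ⨯₃ cubicGrad T x := by
  let v : Fin 3 → MvPolynomial (Fin 3) ℂ := fun i => quadPoly (b.compr₂ (LinearMap.proj i))
  have hv : ∀ x i, eval x (v i) = b x x i := fun x i => by
    simp only [v]; rw [eval_quadPoly]; rfl
  obtain ⟨n, hn, hn0, -⟩ := hT.koszulExact.dot_homogeneous (k := 2) (v := v)
    (fun i => quadPoly_isHomogeneous _) (fun i => quadPoly_isHomogeneous _)
    (MvPolynomial.funext fun x => by
      rw [map_zero, ← h x, ← dotProduct_cubicGrad, dotProduct, map_sum]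
      exact Finset.sum_congr rfl fun i _ => by rw [map_mul, hv, eval_gradPoly])
  refine ⟨fun i => eval 0 (n i), fun x => funext fun i => ?_⟩
  have hc : ∀ i, eval x (n i) = eval 0 (n i) := fun i => eval_eq_of_isHomogeneous_zero (hn0 i) _ _
  rw [← hv, hn, cross_apply, cross_apply]
  fin_cases i <;> simp [eval_gradPoly, hc]

/-- A binary quadratic form over `ℂ` has a nontrivial zero. -/
lemma exists_binary_quadratic_zero (a b c : ℂ) :
    ∃ s t : ℂ, (s ≠ 0 ∨ t ≠ 0) ∧ a * s ^ 2 + b * (s * t) + c * t ^ 2 = 0 := by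
  by_cases ha : a = 0
  · exact ⟨1, 0, Or.inl one_ne_zero, by rw [ha]; ring⟩
  · obtain ⟨d, hd⟩ := IsAlgClosed.exists_pow_nat_eq (b ^ 2 - 4 * a * c) (n := 2) (by norm_num)
    refine ⟨(d - b) / (2 * a), 1, Or.inr one_ne_zero, ?_⟩
    field_simp
    linear_combination hd

/-- The gradients on a plane spanned by `x` and `y` are not all proportional to one vector. -/
lemma NonsingularCubic.false_of_proportional (hT : NonsingularCubic T) {x y n : Fin 3 → ℂ}
    (hxy : ∀ s t : ℂ, s • x + t • y = 0 → s = 0 ∧ t = 0)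
    (h : ∀ (s t : ℂ) (u : Fin 3 → ℂ),
      n ⬝ᵥ u = 0 → T (s • x + t • y) (s • x + t • y) u = 0) : False := by
  by_cases hn : ∃ u, n ⬝ᵥ u ≠ 0
  · obtain ⟨u, hu⟩ := hn
    obtain ⟨s, t, hst, h0⟩ := exists_binary_quadratic_zero (T x x u) (2 * T x y u) (T y y u)
    have hw : s • x + t • y = 0 := hT.nondeg _ fun z => by
      have h1 := h s t (z - ((n ⬝ᵥ z) / (n ⬝ᵥ u)) • u) (by
        rw [dotProduct_sub, dotProduct_smul, smul_eq_mul, div_mul_cancel₀ _ hu, sub_self])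
      have h2 : T (s • x + t • y) (s • x + t • y) u = 0 := by
        simp only [map_add, map_smul, LinearMap.add_apply, LinearMap.smul_apply, smul_eq_mul]
        linear_combination h0 + s * t * hT.comm y x u
      rw [map_sub, map_smul, h2, smul_zero, sub_zero] at h1
      exact h1
    obtain ⟨h1, h2⟩ := hxy s t hw
    rcases hst with h | h
    · exact h h1
    · exact h h2
  · push Not at hn
    have hx : (1 : ℂ) • x + (0 : ℂ) • y = 0 := hT.nondeg _ fun u => h 1 0 u (hn u)
    exact one_ne_zero (hxy 1 0 hx).1

end CubicForm

section CubicDirections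

open Matrix

variable {T : (Fin 3 → ℂ) →ₗ[ℂ] (Fin 3 → ℂ) →ₗ[ℂ] (Fin 3 → ℂ) →ₗ[ℂ] ℂ}

/-- Two vectors are linearly independent. -/
def IndepPair {E : Type*} [AddCommGroup E] [Module ℂ E] (x y : E) : Prop :=
  ∀ s t : ℂ, s • x + t • y = 0 → s = 0 ∧ t = 0

lemma IndepPair.symm {E : Type*} [AddCommGroup E] [Module ℂ E] {x y : E} (h : IndepPair x y) :
    IndepPair y x := fun s t hst => (h t s (by rw [add_comm, hst])).symm

lemma IndepPair.ne_smul {E : Type*} [AddCommGroup E] [Module ℂ E] {x y : E} (h : IndepPair x y)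
    (c : ℂ) : x ≠ c • y := fun e =>
  one_ne_zero (h 1 (-c) (by rw [one_smul, neg_smul, e, add_neg_cancel])).1

lemma exists_vecMul_eq_zero {n a b c : Fin 3 → ℂ} (hn : n ≠ 0) (ha : n ⬝ᵥ a = 0)
    (hb : n ⬝ᵥ b = 0) (hc : n ⬝ᵥ c = 0) :
    ∃ y : Fin 3 → ℂ, y ≠ 0 ∧ y 0 • a + y 1 • b + y 2 • c = 0 := by
  have h1 : (Matrix.of ![a, b, c]) *ᵥ n = 0 := by
    funext i
    rw [mulVec, dotProduct_comm]
    fin_cases i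
    · exact ha
    · exact hb
    · exact hc
  have hdet := exists_mulVec_eq_zero_iff.mp ⟨n, hn, h1⟩
  obtain ⟨y, hy, hy0⟩ := exists_vecMul_eq_zero_iff.mpr hdet
  refine ⟨y, hy, ?_⟩
  rw [← hy0]
  funext i
  simp [vecMul, dotProduct, Fin.sum_univ_three]

lemma eq_smul_add_smul {E : Type*} [AddCommGroup E] [Module ℂ E] {a b c : E}
    (hab : IndepPair a b) (hbc : IndepPair b c) (hac : IndepPair a c) {y : Fin 3 → ℂ} (hy : y ≠ 0)
    (h : y 0 • a + y 1 • b + y 2 • c = 0) :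
    ∃ s t : ℂ, s ≠ 0 ∧ t ≠ 0 ∧ c = s • a + t • b := by
  have h2 : y 2 ≠ 0 := fun h2 => by
    rw [h2, zero_smul, add_zero] at h
    obtain ⟨h0, h1⟩ := hab _ _ h
    exact hy (funext fun i => by fin_cases i <;> assumption)
  have h0 : y 0 ≠ 0 := fun h0 => by
    rw [h0, zero_smul, zero_add] at h
    exact h2 (hbc _ _ h).2
  have h1 : y 1 ≠ 0 := fun h1 => by
    rw [h1, zero_smul, add_zero] at h
    exact h2 (hac _ _ h).2
  refine ⟨-(y 2)⁻¹ * y 0, -(y 2)⁻¹ * y 1, by simp [h0, h2], by simp [h1, h2], ?_⟩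
  rw [mul_smul, mul_smul, ← smul_add, eq_neg_of_add_eq_zero_left h, smul_neg, neg_smul, neg_neg,
    smul_smul, inv_mul_cancel₀ h2, one_smul]

lemma cross_eq_zero_of_forall {n g : Fin 3 → ℂ} (h : ∀ u, n ⬝ᵥ u = 0 → u ⬝ᵥ g = 0) :
    n ⨯₃ g = 0 := by
  rw [cross_eq_zero_iff]
  refine ⟨?_, ?_, ?_⟩
  · have := h ![0, -n 2, n 1] (by simp [dotProduct, Fin.sum_univ_three]; ring)
    simp [dotProduct, Fin.sum_univ_three] at this
    linear_combination this
  · have := h ![n 2, 0, -n 0] (by simp [dotProduct, Fin.sum_univ_three]; ring)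
    simp [dotProduct, Fin.sum_univ_three] at this
    linear_combination this
  · have := h ![-n 1, n 0, 0] (by simp [dotProduct, Fin.sum_univ_three]; ring)
    simp [dotProduct, Fin.sum_univ_three] at this
    linear_combination this

lemma dotProduct_eq_zero_of_cross {n g u : Fin 3 → ℂ} (hn : n ≠ 0) (h : n ⨯₃ g = 0)
    (hu : n ⬝ᵥ u = 0) : u ⬝ᵥ g = 0 := by
  obtain ⟨h0, h1, h2⟩ := cross_eq_zero_iff.mp h
  obtain ⟨i, hi⟩ := Function.ne_iff.mp hn
  refine (mul_eq_zero.mp ?_).resolve_left hi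
  simp only [dotProduct, Fin.sum_univ_three] at hu ⊢
  fin_cases i <;> simp only [Fin.zero_eta, Fin.mk_one, Fin.reduceFinMk]
  · linear_combination g 0 * hu + u 1 * h2 - u 2 * h1
  · linear_combination g 1 * hu - u 0 * h2 + u 2 * h0
  · linear_combination g 2 * hu + u 0 * h1 - u 1 * h0

/-- A cubic form with four distinct zeros on a line vanishes on that line. -/
lemma NonsingularCubic.cross_cubicGrad_eq_zero (hT : NonsingularCubic T) {n : Fin 3 → ℂ}
    (hn : n ≠ 0) {w : Fin 4 → Fin 3 → ℂ} (hw : ∀ i j, i ≠ j → IndepPair (w i) (w j))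
    (h0 : ∀ i, n ⬝ᵥ w i = 0) (h3 : ∀ i, T (w i) (w i) (w i) = 0) :
    n ⨯₃ cubicGrad T (w 0) = 0 := by
  obtain ⟨y, hy, hy0⟩ := exists_vecMul_eq_zero hn (h0 0) (h0 1) (h0 2)
  obtain ⟨z, hz, hz0⟩ := exists_vecMul_eq_zero hn (h0 0) (h0 1) (h0 3)
  obtain ⟨s, t, hs, ht, e2⟩ := eq_smul_add_smul (hw 0 1 (by decide)) (hw 1 2 (by decide))
    (hw 0 2 (by decide)) hy hy0
  obtain ⟨s', t', hs', ht', e3⟩ := eq_smul_add_smul (hw 0 1 (by decide)) (hw 1 3 (by decide))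
    (hw 0 3 (by decide)) hz hz0
  have key : ∀ s t : ℂ, T (s • w 0 + t • w 1) (s • w 0 + t • w 1) (s • w 0 + t • w 1) =
      3 * (s * t) * (s * T (w 0) (w 0) (w 1) + t * T (w 0) (w 1) (w 1)) := fun s t => by
    simp only [map_add, map_smul, LinearMap.add_apply, LinearMap.smul_apply, smul_eq_mul]
    linear_combination s ^ 3 * h3 0 + t ^ 3 * h3 1 - s ^ 2 * t * hT.comm' (w 0) (w 0) (w 1) * 2 +
      s ^ 2 * t * hT.comm (w 1) (w 0) (w 0) +
      s * t ^ 2 * hT.comm (w 1) (w 0) (w 1) + s * t ^ 2 * hT.comm' (w 1) (w 1) (w 0) +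
      s * t ^ 2 * hT.comm (w 1) (w 0) (w 1)
  have k2 := h3 2
  have k3 := h3 3
  rw [e2, key] at k2
  rw [e3, key] at k3
  replace k2 := (mul_eq_zero.mp k2).resolve_left (by simp [hs, ht])
  replace k3 := (mul_eq_zero.mp k3).resolve_left (by simp [hs', ht'])
  have hdet : s * t' - t * s' ≠ 0 := fun h => by
    refine (hw 2 3 (by decide)).ne_smul (s / s') ?_
    rw [e2, e3, smul_add, smul_smul, smul_smul, div_mul_cancel₀ _ hs']
    congr 2
    field_simp
    linear_combination -h
  have h001 : T (w 0) (w 0) (w 1) = 0 := by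
    refine (mul_eq_zero.mp ?_).resolve_left hdet
    linear_combination t' * k2 - t * k3
  refine cross_eq_zero_of_forall fun u hu => ?_
  rw [dotProduct_cubicGrad]
  obtain ⟨x, hx, hx0⟩ := exists_vecMul_eq_zero hn (h0 0) (h0 1) hu
  have hx2 : x 2 ≠ 0 := fun h2 => by
    rw [h2, zero_smul, add_zero] at hx0
    obtain ⟨hx1, hx2⟩ := hw 0 1 (by decide) _ _ hx0
    exact hx (funext fun i => by fin_cases i <;> assumption)
  have := congrArg (T (w 0) (w 0)) hx0
  simp only [map_add, map_smul, smul_eq_mul, h001, h3, mul_zero, zero_add, map_zero] at this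
  exact (mul_eq_zero.mp this).resolve_left hx2

/-- Polar conics: the relations between three of the five directions. -/
lemma NonsingularCubic.mul_eq_mul_of_relations (hT : NonsingularCubic T) {n a b c : Fin 3 → ℂ}
    (hspan : ∀ x : Fin 3 → ℂ, ∃ r s t : ℂ, x = r • a + s • b + t • c)
    (ha : ∀ u, n ⬝ᵥ u = 0 → T a a u = 0) (hb : ∀ u, n ⬝ᵥ u = 0 → T b b u = 0)
    (hc : ∀ u, n ⬝ᵥ u = 0 → T c c u = 0) {y1 y2 y3 z1 z2 z3 : ℂ}
    (hy3 : y3 ≠ 0) (hz3 : z3 ≠ 0)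
    (hy : ∀ u, n ⬝ᵥ u = 0 → y1 * y2 * T a b u + y1 * y3 * T a c u + y2 * y3 * T b c u = 0)
    (hz : ∀ u, n ⬝ᵥ u = 0 → z1 * z2 * T a b u + z1 * z3 * T a c u + z2 * z3 * T b c u = 0) :
    y1 * z2 = y2 * z1 := by
  by_contra hne
  obtain ⟨u, hu, hu0⟩ := (Submodule.ne_bot_iff _).mp (LinearMap.ker_ne_bot_of_finrank_lt
    (f := (dotProductBilin ℂ ℂ n).prod (T a b)) (by simp))
  obtain ⟨hn, hab⟩ : n ⬝ᵥ u = 0 ∧ T a b u = 0 := Prod.mk_eq_zero.mp (LinearMap.mem_ker.mp hu)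
  have e1 := hy u hn
  have e2 := hz u hn
  have hac : T a c u = 0 := by
    refine (mul_eq_zero.mp (?_ : (y3 * z3 * (y1 * z2 - y2 * z1)) * _ = 0)).resolve_left
      (mul_ne_zero (mul_ne_zero hy3 hz3) (sub_ne_zero.mpr hne))
    rw [hab] at e1 e2
    linear_combination z2 * z3 * e1 - y2 * y3 * e2
  have hbc : T b c u = 0 := by
    refine (mul_eq_zero.mp (?_ : (y3 * z3 * (y1 * z2 - y2 * z1)) * _ = 0)).resolve_left
      (mul_ne_zero (mul_ne_zero hy3 hz3) (sub_ne_zero.mpr hne))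
    rw [hab] at e1 e2
    linear_combination -z1 * z3 * e1 + y1 * y3 * e2
  refine hu0 (hT.nondeg u fun x => ?_)
  obtain ⟨r, s, t, rfl⟩ := hspan x
  obtain ⟨r', s', t', hu'⟩ := hspan u
  have hx : ∀ x, T (r' • a + s' • b + t' • c) x u = 0 → T u u x = 0 := fun x h => by
    rw [← hu', hT.comm'] at h; exact h
  refine hx _ ?_
  simp only [map_add, map_smul, LinearMap.add_apply, LinearMap.smul_apply, smul_eq_mul,
    hT.comm b a, hT.comm c a, hT.comm c b, ha u hn, hb u hn, hc u hn, hab, hac, hbc]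
  ring

/-- Two conics in the net of polars meet in at most four points. -/
lemma NonsingularCubic.false_of_five (hT : NonsingularCubic T) {n : Fin 3 → ℂ}
    {w : Fin 5 → Fin 3 → ℂ} (hw : ∀ i j, i ≠ j → IndepPair (w i) (w j))
    (h : ∀ i u, n ⬝ᵥ u = 0 → T (w i) (w i) u = 0) : False := by
  have sq : ∀ (s t : ℂ) (a b u : Fin 3 → ℂ), T (s • a + t • b) (s • a + t • b) u =
      s ^ 2 * T a a u + t ^ 2 * T b b u + 2 * s * t * T a b u := fun s t a b u => by
    simp only [map_add, map_smul, LinearMap.add_apply, LinearMap.smul_apply, smul_eq_mul]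
    linear_combination s * t * hT.comm b a u
  have h3 : ∀ i j k, i ≠ j → ∀ s t : ℂ, s ≠ 0 → t ≠ 0 → w k ≠ s • w i + t • w j := by
    intro i j k hij s t hs ht e
    refine hT.false_of_proportional (n := n) (hw i j hij) fun s' t' u hu => ?_
    have h1 := h k u hu
    rw [e, sq, h i u hu, h j u hu] at h1
    have h2 : T (w i) (w j) u = 0 := by simpa [hs, ht] using h1
    rw [sq, h i u hu, h j u hu, h2]; ring
  have hrel : ∀ i j k, i ≠ j → j ≠ k → i ≠ k → ∀ y : Fin 3 → ℂ,
      y 0 • w i + y 1 • w j + y 2 • w k = 0 → y = 0 := by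
    intro i j k hij hjk hik y hy
    by_contra hy0
    obtain ⟨s, t, hs, ht, e⟩ := eq_smul_add_smul (hw i j hij) (hw j k hjk) (hw i k hik) hy0 hy
    exact h3 i j k hij s t hs ht e
  have hdet : IsUnit (Matrix.of ![w 0, w 1, w 2]).det := by
    rw [isUnit_iff_ne_zero]
    intro h0
    obtain ⟨y, hy, hy0⟩ := exists_vecMul_eq_zero_iff.mpr h0
    refine hy (hrel 0 1 2 (by decide) (by decide) (by decide) y ?_)
    rw [← hy0]
    funext i
    simp [vecMul, dotProduct, Fin.sum_univ_three]
  have hspan : ∀ x : Fin 3 → ℂ, ∃ r s t : ℂ, x = r • w 0 + s • w 1 + t • w 2 := fun x => by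
    refine ⟨(x ᵥ* (Matrix.of ![w 0, w 1, w 2])⁻¹) 0, (x ᵥ* (Matrix.of ![w 0, w 1, w 2])⁻¹) 1,
      (x ᵥ* (Matrix.of ![w 0, w 1, w 2])⁻¹) 2, ?_⟩
    have : x = (x ᵥ* (Matrix.of ![w 0, w 1, w 2])⁻¹) ᵥ* (Matrix.of ![w 0, w 1, w 2]) := by
      rw [vecMul_vecMul, nonsing_inv_mul _ hdet, vecMul_one]
    refine this.trans (funext fun i => ?_)
    simp [vecMul, dotProduct, Fin.sum_univ_three]
  have hcoord : ∀ k, k ≠ 0 → k ≠ 1 → k ≠ 2 → ∀ r s t : ℂ,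
      w k = r • w 0 + s • w 1 + t • w 2 → r ≠ 0 ∧ s ≠ 0 ∧ t ≠ 0 := by
    intro k k0 k1 k2 r s t e
    refine ⟨?_, ?_, ?_⟩
    · rintro rfl
      have := hrel 1 2 k (by decide) (Ne.symm k2) (Ne.symm k1) ![s, t, -1] (by simp [e]; abel)
      simpa using congrFun this 2
    · rintro rfl
      have := hrel 0 2 k (by decide) (Ne.symm k2) (Ne.symm k0) ![r, t, -1] (by simp [e]; abel)
      simpa using congrFun this 2
    · rintro rfl
      have := hrel 0 1 k (by decide) (Ne.symm k1) (Ne.symm k0) ![r, s, -1] (by simp [e]; abel)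
      simpa using congrFun this 2
  obtain ⟨y1, y2, y3, ey⟩ := hspan (w 3)
  obtain ⟨z1, z2, z3, ez⟩ := hspan (w 4)
  obtain ⟨hy1, hy2, hy3⟩ := hcoord 3 (by decide) (by decide) (by decide) _ _ _ ey
  obtain ⟨hz1, hz2, hz3⟩ := hcoord 4 (by decide) (by decide) (by decide) _ _ _ ez
  have conic : ∀ (r s t : ℂ) (k : Fin 5), w k = r • w 0 + s • w 1 + t • w 2 → ∀ u, n ⬝ᵥ u = 0 →
      r * s * T (w 0) (w 1) u + r * t * T (w 0) (w 2) u + s * t * T (w 1) (w 2) u = 0 := by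
    intro r s t k e u hu
    have h1 := h k u hu
    rw [e] at h1
    simp only [map_add, map_smul, LinearMap.add_apply, LinearMap.smul_apply, smul_eq_mul,
      hT.comm (w 1) (w 0), hT.comm (w 2) (w 0), hT.comm (w 2) (w 1), h 0 u hu, h 1 u hu,
      h 2 u hu] at h1
    linear_combination h1 / 2
  have e12 : y1 * z2 = y2 * z1 := hT.mul_eq_mul_of_relations hspan (h 0) (h 1) (h 2) hy3 hz3
    (conic _ _ _ _ ey) (conic _ _ _ _ ez)
  have e13 : y1 * z3 = y3 * z1 := by
    refine hT.mul_eq_mul_of_relations (a := w 0) (b := w 2) (c := w 1) ?_ (h 0) (h 2) (h 1) hy2 hz2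
      (fun u hu => ?_) (fun u hu => ?_)
    · intro x
      obtain ⟨r, s, t, rfl⟩ := hspan x
      exact ⟨r, t, s, by abel⟩
    · rw [hT.comm (w 2) (w 1)]
      linear_combination conic _ _ _ _ ey u hu
    · rw [hT.comm (w 2) (w 1)]
      linear_combination conic _ _ _ _ ez u hu
  refine (hw 4 3 (by decide)).ne_smul (z1 / y1) ?_
  rw [ey, ez, smul_add, smul_add, smul_smul, smul_smul, smul_smul, div_mul_cancel₀ _ hy1]
  congr 3
  · field_simp; linear_combination e12
  · field_simp; linear_combination e13

/-- A vector field `n × ∇T` tangent to ten distinct directions vanishes. -/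
lemma NonsingularCubic.eq_zero_of_cross_eq (hT : NonsingularCubic T) {n : Fin 3 → ℂ}
    {w : Fin 10 → Fin 3 → ℂ} (hw : ∀ i j, i ≠ j → IndepPair (w i) (w j))
    (h : ∀ i, ∃ μ : ℂ, n ⨯₃ cubicGrad T (w i) = μ • w i) : n = 0 := by
  classical
  by_contra hn
  choose μ hμ using h
  by_cases hc : 4 ≤ (Finset.univ.filter fun i => μ i ≠ 0).card
  · let e := Finset.orderEmbOfCardLe _ hc
    have he : ∀ i, μ (e i) ≠ 0 := fun i =>
      (Finset.mem_filter.mp (Finset.orderEmbOfCardLe_mem _ hc i)).2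
    have h0 := hT.cross_cubicGrad_eq_zero hn (w := fun i => w (e i))
      (fun i j hij => hw _ _ (e.injective.ne hij)) (fun i => ?_) (fun i => ?_)
    · rw [hμ] at h0
      rcases smul_eq_zero.mp h0 with h0 | h0
      · exact he 0 h0
      · exact (hw (e 0) (e 1) (e.injective.ne (by decide))).ne_smul 0 (by simpa using h0)
    · have := dot_self_cross n (cubicGrad T (w (e i)))
      rw [hμ, dotProduct_smul] at this
      exact (smul_eq_zero.mp this).resolve_left (he i)
    · have := dot_cross_self n (cubicGrad T (w (e i)))
      rw [hμ, dotProduct_smul, dotProduct_comm, dotProduct_cubicGrad] at this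
      exact (smul_eq_zero.mp this).resolve_left (he i)
  · have hc' : 5 ≤ (Finset.univ.filter fun i => μ i = 0).card := by
      have := Finset.card_filter_add_card_filter_not (s := (Finset.univ : Finset (Fin 10)))
        (fun i => μ i = 0)
      simp only [Finset.card_univ, Fintype.card_fin] at this
      simp only [ne_eq] at hc
      omega
    let e := Finset.orderEmbOfCardLe _ hc'
    have he : ∀ i, μ (e i) = 0 := fun i =>
      (Finset.mem_filter.mp (Finset.orderEmbOfCardLe_mem _ hc' i)).2
    refine hT.false_of_five (n := n) (w := fun i => w (e i))
      (fun i j hij => hw _ _ (e.injective.ne hij)) fun i u hu => ?_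
    rw [← dotProduct_cubicGrad]
    exact dotProduct_eq_zero_of_cross hn (by rw [hμ, he, zero_smul]) hu

end CubicDirections

section VectorField

variable {f : MvPolynomial (Fin 4) ℂ}

/-- The derivative of `g` along the polynomial vector field `θ`. -/
def vfield (θ : Fin 4 → MvPolynomial (Fin 4) ℂ) (g : MvPolynomial (Fin 4) ℂ) :
    MvPolynomial (Fin 4) ℂ :=
  ∑ i, θ i * pderiv i g

/-- The value of a polynomial vector field at a point. -/
def evalVec (x : Fin 4 → ℂ) (θ : Fin 4 → MvPolynomial (Fin 4) ℂ) : Fin 4 → ℂ :=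
  fun i => eval x (θ i)

/-- The directional derivative of a polynomial vector field. -/
def dirVec (u : Fin 4 → ℂ) (θ : Fin 4 → MvPolynomial (Fin 4) ℂ) :
    Fin 4 → MvPolynomial (Fin 4) ℂ :=
  fun i => dirDeriv u (θ i)

lemma dirDeriv_vfield (u : Fin 4 → ℂ) (θ : Fin 4 → MvPolynomial (Fin 4) ℂ)
    (g : MvPolynomial (Fin 4) ℂ) :
    dirDeriv u (vfield θ g) = vfield (dirVec u θ) g + vfield θ (dirDeriv u g) := by
  rw [vfield, vfield, vfield, map_sum, ← Finset.sum_add_distrib]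
  refine Finset.sum_congr rfl fun i _ => ?_
  rw [dirDeriv_mul, ← dirDeriv_single, dirDeriv_comm u, dirVec]
  ring

lemma eval_vfield (x : Fin 4 → ℂ) (θ : Fin 4 → MvPolynomial (Fin 4) ℂ)
    (g : MvPolynomial (Fin 4) ℂ) : eval x (vfield θ g) = eval x (dirDeriv (evalVec x θ) g) := by
  rw [vfield, dirDeriv_eq_sum, map_sum, map_sum]
  exact Finset.sum_congr rfl fun i _ => by rw [map_mul, smul_eval, evalVec]

lemma evalVec_dirVec_add (x u v : Fin 4 → ℂ) (θ : Fin 4 → MvPolynomial (Fin 4) ℂ) :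
    evalVec x (dirVec (u + v) θ) = evalVec x (dirVec u θ) + evalVec x (dirVec v θ) := by
  funext i; simp [evalVec, dirVec, dirDeriv_add]

lemma evalVec_dirVec_smul (c : ℂ) (x u : Fin 4 → ℂ) (θ : Fin 4 → MvPolynomial (Fin 4) ℂ) :
    evalVec x (dirVec (c • u) θ) = c • evalVec x (dirVec u θ) := by
  funext i; simp [evalVec, dirVec, dirDeriv_smul]

lemma dirVec_comm (u v : Fin 4 → ℂ) (θ : Fin 4 → MvPolynomial (Fin 4) ℂ) :
    dirVec u (dirVec v θ) = dirVec v (dirVec u θ) :=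
  funext fun i => dirDeriv_comm u v (θ i)

lemma dirVec_isHomogeneous {θ : Fin 4 → MvPolynomial (Fin 4) ℂ} {e : ℕ}
    (h : ∀ i, (θ i).IsHomogeneous e) (u : Fin 4 → ℂ) (i : Fin 4) :
    (dirVec u θ i).IsHomogeneous (e - 1) := by
  unfold dirVec; exact (h i).dirDeriv u

lemma evalVec_dirVec_self {θ : Fin 4 → MvPolynomial (Fin 4) ℂ} {e : ℕ}
    (h : ∀ i, (θ i).IsHomogeneous e) (x : Fin 4 → ℂ) :
    evalVec x (dirVec x θ) = (e : ℂ) • evalVec x θ :=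
  funext fun i => by
    have := (h i).eval_dirDeriv_self x
    simpa only [evalVec, dirVec, Pi.smul_apply, smul_eq_mul] using this

lemma evalVec_zero_of_isHomogeneous {θ : Fin 4 → MvPolynomial (Fin 4) ℂ}
    (h : ∀ i, (θ i).IsHomogeneous 0) (x y : Fin 4 → ℂ) : evalVec x θ = evalVec y θ :=
  funext fun i => eval_eq_of_isHomogeneous_zero (h i) x y

end VectorField

section TangentForm

/-- `extendZero` as a linear map. -/
def extendZeroₗ : (Fin 3 → ℂ) →ₗ[ℂ] (Fin 4 → ℂ) where
  toFun := extendZero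
  map_add' x y := by
    funext i
    refine Fin.lastCases ?_ (fun i => ?_) i
    · simp only [show Fin.last 3 = 3 from rfl, Pi.add_apply, extendZero_last, add_zero]
    · simp only [Pi.add_apply, extendZero_castSucc]
  map_smul' c x := by
    funext i
    refine Fin.lastCases ?_ (fun i => ?_) i
    · simp only [show Fin.last 3 = 3 from rfl, Pi.smul_apply, extendZero_last, smul_zero]
    · simp only [RingHom.id_apply, Pi.smul_apply, extendZero_castSucc]

lemma extendZeroₗ_castSucc (x : Fin 3 → ℂ) (i : Fin 3) : extendZeroₗ x i.castSucc = x i :=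
  extendZero_castSucc x i

lemma extendZeroₗ_last (x : Fin 3 → ℂ) : extendZeroₗ x 3 = 0 := extendZero_last x

/-- The projection to the plane `x₃ = 0` along `p`. -/
def projAlong (p : Fin 4 → ℂ) : (Fin 4 → ℂ) →ₗ[ℂ] (Fin 3 → ℂ) where
  toFun v i := v i.castSucc - v 3 * p i.castSucc
  map_add' v w := by funext i; simp only [Pi.add_apply]; ring
  map_smul' c v := by funext i; simp only [Pi.smul_apply, smul_eq_mul, RingHom.id_apply]; ring

lemma projAlong_apply (p v : Fin 4 → ℂ) (i : Fin 3) :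
    projAlong p v i = v i.castSucc - v 3 * p i.castSucc := rfl

lemma projAlong_extendZeroₗ (p : Fin 4 → ℂ) (x : Fin 3 → ℂ) :
    projAlong p (extendZeroₗ x) = x := by
  funext i; rw [projAlong_apply, extendZeroₗ_castSucc, extendZeroₗ_last]; ring

variable {f : MvPolynomial (Fin 4) ℂ} {p : Fin 4 → ℂ}

lemma projAlong_self (h3 : p 3 = 1) : projAlong p p = 0 := by
  funext i; rw [projAlong_apply, h3]; simp

lemma extendZeroₗ_projAlong (h3 : p 3 = 1) (v : Fin 4 → ℂ) :
    v = extendZeroₗ (projAlong p v) + v 3 • p := by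
  funext i
  refine Fin.lastCases ?_ (fun i => ?_) i
  · simp only [show Fin.last 3 = 3 from rfl, Pi.add_apply, extendZeroₗ_last, Pi.smul_apply, h3]
    simp
  · simp only [Pi.add_apply, extendZeroₗ_castSucc, projAlong_apply, Pi.smul_apply, smul_eq_mul]
    ring

lemma eq_smul_of_projAlong (h3 : p 3 = 1) {v : Fin 4 → ℂ} (h : projAlong p v = 0) :
    v = v 3 • p := by
  conv_lhs => rw [extendZeroₗ_projAlong h3 v, h, map_zero, zero_add]

/-- The polar form of the tangent cone of `{f = 0}` at a triple point `p`. -/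
def tangentForm (f : MvPolynomial (Fin 4) ℂ) (p : Fin 4 → ℂ) :
    (Fin 3 → ℂ) →ₗ[ℂ] (Fin 3 → ℂ) →ₗ[ℂ] (Fin 3 → ℂ) →ₗ[ℂ] ℂ :=
  LinearMap.mk₂ ℂ (fun x y =>
    { toFun := fun z => eval p (dirDeriv (extendZeroₗ x) (dirDeriv (extendZeroₗ y)
        (dirDeriv (extendZeroₗ z) f)))
      map_add' := fun z w => by simp only [map_add, dirDeriv_add]
      map_smul' := fun c z => by
        simp only [map_smul, Derivation.map_smul, dirDeriv_smul, smul_eval, RingHom.id_apply,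
          smul_eq_mul] })
    (fun x x' y => LinearMap.ext fun z => by
      simp only [LinearMap.coe_mk, AddHom.coe_mk, LinearMap.add_apply, map_add, dirDeriv_add])
    (fun c x y => LinearMap.ext fun z => by
      simp only [LinearMap.coe_mk, AddHom.coe_mk, LinearMap.smul_apply, map_smul,
        dirDeriv_smul, smul_eval, smul_eq_mul])
    (fun x y y' => LinearMap.ext fun z => by
      simp only [LinearMap.coe_mk, AddHom.coe_mk, LinearMap.add_apply, map_add, dirDeriv_add])
    (fun c x y => LinearMap.ext fun z => by
      simp only [LinearMap.coe_mk, AddHom.coe_mk, LinearMap.smul_apply, map_smul,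
        Derivation.map_smul,
        dirDeriv_smul, smul_eval, smul_eq_mul])

lemma tangentForm_apply (x y z : Fin 3 → ℂ) : tangentForm f p x y z =
    eval p (dirDeriv (extendZeroₗ x) (dirDeriv (extendZeroₗ y) (dirDeriv (extendZeroₗ z) f))) := rfl

lemma tangentForm_projAlong (hf : f.IsHomogeneous 6) (hp : TriplePt f p) (h3 : p 3 = 1)
    (x y : Fin 3 → ℂ) (v : Fin 4 → ℂ) : tangentForm f p x y (projAlong p v) =
    eval p (dirDeriv (extendZeroₗ x) (dirDeriv (extendZeroₗ y) (dirDeriv v f))) := by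
  conv_rhs => rw [extendZeroₗ_projAlong h3 v]
  rw [dirDeriv_add, map_add, map_add, map_add, dirDeriv_smul, Derivation.map_smul,
    Derivation.map_smul, smul_eval,
    hp.third_self' hf, mul_zero, add_zero, tangentForm_apply]

lemma TriplePt.nonsingularCubic (hf : f.IsHomogeneous 6) (hp : TriplePt f p) (h3 : p 3 = 1) :
    NonsingularCubic (tangentForm f p) where
  comm x y z := by rw [tangentForm_apply, tangentForm_apply, dirDeriv_comm]
  comm' x y z := by rw [tangentForm_apply, tangentForm_apply, dirDeriv_comm (extendZeroₗ y)]
  nondeg x hx := by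
    obtain ⟨c, hc⟩ := hp.nondeg (extendZeroₗ x) fun u => by
      rw [← tangentForm_projAlong hf hp h3, hx]
    have := congrFun hc 3
    rw [extendZeroₗ_last, Pi.smul_apply, h3, smul_eq_mul, mul_one] at this
    rw [← projAlong_extendZeroₗ p x, hc, ← this, zero_smul, map_zero]

end TangentForm

section LocalSyzygy

variable {f : MvPolynomial (Fin 4) ℂ} {p : Fin 4 → ℂ} {θ : Fin 4 → MvPolynomial (Fin 4) ℂ}

lemma TriplePt.exists_evalVec_eq (hf : f.IsHomogeneous 6) (hp : TriplePt f p)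
    (hθ : vfield θ f = 0) : ∃ α : ℂ, evalVec p θ = α • p := by
  refine hp.nondeg _ fun u => ?_
  have h : eval p (dirDeriv u (dirDeriv (evalVec p θ) (vfield θ f))) = 0 := by
    rw [hθ, map_zero, map_zero, map_zero]
  simp only [dirDeriv_vfield, map_add, eval_vfield, hp.second, hp.first hf, zero_add] at h
  rwa [dirDeriv_comm u] at h

lemma TriplePt.eval_dirVec (hf : f.IsHomogeneous 6) (hp : TriplePt f p) (hθ : vfield θ f = 0)
    {α : ℂ} (hα : evalVec p θ = α • p) (v : Fin 4 → ℂ) :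
    eval p (dirDeriv (evalVec p (dirVec v θ) + α • v) (dirDeriv v (dirDeriv v f))) = 0 := by
  have h : eval p (dirDeriv v (dirDeriv v (dirDeriv v (vfield θ f)))) = 0 := by
    rw [hθ, map_zero, map_zero, map_zero, map_zero]
  have h4 := (((hf.dirDeriv v).dirDeriv v).dirDeriv v).eval_dirDeriv_self p
  simp only [dirDeriv_vfield, map_add, eval_vfield, hp.second, hp.first hf, zero_add, hα,
    dirDeriv_smul, smul_eval, h4] at h
  rw [dirDeriv_add, map_add, dirDeriv_smul, smul_eval]
  norm_num at h
  linear_combination h / 3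

lemma TriplePt.exists_evalVec_dirVec_eq (hf : f.IsHomogeneous 6) (hp : TriplePt f p)
    (h3 : p 3 = 1) (hθ : vfield θ f = 0) {e : ℕ} (he : ∀ i, (θ i).IsHomogeneous e) {α : ℂ}
    (hα : evalVec p θ = α • p) (v : Fin 4 → ℂ) :
    ∃ c : ℂ, evalVec p (dirVec v θ) = -α • v + c • p := by
  let L : (Fin 3 → ℂ) →ₗ[ℂ] Fin 3 → ℂ :=
    { toFun := fun x => projAlong p (evalVec p (dirVec (extendZeroₗ x) θ) + α • extendZeroₗ x)
      map_add' := fun x y => by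
        rw [map_add extendZeroₗ, evalVec_dirVec_add, smul_add, ← map_add]
        congr 1
        abel
      map_smul' := fun c x => by
        rw [map_smul extendZeroₗ, evalVec_dirVec_smul, smul_comm α c, ← smul_add, map_smul]; rfl }
  have hL : L = 0 := (hp.nonsingularCubic hf h3).linear_eq_zero L fun x => by
    have := hp.eval_dirVec hf hθ hα (extendZeroₗ x)
    rw [show L x = projAlong p _ from rfl, tangentForm_projAlong hf hp h3]
    rw [dirDeriv_comm _ (extendZeroₗ x), dirDeriv_comm _ (extendZeroₗ x)] at this
    exact this
  have hx : ∀ x, ∃ c : ℂ, evalVec p (dirVec (extendZeroₗ x) θ) = -α • extendZeroₗ x + c • p :=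
    fun x => ⟨(evalVec p (dirVec (extendZeroₗ x) θ) + α • extendZeroₗ x) 3, by
      rw [← eq_smul_of_projAlong h3 (LinearMap.congr_fun hL x), neg_smul, add_comm,
        add_neg_cancel_right]⟩
  obtain ⟨c, hc⟩ := hx (projAlong p v)
  refine ⟨c + v 3 * (e * α + α), ?_⟩
  conv_lhs => rw [extendZeroₗ_projAlong h3 v]
  conv_rhs => rw [extendZeroₗ_projAlong h3 v]
  rw [evalVec_dirVec_add, evalVec_dirVec_smul, hc, evalVec_dirVec_self he, hα]
  funext i
  simp only [Pi.add_apply, Pi.smul_apply, smul_eq_mul, extendZeroₗ_last, h3]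
  ring

lemma eval_dirDeriv_three {h : MvPolynomial (Fin 4) ℂ} (hh : h.IsHomogeneous 3)
    (x : Fin 4 → ℂ) : eval 0 (dirDeriv x (dirDeriv x (dirDeriv x h))) = 6 * eval x h := by
  rw [eval_eq_of_isHomogeneous_zero (((hh.dirDeriv x).dirDeriv x).dirDeriv x) 0 x,
    ((hh.dirDeriv x).dirDeriv x).eval_dirDeriv_self, (hh.dirDeriv x).eval_dirDeriv_self,
    hh.eval_dirDeriv_self]
  norm_num
  ring

lemma eval_dirDeriv_four {h : MvPolynomial (Fin 4) ℂ} (hh : h.IsHomogeneous 4)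
    (x : Fin 4 → ℂ) :
    eval 0 (dirDeriv x (dirDeriv x (dirDeriv x (dirDeriv x h)))) = 24 * eval x h := by
  rw [eval_dirDeriv_three (hh.dirDeriv x), hh.eval_dirDeriv_self]
  norm_num
  ring

/-- No three triple points are collinear. -/
lemma TriplePt.false_of_collinear (hf : f.IsHomogeneous 6) {q : Fin 4 → ℂ} (hp : TriplePt f p)
    (hq : TriplePt f q) (hpq : IndepPair p q) (h : TriplePt f (p + q)) : False := by
  suffices h0 : ∀ u, eval p (dirDeriv q (dirDeriv q (dirDeriv u f))) = 0 by
    obtain ⟨c, hc⟩ := hp.nondeg q h0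
    exact hpq.symm.ne_smul c hc
  intro u
  have hu := hf.dirDeriv u
  have e1 := eval_dirDeriv_four (hu.dirDeriv p) p
  have e2 := eval_dirDeriv_four (hu.dirDeriv q) p
  have e3 := eval_dirDeriv_four (hu.dirDeriv p) q
  have e4 := eval_dirDeriv_four (hu.dirDeriv q) q
  have e5 := eval_dirDeriv_four (hu.dirDeriv p) (p + q)
  have e6 := eval_dirDeriv_four (hu.dirDeriv q) (p + q)
  have e7 := eval_dirDeriv_three ((hu.dirDeriv q).dirDeriv q) p
  have hqp : ∀ g, dirDeriv q (dirDeriv p g) = dirDeriv p (dirDeriv q g) := dirDeriv_comm q p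
  simp only [hp.second, hq.second, h.second, mul_zero, dirDeriv_add, map_add,
    hqp] at e1 e2 e3 e4 e5 e6 e7
  linear_combination -e7 / 6 + (6 * e5 - 4 * e6 - 6 * e1 - 20 * e2 + 10 * e3 + 4 * e4) / 120

end LocalSyzygy

section Hessian

variable {f : MvPolynomial (Fin 4) ℂ} {p : Fin 4 → ℂ} {θ : Fin 4 → MvPolynomial (Fin 4) ℂ}

/-- The derivative of a vector field at a point, as a linear map. -/
def jacobianₗ (p : Fin 4 → ℂ) (θ : Fin 4 → MvPolynomial (Fin 4) ℂ) :
    (Fin 4 → ℂ) →ₗ[ℂ] Fin 4 → ℂ where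
  toFun v := evalVec p (dirVec v θ)
  map_add' u v := evalVec_dirVec_add p u v θ
  map_smul' c v := evalVec_dirVec_smul c p v θ

/-- The second derivative of a vector field at a point, as a bilinear map. -/
def hessianₗ (p : Fin 4 → ℂ) (θ : Fin 4 → MvPolynomial (Fin 4) ℂ) :
    (Fin 4 → ℂ) →ₗ[ℂ] (Fin 4 → ℂ) →ₗ[ℂ] Fin 4 → ℂ :=
  LinearMap.mk₂ ℂ (fun u v => evalVec p (dirVec u (dirVec v θ)))
    (fun u u' v => evalVec_dirVec_add p u u' _)
    (fun c u v => evalVec_dirVec_smul c p u _)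
    (fun u v v' => by
      rw [dirVec_comm u, evalVec_dirVec_add, dirVec_comm u v, dirVec_comm u v'])
    (fun c u v => by rw [dirVec_comm u, evalVec_dirVec_smul, dirVec_comm u v])

lemma jacobianₗ_apply (v : Fin 4 → ℂ) : jacobianₗ p θ v = evalVec p (dirVec v θ) := rfl

lemma hessianₗ_apply (u v : Fin 4 → ℂ) :
    hessianₗ p θ u v = evalVec p (dirVec u (dirVec v θ)) := rfl

lemma hessianₗ_comm (u v : Fin 4 → ℂ) : hessianₗ p θ u v = hessianₗ p θ v u := by
  rw [hessianₗ_apply, hessianₗ_apply, dirVec_comm]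

/-- For a cubic vector field, the polarization identity `D²θ(p)(q, q) = 2 Dθ(q)(p)`. -/
lemma hessianₗ_eq_jacobianₗ (he : ∀ i, (θ i).IsHomogeneous 3) (p q : Fin 4 → ℂ) :
    hessianₗ p θ q q = (2 : ℂ) • jacobianₗ q θ p := by
  have h1 := dirVec_isHomogeneous (dirVec_isHomogeneous he q) q
  have h0 := dirVec_isHomogeneous h1 p
  have h1' := dirVec_isHomogeneous (dirVec_isHomogeneous he p) q
  have e1 := evalVec_dirVec_self h1 p
  have e2 := evalVec_dirVec_self h1' q
  have e3 := evalVec_dirVec_self (dirVec_isHomogeneous he p) q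
  rw [evalVec_zero_of_isHomogeneous h0 p q, dirVec_comm p, dirVec_comm p, e2, e3] at e1
  rw [hessianₗ_apply, jacobianₗ_apply]
  norm_num at e1
  exact e1.symm

lemma TriplePt.third_hessian (hf : f.IsHomogeneous 6) (hp : TriplePt f p) (hθ : vfield θ f = 0)
    (hα : evalVec p θ = 0) {v : Fin 4 → ℂ} {c : ℂ} (hc : jacobianₗ p θ v = c • p) :
    eval p (dirDeriv (hessianₗ p θ v v + (2 * c) • v) (dirDeriv v (dirDeriv v f))) = 0 := by
  have h : eval p (dirDeriv v (dirDeriv v (dirDeriv v (dirDeriv v (vfield θ f))))) = 0 := by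
    rw [hθ, map_zero, map_zero, map_zero, map_zero, map_zero]
  have h4 := (((hf.dirDeriv v).dirDeriv v).dirDeriv v).eval_dirDeriv_self p
  rw [jacobianₗ_apply] at hc
  simp only [dirDeriv_vfield, map_add, eval_vfield, hp.second, hp.first hf, zero_add, hα, hc,
    dirDeriv_smul, smul_eval, h4, dirDeriv_zero_left, map_zero,
    ← hessianₗ_apply] at h
  rw [dirDeriv_add, map_add, dirDeriv_smul, smul_eval]
  norm_num at h
  linear_combination h / 6

/-- The second derivative at a triple point of a cubic syzygy vanishing there. -/
lemma TriplePt.hessian_eq (hf : f.IsHomogeneous 6) (hp : TriplePt f p) (h3 : p 3 = 1)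
    (hθ : vfield θ f = 0) (he : ∀ i, (θ i).IsHomogeneous 3) (hα : evalVec p θ = 0)
    {q : Fin 10 → Fin 4 → ℂ} (hq : ∀ i, TriplePt f (q i)) (hq3 : ∀ i, q i 3 = 1)
    (hpq : ∀ i j, i ≠ j → IndepPair (projAlong p (q i)) (projAlong p (q j))) :
    ∃ ξ : (Fin 4 → ℂ) →ₗ[ℂ] ℂ, (∀ v, jacobianₗ p θ v = ξ v • p) ∧
      ∀ v, v 3 = 0 → ∃ κ : ℂ, hessianₗ p θ v v = (-2 * ξ v) • v + κ • p := by
  let ξ : (Fin 4 → ℂ) →ₗ[ℂ] ℂ := LinearMap.proj 3 ∘ₗ jacobianₗ p θ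
  have hξ : ∀ v, jacobianₗ p θ v = ξ v • p := fun v => by
    obtain ⟨c, hc⟩ := hp.exists_evalVec_dirVec_eq hf h3 hθ he (α := 0) (by rw [hα, zero_smul]) v
    rw [neg_zero, zero_smul, zero_add, ← jacobianₗ_apply] at hc
    have : ξ v = c := by
      change jacobianₗ p θ v 3 = c
      rw [hc, Pi.smul_apply, h3, smul_eq_mul, mul_one]
    rw [this, hc]
  let b : (Fin 3 → ℂ) →ₗ[ℂ] (Fin 3 → ℂ) →ₗ[ℂ] Fin 3 → ℂ :=
    LinearMap.mk₂ ℂ (fun x y => projAlong p (hessianₗ p θ (extendZeroₗ x) (extendZeroₗ y)) +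
        ξ (extendZeroₗ x) • y + ξ (extendZeroₗ y) • x)
      (fun x x' y => by simp only [map_add, LinearMap.add_apply, add_smul, smul_add]; abel)
      (fun c x y => by
        simp only [map_smul, LinearMap.smul_apply, smul_add, smul_eq_mul, mul_smul]
        rw [smul_comm c (ξ (extendZeroₗ y))])
      (fun x y y' => by simp only [map_add, add_smul, smul_add]; abel)
      (fun c x y => by
        simp only [map_smul, smul_add, smul_eq_mul, mul_smul]
        rw [smul_comm c (ξ (extendZeroₗ x))])
  have hb : ∀ x, b x x = projAlong p (hessianₗ p θ (extendZeroₗ x) (extendZeroₗ x) +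
      (2 * ξ (extendZeroₗ x)) • extendZeroₗ x) := fun x => by
    rw [map_add, map_smul, projAlong_extendZeroₗ, mul_smul, two_smul, ← add_assoc]; rfl
  have hT := hp.nonsingularCubic hf h3
  obtain ⟨n, hn⟩ := hT.quadratic_eq_cross b fun x => by
    rw [hb, tangentForm_projAlong hf hp h3, dirDeriv_comm (extendZeroₗ x) (_ + _),
      dirDeriv_comm (extendZeroₗ x) (_ + _)]
    exact hp.third_hessian hf hθ hα (hξ (extendZeroₗ x))
  have hn0 : n = 0 := hT.eq_zero_of_cross_eq hpq fun i => by
    obtain ⟨α, hαq⟩ := (hq i).exists_evalVec_eq hf hθ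
    obtain ⟨c, hc⟩ := (hq i).exists_evalVec_dirVec_eq hf (hq3 i) hθ he hαq p
    have h1 := extendZeroₗ_projAlong h3 (q i)
    rw [hq3, one_smul] at h1
    have h2 : extendZeroₗ (projAlong p (q i)) = q i - p := eq_sub_of_add_eq h1.symm
    have h4 : hessianₗ p θ (q i) (q i) = (2 : ℂ) • (-α • p + c • q i) := by
      rw [hessianₗ_eq_jacobianₗ he, jacobianₗ_apply, hc]
    have h5 : hessianₗ p θ p (q i) = (2 * ξ (q i)) • p := by
      rw [hessianₗ_apply, evalVec_dirVec_self (dirVec_isHomogeneous he (q i)), ← jacobianₗ_apply,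
        hξ, mul_smul]
      norm_num
    have h6 : hessianₗ p θ p p = 0 := by
      rw [hessianₗ_apply, evalVec_dirVec_self (dirVec_isHomogeneous he p),
        evalVec_dirVec_self he, hα, smul_zero, smul_zero]
    refine ⟨2 * c + 2 * ξ (extendZeroₗ (projAlong p (q i))), ?_⟩
    rw [← hn, hb, map_add, map_smul, projAlong_extendZeroₗ]
    have h7 : hessianₗ p θ (extendZeroₗ (projAlong p (q i))) (extendZeroₗ (projAlong p (q i))) =
        (2 * c) • q i + (-2 * α - 4 * ξ (q i)) • p := by
      rw [h2, map_sub, map_sub, LinearMap.sub_apply, LinearMap.sub_apply, h4,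
        hessianₗ_comm (q i) p, h5, h6]
      module
    rw [h7, map_add, map_smul, map_smul, projAlong_self h3, smul_zero, add_zero, ← add_smul]
  refine ⟨ξ, hξ, fun v hv => ?_⟩
  have hv' : extendZeroₗ (projAlong p v) = v := by
    have := extendZeroₗ_projAlong h3 v
    rw [hv, zero_smul, add_zero] at this
    exact this.symm
  have h := hb (projAlong p v)
  rw [hn, hn0, LinearMap.map_zero, LinearMap.zero_apply, hv'] at h
  refine ⟨(hessianₗ p θ v v + (2 * ξ v) • v) 3, ?_⟩
  rw [← eq_smul_of_projAlong h3 h.symm]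
  module

end Hessian

section Position

variable {f : MvPolynomial (Fin 4) ℂ}

lemma indepPair_of_last {p q : Fin 4 → ℂ} (hp : p 3 = 1) (hq : q 3 = 1) (hpq : p ≠ q) :
    IndepPair p q := fun s t h => by
  have h3 := congr_fun h 3
  simp only [Pi.add_apply, Pi.smul_apply, hp, hq, smul_eq_mul, mul_one, Pi.zero_apply] at h3
  have hs : s = -t := eq_neg_of_add_eq_zero_left h3
  rw [hs, neg_smul, neg_add_eq_zero] at h
  by_cases ht : t = 0
  · exact ⟨by rw [hs, ht, neg_zero], ht⟩
  · exact absurd (smul_right_injective _ ht h) hpq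

lemma IndepPair.smul {E : Type*} [AddCommGroup E] [Module ℂ E] {x y : E} (h : IndepPair x y)
    {a b : ℂ} (ha : a ≠ 0) (hb : b ≠ 0) : IndepPair (a • x) (b • y) := fun s t e => by
  rw [smul_smul, smul_smul] at e
  exact ⟨(mul_eq_zero.mp (h _ _ e).1).resolve_right ha,
    (mul_eq_zero.mp (h _ _ e).2).resolve_right hb⟩

/-- Three distinct triple points are linearly independent. -/
lemma TriplePt.linearIndep (hf : f.IsHomogeneous 6) {p q r : Fin 4 → ℂ} (hp : TriplePt f p)
    (hq : TriplePt f q) (hr : TriplePt f r) (hpq : IndepPair p q) (hqr : IndepPair q r)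
    (hpr : IndepPair p r) {s t u : ℂ} (h : s • p + t • q + u • r = 0) :
    s = 0 ∧ t = 0 ∧ u = 0 := by
  by_cases hs : s = 0
  · rw [hs, zero_smul, zero_add] at h
    exact ⟨hs, hqr _ _ h⟩
  by_cases ht : t = 0
  · rw [ht, zero_smul, add_zero] at h
    exact absurd (hpr _ _ h).1 hs
  by_cases hu : u = 0
  · rw [hu, zero_smul, add_zero] at h
    exact absurd (hpq _ _ h).1 hs
  · refine ((hp.smul hf hs).false_of_collinear hf (hq.smul hf ht) (hpq.smul hs ht) ?_).elim
    rw [eq_neg_of_add_eq_zero_left h, ← neg_smul]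
    exact hr.smul hf (neg_ne_zero.mpr hu)

lemma TriplePt.indepPair_projAlong (hf : f.IsHomogeneous 6) {p q r : Fin 4 → ℂ}
    (hp : TriplePt f p) (hq : TriplePt f q) (hr : TriplePt f r) (hp3 : p 3 = 1) (hq3 : q 3 = 1)
    (hr3 : r 3 = 1) (hpq : p ≠ q) (hqr : q ≠ r) (hpr : p ≠ r) :
    IndepPair (projAlong p q) (projAlong p r) := fun s t h => by
  rw [← map_smul, ← map_smul, ← map_add] at h
  have h' := eq_smul_of_projAlong hp3 h
  obtain ⟨-, h1, h2⟩ := hp.linearIndep hf hq hr (indepPair_of_last hp3 hq3 hpq)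
    (indepPair_of_last hq3 hr3 hqr) (indepPair_of_last hp3 hr3 hpr) (s := -(s • q + t • r) 3)
    (t := s) (u := t) (by rw [add_assoc, neg_smul, ← h', neg_add_cancel])
  exact ⟨h1, h2⟩

end Position

section CrossField

open Matrix

variable {f : MvPolynomial (Fin 4) ℂ} {p : Fin 4 → ℂ} {a b : Fin 4 → MvPolynomial (Fin 4) ℂ}

/-- The combination of two vector fields having no component along the last coordinate. -/
def crossField (a b : Fin 4 → MvPolynomial (Fin 4) ℂ) (i : Fin 4) : MvPolynomial (Fin 4) ℂ :=
  b 3 * a i - a 3 * b i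

lemma vfield_smul_add (c : ℂ) (a b : Fin 4 → MvPolynomial (Fin 4) ℂ) (g : MvPolynomial (Fin 4) ℂ) :
    vfield (b + c • a) g = vfield b g + c • vfield a g := by
  simp only [vfield, Finset.smul_sum, ← Finset.sum_add_distrib, Pi.add_apply, Pi.smul_apply,
    add_mul,
    smul_mul_assoc]

lemma evalVec_smul_add (c : ℂ) (x : Fin 4 → ℂ) (a b : Fin 4 → MvPolynomial (Fin 4) ℂ) :
    evalVec x (b + c • a) = evalVec x b + c • evalVec x a := by
  funext i; simp only [evalVec, Pi.add_apply, Pi.smul_apply, map_add, smul_eval, smul_eq_mul]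

lemma crossField_smul_add (c : ℂ) (a b : Fin 4 → MvPolynomial (Fin 4) ℂ) (i : Fin 4) :
    crossField (b + c • a) a i = -crossField a b i := by
  simp only [crossField, Pi.add_apply, Pi.smul_apply, smul_eq_C_mul]; ring

lemma TriplePt.eval_crossField_of_eq_zero (hf : f.IsHomogeneous 6) (hp : TriplePt f p)
    (h3 : p 3 = 1) (ha : vfield a f = 0) (hb : vfield b f = 0)
    (ha' : ∀ i, (a i).IsHomogeneous 3) (hb' : ∀ i, (b i).IsHomogeneous 3)
    (hα : evalVec p a = 0) {q : Fin 10 → Fin 4 → ℂ} (hq : ∀ i, TriplePt f (q i))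
    (hq3 : ∀ i, q i 3 = 1)
    (hpq : ∀ i j, i ≠ j → IndepPair (projAlong p (q i)) (projAlong p (q j)))
    {v : Fin 4 → ℂ} (hv : v 3 = 0) (i : Fin 4) :
    eval p (dirDeriv v (dirDeriv v (crossField a b i))) = 0 := by
  obtain ⟨ξ, hξ, hA⟩ := hp.hessian_eq hf h3 ha ha' hα hq hq3 hpq
  obtain ⟨κ, hκ⟩ := hA v hv
  obtain ⟨β, hβ⟩ := hp.exists_evalVec_eq hf hb
  obtain ⟨c, hc⟩ := hp.exists_evalVec_dirVec_eq hf h3 hb hb' hβ v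
  have e0 : ∀ i, eval p (a i) = 0 := fun i => congr_fun hα i
  have e1 : ∀ i, eval p (dirDeriv v (a i)) = ξ v * p i := fun i => congr_fun (hξ v) i
  have e2 : ∀ i, eval p (dirDeriv v (dirDeriv v (a i))) = -2 * ξ v * v i + κ * p i :=
    fun i => congr_fun hκ i
  have k0 : ∀ i, eval p (b i) = β * p i := fun i => congr_fun hβ i
  have k1 : ∀ i, eval p (dirDeriv v (b i)) = -β * v i + c * p i := fun i => congr_fun hc i
  simp only [crossField, map_sub, dirDeriv_mul, map_add, map_mul, e0, e1, e2, k0, k1, h3, hv]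
  ring

lemma TriplePt.eval_crossField (hf : f.IsHomogeneous 6) (hp : TriplePt f p)
    (h3 : p 3 = 1) (ha : vfield a f = 0) (hb : vfield b f = 0)
    (ha' : ∀ i, (a i).IsHomogeneous 3) (hb' : ∀ i, (b i).IsHomogeneous 3)
    {q : Fin 10 → Fin 4 → ℂ} (hq : ∀ i, TriplePt f (q i))
    (hq3 : ∀ i, q i 3 = 1)
    (hpq : ∀ i j, i ≠ j → IndepPair (projAlong p (q i)) (projAlong p (q j)))
    {v : Fin 4 → ℂ} (hv : v 3 = 0) (i : Fin 4) :
    eval p (dirDeriv v (dirDeriv v (crossField a b i))) = 0 := by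
  obtain ⟨α, hα⟩ := hp.exists_evalVec_eq hf ha
  obtain ⟨β, hβ⟩ := hp.exists_evalVec_eq hf hb
  by_cases h0 : α = 0
  · exact hp.eval_crossField_of_eq_zero hf h3 ha hb ha' hb' (by rw [hα, h0, zero_smul]) hq hq3 hpq
      hv i
  · have h := hp.eval_crossField_of_eq_zero hf h3 (a := b + (-(β / α)) • a) (b := a)
      (by rw [vfield_smul_add, ha, hb, smul_zero, add_zero]) ha
      (fun i => (hb' i).add (by rw [Pi.smul_apply, smul_eq_C_mul]; exact (ha' i).C_mul _)) ha'
      (by rw [evalVec_smul_add, hα, hβ, smul_smul, ← add_smul, neg_mul, div_mul_cancel₀ _ h0,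
        add_neg_cancel, zero_smul]) hq hq3 hpq hv i
    rwa [crossField_smul_add, map_neg, map_neg, map_neg, neg_eq_zero] at h

lemma NonsingularCubic.eq_zero_of_forall_cross
    {T : (Fin 3 → ℂ) →ₗ[ℂ] (Fin 3 → ℂ) →ₗ[ℂ] (Fin 3 → ℂ) →ₗ[ℂ] ℂ} (hT : NonsingularCubic T)
    {n : Fin 3 → ℂ} (h : ∀ x, n ⨯₃ cubicGrad T x = 0) : n = 0 := by
  by_contra hn
  refine hT.false_of_proportional (x := Pi.single 0 1) (y := Pi.single 1 1) (n := n) ?_ ?_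
  · intro s t hst
    have h0 := congr_fun hst 0
    have h1 := congr_fun hst 1
    simp at h0 h1
    exact ⟨h0, h1⟩
  · intro s t u hu
    rw [← dotProduct_cubicGrad]
    exact dotProduct_eq_zero_of_cross hn (h _) hu

lemma TriplePt.eval_eq_zero_of_cross (hf : f.IsHomogeneous 6) (hp : TriplePt f p)
    (h3 : p 3 = 1) {η : Fin 3 → MvPolynomial (Fin 4) ℂ}
    (hη : (fun i : Fin 3 => crossField a b i.castSucc) =
      η ⨯₃ (fun i : Fin 3 => pderiv i.castSucc f))
    (h : ∀ v : Fin 4 → ℂ, v 3 = 0 → ∀ i, eval p (dirDeriv v (dirDeriv v (crossField a b i))) = 0)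
    (i : Fin 3) : eval p (η i) = 0 := by
  have hT := hp.nonsingularCubic hf h3
  suffices hn : (fun i => eval p (η i)) = 0 from congr_fun hn i
  refine hT.eq_zero_of_forall_cross fun x => ?_
  have hg : ∀ j, cubicGrad (tangentForm f p) x j = eval p (dirDeriv (extendZeroₗ x)
      (dirDeriv (extendZeroₗ x) (pderiv j.castSucc f))) := fun j => by
    rw [cubicGrad, tangentForm_apply,
      show extendZeroₗ (Pi.single j 1) = Pi.single j.castSucc 1 from ?_,
      dirDeriv_single]
    funext k
    refine Fin.lastCases ?_ (fun k => ?_) k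
    · rw [show Fin.last 3 = 3 from rfl, extendZeroₗ_last, Pi.single_eq_of_ne]
      exact (Fin.castSucc_lt_last j).ne'
    · rw [extendZeroₗ_castSucc, Pi.single_apply, Pi.single_apply]
      simp only [Fin.castSucc_inj]
  have hg0 : ∀ j : Fin 3, eval p (pderiv j.castSucc f) = 0 := fun j => by
    rw [← dirDeriv_single, hp.first hf]
  have hg1 : ∀ (j : Fin 3) v, eval p (dirDeriv v (pderiv j.castSucc f)) = 0 := fun j v => by
    rw [← dirDeriv_single, hp.second]
  have hW : ∀ i : Fin 3, eval p (dirDeriv (extendZeroₗ x) (dirDeriv (extendZeroₗ x)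
      ((η ⨯₃ (fun i : Fin 3 => pderiv i.castSucc f)) i))) = 0 := fun i => by
    rw [← hη]; exact h _ (extendZeroₗ_last x) _
  rw [cross_apply] at hW
  rw [cross_apply]
  have h0 := hW 0
  have h1 := hW 1
  have h2 := hW 2
  simp only [Matrix.cons_val_zero, Matrix.cons_val_one, Matrix.cons_val_two, Matrix.head_cons,
    Matrix.tail_cons,
    map_sub, dirDeriv_mul, map_add, map_mul, hg0, hg1, ← hg, mul_zero, zero_mul,
      add_zero] at h0 h1 h2
  rw [h0, h1, h2]
  funext i
  fin_cases i <;> rfl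

end CrossField

section Reduction

open Matrix

variable {f : MvPolynomial (Fin 4) ℂ} {a b : Fin 4 → MvPolynomial (Fin 4) ℂ}

lemma eq_zero_of_linear {η : MvPolynomial (Fin 4) ℂ} (hη : η.IsHomogeneous 1) {ι : Type*}
    {p : ι → Fin 4 → ℂ} (hspan : ∀ l : Fin 4 → ℂ, (∀ j, l ⬝ᵥ p j = 0) → l = 0)
    (h : ∀ j, eval (p j) η = 0) : η = 0 := by
  have key : ∀ x : Fin 4 → ℂ, eval x η = (fun i => eval 0 (pderiv i η)) ⬝ᵥ x := fun x => by
    have h1 := hη.eval_dirDeriv_self x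
    have h2 : eval x (dirDeriv x η) = eval 0 (dirDeriv x η) :=
      eval_eq_of_isHomogeneous_zero (hη.dirDeriv x) x 0
    rw [h2, dirDeriv_eq_sum, map_sum, Nat.cast_one, one_mul] at h1
    rw [← h1, dotProduct]
    exact Finset.sum_congr rfl fun i _ => by rw [smul_eval, mul_comm]
  have h0 := hspan _ fun j => (key (p j)).symm.trans (h j)
  refine MvPolynomial.funext fun x => ?_
  rw [key, h0, zero_dotProduct, map_zero]

lemma crossField_dotProduct (ha : vfield a f = 0) (hb : vfield b f = 0) :
    (fun i : Fin 3 => crossField a b i.castSucc) ⬝ᵥ (fun i : Fin 3 => pderiv i.castSucc f) = 0 := by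
  simp only [vfield, Fin.sum_univ_castSucc (n := 3), show Fin.last 3 = 3 from rfl] at ha hb
  have e1 := eq_neg_of_add_eq_zero_left ha
  have e2 := eq_neg_of_add_eq_zero_left hb
  simp only [dotProduct, crossField, sub_mul, mul_assoc, Finset.sum_sub_distrib, ← Finset.mul_sum,
    e1, e2]
  ring

/-- A syzygy of degree less than five without last component vanishes. -/
lemma eq_zero_of_last_eq_zero (hf : f.IsHomogeneous 6)
    (hH : ∀ x : Fin 4 → ℂ, x 3 = 0 → (∀ i : Fin 3, eval x (pderiv i.castSucc f) = 0) → x = 0)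
    {k : ℕ} (hk : k < 5) (ha : vfield a f = 0) (ha' : ∀ i, (a i).IsHomogeneous k) (h3 : a 3 = 0) :
    a = 0 := by
  obtain ⟨n, hn, -, hn0⟩ := exists_homogeneous_cross (e := 5)
    (g := fun i : Fin 3 => pderiv i.castSucc f) (fun i => hf.pderiv) hH (k := k)
    (v := fun i => a i.castSucc) (fun i => ha' _) (by
      rw [vfield, Fin.sum_univ_castSucc (n := 3), show Fin.last 3 = 3 from rfl, h3, zero_mul,
        add_zero] at ha
      exact ha)
  rw [hn0 hk] at hn
  funext i
  refine Fin.lastCases h3 (fun i => ?_) i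
  have := congr_fun hn i
  simpa using this

lemma exists_homogeneous_syzygy_of_degree (hf : f.IsHomogeneous 6)
    {c : Fin 4 → MvPolynomial (Fin 4) ℂ} (hc : vfield c f = 0) (hc0 : c ≠ 0)
    (hdeg : ∀ i, (c i).totalDegree ≤ 2) :
    ∃ θ : Fin 4 → MvPolynomial (Fin 4) ℂ,
      (∀ i, (θ i).IsHomogeneous 2) ∧ vfield θ f = 0 ∧ θ ≠ 0 := by
  obtain ⟨i, hi⟩ := Function.ne_iff.mp hc0
  obtain ⟨s, hs⟩ := MvPolynomial.ne_zero_iff.mp hi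
  have hs2 : s.degree ≤ 2 := by
    refine le_trans ?_ (hdeg i)
    rw [Finsupp.degree_apply]
    exact le_totalDegree (mem_support_iff.mpr hs)
  refine ⟨fun j => X 3 ^ (2 - s.degree) * homogeneousComponent s.degree (c j), fun j => ?_, ?_, ?_⟩
  · have := ((isHomogeneous_X ℂ (3 : Fin 4)).pow (2 - s.degree)).mul
      (homogeneousComponent_isHomogeneous s.degree (c j))
    rwa [one_mul, Nat.sub_add_cancel hs2] at this
  · have h := congrArg (homogeneousComponent (s.degree + 5)) hc
    rw [vfield, map_sum, map_zero] at h
    rw [vfield]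
    simp only [mul_assoc, ← Finset.mul_sum]
    rw [← mul_zero (X 3 ^ (2 - s.degree)), ← h]
    congr 1
    refine Finset.sum_congr rfl fun j _ => ?_
    rw [homogeneousComponent_mul_of_isHomogeneous_add hf.pderiv]
  · intro h
    have h1 : X 3 ^ (2 - s.degree) * homogeneousComponent s.degree (c i) = 0 := congr_fun h i
    rw [mul_eq_zero, or_iff_right (pow_ne_zero _ (X_ne_zero _))] at h1
    have h2 := congrArg (coeff s) h1
    rw [coeff_homogeneousComponent, if_pos rfl, coeff_zero] at h2
    exact hs h2

/-- Two proportional independent cubic syzygies come from a syzygy of lower degree. -/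
lemma exists_quadratic_syzygy (hf : f.IsHomogeneous 6)
    (hH : ∀ x : Fin 4 → ℂ, x 3 = 0 → (∀ i : Fin 3, eval x (pderiv i.castSucc f) = 0) → x = 0)
    (ha : vfield a f = 0) (hb : vfield b f = 0)
    (ha' : ∀ i, (a i).IsHomogeneous 3) (hb' : ∀ i, (b i).IsHomogeneous 3)
    (hab : IndepPair a b) (hW : ∀ i, crossField a b i = 0) :
    ∃ θ : Fin 4 → MvPolynomial (Fin 4) ℂ,
      (∀ i, (θ i).IsHomogeneous 2) ∧ vfield θ f = 0 ∧ θ ≠ 0 := by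
  have ha0 : a 3 ≠ 0 := fun h => by
    have := eq_zero_of_last_eq_zero hf hH (by norm_num) ha ha' h
    exact one_ne_zero (hab 1 0 (by rw [this, smul_zero, zero_smul, add_zero])).1
  have hb0 : b 3 ≠ 0 := fun h => by
    have := eq_zero_of_last_eq_zero hf hH (by norm_num) hb hb' h
    exact one_ne_zero (hab 0 1 (by rw [this, smul_zero, zero_smul, add_zero])).2
  obtain ⟨α, β, d, hrel, hα, hβ⟩ := UniqueFactorizationMonoid.exists_reduced_factors _ ha0 (b 3)
  have hd0 : d ≠ 0 := fun h => ha0 (by rw [← hα, h, zero_mul])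
  have hα0 : α ≠ 0 := fun h => ha0 (by rw [← hα, h, mul_zero])
  have hβ0 : β ≠ 0 := fun h => hb0 (by rw [← hβ, h, mul_zero])
  have hab' : ∀ i, β * a i = α * b i := fun i => by
    have := hW i
    rw [crossField, ← hα, ← hβ, mul_assoc, mul_assoc, ← mul_sub, mul_eq_zero,
      or_iff_right hd0] at this
    exact sub_eq_zero.mp this
  have hdvd : ∀ i, α ∣ a i := fun i =>
    hrel.dvd_of_dvd_mul_left (Dvd.intro _ (hab' i).symm)
  choose c hc using hdvd
  have hcb : ∀ i, b i = β * c i := fun i => by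
    refine mul_left_cancel₀ hα0 ?_
    rw [← hab', hc]; ring
  have hα1 : α.totalDegree ≠ 0 := fun h => by
    have e1 := (ha' 3).totalDegree ha0
    have e2 := (hb' 3).totalDegree hb0
    rw [← hα, totalDegree_mul_of_isDomain hd0 hα0, h] at e1
    rw [← hβ, totalDegree_mul_of_isDomain hd0 hβ0] at e2
    have hβ1 : β.totalDegree = 0 := by omega
    rw [totalDegree_eq_zero_iff_eq_C] at h hβ1
    have := (hab (β.coeff 0) (-α.coeff 0) (funext fun i => by
      simp only [Pi.add_apply, Pi.smul_apply, smul_eq_C_mul, map_neg, ← h, ← hβ1, Pi.zero_apply]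
      rw [hab']; ring)).1
    rw [this, map_zero] at hβ1
    exact hβ0 hβ1
  refine exists_homogeneous_syzygy_of_degree hf (c := c) ?_ ?_ fun i => ?_
  · have : α * vfield c f = vfield a f := by
      rw [vfield, vfield, Finset.mul_sum]
      exact Finset.sum_congr rfl fun i _ => by rw [hc i, mul_assoc]
    rw [ha, mul_eq_zero] at this
    exact this.resolve_left hα0
  · intro h
    exact ha0 (by rw [hc, h, Pi.zero_apply, mul_zero])
  · by_cases hci : c i = 0
    · rw [hci, totalDegree_zero]; exact Nat.zero_le _
    · have e1 := (ha' i).totalDegree (by rw [hc]; exact mul_ne_zero hα0 hci)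
      rw [hc, totalDegree_mul_of_isDomain hα0 hci] at e1
      omega

/-- Eleven triple points not lying on a plane force a nonzero quadratic syzygy. -/
lemma exists_quadratic_syzygy_of_eleven (hf : f.IsHomogeneous 6)
    (hH : ∀ x : Fin 4 → ℂ, x 3 = 0 → (∀ i : Fin 3, eval x (pderiv i.castSucc f) = 0) → x = 0)
    {p : Fin 11 → Fin 4 → ℂ} (hp : Function.Injective p) (hp3 : ∀ j, p j 3 = 1)
    (htp : ∀ j, TriplePt f (p j)) (hspan : ∀ l : Fin 4 → ℂ, (∀ j, l ⬝ᵥ p j = 0) → l = 0)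
    (ha : vfield a f = 0) (hb : vfield b f = 0)
    (ha' : ∀ i, (a i).IsHomogeneous 3) (hb' : ∀ i, (b i).IsHomogeneous 3) (hab : IndepPair a b) :
    ∃ θ : Fin 4 → MvPolynomial (Fin 4) ℂ,
      (∀ i, (θ i).IsHomogeneous 2) ∧ vfield θ f = 0 ∧ θ ≠ 0 := by
  obtain ⟨η, hη, hη1, -⟩ := exists_homogeneous_cross (e := 5)
    (g := fun i : Fin 3 => pderiv i.castSucc f) (fun i => hf.pderiv) hH (k := 6)
    (v := fun i => crossField a b i.castSucc)
    (fun i => ((hb' _).mul (ha' _)).sub ((ha' _).mul (hb' _))) (crossField_dotProduct ha hb)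
  have hη0 : η = 0 := funext fun i => eq_zero_of_linear (hη1 i) hspan fun j => by
    refine (htp j).eval_eq_zero_of_cross hf (hp3 j) hη (fun v hv k => ?_) i
    refine (htp j).eval_crossField hf (hp3 j) ha hb ha' hb' (q := fun k => p (j.succAbove k))
      (fun k => htp _) (fun k => hp3 _) (fun k l hkl => ?_) hv k
    exact (htp j).indepPair_projAlong hf (htp _) (htp _) (hp3 _) (hp3 _) (hp3 _)
      (hp.ne (Fin.ne_succAbove j k)) (hp.ne fun h => hkl (Fin.succAbove_right_injective h))
      (hp.ne (Fin.ne_succAbove j l))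
  refine exists_quadratic_syzygy hf hH ha hb ha' hb' hab fun i => ?_
  refine Fin.lastCases ?_ (fun i => ?_) i
  · rw [crossField, show Fin.last 3 = 3 from rfl, mul_comm, sub_self]
  · have := congr_fun hη i
    rw [hη0] at this
    simpa using this

end Reduction

section PlaneSyzygy

open Matrix

variable {f : MvPolynomial (Fin 4) ℂ} {θ : Fin 4 → MvPolynomial (Fin 4) ℂ}

lemma eval_cubic_expand {g : MvPolynomial (Fin 4) ℂ} (hg : g.IsHomogeneous 3)
    (p₁ p₂ p₃ : Fin 4 → ℂ) (y₁ y₂ y₃ : ℂ) :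
    eval (y₁ • p₁ + y₂ • p₂ + y₃ • p₃) g = y₁ ^ 3 * eval p₁ g + y₂ ^ 3 * eval p₂ g +
      y₃ ^ 3 * eval p₃ g + y₁ ^ 2 * y₂ * eval p₁ (dirDeriv p₂ g) +
      y₁ ^ 2 * y₃ * eval p₁ (dirDeriv p₃ g) + y₂ ^ 2 * y₁ * eval p₂ (dirDeriv p₁ g) +
      y₂ ^ 2 * y₃ * eval p₂ (dirDeriv p₃ g) + y₃ ^ 2 * y₁ * eval p₃ (dirDeriv p₁ g) +
      y₃ ^ 2 * y₂ * eval p₃ (dirDeriv p₂ g) +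
      y₁ * y₂ * y₃ * eval 0 (dirDeriv p₁ (dirDeriv p₂ (dirDeriv p₃ g))) := by
  have key2 : ∀ {g : MvPolynomial (Fin 4) ℂ}, g.IsHomogeneous 2 → ∀ x : Fin 4 → ℂ,
      2 * eval x g = eval 0 (dirDeriv x (dirDeriv x g)) := fun {g} hg x => by
    rw [eval_eq_of_isHomogeneous_zero ((hg.dirDeriv x).dirDeriv x) 0 x,
      (hg.dirDeriv x).eval_dirDeriv_self, hg.eval_dirDeriv_self]
    norm_num
  have h := eval_dirDeriv_three hg (y₁ • p₁ + y₂ • p₂ + y₃ • p₃)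
  have a1 := eval_dirDeriv_three hg p₁
  have a2 := eval_dirDeriv_three hg p₂
  have a3 := eval_dirDeriv_three hg p₃
  have b12 := key2 (hg.dirDeriv p₂) p₁
  have b13 := key2 (hg.dirDeriv p₃) p₁
  have b21 := key2 (hg.dirDeriv p₁) p₂
  have b23 := key2 (hg.dirDeriv p₃) p₂
  have b31 := key2 (hg.dirDeriv p₁) p₃
  have b32 := key2 (hg.dirDeriv p₂) p₃
  have c21 : ∀ g, dirDeriv p₂ (dirDeriv p₁ g) = dirDeriv p₁ (dirDeriv p₂ g) := dirDeriv_comm _ _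
  have c31 : ∀ g, dirDeriv p₃ (dirDeriv p₁ g) = dirDeriv p₁ (dirDeriv p₃ g) := dirDeriv_comm _ _
  have c32 : ∀ g, dirDeriv p₃ (dirDeriv p₂ g) = dirDeriv p₂ (dirDeriv p₃ g) := dirDeriv_comm _ _
  simp only [dirDeriv_add, dirDeriv_smul, map_add, Derivation.map_smul, smul_eval, c21, c31, c32]
    at h a1 a2 a3 b12 b13 b21 b23 b31 b32
  linear_combination -h / 6 + y₁ ^ 3 / 6 * a1 + y₂ ^ 3 / 6 * a2 + y₃ ^ 3 / 6 * a3 -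
    y₁ ^ 2 * y₂ / 2 * b12 - y₁ ^ 2 * y₃ / 2 * b13 - y₂ ^ 2 * y₁ / 2 * b21 - y₂ ^ 2 * y₃ / 2 * b23 -
    y₃ ^ 2 * y₁ / 2 * b31 - y₃ ^ 2 * y₂ / 2 * b32

lemma eval_quadratic_expand {g : MvPolynomial (Fin 4) ℂ} (hg : g.IsHomogeneous 3)
    (p₁ p₂ p₃ : Fin 4 → ℂ) (y₁ y₂ y₃ : ℂ) :
    eval (y₁ • p₁ + y₂ • p₂ + y₃ • p₃) (dirDeriv p₁ g) = 3 * y₁ ^ 2 * eval p₁ g +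
      2 * y₁ * y₂ * eval p₁ (dirDeriv p₂ g) + 2 * y₁ * y₃ * eval p₁ (dirDeriv p₃ g) +
      y₂ ^ 2 * eval p₂ (dirDeriv p₁ g) + y₃ ^ 2 * eval p₃ (dirDeriv p₁ g) +
      y₂ * y₃ * eval 0 (dirDeriv p₁ (dirDeriv p₂ (dirDeriv p₃ g))) := by
  have key2 : ∀ {g : MvPolynomial (Fin 4) ℂ}, g.IsHomogeneous 2 → ∀ x : Fin 4 → ℂ,
      2 * eval x g = eval 0 (dirDeriv x (dirDeriv x g)) := fun {g} hg x => by
    rw [eval_eq_of_isHomogeneous_zero ((hg.dirDeriv x).dirDeriv x) 0 x,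
      (hg.dirDeriv x).eval_dirDeriv_self, hg.eval_dirDeriv_self]
    norm_num
  have h := key2 (hg.dirDeriv p₁) (y₁ • p₁ + y₂ • p₂ + y₃ • p₃)
  have a1 := eval_dirDeriv_three hg p₁
  have b12 := key2 (hg.dirDeriv p₂) p₁
  have b13 := key2 (hg.dirDeriv p₃) p₁
  have b21 := key2 (hg.dirDeriv p₁) p₂
  have b31 := key2 (hg.dirDeriv p₁) p₃
  have c21 : ∀ g, dirDeriv p₂ (dirDeriv p₁ g) = dirDeriv p₁ (dirDeriv p₂ g) := dirDeriv_comm _ _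
  have c31 : ∀ g, dirDeriv p₃ (dirDeriv p₁ g) = dirDeriv p₁ (dirDeriv p₃ g) := dirDeriv_comm _ _
  have c32 : ∀ g, dirDeriv p₃ (dirDeriv p₂ g) = dirDeriv p₂ (dirDeriv p₃ g) := dirDeriv_comm _ _
  simp only [dirDeriv_add, dirDeriv_smul, map_add, Derivation.map_smul, smul_eval, c21, c31, c32]
    at h a1 b12 b13 b21 b31
  linear_combination h / 2 + y₁ ^ 2 / 2 * a1 -
    y₁ * y₂ * b12 - y₁ * y₃ * b13 - y₂ ^ 2 / 2 * b21 - y₃ ^ 2 / 2 * b31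

lemma evalVec_cubic_expand (hθ : ∀ i, (θ i).IsHomogeneous 3)
    (p₁ p₂ p₃ : Fin 4 → ℂ) (y₁ y₂ y₃ : ℂ) :
    evalVec (y₁ • p₁ + y₂ • p₂ + y₃ • p₃) θ = y₁ ^ 3 • evalVec p₁ θ + y₂ ^ 3 • evalVec p₂ θ +
      y₃ ^ 3 • evalVec p₃ θ + (y₁ ^ 2 * y₂) • evalVec p₁ (dirVec p₂ θ) +
      (y₁ ^ 2 * y₃) • evalVec p₁ (dirVec p₃ θ) + (y₂ ^ 2 * y₁) • evalVec p₂ (dirVec p₁ θ) +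
      (y₂ ^ 2 * y₃) • evalVec p₂ (dirVec p₃ θ) + (y₃ ^ 2 * y₁) • evalVec p₃ (dirVec p₁ θ) +
      (y₃ ^ 2 * y₂) • evalVec p₃ (dirVec p₂ θ) +
      (y₁ * y₂ * y₃) • evalVec 0 (dirVec p₁ (dirVec p₂ (dirVec p₃ θ))) :=
  funext fun i => by
    have := eval_cubic_expand (hθ i) p₁ p₂ p₃ y₁ y₂ y₃
    simpa only [evalVec, dirVec, Pi.add_apply, Pi.smul_apply, smul_eq_mul] using this

lemma evalVec_quadratic_expand (hθ : ∀ i, (θ i).IsHomogeneous 3)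
    (p₁ p₂ p₃ : Fin 4 → ℂ) (y₁ y₂ y₃ : ℂ) :
    evalVec (y₁ • p₁ + y₂ • p₂ + y₃ • p₃) (dirVec p₁ θ) = (3 * y₁ ^ 2) • evalVec p₁ θ +
      (2 * y₁ * y₂) • evalVec p₁ (dirVec p₂ θ) + (2 * y₁ * y₃) • evalVec p₁ (dirVec p₃ θ) +
      y₂ ^ 2 • evalVec p₂ (dirVec p₁ θ) + y₃ ^ 2 • evalVec p₃ (dirVec p₁ θ) +
      (y₂ * y₃) • evalVec 0 (dirVec p₁ (dirVec p₂ (dirVec p₃ θ))) :=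
  funext fun i => by
    have := eval_quadratic_expand (hθ i) p₁ p₂ p₃ y₁ y₂ y₃
    simpa only [evalVec, dirVec, Pi.add_apply, Pi.smul_apply, smul_eq_mul] using this

/-- The shape of a cubic vector field on the span of three points at which it is tangent to the
lines through these points. -/
structure PlaneExpansion (θ : Fin 4 → MvPolynomial (Fin 4) ℂ) (p : Fin 3 → Fin 4 → ℂ)
    (α φ : Fin 3 → ℂ) (ξ : Fin 3 → Fin 3 → ℂ) : Prop where
  value : ∀ i, evalVec (p i) θ = α i • p i
  deriv : ∀ i j, evalVec (p i) (dirVec (p j) θ) = -α i • p j + ξ i j • p i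
  mixed : evalVec 0 (dirVec (p 0) (dirVec (p 1) (dirVec (p 2) θ))) =
    φ 0 • p 0 + φ 1 • p 1 + φ 2 • p 2
  indep : ∀ s t u : ℂ, s • p 0 + t • p 1 + u • p 2 = 0 → s = 0 ∧ t = 0 ∧ u = 0

variable {p : Fin 3 → Fin 4 → ℂ} {α φ : Fin 3 → ℂ} {ξ : Fin 3 → Fin 3 → ℂ}

lemma PlaneExpansion.rotate (h : PlaneExpansion θ p α φ ξ) :
    PlaneExpansion θ (fun i => p (i + 1)) (fun i => α (i + 1)) (fun i => φ (i + 1))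
      (fun i j => ξ (i + 1) (j + 1)) where
  value i := h.value _
  deriv i j := h.deriv _ _
  mixed := by
    have := h.mixed
    simp only [show (2 : Fin 3) + 1 = 0 from rfl, show (1 : Fin 3) + 1 = 2 from rfl, zero_add]
    rw [dirVec_comm (p 2) (p 0), dirVec_comm (p 1) (p 0), this]
    abel
  indep s t u e := by
    simp only [show (2 : Fin 3) + 1 = 0 from rfl, show (1 : Fin 3) + 1 = 2 from rfl, zero_add] at e
    obtain ⟨h1, h2, h3⟩ := h.indep u s t (by rw [← e]; abel)
    exact ⟨h2, h3, h1⟩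

lemma PlaneExpansion.relations (h : PlaneExpansion θ p α φ ξ) (hθ : ∀ i, (θ i).IsHomogeneous 3)
    {q : Fin 4 → ℂ} {y : Fin 3 → ℂ} {a c : ℂ} (hq : q = y 0 • p 0 + y 1 • p 1 + y 2 • p 2)
    (h1 : y 1 ≠ 0) (h2 : y 2 ≠ 0) (hqa : evalVec q θ = a • q)
    (hqc : evalVec q (dirVec (p 0) θ) = -a • p 0 + c • q) :
    (ξ 1 0 - φ 2) * y 1 + (φ 1 - ξ 2 0) * y 2 = 0 ∧
      2 * α 1 * y 1 ^ 2 + (ξ 1 2 - ξ 2 1) * (y 1 * y 2) + -2 * α 2 * y 2 ^ 2 = 0 := by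
  rw [hq, evalVec_cubic_expand hθ, h.value, h.value, h.value, h.deriv, h.deriv, h.deriv, h.deriv,
    h.deriv, h.deriv, h.mixed] at hqa
  rw [hq, evalVec_quadratic_expand hθ, h.value, h.deriv, h.deriv, h.deriv, h.deriv, h.mixed] at hqc
  obtain ⟨-, a1, a2⟩ := h.indep
    (y 0 * (α 0 * y 0 ^ 2 + ξ 0 1 * y 0 * y 1 + ξ 0 2 * y 0 * y 2 - α 1 * y 1 ^ 2 - α 2 * y 2 ^ 2 +
      φ 0 * y 1 * y 2 - a))
    (y 1 * (α 1 * y 1 ^ 2 + ξ 1 0 * y 1 * y 0 + ξ 1 2 * y 1 * y 2 - α 0 * y 0 ^ 2 - α 2 * y 2 ^ 2 +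
      φ 1 * y 0 * y 2 - a))
    (y 2 * (α 2 * y 2 ^ 2 + ξ 2 0 * y 2 * y 0 + ξ 2 1 * y 2 * y 1 - α 0 * y 0 ^ 2 - α 1 * y 1 ^ 2 +
      φ 2 * y 0 * y 1 - a)) (by rw [← sub_eq_zero] at hqa; rw [← hqa]; module)
  obtain ⟨-, d1, d2⟩ := h.indep
    (3 * y 0 ^ 2 * α 0 + 2 * y 0 * y 1 * ξ 0 1 + 2 * y 0 * y 2 * ξ 0 2 - α 1 * y 1 ^ 2 -
      α 2 * y 2 ^ 2 + φ 0 * y 1 * y 2 + a - c * y 0)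
    (y 1 * (-2 * y 0 * α 0 + ξ 1 0 * y 1 + φ 1 * y 2 - c))
    (y 2 * (-2 * y 0 * α 0 + ξ 2 0 * y 2 + φ 2 * y 1 - c))
    (by rw [← sub_eq_zero] at hqc; rw [← hqc]; module)
  replace a1 := (mul_eq_zero.mp a1).resolve_left h1
  replace a2 := (mul_eq_zero.mp a2).resolve_left h2
  replace d1 := (mul_eq_zero.mp d1).resolve_left h1
  replace d2 := (mul_eq_zero.mp d2).resolve_left h2
  have e : (ξ 1 0 - φ 2) * y 1 + (φ 1 - ξ 2 0) * y 2 = 0 := by linear_combination d1 - d2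
  exact ⟨e, by linear_combination a1 - a2 - y 0 * e⟩

lemma eq_zero_of_two_zeros {a b s t s' t' : ℂ} (h : a * s + b * t = 0) (h' : a * s' + b * t' = 0)
    (hne : s * t' - s' * t ≠ 0) : a = 0 ∧ b = 0 := by
  constructor
  · refine (mul_eq_zero.mp ?_).resolve_right hne
    linear_combination t' * h - t * h'
  · refine (mul_eq_zero.mp ?_).resolve_right hne
    linear_combination s * h' - s' * h

lemma eq_zero_of_three_zeros {a b c : ℂ} {s t : Fin 3 → ℂ}
    (h : ∀ i, a * s i ^ 2 + b * (s i * t i) + c * t i ^ 2 = 0) (h01 : s 0 * t 1 - s 1 * t 0 ≠ 0)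
    (h02 : s 0 * t 2 - s 2 * t 0 ≠ 0) (h12 : s 1 * t 2 - s 2 * t 1 ≠ 0) :
    a = 0 ∧ b = 0 ∧ c = 0 := by
  have hne := mul_ne_zero (mul_ne_zero h01 h02) h12
  have e0 := h 0
  have e1 := h 1
  have e2 := h 2
  refine ⟨?_, ?_, ?_⟩ <;> refine (mul_eq_zero.mp ?_).resolve_right hne
  · linear_combination (t 1 * t 2 * (s 1 * t 2 - s 2 * t 1)) * e0 -
      (t 0 * t 2 * (s 0 * t 2 - s 2 * t 0)) * e1 + (t 0 * t 1 * (s 0 * t 1 - s 1 * t 0)) * e2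
  · linear_combination -((s 1 * t 2 + s 2 * t 1) * (s 1 * t 2 - s 2 * t 1)) * e0 +
      ((s 0 * t 2 + s 2 * t 0) * (s 0 * t 2 - s 2 * t 0)) * e1 -
      ((s 0 * t 1 + s 1 * t 0) * (s 0 * t 1 - s 1 * t 0)) * e2
  · linear_combination (s 1 * s 2 * (s 1 * t 2 - s 2 * t 1)) * e0 -
      (s 0 * s 2 * (s 0 * t 2 - s 2 * t 0)) * e1 + (s 0 * s 1 * (s 0 * t 1 - s 1 * t 0)) * e2

lemma PlaneExpansion.coeff_eq (h : PlaneExpansion θ p α φ ξ) (hθ : ∀ i, (θ i).IsHomogeneous 3)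
    {q : Fin 3 → Fin 4 → ℂ} {y : Fin 3 → Fin 3 → ℂ} {a : Fin 3 → ℂ}
    (hq : ∀ m, q m = y m 0 • p 0 + y m 1 • p 1 + y m 2 • p 2) (hy : ∀ m k, y m k ≠ 0)
    (hyy : ∀ m n, m ≠ n → y m 1 * y n 2 - y n 1 * y m 2 ≠ 0)
    (hqa : ∀ m, evalVec (q m) θ = a m • q m)
    (hqc : ∀ m, ∃ c : ℂ, evalVec (q m) (dirVec (p 0) θ) = -a m • p 0 + c • q m) :
    α 1 = 0 ∧ α 2 = 0 ∧ ξ 1 0 = φ 2 ∧ ξ 2 0 = φ 1 := by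
  choose c hc using hqc
  have hr := fun m => h.relations hθ (hq m) (hy m 1) (hy m 2) (hqa m) (hc m)
  obtain ⟨e1, e2⟩ := eq_zero_of_two_zeros (hr 0).1 (hr 1).1 (hyy 0 1 (by decide))
  obtain ⟨e3, -, e4⟩ := eq_zero_of_three_zeros (fun m => (hr m).2) (hyy 0 1 (by decide))
    (hyy 0 2 (by decide)) (hyy 1 2 (by decide))
  refine ⟨?_, ?_, sub_eq_zero.mp e1, (sub_eq_zero.mp e2).symm⟩
  · simpa using e3
  · simpa using e4

/-- A cubic vector field tangent to sufficiently many lines in a plane is proportional to the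
radial field along this plane. -/
lemma PlaneExpansion.evalVec_eq (h : PlaneExpansion θ p α φ ξ) (hθ : ∀ i, (θ i).IsHomogeneous 3)
    {q : Fin 3 → Fin 4 → ℂ} {y : Fin 3 → Fin 3 → ℂ} {a : Fin 3 → ℂ}
    (hq : ∀ m, q m = y m 0 • p 0 + y m 1 • p 1 + y m 2 • p 2) (hy : ∀ m k, y m k ≠ 0)
    (hyy : ∀ m n, m ≠ n → ∀ k l, k ≠ l → y m k * y n l - y n k * y m l ≠ 0)
    (hqa : ∀ m, evalVec (q m) θ = a m • q m)
    (hqc : ∀ m k, ∃ c : ℂ, evalVec (q m) (dirVec (p k) θ) = -a m • p k + c • q m) (z : Fin 3 → ℂ) :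
    evalVec (z 0 • p 0 + z 1 • p 1 + z 2 • p 2) θ =
      (φ 2 * z 0 * z 1 + φ 1 * z 0 * z 2 + φ 0 * z 1 * z 2) •
        (z 0 • p 0 + z 1 • p 1 + z 2 • p 2) := by
  have e10 : (1 : Fin 3) + 1 = 2 := rfl
  have e20 : (2 : Fin 3) + 1 = 0 := rfl
  obtain ⟨a1, a2, b1, b2⟩ := h.coeff_eq hθ hq hy (fun m n hmn => hyy m n hmn 1 2 (by decide)) hqa
    fun m => hqc m 0
  obtain ⟨-, a0, b3, b4⟩ := h.rotate.coeff_eq hθ (y := fun m k => y m (k + 1))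
    (fun m => by rw [hq]; simp only [zero_add, e10, e20]; abel) (fun m k => hy m _)
    (fun m n hmn => hyy m n hmn 2 0 (by decide)) hqa fun m => hqc m 1
  obtain ⟨-, -, b5, b6⟩ := h.rotate.rotate.coeff_eq hθ (y := fun m k => y m (k + 1 + 1))
    (fun m => by rw [hq]; simp only [zero_add, e10, e20]; abel) (fun m k => hy m _)
    (fun m n hmn => hyy m n hmn (1 + 1 + 1) (2 + 1 + 1) (by decide)) hqa fun m => hqc m 2
  simp only [zero_add, e10, e20] at a0 b3 b4 b5 b6
  rw [evalVec_cubic_expand hθ, h.value, h.value, h.value, h.deriv, h.deriv, h.deriv, h.deriv,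
    h.deriv, h.deriv, h.mixed, a0, a1, a2, b1, b2, b3, b4, b5, b6]
  module

end PlaneSyzygy

section LinearForm

open Matrix

/-- The linear form with the given coefficients. -/
def linForm (l : Fin 4 → ℂ) : MvPolynomial (Fin 4) ℂ := ∑ i, C (l i) * X i

lemma eval_linForm (l x : Fin 4 → ℂ) : eval x (linForm l) = l ⬝ᵥ x := by
  simp [linForm, dotProduct]

lemma linForm_isHomogeneous (l : Fin 4 → ℂ) : (linForm l).IsHomogeneous 1 :=
  IsHomogeneous.sum _ _ _ fun i _ => (isHomogeneous_X ℂ i).C_mul _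

lemma dirDeriv_linForm (u l : Fin 4 → ℂ) : dirDeriv u (linForm l) = C (l ⬝ᵥ u) := by
  rw [linForm, map_sum, dotProduct, map_sum]
  refine Finset.sum_congr rfl fun i _ => ?_
  rw [dirDeriv_mul, dirDeriv_C, dirDeriv_X, mul_zero, add_zero, C_mul]

lemma linForm_ne_zero {l : Fin 4 → ℂ} (hl : l ≠ 0) : linForm l ≠ 0 := fun h => by
  obtain ⟨i, hi⟩ := Function.ne_iff.mp hl
  have := eval_linForm l (Pi.single i 1)
  rw [h, map_zero, dotProduct_single, mul_one] at this
  exact hi this.symm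

lemma dotProduct_sub_smul_single {l : Fin 4 → ℂ} {k : Fin 4} (hk : l k ≠ 0) (x : Fin 4 → ℂ) :
    l ⬝ᵥ (x - ((l k)⁻¹ * (l ⬝ᵥ x)) • Pi.single k 1) = 0 := by
  rw [dotProduct_sub, dotProduct_smul, dotProduct_single, mul_one, smul_eq_mul]
  field_simp
  ring

/-- A polynomial that vanishes on a plane, after multiplication by a power of a coordinate which
does not vanish on it, is divisible by the equation of the plane. -/
lemma linForm_dvd_of_forall {l : Fin 4 → ℂ} (hl : l ≠ 0) {p : Fin 4 → ℂ} (hp3 : p 3 = 1)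
    (hp : l ⬝ᵥ p = 0) (m : ℕ) {q : MvPolynomial (Fin 4) ℂ}
    (h : ∀ x, l ⬝ᵥ x = 0 → eval x (X 3 ^ m * q) = 0) : linForm l ∣ q := by
  obtain ⟨k, hk⟩ := Function.ne_iff.mp hl
  let π : Fin 4 → MvPolynomial (Fin 4) ℂ :=
    fun i => X i - C ((l k)⁻¹ * (Pi.single k 1 : Fin 4 → ℂ) i) * linForm l
  have hπ : ∀ x, (fun i => eval x (π i)) = x - ((l k)⁻¹ * (l ⬝ᵥ x)) • Pi.single k 1 := fun x => by
    funext i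
    simp only [π, map_sub, map_mul, eval_X, eval_C, eval_linForm, Pi.sub_apply, Pi.smul_apply,
      smul_eq_mul]
    ring
  have h0 : aeval π (X 3 ^ m * q) = 0 := MvPolynomial.funext fun x => by
    rw [eval_aeval_eq, hπ, h _ (dotProduct_sub_smul_single hk x), map_zero]
  have h1 : aeval π q = 0 := by
    rw [map_mul, map_pow, aeval_X, mul_eq_zero] at h0
    refine h0.resolve_left (pow_ne_zero _ fun h3 => ?_)
    have := congr_fun (hπ p) 3
    rw [h3, map_zero, hp, mul_zero, zero_smul, sub_zero, hp3] at this
    exact zero_ne_one this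
  rw [← Ideal.mem_span_singleton, ← Ideal.Quotient.eq_zero_iff_mem]
  have e : (Ideal.Quotient.mkₐ ℂ (Ideal.span {linForm l})).comp (aeval π) =
      Ideal.Quotient.mkₐ ℂ (Ideal.span {linForm l}) := algHom_ext fun i => by
    rw [AlgHom.comp_apply, aeval_X, ← sub_eq_zero, ← map_sub, Ideal.Quotient.mkₐ_eq_mk,
      Ideal.Quotient.eq_zero_iff_mem, Ideal.mem_span_singleton]
    exact Dvd.intro_left (-C ((l k)⁻¹ * (Pi.single k 1 : Fin 4 → ℂ) i)) (by simp only [π]; ring)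
  have := AlgHom.congr_fun e q
  rw [AlgHom.comp_apply, h1, map_zero] at this
  exact this.symm

lemma exists_eq_of_dotProduct {l : Fin 4 → ℂ} (hl : l ≠ 0) {p : Fin 3 → Fin 4 → ℂ}
    (hp : ∀ k, l ⬝ᵥ p k = 0)
    (hind : ∀ s t u : ℂ, s • p 0 + t • p 1 + u • p 2 = 0 → s = 0 ∧ t = 0 ∧ u = 0)
    {x : Fin 4 → ℂ} (hx : l ⬝ᵥ x = 0) :
    ∃ y : Fin 3 → ℂ, x = y 0 • p 0 + y 1 • p 1 + y 2 • p 2 := by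
  have h1 : (Matrix.of ![p 0, p 1, p 2, x]) *ᵥ l = 0 := by
    funext i
    rw [mulVec, dotProduct_comm]
    fin_cases i
    · exact hp 0
    · exact hp 1
    · exact hp 2
    · exact hx
  obtain ⟨z, hz, hz0⟩ := Matrix.exists_vecMul_eq_zero_iff.mpr
    (Matrix.exists_mulVec_eq_zero_iff.mp ⟨l, hl, h1⟩)
  have hz1 : z 0 • p 0 + z 1 • p 1 + z 2 • p 2 + z 3 • x = 0 := by
    rw [← hz0]
    funext i
    simp [vecMul, dotProduct, Fin.sum_univ_four]
  have hz3 : z 3 ≠ 0 := fun h3 => hz <| by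
    rw [h3, zero_smul, add_zero] at hz1
    obtain ⟨a, b, c⟩ := hind _ _ _ hz1
    funext i
    fin_cases i
    · exact a
    · exact b
    · exact c
    · exact h3
  refine ⟨fun i => -(z 3)⁻¹ * z i.castSucc, ?_⟩
  have : x = -(z 3)⁻¹ • (z 0 • p 0 + z 1 • p 1 + z 2 • p 2) := by
    rw [eq_neg_of_add_eq_zero_left hz1, smul_neg, neg_smul, neg_neg, smul_smul,
      inv_mul_cancel₀ hz3, one_smul]
  conv_lhs => rw [this]
  simp only [show (0 : Fin 3).castSucc = (0 : Fin 4) from rfl,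
    show (1 : Fin 3).castSucc = (1 : Fin 4) from rfl,
    show (2 : Fin 3).castSucc = (2 : Fin 4) from rfl]
  module

end LinearForm

section Plane

open Matrix

variable {f : MvPolynomial (Fin 4) ℂ} {θ : Fin 4 → MvPolynomial (Fin 4) ℂ}

/-- A surface with a triple point does not contain a plane through this point. -/
lemma TriplePt.not_linForm_dvd (hf : f.IsHomogeneous 6) {p q r : Fin 4 → ℂ} (hp : TriplePt f p)
    (hp3 : p 3 = 1) {l : Fin 4 → ℂ} (hlp : l ⬝ᵥ p = 0) (hlq : l ⬝ᵥ q = 0) (hlr : l ⬝ᵥ r = 0)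
    (hqr : IndepPair (projAlong p q) (projAlong p r)) : ¬ linForm l ∣ f := by
  rintro ⟨g, hg⟩
  have hvan : ∀ u v w : Fin 4 → ℂ, l ⬝ᵥ u = 0 → l ⬝ᵥ v = 0 → l ⬝ᵥ w = 0 →
      eval p (dirDeriv u (dirDeriv v (dirDeriv w f))) = 0 := fun u v w hu hv hw => by
    have key : ∀ u g, l ⬝ᵥ u = 0 → dirDeriv u (linForm l * g) = linForm l * dirDeriv u g :=
      fun u g hu => by rw [dirDeriv_mul, dirDeriv_linForm, hu, map_zero, mul_zero, add_zero]
    rw [hg, key _ _ hw, key _ _ hv, key _ _ hu, map_mul, eval_linForm, hlp, zero_mul]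
  have hext : ∀ v, l ⬝ᵥ v = 0 → l ⬝ᵥ extendZeroₗ (projAlong p v) = 0 := fun v hv => by
    have := congrArg (l ⬝ᵥ ·) (extendZeroₗ_projAlong hp3 v)
    simpa [dotProduct_add, dotProduct_smul, hv, hlp] using this.symm
  refine (hp.nonsingularCubic hf hp3).false_of_proportional hqr (n := fun i => l i.castSucc)
    fun s t u hu => ?_
  have hw : l ⬝ᵥ extendZeroₗ (s • projAlong p q + t • projAlong p r) = 0 := by
    rw [map_add, map_smul, map_smul, dotProduct_add, dotProduct_smul, dotProduct_smul,
      hext q hlq, hext r hlr, smul_zero, smul_zero, add_zero]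
  rw [tangentForm_apply]
  refine hvan _ _ _ hw hw ?_
  rw [dotProduct, Fin.sum_univ_castSucc (n := 3), show Fin.last 3 = 3 from rfl, extendZeroₗ_last,
    mul_zero, add_zero, ← hu]
  simp only [extendZeroₗ_castSucc, dotProduct]

/-- Cubic syzygies vanish on planes containing six triple points. -/
lemma evalVec_eq_zero_of_plane (hf : f.IsHomogeneous 6) (hθ : ∀ i, (θ i).IsHomogeneous 3)
    (hsyz : vfield θ f = 0) {l : Fin 4 → ℂ} (hl : l ≠ 0) {p q : Fin 3 → Fin 4 → ℂ}
    (hp : Function.Injective p) (hq : Function.Injective q) (hpq : ∀ i j, p i ≠ q j)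
    (hp3 : ∀ i, p i 3 = 1) (hq3 : ∀ i, q i 3 = 1) (hlp : ∀ i, l ⬝ᵥ p i = 0)
    (hlq : ∀ i, l ⬝ᵥ q i = 0) (htp : ∀ i, TriplePt f (p i)) (htq : ∀ i, TriplePt f (q i))
    {x : Fin 4 → ℂ} (hx : l ⬝ᵥ x = 0) : evalVec x θ = 0 := by
  have hind : ∀ s t u : ℂ, s • p 0 + t • p 1 + u • p 2 = 0 → s = 0 ∧ t = 0 ∧ u = 0 :=
    fun s t u h => (htp 0).linearIndep hf (htp 1) (htp 2)
      (indepPair_of_last (hp3 _) (hp3 _) (hp.ne (by decide)))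
      (indepPair_of_last (hp3 _) (hp3 _) (hp.ne (by decide)))
      (indepPair_of_last (hp3 _) (hp3 _) (hp.ne (by decide))) h
  have hqpp : ∀ m i j, i ≠ j → ∀ s t u : ℂ, s • q m + t • p i + u • p j = 0 → s = 0 :=
    fun m i j hij s t u h => ((htq m).linearIndep hf (htp i) (htp j)
      (indepPair_of_last (hq3 _) (hp3 _) (hpq _ _).symm)
      (indepPair_of_last (hp3 _) (hp3 _) (hp.ne hij))
      (indepPair_of_last (hq3 _) (hp3 _) (hpq _ _).symm) h).1
  have hqqp : ∀ m n i, m ≠ n → ∀ s t u : ℂ, s • q m + t • q n + u • p i = 0 → s = 0 :=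
    fun m n i hmn s t u h => ((htq m).linearIndep hf (htq n) (htp i)
      (indepPair_of_last (hq3 _) (hq3 _) (hq.ne hmn))
      (indepPair_of_last (hq3 _) (hp3 _) (hpq _ _).symm)
      (indepPair_of_last (hq3 _) (hp3 _) (hpq _ _).symm) h).1
  choose y hy using fun m => exists_eq_of_dotProduct hl hlp hind (hlq m)
  have hy0 : ∀ m k, y m k ≠ 0 := fun m k hk => by
    refine one_ne_zero (α := ℂ) ?_
    fin_cases k <;> simp only [Fin.zero_eta, Fin.mk_one, Fin.reduceFinMk] at hk
    · exact hqpp m 1 2 (by decide) 1 (-y m 1) (-y m 2) (by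
        rw [hy m, hk]; module)
    · exact hqpp m 0 2 (by decide) 1 (-y m 0) (-y m 2) (by
        rw [hy m, hk]; module)
    · exact hqpp m 0 1 (by decide) 1 (-y m 0) (-y m 1) (by
        rw [hy m, hk]; module)
  have hyy : ∀ m n, m ≠ n → ∀ k l, k ≠ l → y m k * y n l - y n k * y m l ≠ 0 := by
    intro m n hmn k l' hkl e
    refine hy0 n k ?_
    have hy' : ∀ m, q m = ∑ k, y m k • p k := fun m => by rw [Fin.sum_univ_three]; exact hy m
    obtain ⟨r, hr⟩ : ∃ r : Fin 3, ∀ v : Fin 3 → Fin 4 → ℂ, ∑ j, v j = v k + v l' + v r := by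
      revert hkl; revert k l'
      have : ∀ v : Fin 3 → Fin 4 → ℂ, ∑ j, v j = v 0 + v 1 + v 2 := fun v => Fin.sum_univ_three v
      intro k l' e hkl
      fin_cases k <;> fin_cases l' <;> first | exact absurd rfl hkl | skip
      · exact ⟨2, fun v => by rw [this]; rfl⟩
      · exact ⟨1, fun v => by rw [this]; simp only [Fin.zero_eta, Fin.reduceFinMk]; abel⟩
      · exact ⟨2, fun v => by rw [this]; simp only [Fin.zero_eta, Fin.mk_one]; abel⟩
      · exact ⟨0, fun v => by rw [this]; simp only [Fin.mk_one, Fin.reduceFinMk]; abel⟩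
      · exact ⟨1, fun v => by rw [this]; simp only [Fin.zero_eta, Fin.reduceFinMk]; abel⟩
      · exact ⟨0, fun v => by rw [this]; simp only [Fin.mk_one, Fin.reduceFinMk]; abel⟩
    refine hqqp m n r hmn (y n k) (-y m k) (-(y n k * y m r - y m k * y n r)) ?_
    rw [hy' m, hy' n, hr, hr, ← neg_eq_zero, ← zero_smul ℂ (p l'), ← e]
    module
  choose α hα using fun i => (htp i).exists_evalVec_eq hf hsyz
  choose a ha using fun i => (htq i).exists_evalVec_eq hf hsyz
  choose ξ hξ using fun i j => (htp i).exists_evalVec_dirVec_eq hf (hp3 i) hsyz hθ (hα i) (p j)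
  have hmix : l ⬝ᵥ evalVec 0 (dirVec (p 0) (dirVec (p 1) (dirVec (p 2) θ))) = 0 := by
    have h := evalVec_cubic_expand hθ (p 0) (p 1) (p 2) (y 0 0) (y 0 1) (y 0 2)
    rw [← hy, ha, hα, hα, hα, hξ, hξ, hξ, hξ, hξ, hξ] at h
    have h' := congrArg (l ⬝ᵥ ·) h
    simp only [dotProduct_add, dotProduct_smul, hlp, hlq, smul_zero, add_zero, zero_add] at h'
    exact (smul_eq_zero.mp h'.symm).resolve_left
      (mul_ne_zero (mul_ne_zero (hy0 _ _) (hy0 _ _)) (hy0 _ _))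
  obtain ⟨φ, hφ⟩ := exists_eq_of_dotProduct hl hlp hind hmix
  have hexp : PlaneExpansion θ p α φ ξ := ⟨hα, hξ, hφ, hind⟩
  have hval := hexp.evalVec_eq hθ hy hy0 hyy ha fun m k =>
    (htq m).exists_evalVec_dirVec_eq hf (hq3 m) hsyz hθ (ha m) (p k)
  let F : MvPolynomial (Fin 3) ℂ :=
    aeval (fun i => C (p 0 i) * X 0 + C (p 1 i) * X 1 + C (p 2 i) * X 2) f
  have hF : ∀ z, eval z F = eval (z 0 • p 0 + z 1 • p 1 + z 2 • p 2) f := fun z => by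
    rw [eval_aeval_eq]
    congr 1
    simp only [map_add, map_mul, eval_C, eval_X]
    congr 1
    funext i
    simp only [Pi.add_apply, Pi.smul_apply, smul_eq_mul]
    ring
  let U : MvPolynomial (Fin 3) ℂ := C (φ 2) * X 0 * X 1 + C (φ 1) * X 0 * X 2 + C (φ 0) * X 1 * X 2
  have hU : ∀ z, eval z U = φ 2 * z 0 * z 1 + φ 1 * z 0 * z 2 + φ 0 * z 1 * z 2 := fun z => by
    simp [U]
  have hUF : U * F = 0 := MvPolynomial.funext fun z => by
    have h := eval_vfield (z 0 • p 0 + z 1 • p 1 + z 2 • p 2) θ f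
    rw [hsyz, hval, dirDeriv_smul, smul_eval, hf.eval_dirDeriv_self, map_zero, ← hU, ← hF] at h
    rw [map_mul, map_zero]
    norm_num at h
    simpa using h
  have hF0 : F ≠ 0 := fun h0 => by
    refine (htp 0).not_linForm_dvd hf (hp3 0) (hlp 0) (hlp 1) (hlp 2)
      ((htp 0).indepPair_projAlong hf (htp 1) (htp 2) (hp3 0) (hp3 1) (hp3 2) (hp.ne (by decide))
        (hp.ne (by decide)) (hp.ne (by decide)))
      (linForm_dvd_of_forall hl (hp3 0) (hlp 0) 0 fun x hx => ?_)
    obtain ⟨z, rfl⟩ := exists_eq_of_dotProduct hl hlp hind hx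
    rw [pow_zero, one_mul, ← hF, h0, map_zero]
  have hU0 : U = 0 := (mul_eq_zero.mp hUF).resolve_right hF0
  obtain ⟨z, rfl⟩ := exists_eq_of_dotProduct hl hlp hind hx
  rw [hval, ← hU, hU0, map_zero, zero_smul]

/-- If six triple points lie on a plane, there are no nonzero syzygies of degree at most three. -/
lemma syzygy_eq_zero_of_plane (hf : f.IsHomogeneous 6) {l : Fin 4 → ℂ} (hl : l ≠ 0)
    {p q : Fin 3 → Fin 4 → ℂ}
    (hp : Function.Injective p) (hq : Function.Injective q) (hpq : ∀ i j, p i ≠ q j)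
    (hp3 : ∀ i, p i 3 = 1) (hq3 : ∀ i, q i 3 = 1) (hlp : ∀ i, l ⬝ᵥ p i = 0)
    (hlq : ∀ i, l ⬝ᵥ q i = 0) (htp : ∀ i, TriplePt f (p i)) (htq : ∀ i, TriplePt f (q i))
    {e : ℕ} (he : e ≤ 3) (hθ : ∀ i, (θ i).IsHomogeneous e) (hsyz : vfield θ f = 0) : θ = 0 := by
  induction e generalizing θ with
  | zero =>
    have hdvd := fun i => linForm_dvd_of_forall hl (hp3 0) (hlp 0) 3 (q := θ i) fun x hx =>
      congr_fun (evalVec_eq_zero_of_plane hf (θ := fun i => X 3 ^ 3 * θ i)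
        (fun i => by
          have := ((isHomogeneous_X ℂ (3 : Fin 4)).pow 3).mul (hθ i)
          exact this)
        (by
          simp only [vfield, mul_assoc, ← Finset.mul_sum]
          rw [← vfield, hsyz, mul_zero]) hl hp hq hpq hp3 hq3 hlp hlq htp htq hx) i
    funext i
    obtain ⟨g, hg⟩ := hdvd i
    refine MvPolynomial.funext fun x => ?_
    rw [eval_eq_of_isHomogeneous_zero (hθ i) x (p 0), hg, map_mul, eval_linForm, hlp, zero_mul,
      Pi.zero_apply, map_zero]
  | succ e ih =>
    have hdvd := fun i => linForm_dvd_of_forall hl (hp3 0) (hlp 0) (3 - (e + 1)) (q := θ i)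
      fun x hx => congr_fun (evalVec_eq_zero_of_plane hf (θ := fun i => X 3 ^ (3 - (e + 1)) * θ i)
        (fun i => by
          have := ((isHomogeneous_X ℂ (3 : Fin 4)).pow (3 - (e + 1))).mul (hθ i)
          rwa [one_mul, Nat.sub_add_cancel he] at this)
        (by
          simp only [vfield, mul_assoc, ← Finset.mul_sum]
          rw [← vfield, hsyz, mul_zero]) hl hp hq hpq hp3 hq3 hlp hlq htp htq hx) i
    choose g hg using hdvd
    have hg' : ∀ i, θ i = homogeneousComponent e (g i) * linForm l := fun i => by
      rw [← homogeneousComponent_mul_of_isHomogeneous_add (linForm_isHomogeneous l), mul_comm,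
        ← hg]
      have := homogeneousComponent_of_mem ((mem_homogeneousSubmodule (e + 1) (θ i)).mpr (hθ i))
        (m := e + 1)
      rw [this, if_pos rfl]
    have h0 := ih (θ := fun i => homogeneousComponent e (g i)) (by omega)
      (fun i => homogeneousComponent_isHomogeneous _ _) (by
        refine (mul_eq_zero.mp (?_ : linForm l * _ = 0)).resolve_left (linForm_ne_zero hl)
        rw [← hsyz, vfield, vfield, Finset.mul_sum]
        refine Finset.sum_congr rfl fun i _ => ?_
        rw [hg']; ring)
    funext i
    rw [hg', show homogeneousComponent e (g i) = 0 from congr_fun h0 i, zero_mul, Pi.zero_apply]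

end Plane

section EigenBasis

variable {ι : Type*} {V : Type*} [AddCommGroup V] [Module ℂ V]

/-- A bilinear map that is diagonal on pairs of vectors of a family: the eigenvalue of a vector
outside a basis vanishes, and so do its coordinates along basis vectors of nonzero eigenvalue. -/
lemma eigenvalue_mul_repr_eq_zero (Q : V →ₗ[ℂ] V →ₗ[ℂ] V) {p : ι → V} {α : ι → ℂ}
    (hne : ∀ i j, i ≠ j → Q (p i) (p j) = -(α i • p j + α j • p i))
    (hself : ∀ i, Q (p i) (p i) = (2 * α i) • p i) (b : Module.Basis (Fin 4) ℂ V) {e : Fin 4 → ι}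
    (hb : ∀ k, b k = p (e k)) {j : ι} (hj : ∀ k, e k ≠ j) (hj0 : p j ≠ 0) :
    α j = 0 ∧ ∀ k, α (e k) * b.repr (p j) k = 0 := by
  set y := b.repr (p j) with hy
  have hsum : p j = ∑ k, y k • p (e k) := by
    conv_lhs => rw [← b.sum_repr (p j)]
    simp only [hb, hy]
  have hcoord : ∀ k l, b.coord k (p (e l)) = if l = k then 1 else 0 := fun k l => by
    rw [← hb, Module.Basis.coord_apply, b.repr_self, Finsupp.single_apply]
  have hQ : ∀ k l, b.coord k (Q (p (e l)) (p (e k))) =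
      (if l = k then 3 * α (e k) else 0) - α (e l) := fun k l => by
    by_cases hlk : l = k
    · subst hlk
      rw [hself, map_smul, hcoord, if_pos rfl, if_pos rfl, smul_eq_mul]; ring
    · have : e l ≠ e k := fun h => hlk (b.injective (by rw [hb, hb, h]))
      rw [hne _ _ this, map_neg, map_add, map_smul, map_smul, hcoord, hcoord, if_pos rfl,
        if_neg hlk, if_neg hlk]
      simp
  have h1 : ∀ k, α j = (∑ l, y l * α (e l)) - 4 * (α (e k) * y k) := fun k => by
    have h := congrArg (b.coord k) (hne j (e k) (hj k).symm)
    rw [map_neg, map_add, map_smul, map_smul, hcoord, if_pos rfl,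
      show b.coord k (p j) = y k from rfl] at h
    conv_lhs at h => rw [hsum]
    rw [map_sum, LinearMap.sum_apply, map_sum] at h
    simp only [map_smul, LinearMap.smul_apply, hQ, smul_eq_mul, mul_sub, mul_ite, mul_zero,
      Finset.sum_sub_distrib, Finset.sum_ite_eq', Finset.mem_univ, if_true] at h
    linear_combination h
  have h2 : α j = 0 := by
    have := (Finset.sum_congr rfl fun k _ => h1 k : ∑ _k : Fin 4, α j = _)
    simp only [Finset.sum_sub_distrib, Finset.sum_const, Finset.card_univ, Fintype.card_fin,
      ← Finset.mul_sum, nsmul_eq_mul] at this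
    rw [Finset.sum_congr rfl fun k _ => mul_comm (α (e k)) (y k)] at this
    push_cast at this
    linear_combination this / 4
  have h3 : ∑ l, y l * α (e l) = 0 := by
    have h := hself j
    rw [h2, mul_zero, zero_smul] at h
    conv_lhs at h => arg 2; rw [hsum]
    rw [map_sum] at h
    simp only [map_smul, hne j _ (hj _).symm, h2, zero_smul, zero_add, smul_neg, smul_smul,
      Finset.sum_neg_distrib, ← Finset.sum_smul, neg_eq_zero] at h
    exact (smul_eq_zero.mp h).resolve_right hj0
  refine ⟨h2, fun k => ?_⟩
  have := h1 k
  rw [h2, h3] at this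
  linear_combination this / 4

end EigenBasis

section Bound

open Matrix

variable {f : MvPolynomial (Fin 4) ℂ} {θ : Fin 4 → MvPolynomial (Fin 4) ℂ}

/-- The second derivative of a vector field at the origin. -/
def polarVec (θ : Fin 4 → MvPolynomial (Fin 4) ℂ) :
    (Fin 4 → ℂ) →ₗ[ℂ] (Fin 4 → ℂ) →ₗ[ℂ] (Fin 4 → ℂ) :=
  LinearMap.mk₂ ℂ (fun x v => evalVec 0 (dirVec x (dirVec v θ)))
    (fun x y v => evalVec_dirVec_add _ _ _ _) (fun c x v => evalVec_dirVec_smul _ _ _ _)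
    (fun x v w => by rw [dirVec_comm, evalVec_dirVec_add, dirVec_comm v, dirVec_comm w])
    (fun c x v => by rw [dirVec_comm, evalVec_dirVec_smul, dirVec_comm v])

lemma polarVec_apply (hθ : ∀ i, (θ i).IsHomogeneous 2) (x v : Fin 4 → ℂ) :
    polarVec θ x v = evalVec x (dirVec v θ) := by
  have h := evalVec_dirVec_self (dirVec_isHomogeneous hθ v) x
  rw [Nat.add_one_sub_one, Nat.cast_one, one_smul] at h
  rw [← h]
  exact evalVec_zero_of_isHomogeneous (dirVec_isHomogeneous (dirVec_isHomogeneous hθ v) x) _ _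

lemma polarVec_comm (x v : Fin 4 → ℂ) : polarVec θ x v = polarVec θ v x :=
  congrArg (evalVec 0) (dirVec_comm x v θ)

lemma eq_zero_of_polarVec (hθ : ∀ i, (θ i).IsHomogeneous 2) (h : polarVec θ = 0) : θ = 0 :=
  funext fun i => MvPolynomial.funext fun x => by
    have h1 := evalVec_dirVec_self hθ x
    rw [← polarVec_apply hθ, h, LinearMap.zero_apply, LinearMap.zero_apply] at h1
    have := congr_fun h1 i
    rw [Pi.smul_apply, Pi.zero_apply, eq_comm, smul_eq_zero] at this
    rw [Pi.zero_apply, map_zero]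
    exact this.resolve_left (by norm_num)

lemma polarVec_self {p : Fin 4 → ℂ} (hθ : ∀ i, (θ i).IsHomogeneous 2) {α : ℂ}
    (hα : evalVec p θ = α • p) : polarVec θ p p = (2 * α) • p := by
  rw [polarVec_apply hθ, evalVec_dirVec_self hθ, hα, smul_smul, Nat.cast_ofNat]

lemma TriplePt.polarVec_of_ne (hf : f.IsHomogeneous 6) {p q : Fin 4 → ℂ} (hp : TriplePt f p)
    (hq : TriplePt f q) (hp3 : p 3 = 1) (hq3 : q 3 = 1) (hpq : p ≠ q)
    (hθ : ∀ i, (θ i).IsHomogeneous 2) (hs : vfield θ f = 0) {α β : ℂ}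
    (hα : evalVec p θ = α • p) (hβ : evalVec q θ = β • q) :
    polarVec θ p q = -(α • q + β • p) := by
  obtain ⟨c, hc⟩ := hp.exists_evalVec_dirVec_eq hf hp3 hs hθ hα q
  obtain ⟨d, hd⟩ := hq.exists_evalVec_dirVec_eq hf hq3 hs hθ hβ p
  rw [← polarVec_apply hθ] at hc hd
  rw [polarVec_comm, hc, ← sub_eq_zero] at hd
  obtain ⟨h, -⟩ := indepPair_of_last hp3 hq3 hpq (c + β) (-α - d) (by rw [← hd]; module)
  rw [hc, eq_neg_of_add_eq_zero_left h]
  module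

/-- A nonzero quadratic syzygy forces all but one of the triple points to be coplanar. -/
lemma exists_plane_of_quadratic_syzygy (hf : f.IsHomogeneous 6) {ι : Type*} {p : ι → Fin 4 → ℂ}
    (hp : Function.Injective p) (hp3 : ∀ j, p j 3 = 1) (htp : ∀ j, TriplePt f (p j))
    (hspan : ∀ l : Fin 4 → ℂ, (∀ j, l ⬝ᵥ p j = 0) → l = 0)
    (hθ : ∀ i, (θ i).IsHomogeneous 2) (hs : vfield θ f = 0) (h0 : θ ≠ 0) :
    ∃ l : Fin 4 → ℂ, l ≠ 0 ∧ ∃ i, ∀ j, j ≠ i → l ⬝ᵥ p j = 0 := by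
  choose α hα using fun j => (htp j).exists_evalVec_eq hf hs
  have hself := fun j => polarVec_self hθ (hα j)
  have hne := fun i j (h : i ≠ j) => (htp i).polarVec_of_ne hf (htp j) (hp3 i) (hp3 j)
    (hp.ne h) hθ hs (hα i) (hα j)
  have htop : ⊤ ≤ Submodule.span ℂ (Set.range p) := by
    by_contra hcon
    obtain ⟨v, -, hv⟩ := Set.not_subset.mp hcon
    obtain ⟨φ, hφ, hker⟩ := Submodule.exists_le_ker_of_notMem hv
    have hdot : ∀ x, φ x = (fun i => φ (Pi.single i 1)) ⬝ᵥ x := fun x => by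
      conv_lhs => rw [pi_eq_sum_univ' x, map_sum]
      exact Finset.sum_congr rfl fun i _ => by rw [map_smul, smul_eq_mul, mul_comm]
    have := hspan (fun i => φ (Pi.single i 1)) fun j => by
      rw [← hdot]; exact hker (Submodule.subset_span ⟨j, rfl⟩)
    exact hφ (by rw [hdot, this, zero_dotProduct])
  let b₀ := Module.Basis.ofSpan htop
  let b := b₀.reindex (b₀.indexEquiv (Pi.basisFun ℂ (Fin 4)))
  have hb : ∀ k, ∃ j, p j = b k := fun k => by
    rw [Module.Basis.reindex_apply]
    exact Module.Basis.ofSpan_subset htop ⟨_, rfl⟩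
  choose e he using hb
  have key : ∀ j, (∀ k, e k ≠ j) → α j = 0 ∧ ∀ k, α (e k) * b.repr (p j) k = 0 := fun j hj =>
    eigenvalue_mul_repr_eq_zero (polarVec θ) hne hself b (fun k => (he k).symm) hj (htp j).ne_zero
  have hk : ∃ k, α (e k) ≠ 0 := by
    by_contra! hk
    refine h0 (eq_zero_of_polarVec hθ (b.ext fun k => b.ext fun l => ?_))
    rw [← he, ← he, LinearMap.zero_apply, LinearMap.zero_apply]
    by_cases hkl : e k = e l
    · rw [hkl, hself, hk, mul_zero, zero_smul]
    · rw [hne _ _ hkl, hk, hk, zero_smul, zero_smul, add_zero, neg_zero]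
  obtain ⟨k, hk⟩ := hk
  have hdot : ∀ x, (fun i => b.coord k (Pi.single i 1)) ⬝ᵥ x = b.repr x k := fun x => by
    rw [← Module.Basis.coord_apply]
    conv_rhs => rw [pi_eq_sum_univ' x, map_sum]
    exact Finset.sum_congr rfl fun i _ => by rw [map_smul, smul_eq_mul, mul_comm]
  refine ⟨fun i => b.coord k (Pi.single i 1), fun h => ?_, e k, fun j hj => ?_⟩
  · have := hdot (b k)
    rw [h, zero_dotProduct, b.repr_self, Finsupp.single_eq_same] at this
    exact zero_ne_one this
  · rw [hdot]
    by_cases hjk : ∃ l, e l = j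
    · obtain ⟨l, rfl⟩ := hjk
      rw [he, b.repr_self, Finsupp.single_apply, if_neg]
      exact fun h => hj (by rw [h])
    · rw [not_exists] at hjk
      exact (mul_eq_zero.mp ((key j hjk).2 k)).resolve_left hk

/-- A cubic or lower syzygy vanishes when six triple points lie on a plane. -/
lemma syzygy_eq_zero_of_plane_succAbove (hf : f.IsHomogeneous 6) {p : Fin 11 → Fin 4 → ℂ}
    (hp : Function.Injective p) (hp3 : ∀ j, p j 3 = 1) (htp : ∀ j, TriplePt f (p j))
    {l : Fin 4 → ℂ} (hl : l ≠ 0) {i : Fin 11} (hlp : ∀ j, j ≠ i → l ⬝ᵥ p j = 0)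
    {e : ℕ} (he : e ≤ 3) (hθ : ∀ i, (θ i).IsHomogeneous e) (hs : vfield θ f = 0) : θ = 0 := by
  refine syzygy_eq_zero_of_plane hf hl
    (p := fun k => p (i.succAbove (Fin.castLE (by norm_num) k)))
    (q := fun k => p (i.succAbove (Fin.natAdd 7 k)))
    (fun k k' h => ?_) (fun k k' h => ?_) (fun k k' h => ?_)
    (fun _ => hp3 _) (fun _ => hp3 _) (fun _ => hlp _ (Fin.succAbove_ne _ _))
    (fun _ => hlp _ (Fin.succAbove_ne _ _)) (fun _ => htp _) (fun _ => htp _) he hθ hs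
  · simpa [Fin.ext_iff] using Fin.succAbove_right_injective (hp h)
  · simpa [Fin.ext_iff] using Fin.succAbove_right_injective (hp h)
  · have := Fin.succAbove_right_injective (hp h)
    simp [Fin.ext_iff] at this
    omega

theorem false_of_eleven (hf : f.IsHomogeneous 6)
    (hH : ∀ x : Fin 4 → ℂ, x 3 = 0 → (∀ i : Fin 3, eval x (pderiv i.castSucc f) = 0) → x = 0)
    {p : Fin 11 → Fin 4 → ℂ} (hp : Function.Injective p) (hp3 : ∀ j, p j 3 = 1)
    (htp : ∀ j, TriplePt f (p j)) : False := by
  obtain ⟨a, b, ha', hb', ha, hb, hab⟩ := exists_cubic_syzygies hf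
    (two_le_finrank_ker_cubicCombination hf hH hp hp3 fun j => (htp j).second)
  have ha0 : a ≠ 0 := fun h => one_ne_zero
    (hab 1 0 (by rw [h, smul_zero, zero_smul, add_zero])).1
  have hspan : ∀ l : Fin 4 → ℂ, (∀ j, l ⬝ᵥ p j = 0) → l = 0 := fun l hl => by
    by_contra hl0
    exact ha0 (syzygy_eq_zero_of_plane_succAbove hf hp hp3 htp hl0 (i := 0) (fun j _ => hl j)
      le_rfl ha' ha)
  obtain ⟨θ, hθ, hs, h0⟩ := exists_quadratic_syzygy_of_eleven hf hH hp hp3 htp hspan ha hb ha' hb'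
    hab
  obtain ⟨l, hl, i, hli⟩ := exists_plane_of_quadratic_syzygy hf hp hp3 htp hspan hθ hs h0
  exact h0 (syzygy_eq_zero_of_plane_succAbove hf hp hp3 htp hl hli (by norm_num) hθ hs)

end Bound

section Projective

open Matrix LinearAlgebra.Projectivization

variable {f : MvPolynomial (Fin 4) ℂ}

lemma mk_mem_singSet_iff (hf : f.IsHomogeneous 6) {x : Fin 4 → ℂ} (hx : x ≠ 0) :
    Projectivization.mk ℂ x hx ∈ SingSet f ↔ ∀ i, eval x (pderiv i f) = 0 := by
  obtain ⟨a, ha⟩ := Projectivization.exists_smul_eq_mk_rep ℂ x hx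
  have ha' : ∀ g : MvPolynomial (Fin 4) ℂ, g.IsHomogeneous 5 →
      (eval (Projectivization.mk ℂ x hx).rep g = 0 ↔ eval x g = 0) := fun g hg => by
    rw [← ha, Units.smul_def, eval_smul_of_isHomogeneous hg, mul_eq_zero,
      or_iff_right (pow_ne_zero _ a.ne_zero)]
  rw [SingSet, Set.mem_ofPred_eq, singularAt_iff hf]
  refine ⟨fun h i => ?_, fun h u => ?_⟩
  · have := h (Pi.single i 1)
    rwa [ha' _ (hf.dirDeriv _), dirDeriv_single] at this
  · rw [ha' _ (hf.dirDeriv u), dirDeriv_eq_sum, map_sum]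
    exact Finset.sum_eq_zero fun i _ => by rw [smul_eval, h, mul_zero]

lemma Projectivization.eq_of_smul_rep_eq {P Q : Projectivization ℂ (Fin 4 → ℂ)} {a b : ℂ}
    (ha : a ≠ 0) (h : a • P.rep = b • Q.rep) : P = Q := by
  rw [← P.mk_rep, ← Q.mk_rep, Projectivization.mk_eq_mk_iff']
  exact ⟨a⁻¹ * b, by rw [mul_smul, ← h, smul_smul, inv_mul_cancel₀ ha, one_smul]⟩

theorem OnlyTriplePoints.le_ten (hf : f.IsHomogeneous 6) (hf0 : f ≠ 0) {ν : ℕ}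
    (h : OnlyTriplePoints 6 ν f) : ν ≤ 10 := by
  obtain ⟨hfin, hcard, hord⟩ := h
  by_contra! hν
  have : Finite (SingSet f) := hfin
  obtain ⟨B, hB, hH, hy⟩ := exists_coordinates hf hf0 (P := fun P : SingSet f => P.1.rep)
    (fun P => P.1.rep_nonzero) fun x hx hx' => by
      obtain ⟨a, ha⟩ := Projectivization.exists_smul_eq_mk_rep ℂ x hx
      refine ⟨⟨_, (mk_mem_singSet_iff hf hx).mpr hx'⟩, ((a⁻¹ : ℂˣ) : ℂ), ?_⟩
      rw [← Units.smul_def]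
      exact eq_inv_smul_iff.mpr ha
  choose y hy3 c hc hyc using hy
  have htp : ∀ P, TriplePt (substMatrix B f) (y P) := fun P => by
    refine TriplePt.substMatrix hB ?_
    rw [hyc]
    exact (triplePt_of_ordinary hf (hord _ P.2)).smul hf (hc P)
  have hyinj : Function.Injective y := fun P Q hPQ => by
    refine Subtype.ext (Projectivization.eq_of_smul_rep_eq (b := c Q) (hc P)
      ((hyc P).symm.trans ?_))
    rw [hPQ, hyc]
  have := Fintype.ofFinite (SingSet f)
  have hc11 : Fintype.card (Fin 11) ≤ Fintype.card (SingSet f) := by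
    rw [Fintype.card_fin, ← Nat.card_eq_fintype_card, Nat.card_coe_set_eq, hcard]
    exact hν
  obtain ⟨g⟩ := Function.Embedding.nonempty_of_card_le hc11
  exact false_of_eleven (substMatrix_isHomogeneous B hf) hH (p := fun j => y (g j))
    (hyinj.comp g.injective) (fun j => hy3 _) fun j => htp _

end Projective

section CoefficientRing

/-- The ring `ℤ[φ][ω]` with `φ² = 1 + φ` and `ω² = -1 - ω`. -/
abbrev CoeffRing : Type := QuadraticAlgebra (QuadraticAlgebra ℤ 1 1) (-1) (-1)

/-- The element `a + bφ + (c + dφ)ω`. -/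
abbrev CoeffRing.mk (a b c d : ℤ) : CoeffRing := ⟨⟨a, b⟩, ⟨c, d⟩⟩

/-- Evaluation of `CoeffRing` at roots `φ`, `ω` of `X² - X - 1` and `X² + X + 1`. -/
def CoeffRing.hom {S : Type*} [CommRing S] (φ ω : S) (hφ : φ ^ 2 = 1 + φ)
    (hω : ω ^ 2 = -1 - ω) : CoeffRing →+* S where
  toFun x := (x.re.re : S) + x.re.im * φ + (x.im.re + x.im.im * φ) * ω
  map_one' := by simp [QuadraticAlgebra.re_one, QuadraticAlgebra.im_one]
  map_zero' := by simp
  map_add' x y := by simp; ring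
  map_mul' x y := by
    simp
    generalize (x.re.re : S) = a
    generalize (x.re.im : S) = b
    generalize (x.im.re : S) = c
    generalize (x.im.im : S) = d
    generalize (y.re.re : S) = a'
    generalize (y.re.im : S) = b'
    generalize (y.im.re : S) = c'
    generalize (y.im.im : S) = d'
    linear_combination (-(b * b') - (b * d' + d * b') * ω + d * d' * (1 + ω)) * hφ -
      (c + d * φ) * (c' + d' * φ) * hω

lemma CoeffRing.hom_apply {S : Type*} [CommRing S] (φ ω : S) (hφ : φ ^ 2 = 1 + φ)
    (hω : ω ^ 2 = -1 - ω) (x : CoeffRing) : CoeffRing.hom φ ω hφ hω x =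
      (x.re.re : S) + x.re.im * φ + (x.im.re + x.im.im * φ) * ω := rfl

/-- A cube root of unity. -/
def cubeRoot : ℂ := ⟨-1 / 2, √3 / 2⟩

lemma cubeRoot_sq : cubeRoot ^ 2 = -1 - cubeRoot := by
  have h : √3 * √3 = 3 := Real.mul_self_sqrt (by norm_num)
  rw [sq]
  apply Complex.ext
  · simp [cubeRoot]; nlinarith
  · simp [cubeRoot]; ring

/-- The complex embedding of `CoeffRing`. -/
def toComplex : CoeffRing →+* ℂ :=
  CoeffRing.hom (Real.goldenRatio : ℂ) cubeRoot (by
    rw [add_comm]; exact_mod_cast Real.goldenRatio_sq) cubeRoot_sq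

lemma int_eq_zero_of_add_mul_goldenRatio {a b : ℤ} (h : (a : ℝ) + b * Real.goldenRatio = 0) :
    a = 0 ∧ b = 0 := by
  have hb : b = 0 := by
    by_contra hb
    refine Real.goldenRatio_irrational ⟨-a / b, ?_⟩
    have : (b : ℝ) ≠ 0 := by exact_mod_cast hb
    push_cast
    rw [div_eq_iff this]
    linear_combination -h
  subst hb
  exact ⟨by simpa using h, rfl⟩

lemma toComplex_injective : Function.Injective toComplex := by
  rw [injective_iff_map_eq_zero]
  intro x hx
  rw [toComplex, CoeffRing.hom_apply] at hx
  have h3 : √3 ≠ 0 := by positivity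
  have him := congrArg Complex.im hx
  have hre := congrArg Complex.re hx
  simp [cubeRoot, h3] at him hre
  obtain ⟨h1, h2⟩ := int_eq_zero_of_add_mul_goldenRatio him
  rw [h1, h2] at hre
  obtain ⟨h3, h4⟩ := int_eq_zero_of_add_mul_goldenRatio (by simpa using hre)
  ext <;> simpa

instance fact_prime_thirtyOne : Fact (Nat.Prime 31) := ⟨by norm_num⟩

/-- The reduction of `CoeffRing` modulo a prime of norm `31`. -/
def reduction : CoeffRing →+* ZMod 31 := CoeffRing.hom 19 5 (by decide) (by decide)

lemma reduction_surjective : Function.Surjective reduction := fun x =>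
  ⟨CoeffRing.mk x.val 0 0 0, by simp [reduction, CoeffRing.hom_apply]⟩

end CoefficientRing
section Lifting

open Matrix
lemma Matrix.exists_right_inverse_of_linearIndependent_row {F m n : Type*} [Field F] [Fintype m]
    [DecidableEq m] [Fintype n] [DecidableEq n] {M : Matrix m n F}
    (h : LinearIndependent F M.row) : ∃ B : Matrix n m F, M * B = 1 := by
  obtain ⟨g, hg⟩ := (Matrix.toLinearMapRight' (R := F) M).exists_leftInverse_of_injective
    (LinearMap.ker_eq_bot.mpr (Matrix.vecMul_injective_iff.mpr h))
  have hB (v : n → F) : v ᵥ* (Matrix.of fun k => g (Pi.single k 1)) = g v := by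
    conv_rhs => rw [pi_eq_sum_univ' v]
    ext i
    simp [Matrix.vecMul, dotProduct]
  refine ⟨Matrix.of fun k => g (Pi.single k 1), Matrix.ext fun i j => ?_⟩
  have h1 := LinearMap.congr_fun hg (Pi.single i 1)
  rw [LinearMap.comp_apply, Matrix.toLinearMapRight'_apply, Matrix.single_one_vecMul] at h1
  rw [Matrix.mul_apply_eq_vecMul, hB, Matrix.one_eq_pi_single]
  exact congrFun h1 j

open Polynomial in
/-- Linear independence modulo a prime lifts to linear independence over a field containing
the coefficient ring. -/
lemma linearIndependent_map_of_linearIndependent_map {A F E : Type*} [CommRing A] [Field F]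
    [Field E] {ρ : A →+* F} {ι : A →+* E} (hρ : Function.Surjective ρ)
    (hι : Function.Injective ι) {n : ℕ} {r : Fin n → A[X]}
    (h : LinearIndependent F fun i => (r i).map ρ) :
    LinearIndependent E fun i => (r i).map ι := by
  obtain ⟨N, hN⟩ : ∃ N, ∀ i, (r i).natDegree < N :=
    ⟨(Finset.univ.sup fun i => (r i).natDegree) + 1, fun i =>
      Nat.lt_succ_of_le (Finset.le_sup (f := fun i => (r i).natDegree) (Finset.mem_univ i))⟩
  let M : Matrix (Fin n) (Fin N) A := Matrix.of fun i k => (r i).coeff k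
  have hM : LinearIndependent F (M.map ρ).row := by
    rw [Fintype.linearIndependent_iff] at h ⊢
    intro g hg
    refine h g (Polynomial.ext fun k => ?_)
    rw [Polynomial.finsetSum_coeff]
    by_cases hk : k < N
    · simpa [M, Matrix.map_apply] using congrFun hg ⟨k, hk⟩
    · refine Finset.sum_eq_zero fun i _ => ?_
      rw [Polynomial.coeff_smul, Polynomial.coeff_map,
        Polynomial.coeff_eq_zero_of_natDegree_lt (by have := hN i; omega), map_zero, smul_zero]
  obtain ⟨B, hB⟩ := Matrix.exists_right_inverse_of_linearIndependent_row hM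
  let B' : Matrix (Fin N) (Fin n) A := B.map (Function.surjInv hρ)
  have hB' : B'.map ρ = B := by ext i j; simp [B', Function.surjInv_eq hρ]
  have hdet : (M * B').det ≠ 0 := by
    intro h0
    have := congrArg ρ h0
    rw [RingHom.map_det, RingHom.mapMatrix_apply, Matrix.map_mul, hB', hB, Matrix.det_one,
      map_zero] at this
    exact one_ne_zero this
  have hdet' : (M.map ι * B'.map ι).det ≠ 0 := by
    rw [← Matrix.map_mul, ← RingHom.mapMatrix_apply, ← RingHom.map_det]
    exact (map_ne_zero_iff ι hι).mpr hdet
  rw [Fintype.linearIndependent_iff]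
  intro g hg
  have h1 : Matrix.vecMul g (M.map ι) = 0 := by
    ext k
    have := congrArg (fun q : E[X] => q.coeff k) hg
    simpa [Matrix.vecMul, dotProduct, M, Matrix.map_apply, Polynomial.finsetSum_coeff] using this
  have h2 : Matrix.vecMul g (M.map ι * B'.map ι) = 0 := by
    rw [← Matrix.vecMul_vecMul, h1, Matrix.zero_vecMul]
  exact congrFun (Matrix.eq_zero_of_vecMul_eq_zero hdet' h2)

end Lifting

section Packed

/-- Continue with the value of `n`, evaluating it first. -/
def forceNat {α : Type} (n : ℕ) (k : ℕ → α) : α := Nat.rec (k 0) (fun m _ => k (m + 1)) n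

lemma forceNat_eq {α : Type} (n : ℕ) (k : ℕ → α) : forceNat n k = k n := by
  cases n <;> rfl

/-- The number all of whose first `n` base `4096` digits are `127`. -/
def slotMask (n : ℕ) : ℕ := (4096 ^ n - 1) / 4095 * 127

/-- Replace each of the first `n` base `4096` digits `d` by `d % 32 + d / 32`. -/
def foldDigits (n X : ℕ) : ℕ := X - 31 * Nat.land (Nat.shiftRight X 5) (slotMask n)

/-- The `j`-th digit in base `4096`. -/
def digitAt (X j : ℕ) : ℕ := Nat.shiftRight X (12 * j) % 4096

lemma slotMask_succ (n : ℕ) : slotMask (n + 1) = 127 + 4096 * slotMask n := by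
  have h (n : ℕ) : (4096 ^ n - 1) / 4095 = ∑ i ∈ Finset.range n, 4096 ^ i := by
    rw [Nat.geomSum_eq (by norm_num)]
  rw [slotMask, slotMask, h, h, Finset.sum_range_succ']
  simp only [pow_succ, ← Finset.sum_mul]
  ring

lemma shiftRight_land_add {d : ℕ} (hd : d < 4096) (Y M : ℕ) :
    Nat.land (Nat.shiftRight (d + 4096 * Y) 5) (127 + 4096 * M) =
      d / 32 + 4096 * Nat.land (Nat.shiftRight Y 5) M := by
  change ((d + 4096 * Y) >>> 5) &&& (127 + 4096 * M) = d / 32 + 4096 * ((Y >>> 5) &&& M)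
  rw [← Nat.div_add_mod (((d + 4096 * Y) >>> 5) &&& (127 + 4096 * M)) (2 ^ 12),
    Nat.and_div_two_pow, Nat.and_mod_two_pow, Nat.shiftRight_eq_div_pow, Nat.shiftRight_eq_div_pow]
  have h1 : (127 + 4096 * M) / 2 ^ 12 = M := by omega
  have h2 : (127 + 4096 * M) % 2 ^ 12 = 2 ^ 7 - 1 := by omega
  have h3 : (d + 4096 * Y) / 2 ^ 5 / 2 ^ 12 = Y / 2 ^ 5 := by omega
  rw [h1, h2, h3, Nat.and_two_pow_sub_one_eq_mod]
  omega

lemma land_slotMask {a : ℕ → ℕ} (n : ℕ) (ha : ∀ i, a i < 4096) :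
    Nat.land (Nat.shiftRight (∑ i ∈ Finset.range n, a i * 4096 ^ i) 5) (slotMask n) =
      ∑ i ∈ Finset.range n, a i / 32 * 4096 ^ i := by
  induction n generalizing a with
  | zero => simp [slotMask]
  | succ n ih =>
    have h (b : ℕ → ℕ) : ∑ i ∈ Finset.range (n + 1), b i * 4096 ^ i =
        b 0 + 4096 * ∑ i ∈ Finset.range n, b (i + 1) * 4096 ^ i := by
      rw [Finset.sum_range_succ', Finset.mul_sum, add_comm]
      congr 1
      · simp
      · exact Finset.sum_congr rfl fun i _ => by ring
    rw [h, h, slotMask_succ, shiftRight_land_add (ha 0), ih fun i => ha (i + 1)]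

lemma digitAt_eval {v : Polynomial ℕ} (hv : ∀ i, v.coeff i < 4096) (j : ℕ) :
    digitAt (v.eval 4096) j = v.coeff j := by
  have h (v : Polynomial ℕ) : v.eval 4096 = v.divX.eval 4096 * 4096 + v.coeff 0 := by
    conv_lhs => rw [← v.divX_mul_X_add]
    simp
  change (v.eval 4096) >>> (12 * j) % 4096 = _
  induction j generalizing v with
  | zero => rw [h]; have := hv 0; simp; omega
  | succ j ih =>
    rw [show 12 * (j + 1) = 12 + 12 * j by ring, Nat.shiftRight_add]
    have h1 : v.eval 4096 >>> 12 = v.divX.eval 4096 := by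
      rw [Nat.shiftRight_eq_div_pow, h]; have := hv 0; omega
    rw [h1, ih fun i => by rw [Polynomial.coeff_divX]; exact hv _, Polynomial.coeff_divX]

/-- The base `4096` digits of `X` are at most `B` and represent `g` modulo `31`. -/
def Packed (n B X : ℕ) (g : Polynomial (ZMod 31)) : Prop :=
  ∃ v : Polynomial ℕ, v.eval 4096 = X ∧ v.map (Nat.castRingHom (ZMod 31)) = g ∧
    (∀ i, v.coeff i ≤ B) ∧ v.natDegree < n

namespace Packed

variable {n B B' X Y : ℕ} {g h : Polynomial (ZMod 31)}

lemma mono (hX : Packed n B X g) (hB : B ≤ B') : Packed n B' X g := by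
  obtain ⟨v, h1, h2, h3, h4⟩ := hX
  exact ⟨v, h1, h2, fun i => (h3 i).trans hB, h4⟩

lemma add_mul (hX : Packed n B X g) (hY : Packed n B' Y h) (x : ℕ) :
    Packed n (B + x * B') (X + x * Y) (g + (x : ZMod 31) • h) := by
  obtain ⟨v, rfl, rfl, h3, h4⟩ := hX
  obtain ⟨w, rfl, rfl, h3', h4'⟩ := hY
  refine ⟨v + x • w, by simp, ?_, fun i => ?_, ?_⟩
  · ext i; simp
  · simpa using add_le_add (h3 i) (Nat.mul_le_mul_left x (h3' i))
  · exact (Polynomial.natDegree_add_le _ _).trans_lt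
      (max_lt h4 ((Polynomial.natDegree_smul_le _ _).trans_lt h4'))

lemma mul_left (hY : Packed n B Y h) (x : ℕ) :
    Packed n (x * B) (x * Y) ((x : ZMod 31) • h) := by
  obtain ⟨w, rfl, rfl, h3', h4'⟩ := hY
  refine ⟨x • w, by simp, ?_, fun i => ?_, ?_⟩
  · ext i; simp
  · simpa using Nat.mul_le_mul_left x (h3' i)
  · exact (Polynomial.natDegree_smul_le _ _).trans_lt h4'

lemma digitAt (hX : Packed n B X g) (hB : B < 4096) (j : ℕ) :
    ((digitAt X j : ℕ) : ZMod 31) = g.coeff j := by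
  obtain ⟨v, rfl, rfl, h3, -⟩ := hX
  rw [digitAt_eval fun i => (h3 i).trans_lt hB]
  simp

lemma foldDigits (hX : Packed n B X g) (hB : B < 4096) :
    Packed n (31 + B / 32) (foldDigits n X) g := by
  obtain ⟨v, rfl, rfl, h3, h4⟩ := hX
  let w (k : ℕ → ℕ) : Polynomial ℕ := ∑ i ∈ Finset.range n, Polynomial.monomial i (k i)
  have hc (k : ℕ → ℕ) (i : ℕ) : (w k).coeff i = if i < n then k i else 0 := by
    simp [w, Polynomial.finsetSum_coeff, Polynomial.coeff_monomial]
  have he (k : ℕ → ℕ) : (w k).eval 4096 = ∑ i ∈ Finset.range n, k i * 4096 ^ i := by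
    simp [w, Polynomial.eval_finsetSum]
  have hv : v = w fun i => v.coeff i := by
    ext i
    rw [hc]
    split_ifs with h
    · rfl
    · exact Polynomial.coeff_eq_zero_of_natDegree_lt (by omega)
  refine ⟨w fun i => v.coeff i % 32 + v.coeff i / 32, ?_, ?_, fun i => ?_, ?_⟩
  · rw [_root_.foldDigits, Polynomial.eval_eq_sum_range' h4, land_slotMask n fun i =>
      (h3 i).trans_lt hB, he, eq_comm, Nat.sub_eq_iff_eq_add, Finset.mul_sum,
      ← Finset.sum_add_distrib]
    · refine Finset.sum_congr rfl fun i _ => ?_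
      conv_lhs => rw [← Nat.div_add_mod (v.coeff i) 32]
      ring
    · rw [Finset.mul_sum]
      refine Finset.sum_le_sum fun i _ => ?_
      rw [← mul_assoc]
      exact Nat.mul_le_mul_right _ (by omega)
  · conv_rhs => rw [hv]
    ext i
    rw [Polynomial.coeff_map, Polynomial.coeff_map, hc, hc]
    split_ifs
    · conv_rhs => rw [← Nat.div_add_mod (v.coeff i) 32]
      have : (32 : ZMod 31) = 1 := by decide
      simp [this]; ring
    · rfl
  · rw [hc]
    have := h3 i
    split_ifs <;> omega
  · refine Nat.lt_of_le_pred (by omega) (Polynomial.natDegree_le_iff_coeff_eq_zero.mpr ?_)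
    intro i hi
    rw [hc, if_neg (by rw [Nat.pred_eq_sub_one] at hi; omega)]

lemma shiftLeft {m : ℕ} (hX : Packed m B X g) (e : ℕ) (he : m + e ≤ n) :
    Packed n B (Nat.shiftLeft X (12 * e)) (Polynomial.X ^ e * g) := by
  obtain ⟨v, rfl, rfl, h3, h4⟩ := hX
  refine ⟨Polynomial.X ^ e * v, ?_, ?_, fun i => ?_, ?_⟩
  · change _ = v.eval 4096 <<< (12 * e)
    rw [Nat.shiftLeft_eq, pow_mul]
    simp [mul_comm]
  · simp
  · rw [Polynomial.coeff_X_pow_mul']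
    split_ifs
    · exact h3 _
    · exact Nat.zero_le _
  · refine (Polynomial.natDegree_mul_le.trans (add_le_add_left
      (Polynomial.natDegree_X_pow_le e) _)).trans_lt (by omega)

end Packed

/-- Subtract the multiple of `r` from `s` that kills the digit at `c` modulo `31`. -/
def elimRow (n r c s : ℕ) : ℕ :=
  forceNat (digitAt s c % 31) fun d =>
    cond (Nat.beq d 0) s (foldDigits n (foldDigits n (s + (31 - d) * r)))

/-- Apply `elimRow` to all rows and check that the digits at `c` have been killed. -/
def elimRows (n c r : ℕ) (l : List ℕ) : (List ℕ → Bool) → Bool :=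
  List.rec (fun k => k []) (fun s _ ih k => forceNat (elimRow n r c s) fun s' =>
    cond (Nat.beq (digitAt s' c % 31) 0) (ih fun t => k (s' :: t)) false) l

/-- Gaussian elimination with prescribed pivot columns, checking independence of the rows. -/
def checkIndep (n : ℕ) (cs : List ℕ) : List ℕ → Bool :=
  List.rec (fun rs => List.casesOn rs true fun _ _ => false)
    (fun c _ ih rs => List.casesOn rs false fun r rs =>
      forceNat (digitAt r c % 31) fun d => cond (Nat.beq d 0) false
        (forceNat (foldDigits n (foldDigits n (d ^ 29 % 31 * r))) fun r' =>
          elimRows n c r' rs ih)) cs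

lemma natCast_mod_thirtyOne (a : ℕ) : ((a % 31 : ℕ) : ZMod 31) = a := by simp

lemma elimRow_spec {n r c s : ℕ} {g h : Polynomial (ZMod 31)} (hr : Packed n 40 r h)
    (hs : Packed n 40 s g) : ∃ α : ZMod 31, Packed n 40 (elimRow n r c s) (g + α • h) := by
  rw [elimRow, forceNat_eq]
  cases hd : Nat.beq (digitAt s c % 31) 0
  · have h1 := hs.add_mul hr (31 - digitAt s c % 31)
    have h2 : 40 + (31 - digitAt s c % 31) * 40 ≤ 1280 := by omega
    exact ⟨_, (((h1.mono h2).foldDigits (by norm_num)).foldDigits (by norm_num)).mono (by norm_num)⟩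
  · exact ⟨0, by simpa using hs⟩

lemma elimRows_spec {n c r : ℕ} {h : Polynomial (ZMod 31)} (hr : Packed n 40 r h)
    {l : List ℕ} {gs : List (Polynomial (ZMod 31))} (hl : List.Forall₂ (Packed n 40) l gs)
    {k : List ℕ → Bool} (hk : elimRows n c r l k = true) :
    ∃ l' gs', k l' = true ∧ List.Forall₂ (Packed n 40) l' gs' ∧
      List.Forall₂ (fun g g' => (∃ α : ZMod 31, g = g' + α • h) ∧ g'.coeff c = 0) gs gs' := by
  induction hl generalizing k with
  | nil => exact ⟨[], [], hk, .nil, .nil⟩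
  | @cons s g ss gs hs _ ih =>
    obtain ⟨α, hα⟩ := elimRow_spec (c := c) hr hs
    have hk' : cond (Nat.beq (digitAt (elimRow n r c s) c % 31) 0)
        (elimRows n c r ss fun t => k (elimRow n r c s :: t)) false = true := by
      have e : elimRows n c r (s :: ss) k = forceNat (elimRow n r c s) fun s' =>
        cond (Nat.beq (digitAt s' c % 31) 0) (elimRows n c r ss fun t => k (s' :: t)) false := rfl
      rwa [e, forceNat_eq] at hk
    cases hd : Nat.beq (digitAt (elimRow n r c s) c % 31) 0
    · rw [hd] at hk'
      exact absurd hk' Bool.false_ne_true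
    · rw [hd] at hk'
      obtain ⟨l', gs', h1, h2, h3⟩ := ih hk'
      refine ⟨_, _, h1, .cons hα h2, .cons ⟨⟨-α, by simp⟩, ?_⟩ h3⟩
      rw [← hα.digitAt (by norm_num), ← natCast_mod_thirtyOne, Nat.eq_of_beq_eq_true hd,
        Nat.cast_zero]

/-- Linear independence of a list of vectors. -/
def ListIndep {F V : Type*} [Field F] [AddCommGroup V] [Module F V] (gs : List V) : Prop :=
  ∀ a : List F, a.length = gs.length → (List.zipWith (· • ·) a gs).sum = 0 → ∀ x ∈ a, x = 0

lemma exists_sum_zipWith_eq {F V : Type*} [Field F] [AddCommGroup V] [Module F V] {h : V}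
    {P : V → V → Prop} {gs gs' : List V}
    (H : List.Forall₂ (fun g g' => (∃ α : F, g = g' + α • h) ∧ P g g') gs gs') (a : List F) :
    ∃ β : F, (List.zipWith (· • ·) a gs).sum = (List.zipWith (· • ·) a gs').sum + β • h := by
  induction H generalizing a with
  | nil => exact ⟨0, by simp⟩
  | cons hg _ ih =>
    obtain ⟨⟨α, rfl⟩, -⟩ := hg
    cases a with
    | nil => exact ⟨0, by simp⟩
    | cons x a =>
      obtain ⟨β, hβ⟩ := ih a
      refine ⟨x * α + β, ?_⟩
      rw [List.zipWith_cons_cons, List.zipWith_cons_cons, List.sum_cons, List.sum_cons, hβ]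
      module

lemma coeff_sum_zipWith_eq_zero {F : Type*} [Field F] {c : ℕ}
    {R : Polynomial F → Polynomial F → Prop}
    {gs gs' : List (Polynomial F)}
    (H : List.Forall₂ (fun g g' => R g g' ∧ g'.coeff c = 0) gs gs') (a : List F) :
    ((List.zipWith (· • ·) a gs').sum).coeff c = 0 := by
  induction H generalizing a with
  | nil => simp
  | cons hg _ ih => cases a with
    | nil => simp
    | cons x a => simp [hg.2, ih a]

lemma sum_zipWith_eq_zero {F V : Type*} [Field F] [AddCommGroup V] [Module F V] {a : List F}
    (ha : ∀ x ∈ a, x = 0) (gs : List V) : (List.zipWith (· • ·) a gs).sum = 0 := by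
  induction a generalizing gs with
  | nil => simp
  | cons x a ih => cases gs with
    | nil => simp
    | cons g gs =>
      rw [List.forall_mem_cons] at ha
      simp [ha.1, ih ha.2 gs]

lemma listIndep_of_checkIndep {n : ℕ} {cs l : List ℕ} {gs : List (Polynomial (ZMod 31))}
    (hl : List.Forall₂ (Packed n 40) l gs) (h : checkIndep n cs l = true) :
    ListIndep (F := ZMod 31) gs := by
  induction cs generalizing l gs with
  | nil =>
    cases hl with
    | nil =>
      intro a ha _ x hx
      rw [List.length_eq_zero_iff.mp ha] at hx
      simp at hx
    | cons _ _ => exact absurd h Bool.false_ne_true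
  | cons c cs ih =>
    cases hl with
    | nil => exact absurd h Bool.false_ne_true
    | @cons r g rs gs hr hl =>
      have h' : cond (Nat.beq (digitAt r c % 31) 0) false
          (elimRows n c (foldDigits n (foldDigits n ((digitAt r c % 31) ^ 29 % 31 * r))) rs
            (checkIndep n cs)) = true := by
        have e : checkIndep n (c :: cs) (r :: rs) = forceNat (digitAt r c % 31) fun d =>
          cond (Nat.beq d 0) false (forceNat (foldDigits n (foldDigits n (d ^ 29 % 31 * r)))
            fun r' => elimRows n c r' rs (checkIndep n cs)) := rfl
        rwa [e, forceNat_eq, forceNat_eq] at h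
      cases hd : Nat.beq (digitAt r c % 31) 0
      swap
      · rw [hd] at h'
        exact absurd h' Bool.false_ne_true
      rw [hd] at h'
      have hgc : g.coeff c ≠ 0 := by
        rw [← hr.digitAt (by norm_num), ← natCast_mod_thirtyOne, Ne,
          ZMod.natCast_eq_zero_iff]
        intro hdvd
        have := Nat.eq_zero_of_dvd_of_lt hdvd (Nat.mod_lt _ (by norm_num))
        rw [this] at hd
        exact absurd hd (by decide)
      have hy := Nat.mod_lt ((digitAt r c % 31) ^ 29) (show 31 > 0 by norm_num)
      generalize (digitAt r c % 31) ^ 29 % 31 = y at hy h'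
      have h1 := hr.mul_left y
      have h2 : y * 40 ≤ 1280 := by omega
      obtain ⟨l', gs', h3, h4, h5⟩ := elimRows_spec ((((h1.mono h2).foldDigits
        (by norm_num)).foldDigits (by norm_num)).mono (by norm_num)) hl h'
      have hI := ih h4 h3
      intro a ha hsum
      cases a with
      | nil => simp
      | cons x a =>
        rw [List.zipWith_cons_cons, List.sum_cons] at hsum
        obtain ⟨β, hβ⟩ := exists_sum_zipWith_eq h5 a
        have hlen : a.length = gs'.length := by
          rw [← h5.length_eq]; simpa using ha
        have hsum' : (List.zipWith (· • ·) a gs').sum +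
            (x + β * (y : ZMod 31)) • g = 0 := by
          rw [← hsum, hβ]; module
        have hc := congrArg (Polynomial.coeff · c) hsum'
        simp only [Polynomial.coeff_add, coeff_sum_zipWith_eq_zero
            (R := fun g₁ g' => ∃ α : ZMod 31, g₁ = g' + α • (y : ZMod 31) • g) h5 a,
          Polynomial.coeff_smul, Polynomial.coeff_zero, zero_add, smul_eq_mul] at hc
        rw [(mul_eq_zero.mp hc).resolve_right hgc, zero_smul, add_zero] at hsum'
        have ha0 := hI a hlen hsum'
        rw [sum_zipWith_eq_zero ha0, add_zero] at hsum
        have hx : x = 0 := by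
          refine (smul_eq_zero.mp hsum).resolve_right fun hg => hgc ?_
          rw [hg, Polynomial.coeff_zero]
        exact List.forall_mem_cons.mpr ⟨hx, ha0⟩

lemma ListIndep.linearIndependent {F V : Type*} [Field F] [AddCommGroup V] [Module F V]
    {gs : List V} (h : ListIndep (F := F) gs) : LinearIndependent F fun i => gs.get i := by
  rw [Fintype.linearIndependent_iff]
  intro a ha i
  refine h (List.ofFn a) (by simp) ?_ _ (List.mem_ofFn.mpr ⟨i, rfl⟩)
  rw [← ha, ← List.sum_ofFn]
  congr 1
  refine List.ext_get (by simp) fun k h1 h2 => by simp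

end Packed

section Terms

variable {R S : Type*} [CommSemiring R] [CommSemiring S]

/-- The exponent of the `i`-th variable. -/
def exponentAt (e : ℕ × ℕ × ℕ × ℕ) : ℕ → ℕ
  | 0 => e.1
  | 1 => e.2.1
  | 2 => e.2.2.1
  | _ => e.2.2.2

/-- Lower the exponent of the `i`-th variable by one. -/
def lowerExponent (e : ℕ × ℕ × ℕ × ℕ) : ℕ → ℕ × ℕ × ℕ × ℕ
  | 0 => (e.1 - 1, e.2)
  | 1 => (e.1, e.2.1 - 1, e.2.2)
  | 2 => (e.1, e.2.1, e.2.2.1 - 1, e.2.2.2)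
  | _ => (e.1, e.2.1, e.2.2.1, e.2.2.2 - 1)

/-- Formal partial derivative of a list of terms. -/
def termsDeriv (i : ℕ) (L : List ((ℕ × ℕ × ℕ × ℕ) × R)) : List ((ℕ × ℕ × ℕ × ℕ) × R) :=
  L.map fun t => (lowerExponent t.1 i, exponentAt t.1 i * t.2)

/-- Apply a map to the coefficients of a list of terms. -/
def termsMap {R S : Type*} (h : R → S) (L : List ((ℕ × ℕ × ℕ × ℕ) × R)) :
    List ((ℕ × ℕ × ℕ × ℕ) × S) := L.map fun t => (t.1, h t.2)

/-- The exponent vector of a term. -/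
def exponentVec (e : ℕ × ℕ × ℕ × ℕ) : Fin 4 →₀ ℕ := Finsupp.equivFunOnFinite.symm fun i =>
  exponentAt e i

/-- The polynomial in four variables given by a list of terms. -/
def termsPoly (L : List ((ℕ × ℕ × ℕ × ℕ) × R)) : MvPolynomial (Fin 4) R :=
  (L.map fun t => monomial (exponentVec t.1) t.2).sum

/-- The position of a monomial under Kronecker substitution. -/
def kroneckerPos (e : ℕ × ℕ × ℕ × ℕ) : ℕ := e.1 + 11 * e.2.1 + 121 * e.2.2.1

/-- The univariate polynomial obtained from a list of terms by Kronecker substitution. -/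
def termsKronecker (L : List ((ℕ × ℕ × ℕ × ℕ) × R)) : Polynomial R :=
  (L.map fun t => Polynomial.monomial (kroneckerPos t.1) t.2).sum

/-- The value of a list of terms at a point. -/
def termsEval (P : R × R × R × R) (L : List ((ℕ × ℕ × ℕ × ℕ) × R)) : R :=
  (L.map fun t => t.2 * (P.1 ^ t.1.1 * P.2.1 ^ t.1.2.1 * P.2.2.1 ^ t.1.2.2.1 *
    P.2.2.2 ^ t.1.2.2.2)).sum

/-- A quadruple as a vector. -/
def quadVec {R : Type*} (P : R × R × R × R) : Fin 4 → R := ![P.1, P.2.1, P.2.2.1, P.2.2.2]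

/-- Apply a map to the entries of a quadruple. -/
def quadMap {R S : Type*} (h : R → S) (P : R × R × R × R) : S × S × S × S :=
  (h P.1, h P.2.1, h P.2.2.1, h P.2.2.2)

lemma termsDeriv_termsMap (h : R →+* S) (i : ℕ) (L : List ((ℕ × ℕ × ℕ × ℕ) × R)) :
    termsDeriv i (termsMap h L) = termsMap h (termsDeriv i L) := by
  simp [termsDeriv, termsMap, Function.comp_def]

lemma termsEval_termsMap (h : R →+* S) (P : R × R × R × R) (L : List ((ℕ × ℕ × ℕ × ℕ) × R)) :
    termsEval (quadMap h P) (termsMap h L) = h (termsEval P L) := by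
  simp [termsEval, termsMap, quadMap, map_list_sum, Function.comp_def]

lemma termsKronecker_termsMap (h : R →+* S) (L : List ((ℕ × ℕ × ℕ × ℕ) × R)) :
    termsKronecker (termsMap h L) = (termsKronecker L).map h := by
  rw [← Polynomial.coe_mapRingHom]
  simp [termsKronecker, termsMap, map_list_sum, Function.comp_def]

lemma exponentVec_lowerExponent (e : ℕ × ℕ × ℕ × ℕ) (i : Fin 4) :
    exponentVec (lowerExponent e i) = exponentVec e - Finsupp.single i 1 := by
  ext j
  fin_cases i <;> fin_cases j <;>
    simp [exponentVec, lowerExponent, exponentAt]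

lemma pderiv_termsPoly (i : Fin 4) (L : List ((ℕ × ℕ × ℕ × ℕ) × R)) :
    pderiv i (termsPoly L) = termsPoly (termsDeriv i L) := by
  rw [termsPoly, termsPoly, termsDeriv, map_list_sum, List.map_map, List.map_map]
  congr 2
  ext1 t
  simp only [Function.comp_apply]
  rw [pderiv_monomial, exponentVec_lowerExponent, mul_comm]
  rfl

lemma termsPoly_isHomogeneous {L : List ((ℕ × ℕ × ℕ × ℕ) × R)} {d : ℕ}
    (h : ∀ t ∈ L, t.1.1 + t.1.2.1 + t.1.2.2.1 + t.1.2.2.2 = d) :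
    (termsPoly L).IsHomogeneous d := by
  induction L with
  | nil => exact isHomogeneous_zero _ _ _
  | cons t L ih =>
    rw [List.forall_mem_cons] at h
    rw [termsPoly, List.map_cons, List.sum_cons]
    refine (isHomogeneous_monomial _ ?_).add (ih h.2)
    rw [← h.1, Finsupp.degree_eq_sum, Fin.sum_univ_four]
    rfl

lemma eval_termsPoly (P : R × R × R × R) (L : List ((ℕ × ℕ × ℕ × ℕ) × R)) :
    eval (quadVec P) (termsPoly L) = termsEval P L := by
  rw [termsPoly, termsEval, map_list_sum, List.map_map]
  congr 2
  ext1 t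
  simp only [Function.comp_apply]
  rw [eval_monomial, Finsupp.prod_fintype _ _ (by simp), Fin.prod_univ_four]
  rfl

/-- Kronecker substitution `x ↦ X`, `y ↦ X ^ 11`, `z ↦ X ^ 121`. -/
def kronecker : MvPolynomial (Fin 3) ℂ →ₐ[ℂ] Polynomial ℂ :=
  aeval ![Polynomial.X, Polynomial.X ^ 11, Polynomial.X ^ 121]

/-- Restriction to the plane where the last coordinate vanishes. -/
def restrictPlane : MvPolynomial (Fin 4) ℂ →ₐ[ℂ] MvPolynomial (Fin 3) ℂ :=
  aeval (Fin.snoc (α := fun _ => MvPolynomial (Fin 3) ℂ) X 0)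

lemma aeval_monomial_exponentVec {B : Type*} [CommRing B] [Algebra ℂ B] (b : Fin 4 → B)
    (e : ℕ × ℕ × ℕ × ℕ) (c : ℂ) : aeval b (monomial (exponentVec e) c) =
      algebraMap ℂ B c * (b 0 ^ e.1 * b 1 ^ e.2.1 * b 2 ^ e.2.2.1 * b 3 ^ e.2.2.2) := by
  rw [aeval_monomial, Finsupp.prod_fintype _ _ (by simp), Fin.prod_univ_four]
  rfl

lemma kronecker_dehom_termsPoly (L : List ((ℕ × ℕ × ℕ × ℕ) × ℂ)) :
    kronecker (dehom (termsPoly L)) = termsKronecker L := by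
  rw [termsPoly, termsKronecker, map_list_sum, map_list_sum, List.map_map, List.map_map]
  congr 2
  ext1 t
  simp only [Function.comp_apply]
  rw [dehom, aeval_monomial_exponentVec]
  have h0 : (Fin.snoc (α := fun _ => MvPolynomial (Fin 3) ℂ) X 1 : Fin 4 → _) 0 = X 0 := rfl
  have h1 : (Fin.snoc (α := fun _ => MvPolynomial (Fin 3) ℂ) X 1 : Fin 4 → _) 1 = X 1 := rfl
  have h2 : (Fin.snoc (α := fun _ => MvPolynomial (Fin 3) ℂ) X 1 : Fin 4 → _) 2 = X 2 := rfl
  have h3 : (Fin.snoc (α := fun _ => MvPolynomial (Fin 3) ℂ) X 1 : Fin 4 → _) 3 = 1 := rfl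
  rw [h0, h1, h2, h3, one_pow, mul_one, kroneckerPos, ← Polynomial.C_mul_X_pow_eq_monomial]
  simp [kronecker, pow_add, pow_mul]

lemma kronecker_restrictPlane_termsPoly (L : List ((ℕ × ℕ × ℕ × ℕ) × ℂ)) :
    kronecker (restrictPlane (termsPoly L)) =
      termsKronecker (L.filter fun t => t.1.2.2.2 == 0) := by
  induction L with
  | nil => simp [termsPoly, termsKronecker]
  | cons t L ih =>
    have h0 : (Fin.snoc (α := fun _ => MvPolynomial (Fin 3) ℂ) X 0 : Fin 4 → _) 0 = X 0 := rfl
    have h1 : (Fin.snoc (α := fun _ => MvPolynomial (Fin 3) ℂ) X 0 : Fin 4 → _) 1 = X 1 := rfl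
    have h2 : (Fin.snoc (α := fun _ => MvPolynomial (Fin 3) ℂ) X 0 : Fin 4 → _) 2 = X 2 := rfl
    have h3 : (Fin.snoc (α := fun _ => MvPolynomial (Fin 3) ℂ) X 0 : Fin 4 → _) 3 = 0 := rfl
    have ht : kronecker (restrictPlane (monomial (exponentVec t.1) t.2)) =
        if t.1.2.2.2 = 0 then Polynomial.monomial (kroneckerPos t.1) t.2 else 0 := by
      rw [restrictPlane, aeval_monomial_exponentVec, h0, h1, h2, h3, kroneckerPos,
        ← Polynomial.C_mul_X_pow_eq_monomial]
      split_ifs with h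
      · simp [kronecker, pow_add, pow_mul, h]
      · simp [h]
    rw [termsPoly, List.map_cons, List.sum_cons, map_add, map_add, ht, ← termsPoly, ih,
      List.filter_cons]
    by_cases h : t.1.2.2.2 = 0 <;> simp [h, termsKronecker]

end Terms

section RowCheck

/-- Continue with the image of a list under `f`, evaluating all entries first. -/
def forceMap {α β : Type} (f : β → ℕ) (l : List β) : (List ℕ → α) → α :=
  List.rec (fun k => k []) (fun b _ ih k => forceNat (f b) fun x => ih fun t => k (x :: t)) l

lemma forceMap_eq {α β : Type} (f : β → ℕ) (l : List β) (k : List ℕ → α) :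
    forceMap f l k = k (l.map f) := by
  induction l generalizing k with
  | nil => rfl
  | cons b l ih =>
    have e : forceMap f (b :: l) k =
      forceNat (f b) fun x => forceMap f l fun t => k (x :: t) := rfl
    rw [e, forceNat_eq, ih]
    rfl

/-- Pack the Kronecker substitution of a list of terms into a number in base `4096`. -/
def packTerms (L : List ((ℕ × ℕ × ℕ × ℕ) × ℕ)) : ℕ :=
  L.foldr (fun t s => t.2 * 4096 ^ kroneckerPos t.1 + s) 0

/-- The multiples `X ^ e * Gₖ`, for `(k, e)` in `rows`, are independent modulo `31`. -/
def rowsCheck (G : List (List ((ℕ × ℕ × ℕ × ℕ) × ℕ))) (rows : List (ℕ × ℕ)) (cs : List ℕ) : Bool :=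
  forceMap (fun L => foldDigits 734 (foldDigits 734 (packTerms L))) G fun Xs =>
    forceMap (fun p => Nat.shiftLeft (Xs.getD p.1 0) (12 * p.2)) rows (checkIndep 1400 cs)

/-- Size conditions under which `rowsCheck` is meaningful. -/
def rowsBound (G : List (List ((ℕ × ℕ × ℕ × ℕ) × ℕ))) (rows : List (ℕ × ℕ)) : Prop :=
  (∀ L ∈ G, (∀ t ∈ L, kroneckerPos t.1 < 734) ∧ (L.map Prod.snd).sum < 4096) ∧
    ∀ p ∈ rows, p.2 < 666

lemma packed_packTerms {L : List ((ℕ × ℕ × ℕ × ℕ) × ℕ)} {n : ℕ} (hn : 0 < n)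
    (h : ∀ t ∈ L, kroneckerPos t.1 < n) : Packed n (L.map Prod.snd).sum (packTerms L)
      (termsKronecker (termsMap (Nat.castRingHom (ZMod 31)) L)) := by
  refine ⟨termsKronecker L, ?_, (termsKronecker_termsMap _ _).symm, ?_, ?_⟩
  · induction L with
    | nil => simp [termsKronecker, packTerms]
    | cons t L ih =>
      rw [List.forall_mem_cons] at h
      have := ih h.2
      simp [termsKronecker, packTerms] at this ⊢
      exact this
  · induction L with
    | nil => simp [termsKronecker]
    | cons t L ih =>
      intro i
      rw [List.forall_mem_cons] at h
      have := ih h.2 i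
      simp only [termsKronecker, List.map_cons, List.sum_cons, Polynomial.coeff_add,
        Polynomial.coeff_monomial] at this ⊢
      split_ifs <;> omega
  · induction L with
    | nil => simpa [termsKronecker] using hn
    | cons t L ih =>
      rw [List.forall_mem_cons] at h
      rw [termsKronecker, List.map_cons, List.sum_cons]
      exact (Polynomial.natDegree_add_le _ _).trans_lt
        (max_lt ((Polynomial.natDegree_monomial_le _).trans_lt h.1) (ih h.2))

lemma packed_zero {n : ℕ} (hn : 0 < n) (B : ℕ) : Packed n B 0 0 :=
  ⟨0, by simp, by simp, by simp, by simpa using hn⟩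

lemma packed_fold_packTerms {L : List ((ℕ × ℕ × ℕ × ℕ) × ℕ)}
    (h : ∀ t ∈ L, kroneckerPos t.1 < 734) (hB : (L.map Prod.snd).sum < 4096) :
    Packed 734 40 (foldDigits 734 (foldDigits 734 (packTerms L)))
      (termsKronecker (termsMap (Nat.castRingHom (ZMod 31)) L)) :=
  ((((packed_packTerms (by norm_num) h).mono (Nat.lt_succ_iff.mp hB)).foldDigits
    (by norm_num)).foldDigits (by norm_num)).mono (by norm_num)

/-- The monomial at a given Kronecker position. -/
def kroneckerMonomial (e : ℕ) : MvPolynomial (Fin 3) ℂ :=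
  X 0 ^ (e % 11) * X 1 ^ (e / 11 % 11) * X 2 ^ (e / 121)

lemma kronecker_kroneckerMonomial (e : ℕ) :
    kronecker (kroneckerMonomial e) = Polynomial.X ^ e := by
  have : e = e % 11 + 11 * (e / 11 % 11) + 121 * (e / 121) := by omega
  conv_rhs => rw [this]
  simp [kronecker, kroneckerMonomial, pow_add, pow_mul]

lemma linearIndependent_of_rowsCheck {G : List (List ((ℕ × ℕ × ℕ × ℕ) × CoeffRing))}
    {GN : List (List ((ℕ × ℕ × ℕ × ℕ) × ℕ))} {rows : List (ℕ × ℕ)} {cs : List ℕ}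
    (hG : GN.map (termsMap (Nat.castRingHom (ZMod 31))) = G.map (termsMap reduction))
    (hb : rowsBound GN rows) (h : rowsCheck GN rows cs = true)
    {F : ℕ → MvPolynomial (Fin 3) ℂ}
    (hF : ∀ k, kronecker (F k) = termsKronecker (termsMap toComplex (G.getD k []))) :
    LinearIndependent ℂ fun j : Fin rows.length =>
      kroneckerMonomial (rows.get j).2 * F (rows.get j).1 := by
  rw [rowsCheck, forceMap_eq, forceMap_eq] at h
  have hget (k : ℕ) : Packed 734 40
      ((GN.map fun L => foldDigits 734 (foldDigits 734 (packTerms L))).getD k 0)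
      ((termsKronecker (G.getD k [])).map reduction) := by
    rw [← termsKronecker_termsMap]
    have e : termsMap reduction (G.getD k []) =
        termsMap (Nat.castRingHom (ZMod 31)) (GN.getD k []) := by
      have h1 := congrArg (fun l => l.getD k []) hG
      simp only [List.getD_eq_getElem?_getD, List.getElem?_map] at h1 ⊢
      have h2 {R S : Type} (f : R → S) (o : Option (List ((ℕ × ℕ × ℕ × ℕ) × R))) :
          (o.map (termsMap f)).getD [] = termsMap f (o.getD []) := by cases o <;> rfl
      rw [h2, h2] at h1
      exact h1.symm
    rw [e]
    by_cases hk : k < GN.length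
    · have hm := hb.1 (GN.getD k []) (by
        rw [List.getD_eq_getElem _ _ hk]; exact List.getElem_mem hk)
      have := packed_fold_packTerms hm.1 hm.2
      rw [List.getD_eq_getElem _ _ hk] at this ⊢
      rw [List.getD_eq_getElem _ _ (by simpa using hk), List.getElem_map]
      exact this
    · rw [List.getD_eq_default _ _ (by simpa using hk),
        List.getD_eq_default _ _ (by simpa using hk)]
      exact packed_zero (by norm_num) _
  let r (p : ℕ × ℕ) : Polynomial CoeffRing := Polynomial.X ^ p.2 * termsKronecker (G.getD p.1 [])
  have hI := (listIndep_of_checkIndep (gs := rows.map fun p => (r p).map reduction) (by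
    rw [List.forall₂_map_left_iff, List.forall₂_map_right_iff, List.forall₂_same]
    intro p hp
    have := (hget p.1).shiftLeft (n := 1400) p.2 (by have := hb.2 p hp; omega)
    simpa [r] using this) h).linearIndependent
  have hI' : LinearIndependent (ZMod 31)
      fun j : Fin rows.length => (r (rows.get j)).map reduction := by
    have := hI.comp (Fin.cast (by simp) : Fin rows.length → _) (Fin.cast_injective _)
    simpa [Function.comp_def] using this
  have hC := linearIndependent_map_of_linearIndependent_map reduction_surjective
    toComplex_injective hI'
  refine LinearIndependent.of_comp kronecker.toLinearMap ?_
  have hr : (kronecker.toLinearMap ∘ fun j : Fin rows.length =>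
      kroneckerMonomial (rows.get j).2 * F (rows.get j).1) =
      fun j => (r (rows.get j)).map toComplex := by
    funext j
    rw [Function.comp_apply, AlgHom.toLinearMap_apply, map_mul, kronecker_kroneckerMonomial, hF,
      termsKronecker_termsMap]
    simp [r]
  rw [hr]
  exact hC

end RowCheck

section Sextic

/-- Cyclically permute the first three exponents. -/
def rotateExponent (e : ℕ × ℕ × ℕ × ℕ) : ℕ × ℕ × ℕ × ℕ := (e.2.1, e.2.2.1, e.1, e.2.2.2)

/-- Terms of the sextic fixed by the cyclic permutation. -/
def sexticFixedTerms : List ((ℕ × ℕ × ℕ × ℕ) × CoeffRing) :=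
  [((1, 1, 1, 3), CoeffRing.mk 6 9 15 12),
   ((2, 2, 2, 0), CoeffRing.mk (-408) (-252) (-186) (-132))]

/-- Representatives of the nontrivial cyclic orbits of terms of the sextic. -/
def sexticOrbitTerms : List ((ℕ × ℕ × ℕ × ℕ) × CoeffRing) :=
  [((0, 0, 3, 3), CoeffRing.mk 3 0 2 (-1)), ((0, 0, 4, 2), CoeffRing.mk (-9) 0 (-6) 3),
   ((0, 0, 5, 1), CoeffRing.mk 9 0 6 (-3)), ((0, 0, 6, 0), CoeffRing.mk (-3) 0 (-2) 1),
   ((0, 1, 2, 3), CoeffRing.mk 9 (-3) 6 0), ((0, 1, 3, 2), CoeffRing.mk (-42) 12 (-24) 6),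
   ((0, 1, 4, 1), CoeffRing.mk 57 (-15) 30 (-12)), ((0, 1, 5, 0), CoeffRing.mk (-24) 6 (-12) 6),
   ((0, 2, 1, 3), CoeffRing.mk 6 3 0 3), ((0, 2, 2, 2), CoeffRing.mk (-57) (-6) (-18) (-9)),
   ((0, 2, 3, 1), CoeffRing.mk 120 (-6) 42 (-6)), ((0, 2, 4, 0), CoeffRing.mk (-69) 9 (-24) 12),
   ((0, 3, 1, 2), CoeffRing.mk (-30) (-12) 0 (-6)), ((0, 3, 2, 1), CoeffRing.mk 102 30 6 12),
   ((0, 3, 3, 0), CoeffRing.mk (-87) (-12) (-13) 7), ((0, 4, 1, 1), CoeffRing.mk 42 15 0 3),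
   ((0, 4, 2, 0), CoeffRing.mk (-54) (-21) 6 (-3)), ((0, 5, 1, 0), CoeffRing.mk (-18) (-6) 0 0),
   ((1, 1, 2, 2), CoeffRing.mk (-87) (-48) (-69) (-57)),
   ((1, 1, 3, 1), CoeffRing.mk 201 69 90 57),
   ((1, 1, 4, 0), CoeffRing.mk (-120) (-30) (-36) (-12)),
   ((1, 2, 2, 1), CoeffRing.mk 306 168 168 138),
   ((1, 2, 3, 0), CoeffRing.mk (-270) (-105) (-105) (-48)),
   ((1, 3, 2, 0), CoeffRing.mk (-258) (-129) (-81) (-60))]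

/-- The terms of a sextic with ten triple points. -/
def sexticTerms : List ((ℕ × ℕ × ℕ × ℕ) × CoeffRing) :=
  sexticFixedTerms ++ sexticOrbitTerms.flatMap fun t =>
    [t, (rotateExponent t.1, t.2), (rotateExponent (rotateExponent t.1), t.2)]

/-- The ten triple points. -/
def triplePoint : Fin 10 → CoeffRing × CoeffRing × CoeffRing × CoeffRing :=
  ![(CoeffRing.mk 0 0 0 0, CoeffRing.mk 0 0 0 0, CoeffRing.mk 0 0 0 0, CoeffRing.mk 1 0 0 0),
    (CoeffRing.mk 1 0 0 0, CoeffRing.mk 0 0 0 0, CoeffRing.mk 0 0 0 0, CoeffRing.mk 1 0 0 0),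
    (CoeffRing.mk 0 0 0 0, CoeffRing.mk 1 0 0 0, CoeffRing.mk 0 0 0 0, CoeffRing.mk 1 0 0 0),
    (CoeffRing.mk 0 0 0 0, CoeffRing.mk 0 0 0 0, CoeffRing.mk 1 0 0 0, CoeffRing.mk 1 0 0 0),
    (CoeffRing.mk 1 0 0 0, CoeffRing.mk 1 0 0 0, CoeffRing.mk 0 0 1 0, CoeffRing.mk 3 0 1 0),
    (CoeffRing.mk 1 0 0 0, CoeffRing.mk 0 0 1 0, CoeffRing.mk 1 0 0 0, CoeffRing.mk 3 0 1 0),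
    (CoeffRing.mk 0 0 1 0, CoeffRing.mk 1 0 0 0, CoeffRing.mk 1 0 0 0, CoeffRing.mk 3 0 1 0),
    (CoeffRing.mk 1 0 0 0, CoeffRing.mk (-1) 0 0 0, CoeffRing.mk 0 1 0 1, CoeffRing.mk 1 1 0 1),
    (CoeffRing.mk (-1) 0 0 0, CoeffRing.mk 0 1 0 1, CoeffRing.mk 1 0 0 0, CoeffRing.mk 1 1 0 1),
    (CoeffRing.mk 0 1 0 1, CoeffRing.mk 1 0 0 0, CoeffRing.mk (-1) 0 0 0, CoeffRing.mk 1 1 0 1)]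

/-- Continue with the value of `n`, evaluating it first. -/
def forceInt {α : Type} (n : ℤ) (k : ℤ → α) : α :=
  Int.rec (fun m => forceNat m fun m => k (Int.ofNat m))
    (fun m => forceNat m fun m => k (Int.negSucc m)) n

lemma forceInt_eq {α : Type} (n : ℤ) (k : ℤ → α) : forceInt n k = k n := by
  cases n with
  | ofNat m => exact forceNat_eq m fun m => k (Int.ofNat m)
  | negSucc m => exact forceNat_eq m fun m => k (Int.negSucc m)

/-- Continue with the value of `x`, evaluating it first. -/
def forceCoeff {α : Type} (x : CoeffRing) (k : CoeffRing → α) : α :=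
  forceInt x.re.re fun a => forceInt x.re.im fun b => forceInt x.im.re fun c =>
    forceInt x.im.im fun d => k (CoeffRing.mk a b c d)

lemma forceCoeff_eq {α : Type} (x : CoeffRing) (k : CoeffRing → α) : forceCoeff x k = k x := by
  simp [forceCoeff, forceInt_eq]

/-- Continue with `y * x ^ n`, evaluating it first. -/
def forceMulPow {α : Type} (x : CoeffRing) (n : ℕ) : CoeffRing → (CoeffRing → α) → α :=
  Nat.rec (fun y k => k y) (fun _ ih y k => forceCoeff (y * x) fun z => ih z k) n

lemma forceMulPow_eq {α : Type} (x : CoeffRing) (n : ℕ) (y : CoeffRing) (k : CoeffRing → α) :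
    forceMulPow x n y k = k (y * x ^ n) := by
  induction n generalizing y with
  | zero =>
    have e : forceMulPow x 0 y k = k y := rfl
    rw [e, pow_zero, mul_one]
  | succ n ih =>
    have e : forceMulPow x (n + 1) y k = forceCoeff (y * x) fun z => forceMulPow x n z k := rfl
    rw [e, forceCoeff_eq, ih, pow_succ', mul_assoc]

/-- Continue with `s` plus the value of a list of terms, evaluating it first. -/
def forceTermsEval {α : Type} (P : CoeffRing × CoeffRing × CoeffRing × CoeffRing)
    (L : List ((ℕ × ℕ × ℕ × ℕ) × CoeffRing)) : CoeffRing → (CoeffRing → α) → α :=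
  List.rec (fun s k => k s) (fun t _ ih s k =>
    forceCoeff t.2 fun c => forceMulPow P.1 t.1.1 c fun c => forceMulPow P.2.1 t.1.2.1 c fun c =>
      forceMulPow P.2.2.1 t.1.2.2.1 c fun c => forceMulPow P.2.2.2 t.1.2.2.2 c fun c =>
        forceCoeff (s + c) fun s => ih s k) L

lemma forceTermsEval_eq {α : Type} (P : CoeffRing × CoeffRing × CoeffRing × CoeffRing)
    (L : List ((ℕ × ℕ × ℕ × ℕ) × CoeffRing)) (s : CoeffRing) (k : CoeffRing → α) :
    forceTermsEval P L s k = k (s + termsEval P L) := by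
  induction L generalizing s with
  | nil =>
    have e : forceTermsEval P [] s k = k s := rfl
    simp [e, termsEval]
  | cons t L ih =>
    have e : forceTermsEval P (t :: L) s k =
      forceCoeff t.2 fun c => forceMulPow P.1 t.1.1 c fun c => forceMulPow P.2.1 t.1.2.1 c fun c =>
        forceMulPow P.2.2.1 t.1.2.2.1 c fun c => forceMulPow P.2.2.2 t.1.2.2.2 c fun c =>
          forceCoeff (s + c) fun s => forceTermsEval P L s k := rfl
    rw [e]
    simp only [forceCoeff_eq, forceMulPow_eq, ih, termsEval, List.map_cons, List.sum_cons]
    congr 1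
    ring

/-- Continue with a list of terms, evaluating the exponents and coefficients first. -/
def forceTerms {α : Type} (L : List ((ℕ × ℕ × ℕ × ℕ) × CoeffRing)) :
    (List ((ℕ × ℕ × ℕ × ℕ) × CoeffRing) → α) → α :=
  List.rec (fun k => k []) (fun t _ ih k =>
    forceNat t.1.1 fun a => forceNat t.1.2.1 fun b => forceNat t.1.2.2.1 fun c =>
      forceNat t.1.2.2.2 fun d => forceCoeff t.2 fun x => ih fun L => k (((a, b, c, d), x) :: L)) L

lemma forceTerms_eq {α : Type} (L : List ((ℕ × ℕ × ℕ × ℕ) × CoeffRing))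
    (k : List ((ℕ × ℕ × ℕ × ℕ) × CoeffRing) → α) : forceTerms L k = k L := by
  induction L generalizing k with
  | nil => rfl
  | cons t L ih =>
    have e : forceTerms (t :: L) k =
      forceNat t.1.1 fun a => forceNat t.1.2.1 fun b => forceNat t.1.2.2.1 fun c =>
        forceNat t.1.2.2.2 fun d => forceCoeff t.2 fun x =>
          forceTerms L fun L => k (((a, b, c, d), x) :: L) := rfl
    rw [e]
    simp only [forceCoeff_eq, forceNat_eq, ih]

/-- Whether an element of `CoeffRing` is zero. -/
def isZeroCoeff (x : CoeffRing) : Bool :=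
  decide (x.re.re = 0) && decide (x.re.im = 0) && decide (x.im.re = 0) && decide (x.im.im = 0)

lemma eq_zero_of_isZeroCoeff {x : CoeffRing} (h : isZeroCoeff x = true) : x = 0 := by
  simp only [isZeroCoeff, Bool.and_eq_true, decide_eq_true_eq] at h
  obtain ⟨⟨⟨h1, h2⟩, h3⟩, h4⟩ := h
  ext <;> assumption

/-- All second partial derivatives vanish at all the given points. -/
def tripleCheck (L : List ((ℕ × ℕ × ℕ × ℕ) × CoeffRing)) : Bool :=
  (List.range 4).all fun i => (List.range (i + 1)).all fun j =>
    forceTerms (termsDeriv i (termsDeriv j L)) fun L' => (List.finRange 10).all fun m =>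
      forceTermsEval (triplePoint m) L' 0 isZeroCoeff

set_option maxRecDepth 100000 in
lemma tripleCheck_sexticTerms : tripleCheck sexticTerms = true := by decide +kernel

end Sextic

section FormsAndRows

lemma homogeneousSubmodule_le_span {N d : ℕ} {v : Fin N → MvPolynomial (Fin 3) ℂ}
    (hli : LinearIndependent ℂ v) (hv : ∀ j, (v j).IsHomogeneous d)
    (hN : N = Nat.multichoose 3 d) :
    homogeneousSubmodule (Fin 3) ℂ d ≤ Submodule.span ℂ (Set.range v) := by
  have hfin : Module.finrank ℂ (homogeneousSubmodule (Fin 3) ℂ d) = N := by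
    rw [finrank_homogeneousSubmodule, hN]
  have hle : Submodule.span ℂ (Set.range v) ≤ homogeneousSubmodule (Fin 3) ℂ d := by
    rw [Submodule.span_le]
    rintro _ ⟨j, rfl⟩
    exact hv j
  refine (Submodule.eq_of_le_of_finrank_eq hle ?_).ge
  rw [hfin, finrank_span_eq_card hli, Fintype.card_fin]

lemma eq_zero_of_eval_eq_zero {N d : ℕ} {v : Fin N → MvPolynomial (Fin 3) ℂ}
    (hli : LinearIndependent ℂ v) (hv : ∀ j, (v j).IsHomogeneous d)
    (hN : N = Nat.multichoose 3 d) {x : Fin 3 → ℂ} (hx : ∀ j, eval x (v j) = 0) : x = 0 := by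
  funext i
  have h1 : Submodule.span ℂ (Set.range v) ≤ LinearMap.ker (aeval (R := ℂ) x).toLinearMap := by
    rw [Submodule.span_le]
    rintro _ ⟨j, rfl⟩
    simpa [coe_aeval_eq_eval] using hx j
  have h2 := h1 (homogeneousSubmodule_le_span hli hv hN
    (isHomogeneous_X_pow (R := ℂ) i d))
  have h3 : x i ^ d = 0 := by simpa using h2
  exact eq_zero_of_pow_eq_zero h3

lemma top_le_degreeLT_sup {d : ℕ} {S : Submodule ℂ (MvPolynomial (Fin 3) ℂ)}
    (hS : ∀ i, ∀ p ∈ S, X i * p ∈ S)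
    (h : homogeneousSubmodule (Fin 3) ℂ d ≤ degreeLT (Fin 3) d ⊔ S) :
    ⊤ ≤ degreeLT (Fin 3) d ⊔ S := by
  have key (k : ℕ) : homogeneousSubmodule (Fin 3) ℂ (d + k) ≤ degreeLT (Fin 3) (d + k) ⊔ S := by
    induction k with
    | zero => exact h
    | succ k ih =>
      intro p hp
      rw [p.as_sum]
      refine Submodule.sum_mem _ fun s hs => ?_
      have hs' : s.degree = d + k + 1 := by
        have := isHomogeneous_iff_degree.mp ((mem_homogeneousSubmodule _ _).mp hp) s
          (mem_support_iff.mp hs)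
        omega
      obtain ⟨i, hi⟩ : ∃ i, s i ≠ 0 := by
        by_contra! hcon
        have : s = 0 := Finsupp.ext hcon
        simp [this] at hs'
      have hsi : Finsupp.single i 1 ≤ s := by
        rw [Finsupp.single_le_iff]; omega
      have hs2 := tsub_add_cancel_of_le hsi
      have hdeg : (s - Finsupp.single i 1).degree = d + k := by
        have := congrArg Finsupp.degree hs2
        rw [map_add, Finsupp.degree_single] at this
        omega
      have e : monomial s (coeff s p) =
          X i * monomial (s - Finsupp.single i 1) (coeff s p) := by
        rw [mul_comm, X, monomial_mul, hs2, mul_one]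
      rw [e]
      obtain ⟨l, hl, q, hq, hlq⟩ := Submodule.mem_sup.mp
        (ih (isHomogeneous_monomial (coeff s p) hdeg))
      rw [← hlq, mul_add]
      refine Submodule.add_mem_sup ?_ (hS i q hq)
      have hX : (X i : MvPolynomial (Fin 3) ℂ) ∈ degreeLT (Fin 3) (1 + 1) :=
        (isHomogeneous_X ℂ i).mem_degreeLT
      have := mul_mem_degreeLT hl hX
      rwa [mul_comm] at this
  have hle (k : ℕ) : degreeLT (Fin 3) (d + k) ≤ degreeLT (Fin 3) d ⊔ S := by
    induction k with
    | zero => exact le_sup_left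
    | succ k ih =>
      intro p hp
      have h1 := ih (x := p - homogeneousComponent (d + k) p)
      have h2 := key k (homogeneousComponent_mem (d + k) p)
      have h3 := sup_le ih le_sup_right h2
      have := Submodule.add_mem _ (h1 (sub_homogeneousComponent_mem hp)) h3
      rwa [sub_add_cancel] at this
  intro p _
  obtain ⟨k, hk⟩ := exists_mem_degreeLT p
  exact hle k (degreeLT_mono (by omega) hk)

lemma restrictPlane_rename (g : MvPolynomial (Fin 3) ℂ) :
    restrictPlane (rename Fin.castSucc g) = g := by
  rw [restrictPlane, aeval_rename]
  have : (Fin.snoc (α := fun _ => MvPolynomial (Fin 3) ℂ) X 0 : Fin 4 → _) ∘ Fin.castSucc = X :=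
    funext fun i => Fin.snoc_castSucc (α := fun _ => MvPolynomial (Fin 3) ℂ) _ _ _
  rw [this, aeval_X_left_apply]

lemma restrictPlane_X_three : restrictPlane (X 3) = 0 := by
  rw [restrictPlane, aeval_X]; rfl

lemma restrictPlane_expansion (d : ℕ) (g : ℕ → MvPolynomial (Fin 3) ℂ) :
    restrictPlane (∑ j ∈ Finset.range (d + 1), (X 3) ^ (d - j) * rename Fin.castSucc (g j)) =
      g d := by
  rw [map_sum, Finset.sum_range_succ, Finset.sum_eq_zero]
  · rw [map_mul, restrictPlane_rename, Nat.sub_self, pow_zero, map_one, one_mul, zero_add]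
  · intro j hj
    have : d - j ≠ 0 := by have := Finset.mem_range.mp hj; omega
    rw [map_mul, map_pow, restrictPlane_X_three, zero_pow this, zero_mul]

lemma restrictPlane_isHomogeneous {P : MvPolynomial (Fin 4) ℂ} {d : ℕ} (hP : P.IsHomogeneous d) :
    (restrictPlane P).IsHomogeneous d := by
  obtain ⟨g, hg, rfl⟩ := exists_castSucc_expansion hP
  rw [restrictPlane_expansion]
  exact hg d

lemma dehom_sub_restrictPlane_mem {P : MvPolynomial (Fin 4) ℂ} {d : ℕ} (hP : P.IsHomogeneous d) :
    dehom P - restrictPlane P ∈ degreeLT (Fin 3) d := by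
  obtain ⟨g, hg, rfl⟩ := exists_castSucc_expansion hP
  rw [restrictPlane_expansion, dehom_expansion, Finset.sum_range_succ, add_sub_cancel_right]
  exact Submodule.sum_mem _ fun j hj => (hg j).degreeLT_of_lt (Finset.mem_range.mp hj)

lemma eval_restrictPlane (P : MvPolynomial (Fin 4) ℂ) {x : Fin 4 → ℂ} (hx : x 3 = 0) :
    eval (fun i : Fin 3 => x i.castSucc) (restrictPlane P) = eval x P := by
  induction P using MvPolynomial.induction_on with
  | C a => simp [restrictPlane]
  | add p q hp hq => rw [map_add, map_add, map_add, hp, hq]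
  | mul_X p i hp =>
    rw [map_mul, map_mul, map_mul, hp]
    congr 1
    refine Fin.lastCases ?_ (fun k => ?_) i
    · rw [show Fin.last 3 = 3 from rfl, restrictPlane_X_three, map_zero, eval_X, hx]
    · rw [restrictPlane, aeval_X, Fin.snoc_castSucc (α := fun _ => MvPolynomial (Fin 3) ℂ),
        eval_X, eval_X]

end FormsAndRows

section RankData

/-- A natural number representing the reduction of an element of `CoeffRing`. -/
def residue (x : CoeffRing) : ℕ :=
  ((x.re.re + 19 * x.re.im + 5 * x.im.re + 95 * x.im.im) % 31).toNat

lemma residue_cast (x : CoeffRing) : ((residue x : ℕ) : ZMod 31) = reduction x := by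
  have h : (((residue x : ℕ) : ℤ) : ZMod 31) = reduction x := by
    rw [residue, Int.toNat_of_nonneg (Int.emod_nonneg _ (by norm_num)), reduction,
      CoeffRing.hom_apply]
    have : (31 : ZMod 31) = 0 := rfl
    rw [show (31 : ℤ) = ((31 : ℕ) : ℤ) from rfl, ZMod.intCast_mod]
    push_cast
    ring
  rw [← h, Int.cast_natCast]

lemma termsMap_residue (L : List ((ℕ × ℕ × ℕ × ℕ) × CoeffRing)) :
    termsMap (Nat.castRingHom (ZMod 31)) (termsMap residue L) = termsMap reduction L := by
  simp [termsMap, Function.comp_def, residue_cast]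

lemma quadMap_residue (P : CoeffRing × CoeffRing × CoeffRing × CoeffRing) :
    quadMap (Nat.castRingHom (ZMod 31)) (quadMap residue P) = quadMap reduction P := by
  simp [quadMap, residue_cast]

/-- The exponents of the product of two of the variables. -/
def pairExponent (a b : ℕ) : ℕ × ℕ × ℕ × ℕ :=
  ((if a = 0 then 1 else 0) + (if b = 0 then 1 else 0),
    (if a = 1 then 1 else 0) + (if b = 1 then 1 else 0),
    (if a = 2 then 1 else 0) + (if b = 2 then 1 else 0), 0)

/-- The first three partial derivatives of the cubic form on the first three coordinates given
by third partial derivatives, where `ev` is evaluation at a point. -/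
def polarQuadrics {R : Type} (ev : List ((ℕ × ℕ × ℕ × ℕ) × CoeffRing) → R)
    (L : List ((ℕ × ℕ × ℕ × ℕ) × CoeffRing)) : List (List ((ℕ × ℕ × ℕ × ℕ) × R)) :=
  (List.range 3).map fun i => (List.range 3).flatMap fun a => (List.range 3).map fun b =>
    (pairExponent a b, ev (termsDeriv a (termsDeriv b (termsDeriv i L))))

/-- Evaluation at a point, modulo `31`. -/
def residueEval (P : CoeffRing × CoeffRing × CoeffRing × CoeffRing)
    (L : List ((ℕ × ℕ × ℕ × ℕ) × CoeffRing)) : ℕ :=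
  termsEval (quadMap residue P) (termsMap residue L) % 31

lemma residueEval_cast (P : CoeffRing × CoeffRing × CoeffRing × CoeffRing)
    (L : List ((ℕ × ℕ × ℕ × ℕ) × CoeffRing)) :
    ((residueEval P L : ℕ) : ZMod 31) = reduction (termsEval P L) := by
  rw [residueEval, natCast_mod_thirtyOne, ← termsEval_termsMap, ← termsMap_residue,
    ← quadMap_residue, termsEval_termsMap]
  rfl

lemma polarQuadrics_residueEval (P : CoeffRing × CoeffRing × CoeffRing × CoeffRing)
    (L : List ((ℕ × ℕ × ℕ × ℕ) × CoeffRing)) :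
    (polarQuadrics (residueEval P) L).map (termsMap (Nat.castRingHom (ZMod 31))) =
      (polarQuadrics (termsEval P) L).map (termsMap reduction) := by
  simp [polarQuadrics, termsMap, Function.comp_def, residueEval_cast, List.map_flatMap]

/-- Multiples of the polar quadrics spanning the quartic forms. -/
def quadricRows : List (ℕ × ℕ) :=
  [(0, 2), (1, 2), (2, 2), (0, 12), (1, 12), (2, 12), (0, 122), (1, 122), (2, 122), (0, 22),
   (1, 22), (2, 22), (0, 132), (1, 132), (0, 242)]

/-- Pivots for `quadricRows`. -/
def quadricPivots : List ℕ :=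
  [244, 134, 124, 254, 144, 34, 364, 24, 14, 264, 154, 44, 374, 4, 484]

/-- The partial derivatives of the sextic. -/
def sexticPartials : List (List ((ℕ × ℕ × ℕ × ℕ) × CoeffRing)) :=
  (List.range 4).map fun i => termsDeriv i sexticTerms

/-- The restrictions of the partial derivatives of the sextic to the plane at infinity. -/
def sexticPartialsInfinity : List (List ((ℕ × ℕ × ℕ × ℕ) × CoeffRing)) :=
  sexticPartials.map (List.filter fun t => t.1.2.2.2 == 0)

/-- Multiples of the restricted partial derivatives spanning the forms of degree nine. -/
def planeRows : List (ℕ × ℕ) :=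
  [(0, 4), (1, 4), (2, 4), (3, 4), (0, 14), (1, 14), (2, 14), (3, 14), (0, 124), (1, 124),
   (2, 124), (3, 124), (0, 24), (1, 24), (2, 24), (3, 24), (0, 134), (1, 134), (2, 134), (3, 134),
   (0, 244), (1, 244), (2, 244), (3, 244), (0, 34), (1, 34), (2, 34), (3, 34), (0, 144), (1, 144),
   (2, 144), (3, 144), (0, 254), (1, 254), (2, 254), (3, 254), (0, 364), (1, 364), (2, 364),
   (3, 364), (0, 44), (1, 44), (2, 44), (3, 44), (0, 154), (1, 154), (2, 154), (3, 154), (0, 264),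
   (1, 264), (2, 264), (3, 264), (0, 374), (1, 374), (0, 484)]

/-- Pivots for `planeRows`. -/
def planePivots : List ℕ :=
  [609, 499, 489, 389, 619, 509, 399, 379, 729, 369, 289, 279, 629, 519, 409, 269, 739, 299, 259,
   249, 849, 189, 179, 169, 639, 529, 419, 199, 749, 309, 159, 149, 859, 139, 129, 89, 969, 79,
   69, 59, 649, 539, 429, 209, 759, 319, 49, 99, 869, 39, 29, 19, 979, 9, 1089]

/-- Independent multiples of the dehomogenized partial derivatives. -/
def affineRows : List (ℕ × ℕ) :=
  [(0, 0), (1, 0), (2, 0), (3, 0), (0, 1), (1, 1), (2, 1), (3, 1), (0, 11), (1, 11), (2, 11),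
   (3, 11), (0, 121), (1, 121), (2, 121), (3, 121), (0, 2), (1, 2), (2, 2), (3, 2), (0, 12),
   (1, 12), (2, 12), (3, 12), (0, 122), (1, 122), (2, 122), (3, 122), (0, 22), (1, 22), (2, 22),
   (3, 22), (0, 132), (1, 132), (2, 132), (3, 132), (0, 242), (1, 242), (2, 242), (3, 242),
   (0, 3), (1, 3), (2, 3), (3, 3), (0, 13), (1, 13), (2, 13), (3, 13), (0, 123), (1, 123),
   (2, 123), (3, 123), (0, 23), (1, 23), (2, 23), (3, 23), (0, 133), (1, 133), (2, 133), (3, 133),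
   (0, 243), (1, 243), (2, 243), (3, 243), (0, 33), (1, 33), (2, 33), (3, 33), (0, 143), (1, 143),
   (2, 143), (3, 143), (0, 253), (1, 253), (2, 253), (3, 253), (0, 363), (1, 363), (2, 363),
   (3, 363), (0, 4), (1, 4), (2, 4), (3, 4), (0, 14), (1, 14), (2, 14), (3, 14), (0, 124),
   (1, 124), (2, 124), (3, 124), (0, 24), (1, 24), (2, 24), (3, 24), (0, 134), (1, 134), (2, 134),
   (3, 134), (0, 244), (1, 244), (2, 244), (3, 244), (0, 34), (1, 34), (2, 34), (3, 34), (0, 144),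
   (1, 144), (2, 144), (3, 144), (0, 254), (1, 254), (2, 254), (3, 254), (0, 364), (1, 364),
   (2, 364), (3, 364), (0, 44), (1, 44), (2, 44), (3, 44), (0, 154), (1, 154), (2, 154), (3, 154),
   (0, 264), (1, 264), (2, 264), (3, 264), (0, 374), (1, 374), (2, 374), (3, 374), (0, 484),
   (1, 484), (2, 484), (0, 5), (1, 5), (2, 5), (3, 5), (0, 15), (1, 15), (2, 15), (3, 15),
   (0, 125), (1, 125), (2, 125), (3, 125), (0, 25), (1, 25), (2, 25), (3, 25), (0, 135), (1, 135),
   (2, 135), (3, 135), (0, 245), (1, 245), (2, 245), (3, 245), (0, 35), (1, 35), (2, 35), (3, 35),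
   (0, 145), (1, 145), (2, 145), (3, 145), (0, 255), (1, 255), (2, 255), (3, 255), (0, 365),
   (1, 365), (2, 365), (3, 365), (0, 45), (1, 45), (2, 45), (3, 45), (0, 155), (1, 155), (2, 155),
   (3, 155), (0, 265), (1, 265), (2, 265), (3, 265), (0, 375), (1, 375), (2, 375), (0, 485),
   (0, 55), (1, 55), (2, 55), (3, 55), (0, 165), (1, 165), (3, 165), (0, 275), (0, 385), (0, 495),
   (0, 605)]

/-- Pivots for `affineRows`. -/
def affinePivots : List ℕ :=
  [605, 495, 485, 484, 606, 496, 486, 386, 616, 506, 396, 385, 726, 376, 375, 374, 607, 497, 487,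
   387, 617, 507, 397, 377, 727, 367, 366, 364, 627, 517, 407, 365, 737, 297, 287, 286, 847, 277,
   276, 275, 608, 498, 488, 388, 618, 508, 398, 378, 728, 368, 288, 278, 628, 518, 408, 268, 738,
   298, 267, 266, 848, 265, 264, 258, 638, 528, 418, 257, 748, 308, 256, 255, 858, 254, 253, 248,
   968, 247, 245, 246, 609, 499, 489, 389, 619, 509, 399, 379, 729, 369, 289, 279, 629, 519, 409,
   269, 739, 299, 259, 249, 849, 244, 243, 198, 639, 529, 419, 199, 749, 309, 189, 188, 859, 187,
   179, 178, 969, 177, 176, 169, 649, 539, 429, 209, 759, 319, 168, 167, 869, 166, 165, 159, 979,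
   158, 157, 156, 1089, 155, 149, 610, 500, 490, 390, 620, 510, 400, 380, 730, 370, 290, 280, 630,
   520, 410, 270, 740, 300, 260, 250, 850, 190, 180, 170, 640, 530, 420, 200, 750, 310, 160, 150,
   860, 148, 147, 146, 970, 145, 144, 140, 650, 540, 430, 210, 760, 320, 139, 138, 870, 137, 136,
   135, 980, 130, 100, 1090, 660, 550, 440, 220, 770, 330, 110, 880, 990, 1100, 1210]

set_option maxRecDepth 100000 in
lemma rowsCheck_planeRows : rowsCheck (sexticPartialsInfinity.map (termsMap residue)) planeRows
    planePivots = true := by decide +kernel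

set_option maxRecDepth 100000 in
lemma rowsCheck_affineRows : rowsCheck (sexticPartials.map (termsMap residue)) affineRows
    affinePivots = true := by decide +kernel

set_option maxRecDepth 100000 in
lemma rowsCheck_quadricRows : ∀ m : Fin 10, rowsCheck
    (polarQuadrics (residueEval (triplePoint m)) sexticTerms) quadricRows quadricPivots = true := by
  decide +kernel

set_option maxRecDepth 100000 in
lemma rowsBound_planeRows :
    rowsBound (sexticPartialsInfinity.map (termsMap residue)) planeRows := by
  unfold rowsBound; decide +kernel

set_option maxRecDepth 100000 in
lemma rowsBound_affineRows : rowsBound (sexticPartials.map (termsMap residue)) affineRows := by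
  unfold rowsBound; decide +kernel

set_option maxRecDepth 100000 in
lemma rowsBound_quadricRows : ∀ m : Fin 10, rowsBound
    (polarQuadrics (residueEval (triplePoint m)) sexticTerms) quadricRows := by
  unfold rowsBound; decide +kernel

end RankData

section TenPointBound

variable {f : MvPolynomial (Fin 4) ℂ}

/-- The ideal of the dehomogenized partial derivatives. -/
def affineIdeal (f : MvPolynomial (Fin 4) ℂ) : Ideal (MvPolynomial (Fin 3) ℂ) :=
  Ideal.span (Set.range fun i => dehom (pderiv i f))

lemma dehom_pderiv_mem_affineIdeal (i : Fin 4) : dehom (pderiv i f) ∈ affineIdeal f :=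
  Ideal.subset_span ⟨i, rfl⟩

lemma finrank_le_of_rows {N k d : ℕ} {v : Fin N → MvPolynomial (Fin 3) ℂ}
    (hli : LinearIndependent ℂ v) (hd : ∀ j, v j ∈ degreeLT (Fin 3) (k + 1))
    (hv : ∀ j, v j ∈ affineIdeal f) (hdk : d ≤ k + 1)
    (htop : ⊤ ≤ degreeLT (Fin 3) d ⊔ (affineIdeal f).restrictScalars ℂ)
    {V : Type*} [AddCommGroup V] [Module ℂ V] {φ : MvPolynomial (Fin 3) ℂ →ₗ[ℂ] V}
    (hφ : Function.Surjective φ) (h0 : ∀ t ∈ affineIdeal f, φ t = 0) :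
    N + Module.finrank ℂ V ≤ Nat.multichoose 4 k := by
  let ψ := φ ∘ₗ (degreeLT (Fin 3) (k + 1)).subtype
  have hψ : LinearMap.range ψ = ⊤ := by
    rw [LinearMap.range_eq_top]
    intro y
    obtain ⟨t, rfl⟩ := hφ y
    obtain ⟨a, ha, b, hb, rfl⟩ := Submodule.mem_sup.mp (htop (Submodule.mem_top (x := t)))
    exact ⟨⟨a, degreeLT_mono hdk ha⟩, by
      rw [map_add, h0 b (Submodule.restrictScalars_mem ℂ _ _ |>.mp hb), add_zero]; rfl⟩
  have h1 := LinearMap.finrank_range_add_finrank_ker ψ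
  rw [hψ, finrank_top, finrank_degreeLT] at h1
  let v' : Fin N → LinearMap.ker ψ := fun j => ⟨⟨v j, hd j⟩, h0 _ (hv j)⟩
  have hli' : LinearIndependent ℂ v' :=
    LinearIndependent.of_comp ((degreeLT (Fin 3) (k + 1)).subtype ∘ₗ (LinearMap.ker ψ).subtype) hli
  have h2 := hli'.fintype_card_le_finrank
  rw [Fintype.card_fin] at h2
  omega

lemma exists_eq_of_singular {ι : Type*} [Fintype ι] {N k d : ℕ}
    {v : Fin N → MvPolynomial (Fin 3) ℂ}
    (hli : LinearIndependent ℂ v) (hd : ∀ j, v j ∈ degreeLT (Fin 3) (k + 1))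
    (hv : ∀ j, v j ∈ affineIdeal f) (hdk : d ≤ k + 1)
    (htop : ⊤ ≤ degreeLT (Fin 3) d ⊔ (affineIdeal f).restrictScalars ℂ)
    (hf : f.IsHomogeneous 6) {p : ι → Fin 4 → ℂ} (hp : Function.Injective p)
    (h1 : ∀ j, p j 3 = 1) (h2 : ∀ j u v, eval (p j) (dirDeriv u (dirDeriv v f)) = 0)
    (hN : Nat.multichoose 4 k ≤ N + 8 * Fintype.card ι)
    {s : Fin 4 → ℂ} (hs3 : s 3 = 1) (hs : ∀ i, eval s (pderiv i f) = 0) : ∃ j, s = p j := by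
  by_contra! hcon
  have hdiff (j : ι) : ∃ i : Fin 3, s i.castSucc ≠ p j i.castSucc := by
    by_contra! h
    refine hcon j (funext fun i => ?_)
    refine Fin.lastCases ?_ (fun l => h l) i
    exact hs3.trans (h1 j).symm
  choose i hi using hdiff
  let s' : Fin 3 → ℂ := fun l => s l.castSucc
  have hss : Fin.snoc s' 1 = s := by
    rw [← hs3]; exact Fin.snoc_init_self s
  let r : MvPolynomial (Fin 3) ℂ := ∏ j, (X (i j) - C (p j (i j).castSucc)) ^ 4
  have hr (j : ι) : r ∈ localIdeal f (p j) :=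
    Ideal.mem_of_dvd _ (Finset.dvd_prod_of_mem _ (Finset.mem_univ j)) (pow_mem_localIdeal (i j))
  have hrs : eval s' r ≠ 0 := by
    rw [map_prod]
    refine Finset.prod_ne_zero_iff.mpr fun j _ => ?_
    rw [map_pow, map_sub, eval_X, eval_C]
    exact pow_ne_zero _ (sub_ne_zero.mpr (hi j))
  have hle := finrank_le_of_rows hli hd hv hdk htop
    (φ := (localEval f p).prod (aeval (R := ℂ) s').toLinearMap) ?_ ?_
  · have := mul_card_le_finrank hf h1 h2
    rw [Module.finrank_prod, Module.finrank_self] at hle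
    omega
  · rintro ⟨y, c⟩
    obtain ⟨t, rfl⟩ := localEval_surjective (f := f) hp h1 y
    refine ⟨t + ((c - eval s' t) / eval s' r) • r, Prod.ext ?_ ?_⟩
    · simp [localEval_eq_zero hr]
    · simp [hrs]
  · intro t ht
    refine Prod.ext (localEval_eq_zero fun j => ?_) ?_
    · refine (Ideal.span_le.mpr ?_ : affineIdeal f ≤ _) ht
      rintro _ ⟨l, rfl⟩
      exact dehom_pderiv_mem_localIdeal (h1 j) hf (h2 j) l
    · have hle : affineIdeal f ≤ RingHom.ker (eval s') := by
        refine Ideal.span_le.mpr ?_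
        rintro _ ⟨l, rfl⟩
        rw [SetLike.mem_coe, RingHom.mem_ker, eval_dehom, hss, hs]
      have := hle ht
      rw [RingHom.mem_ker] at this
      simpa [coe_aeval_eq_eval] using this

/-- A second order condition for the cubic tangent cone to be nonsingular. -/
lemma triplePt_of_polar (hf : f.IsHomogeneous 6) {p : Fin 4 → ℂ} (hp3 : p 3 ≠ 0)
    (h2 : ∀ u v, eval p (dirDeriv u (dirDeriv v f)) = 0)
    (hw : ∀ w : Fin 3 → ℂ, (∀ i : Fin 3, ∑ a : Fin 3, ∑ b : Fin 3, w a * w b *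
      eval p (pderiv b.castSucc (pderiv a.castSucc (pderiv i.castSucc f))) = 0) → w = 0) :
    TriplePt f p := by
  refine ⟨fun h => hp3 (by rw [h]; rfl), h2, fun w h => ⟨w 3 / p 3, ?_⟩⟩
  have hp (u v : Fin 4 → ℂ) : eval p (dirDeriv p (dirDeriv u (dirDeriv v f))) = 0 := by
    rw [((hf.dirDeriv v).dirDeriv u).eval_dirDeriv_self p, h2, mul_zero]
  set c := w 3 / p 3
  set w' := w - c • p with hw'
  have h3 : w' 3 = 0 := by simp [hw', c, hp3]
  have hq (u : Fin 4 → ℂ) : eval p (dirDeriv w' (dirDeriv w' (dirDeriv u f))) = 0 := by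
    rw [hw', dirDeriv_sub, dirDeriv_sub, dirDeriv_smul, dirDeriv_smul]
    simp only [Derivation.map_smul, map_sub, smul_eval, h, hp]
    rw [dirDeriv_comm w p, hp]
    ring
  have h0 := hw (fun a => w' a.castSucc) fun i => by
    have := hq (Pi.single i.castSucc 1)
    rw [dirDeriv_single] at this
    simp only [dirDeriv_eq_sum, Fin.sum_univ_castSucc (n := 3), show Fin.last 3 = 3 from rfl, h3,
      zero_smul, add_zero, map_sum, Derivation.map_smul, smul_eval] at this
    rw [← this]
    refine Finset.sum_congr rfl fun a _ => ?_
    rw [Finset.mul_sum]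
    exact Finset.sum_congr rfl fun b _ => by ring
  rw [← sub_eq_zero]
  refine funext fun i => Fin.lastCases h3 (fun l => congrFun h0 l) i

end TenPointBound

section TenPointSextic

/-- A sextic with ten triple points. -/
def tenPointSextic : MvPolynomial (Fin 4) ℂ := termsPoly (termsMap toComplex sexticTerms)

/-- The triple points of `tenPointSextic`. -/
def tenPoint (m : Fin 10) : Fin 4 → ℂ := quadVec (quadMap toComplex (triplePoint m))

lemma sexticTerms_degree :
    ∀ t ∈ sexticTerms, t.1.1 + t.1.2.1 + t.1.2.2.1 + t.1.2.2.2 = 6 := by decide +kernel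

lemma tenPointSextic_isHomogeneous : tenPointSextic.IsHomogeneous 6 := by
  refine termsPoly_isHomogeneous fun t ht => ?_
  obtain ⟨t', ht', rfl⟩ := List.mem_map.mp ht
  exact sexticTerms_degree t' ht'

lemma pderiv_termsPoly_termsMap (i : Fin 4) (L : List ((ℕ × ℕ × ℕ × ℕ) × CoeffRing)) :
    pderiv i (termsPoly (termsMap toComplex L)) =
      termsPoly (termsMap toComplex (termsDeriv i L)) := by
  rw [pderiv_termsPoly, termsDeriv_termsMap]

lemma eval_tenPoint (m : Fin 10) (L : List ((ℕ × ℕ × ℕ × ℕ) × CoeffRing)) :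
    eval (tenPoint m) (termsPoly (termsMap toComplex L)) =
      toComplex (termsEval (triplePoint m) L) := by
  rw [tenPoint, eval_termsPoly, termsEval_termsMap]

lemma eval_pderiv_pderiv_tenPointSextic (m : Fin 10) (i j : Fin 4) :
    eval (tenPoint m) (pderiv i (pderiv j tenPointSextic)) = 0 := by
  wlog hij : j ≤ i generalizing i j
  · rw [← dirDeriv_single, ← dirDeriv_single, dirDeriv_comm, dirDeriv_single, dirDeriv_single]
    exact this j i (le_of_not_ge hij)
  have h := tripleCheck_sexticTerms
  simp only [tripleCheck, List.all_eq_true, forceTerms_eq, forceTermsEval_eq, zero_add,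
    List.mem_range] at h
  rw [tenPointSextic, pderiv_termsPoly_termsMap, pderiv_termsPoly_termsMap, eval_tenPoint,
    eq_zero_of_isZeroCoeff (h i i.2 j (Nat.lt_succ_of_le hij) m (List.mem_finRange m)), map_zero]

lemma eval_dirDeriv_dirDeriv_tenPointSextic (m : Fin 10) (u v : Fin 4 → ℂ) :
    eval (tenPoint m) (dirDeriv u (dirDeriv v tenPointSextic)) = 0 := by
  simp only [dirDeriv_eq_sum, map_sum, Derivation.map_smul, smul_eval,
    eval_pderiv_pderiv_tenPointSextic, mul_zero, Finset.sum_const_zero]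

lemma kroneckerMonomial_isHomogeneous (e : ℕ) :
    (kroneckerMonomial e).IsHomogeneous (e % 11 + e / 11 % 11 + e / 121) :=
  ((isHomogeneous_X_pow 0 _).mul (isHomogeneous_X_pow 1 _)).mul (isHomogeneous_X_pow 2 _)

/-- The quadratic forms in three variables given by `polarQuadrics`. -/
def polarQuadric (m : Fin 10) (k : ℕ) : MvPolynomial (Fin 3) ℂ :=
  restrictPlane (termsPoly (termsMap toComplex
    ((polarQuadrics (termsEval (triplePoint m)) sexticTerms).getD k [])))

lemma filter_termsMap {R S : Type*} (h : R → S) (L : List ((ℕ × ℕ × ℕ × ℕ) × R)) :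
    (termsMap h L).filter (fun t => t.1.2.2.2 == 0) =
      termsMap h (L.filter fun t => t.1.2.2.2 == 0) := by
  rw [termsMap, List.filter_map]
  rfl

lemma polarQuadrics_exponent {R : Type} (ev : List ((ℕ × ℕ × ℕ × ℕ) × CoeffRing) → R)
    (L : List ((ℕ × ℕ × ℕ × ℕ) × CoeffRing)) (k : ℕ) :
    ∀ t ∈ (polarQuadrics ev L).getD k [],
      t.1.2.2.2 = 0 ∧ t.1.1 + t.1.2.1 + t.1.2.2.1 + t.1.2.2.2 = 2 := by
  intro t ht
  by_cases hk : k < (polarQuadrics ev L).length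
  · rw [List.getD_eq_getElem _ _ hk] at ht
    simp only [polarQuadrics, List.getElem_map, List.mem_flatMap, List.mem_map,
      List.mem_range] at ht
    obtain ⟨a, ha, b, hb, rfl⟩ := ht
    interval_cases a <;> interval_cases b <;> simp [pairExponent]
  · rw [List.getD_eq_default _ _ (not_lt.mp hk)] at ht
    simp at ht

lemma kronecker_polarQuadric (m : Fin 10) (k : ℕ) : kronecker (polarQuadric m k) =
    termsKronecker (termsMap toComplex
      ((polarQuadrics (termsEval (triplePoint m)) sexticTerms).getD k [])) := by
  rw [polarQuadric, kronecker_restrictPlane_termsPoly, filter_termsMap, List.filter_eq_self.mpr]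
  intro t ht
  simpa using (polarQuadrics_exponent _ _ _ t ht).1

lemma polarQuadric_isHomogeneous (m : Fin 10) (k : ℕ) : (polarQuadric m k).IsHomogeneous 2 := by
  refine restrictPlane_isHomogeneous (termsPoly_isHomogeneous fun t ht => ?_)
  obtain ⟨t', ht', rfl⟩ := List.mem_map.mp ht
  exact (polarQuadrics_exponent _ _ _ t' ht').2

lemma linearIndependent_polarQuadric (m : Fin 10) :
    LinearIndependent ℂ fun j : Fin quadricRows.length =>
      kroneckerMonomial (quadricRows.get j).2 * polarQuadric m (quadricRows.get j).1 :=
  linearIndependent_of_rowsCheck (polarQuadrics_residueEval _ _) (rowsBound_quadricRows m)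
    (rowsCheck_quadricRows m) (kronecker_polarQuadric m)

/-- The `k`-th partial derivative of the sextic. -/
def sexticPartial (k : ℕ) : MvPolynomial (Fin 4) ℂ :=
  termsPoly (termsMap toComplex (sexticPartials.getD k []))

lemma sexticPartial_eq (i : Fin 4) : sexticPartial i = pderiv i tenPointSextic := by
  rw [tenPointSextic, pderiv_termsPoly_termsMap, sexticPartial]
  congr 2
  fin_cases i <;> rfl

lemma linearIndependent_affineRows : LinearIndependent ℂ fun j : Fin affineRows.length =>
    kroneckerMonomial (affineRows.get j).2 * dehom (sexticPartial (affineRows.get j).1) := by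
  refine linearIndependent_of_rowsCheck (G := sexticPartials) ?_ rowsBound_affineRows
    rowsCheck_affineRows (F := fun k => dehom (sexticPartial k)) fun k =>
      kronecker_dehom_termsPoly _
  rw [List.map_map]
  exact List.map_congr_left fun L _ => termsMap_residue L

lemma linearIndependent_planeRows : LinearIndependent ℂ fun j : Fin planeRows.length =>
    kroneckerMonomial (planeRows.get j).2 * restrictPlane (sexticPartial (planeRows.get j).1) := by
  refine linearIndependent_of_rowsCheck (G := sexticPartialsInfinity) ?_ rowsBound_planeRows
    rowsCheck_planeRows (F := fun k => restrictPlane (sexticPartial k)) fun k => ?_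
  · rw [List.map_map]
    exact List.map_congr_left fun L _ => termsMap_residue L
  · rw [sexticPartial, kronecker_restrictPlane_termsPoly, filter_termsMap, sexticPartialsInfinity]
    congr 2
    simp only [List.getD_eq_getElem?_getD, List.getElem?_map]
    cases sexticPartials[k]? <;> rfl

lemma planeRows_spec : ∀ p ∈ planeRows, p.1 < 4 ∧ p.2 % 11 + p.2 / 11 % 11 + p.2 / 121 = 4 := by
  decide

set_option maxRecDepth 10000 in
lemma affineRows_spec :
    ∀ p ∈ affineRows, p.1 < 4 ∧ p.2 % 11 + p.2 / 11 % 11 + p.2 / 121 ≤ 5 := by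
  decide

lemma quadricRows_spec :
    ∀ p ∈ quadricRows, p.1 < 3 ∧ p.2 % 11 + p.2 / 11 % 11 + p.2 / 121 = 2 := by
  decide

lemma planeRow_isHomogeneous (j : Fin planeRows.length) :
    (kroneckerMonomial (planeRows.get j).2 *
      restrictPlane (sexticPartial (planeRows.get j).1)).IsHomogeneous 9 := by
  obtain ⟨h1, h2⟩ := planeRows_spec _ (List.get_mem planeRows j)
  have := kroneckerMonomial_isHomogeneous (planeRows.get j).2
  rw [h2] at this
  have h3 := sexticPartial_eq ⟨_, h1⟩
  rw [h3]
  exact this.mul (restrictPlane_isHomogeneous tenPointSextic_isHomogeneous.pderiv)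

lemma eq_zero_of_singular_infinity {x : Fin 4 → ℂ}
    (hx : ∀ i, eval x (pderiv i tenPointSextic) = 0) (h3 : x 3 = 0) : x = 0 := by
  have h := eq_zero_of_eval_eq_zero linearIndependent_planeRows planeRow_isHomogeneous
    (by norm_num [planeRows, Nat.multichoose_eq, Nat.choose]) (x := fun i => x i.castSucc)
    fun j => by
      have h1 := (planeRows_spec _ (List.get_mem planeRows j)).1
      have h4 := sexticPartial_eq ⟨_, h1⟩
      rw [map_mul, eval_restrictPlane _ h3, h4, hx, mul_zero]
  exact funext fun i => Fin.lastCases h3 (fun l => congrFun h l) i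

lemma top_le_degreeLT_sup_affineIdeal :
    ⊤ ≤ degreeLT (Fin 3) 9 ⊔ (affineIdeal tenPointSextic).restrictScalars ℂ := by
  refine top_le_degreeLT_sup (fun i p hp => Ideal.mul_mem_left _ _ hp)
    ((homogeneousSubmodule_le_span linearIndependent_planeRows planeRow_isHomogeneous
      (by norm_num [planeRows, Nat.multichoose_eq, Nat.choose])).trans
      (Submodule.span_le.mpr ?_))
  rintro _ ⟨j, rfl⟩
  obtain ⟨h1, h2⟩ := planeRows_spec _ (List.get_mem planeRows j)
  have hm := kroneckerMonomial_isHomogeneous (planeRows.get j).2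
  rw [h2] at hm
  have h3 := sexticPartial_eq ⟨_, h1⟩
  dsimp only
  rw [h3]
  generalize kroneckerMonomial (planeRows.get j).2 = q at hm
  generalize (⟨(planeRows.get j).1, h1⟩ : Fin 4) = i
  have h4 := dehom_sub_restrictPlane_mem (tenPointSextic_isHomogeneous.pderiv (i := i))
  have h5 := mul_mem_degreeLT h4 hm.mem_degreeLT
  have e : q * restrictPlane (pderiv i tenPointSextic) =
      -((dehom (pderiv i tenPointSextic) - restrictPlane (pderiv i tenPointSextic)) * q) +
        q * dehom (pderiv i tenPointSextic) := by ring
  rw [e]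
  exact Submodule.add_mem_sup (Submodule.neg_mem _ h5)
    (Ideal.mul_mem_left _ _ (dehom_pderiv_mem_affineIdeal i))

lemma affineRows_length : affineRows.length = 206 := by decide +kernel

lemma affineRow_mem (j : Fin affineRows.length) :
    kroneckerMonomial (affineRows.get j).2 * dehom (sexticPartial (affineRows.get j).1) ∈
      degreeLT (Fin 3) (10 + 1) ∧
    kroneckerMonomial (affineRows.get j).2 * dehom (sexticPartial (affineRows.get j).1) ∈
      affineIdeal tenPointSextic := by
  obtain ⟨h1, h2⟩ := affineRows_spec _ (List.get_mem affineRows j)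
  have h3 := sexticPartial_eq ⟨_, h1⟩
  rw [h3]
  refine ⟨?_, Ideal.mul_mem_left _ _ (dehom_pderiv_mem_affineIdeal _)⟩
  exact mul_mem_degreeLT (b := 5) ((kroneckerMonomial_isHomogeneous _).degreeLT_of_lt (by omega))
    (dehom_mem_degreeLT tenPointSextic_isHomogeneous.pderiv)

lemma eval_polarQuadric (m : Fin 10) (i : Fin 3) (w : Fin 3 → ℂ) :
    eval w (polarQuadric m i) = ∑ a : Fin 3, ∑ b : Fin 3, w a * w b *
      eval (tenPoint m)
        (pderiv b.castSucc (pderiv a.castSucc (pderiv i.castSucc tenPointSextic))) := by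
  have hw : w = fun l : Fin 3 => quadVec (w 0, w 1, w 2, 0) l.castSucc := by
    funext l; fin_cases l <;> rfl
  conv_lhs => rw [hw]
  rw [polarQuadric, eval_restrictPlane _ rfl, eval_termsPoly]
  have key (a b : Fin 3) : eval (tenPoint m)
      (pderiv b.castSucc (pderiv a.castSucc (pderiv i.castSucc tenPointSextic))) =
      toComplex (termsEval (triplePoint m)
        (termsDeriv b (termsDeriv a (termsDeriv i sexticTerms)))) := by
    rw [tenPointSextic, pderiv_termsPoly_termsMap, pderiv_termsPoly_termsMap,
      pderiv_termsPoly_termsMap, eval_tenPoint, Fin.val_castSucc, Fin.val_castSucc,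
      Fin.val_castSucc]
  simp only [key, Fin.sum_univ_three]
  fin_cases i <;>
  · simp [polarQuadrics, termsMap, List.range_succ]
    rw [termsEval]
    simp [pairExponent]
    ring

lemma triplePoint_last (m : Fin 10) : (triplePoint m).2.2.2 ≠ 0 := by
  intro h
  have h1 := congrArg (fun x : CoeffRing => x.re.re) h
  fin_cases m <;> exact absurd h1 (by decide)

lemma tenPoint_three_ne_zero (m : Fin 10) : tenPoint m 3 ≠ 0 := fun h =>
  triplePoint_last m ((map_eq_zero_iff toComplex toComplex_injective).mp h)

lemma triplePt_tenPoint (m : Fin 10) : TriplePt tenPointSextic (tenPoint m) := by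
  refine triplePt_of_polar tenPointSextic_isHomogeneous (tenPoint_three_ne_zero m)
    (eval_dirDeriv_dirDeriv_tenPointSextic m) fun w hw => ?_
  refine eq_zero_of_eval_eq_zero (d := 4) (linearIndependent_polarQuadric m) (fun j => ?_)
    (by norm_num [quadricRows, Nat.multichoose_eq, Nat.choose]) fun j => ?_
  · have h2 := (quadricRows_spec _ (List.get_mem quadricRows j)).2
    have := kroneckerMonomial_isHomogeneous (quadricRows.get j).2
    rw [h2] at this
    exact this.mul (polarQuadric_isHomogeneous m _)
  · have h1 := (quadricRows_spec _ (List.get_mem quadricRows j)).1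
    rw [map_mul, ← Fin.val_mk h1, eval_polarQuadric m ⟨_, h1⟩, hw, mul_zero]

/-- All cross products of two quadruples with the last entries vanish. -/
def sameChartPoint (P Q : CoeffRing × CoeffRing × CoeffRing × CoeffRing) : Bool :=
  isZeroCoeff (P.1 * Q.2.2.2 - Q.1 * P.2.2.2) &&
    isZeroCoeff (P.2.1 * Q.2.2.2 - Q.2.1 * P.2.2.2) &&
      isZeroCoeff (P.2.2.1 * Q.2.2.2 - Q.2.2.1 * P.2.2.2)

lemma isZeroCoeff_zero : isZeroCoeff 0 = true := by decide

lemma sameChartPoint_triplePoint :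
    ∀ m n : Fin 10, sameChartPoint (triplePoint m) (triplePoint n) = true → m = n := by
  decide +kernel

/-- The triple points normalized to have last coordinate one. -/
def normalizedPoint (m : Fin 10) : Fin 4 → ℂ := (tenPoint m 3)⁻¹ • tenPoint m

lemma normalizedPoint_three (m : Fin 10) : normalizedPoint m 3 = 1 :=
  inv_mul_cancel₀ (tenPoint_three_ne_zero m)

lemma normalizedPoint_injective : Function.Injective normalizedPoint := by
  intro m n h
  have hm := tenPoint_three_ne_zero m
  have hn := tenPoint_three_ne_zero n
  have key (i : Fin 4) : tenPoint m i * tenPoint n 3 - tenPoint n i * tenPoint m 3 = 0 := by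
    have := congrFun h i
    simp only [normalizedPoint, Pi.smul_apply, smul_eq_mul] at this
    field_simp at this
    rw [sub_eq_zero]
    linear_combination this
  refine sameChartPoint_triplePoint m n ?_
  have h0 : (triplePoint m).1 * (triplePoint n).2.2.2 - (triplePoint n).1 * (triplePoint m).2.2.2 =
      0 := toComplex_injective (by
    rw [map_sub, map_mul, map_mul, map_zero]; exact key 0)
  have h1 : (triplePoint m).2.1 * (triplePoint n).2.2.2 -
      (triplePoint n).2.1 * (triplePoint m).2.2.2 = 0 := toComplex_injective (by
    rw [map_sub, map_mul, map_mul, map_zero]; exact key 1)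
  have h2 : (triplePoint m).2.2.1 * (triplePoint n).2.2.2 -
      (triplePoint n).2.2.1 * (triplePoint m).2.2.2 = 0 := toComplex_injective (by
    rw [map_sub, map_mul, map_mul, map_zero]; exact key 2)
  rw [sameChartPoint, h0, h1, h2, isZeroCoeff_zero]
  rfl

lemma triplePt_normalizedPoint (m : Fin 10) : TriplePt tenPointSextic (normalizedPoint m) :=
  (triplePt_tenPoint m).smul tenPointSextic_isHomogeneous
    (inv_ne_zero (tenPoint_three_ne_zero m))

lemma exists_smul_normalizedPoint {x : Fin 4 → ℂ} (hx : x ≠ 0)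
    (h : ∀ i, eval x (pderiv i tenPointSextic) = 0) : ∃ m, x = x 3 • normalizedPoint m := by
  have h3 : x 3 ≠ 0 := fun h3 => hx (eq_zero_of_singular_infinity h h3)
  obtain ⟨m, hm⟩ := exists_eq_of_singular linearIndependent_affineRows
    (fun j => (affineRow_mem j).1) (fun j => (affineRow_mem j).2) (by norm_num)
    top_le_degreeLT_sup_affineIdeal tenPointSextic_isHomogeneous normalizedPoint_injective
    normalizedPoint_three (fun m => (triplePt_normalizedPoint m).second)
    (by rw [affineRows_length, Fintype.card_fin]; norm_num [Nat.multichoose_eq, Nat.choose])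
    (s := (x 3)⁻¹ • x)
    (inv_mul_cancel₀ h3) fun i => by
      rw [eval_smul_of_isHomogeneous (tenPointSextic_isHomogeneous.pderiv (i := i)), h, mul_zero]
  exact ⟨m, by rw [← hm, smul_inv_smul₀ h3]⟩

lemma tenPointSextic_ne_zero : tenPointSextic ≠ 0 := by
  intro h
  have := eq_zero_of_singular_infinity (x := Pi.single 0 1) (fun i => by simp [h]) rfl
  exact one_ne_zero ((Pi.single_eq_same (M := fun _ : Fin 4 => ℂ) 0 1).symm.trans
    (congrFun this 0))

lemma onlyTriplePoints_tenPointSextic : OnlyTriplePoints 6 10 tenPointSextic := by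
  have hf := tenPointSextic_isHomogeneous
  let P (m : Fin 10) : Projectivization ℂ (Fin 4 → ℂ) :=
    Projectivization.mk ℂ (normalizedPoint m) (triplePt_normalizedPoint m).ne_zero
  have hP : Function.Injective P := by
    intro m n h
    obtain ⟨a, ha⟩ := (Projectivization.mk_eq_mk_iff' ℂ _ _ _ _).mp h
    refine normalizedPoint_injective ?_
    have h3 := congrFun ha 3
    rw [Pi.smul_apply, normalizedPoint_three, normalizedPoint_three, smul_eq_mul, mul_one] at h3
    rw [← ha, h3, one_smul]
  have hS : SingSet tenPointSextic = Set.range P := by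
    refine Set.Subset.antisymm (fun Q hQ => ?_) ?_
    · induction Q using Projectivization.ind with
      | h x hx =>
        obtain ⟨m, hm⟩ := exists_smul_normalizedPoint hx ((mk_mem_singSet_iff hf hx).mp hQ)
        exact ⟨m, (Projectivization.mk_eq_mk_iff' ℂ _ _ _ _).mpr ⟨(x 3)⁻¹, by
          have h3 : x 3 ≠ 0 := fun h3 => hx (by rw [hm, h3, zero_smul])
          exact (inv_smul_eq_iff₀ h3).mpr hm⟩⟩
    · rintro _ ⟨m, rfl⟩
      refine (mk_mem_singSet_iff hf _).mpr fun i => ?_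
      rw [← dirDeriv_single]
      exact (triplePt_normalizedPoint m).first hf _
  refine ⟨hS ▸ Set.finite_range P, ?_, ?_⟩
  · rw [hS, ← Set.image_univ, Set.ncard_image_of_injective _ hP, Set.ncard_univ]
    simp
  · rw [hS]
    rintro _ ⟨m, rfl⟩
    obtain ⟨a, ha⟩ := Projectivization.exists_smul_eq_mk_rep ℂ (normalizedPoint m)
      (triplePt_normalizedPoint m).ne_zero
    refine ordinary_of_triplePt hf ?_
    rw [← ha]
    exact (triplePt_normalizedPoint m).smul hf a.ne_zero

end TenPointSextic

/-- Every sextic surface whose only singularities are `ν` ordinary triple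
points satisfies `ν ≤ 10`, and there is a sextic with exactly `10` ordinary triple points
as its only singularities.  Hence `μ₃(6) = 10`. -/
theorem mu3_of_sextics :
    (∀ (ν : ℕ) (f : MvPolynomial (Fin 4) ℂ), f ≠ 0 → f.IsHomogeneous 6 →
      OnlyTriplePoints 6 ν f → ν ≤ 10) ∧
    (∃ f : MvPolynomial (Fin 4) ℂ, f ≠ 0 ∧ f.IsHomogeneous 6 ∧
      OnlyTriplePoints 6 10 f) :=
  ⟨fun _ _ hf0 hf h => h.le_ten hf hf0, tenPointSextic, tenPointSextic_ne_zero,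
    tenPointSextic_isHomogeneous, onlyTriplePoints_tenPointSextic⟩
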